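/- Let α ∈ (0,1), N ≥ 2, and 1 ≤ M ≤ N−1, and let ℒ be the lattice generated by linearly independent vectors a_1, …, a_M that all lie in the subspace ℝ^M × {0} of ℝ^N. Then the family φ_r of Theorem 1.1 (continuous even functions on S with sup_S|φ_r| < 1 and sup_S|φ_r| → 0, such that E_r = ⋃_{p∈ℒ}(B_{φ_r} + rp) has constant nonlocal mean curvature equal to that of the unit sphere) can be chosen so that in addition, for every r > r₀, the function φ_r is non-constant on S. -/

import Mathlib

open MeasureTheory Filter

/-- The truncated integral whose limit (as `ε → 0⁺`) is, up to the constant `d_{N,α}`, the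
nonlocal mean curvature of order `α` of the set `E` at the point `x`. Here `E^c = ℝ^N \ closure E`. -/
noncomputable def pvInt (N : ℕ) (α : ℝ) (E : Set (EuclideanSpace ℝ (Fin N)))
    (x : EuclideanSpace ℝ (Fin N)) (ε : ℝ) : ℝ :=
  ∫ y in {y : EuclideanSpace ℝ (Fin N) | ε < ‖y - x‖},
    (Set.indicator (closure E)ᶜ (fun _ => (1 : ℝ)) y - Set.indicator E (fun _ => (1 : ℝ)) y) *
      ‖y - x‖ ^ (-((N : ℝ) + α))

/-- The open star-shaped body `B_φ` enclosed by the deformed sphere `S_φ`. -/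
def starBody {N : ℕ} (φ : EuclideanSpace ℝ (Fin N) → ℝ) : Set (EuclideanSpace ℝ (Fin N)) :=
  {x | ∃ σ ∈ Metric.sphere (0 : EuclideanSpace ℝ (Fin N)) 1,
        ∃ t ∈ Set.Ico (0 : ℝ) 1, x = t • ((1 + φ σ) • σ)}

/-- The `M`-dimensional lattice in `ℝ^N` generated by the vectors `a 0, …, a (M-1)`. -/
def latticeSet {N M : ℕ} (a : Fin M → EuclideanSpace ℝ (Fin N)) :
    Set (EuclideanSpace ℝ (Fin N)) :=
  {p | ∃ k : Fin M → ℤ, p = ∑ i, (k i : ℝ) • a i}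

/-- The periodic set `E_r = ⋃_{p ∈ ℒ} (B_φ + r p)`. -/
def translatedBodies {N M : ℕ} (a : Fin M → EuclideanSpace ℝ (Fin N)) (r : ℝ)
    (φ : EuclideanSpace ℝ (Fin N) → ℝ) : Set (EuclideanSpace ℝ (Fin N)) :=
  ⋃ p ∈ latticeSet a, (fun y => y + r • p) '' starBody φ

namespace NonlocalSphere

open Real Set Topology
open Metric (closedBall sphere ball isOpen_ball)
open Module (finrank)
open ENNReal (ofReal ofReal_mul ofReal_lt_top toReal_mul toReal_ofReal toReal_nonneg
  ofReal_ne_top)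
open Function (uncurry comp_def onFun)

set_option linter.unusedSectionVars false

section Scalar

/-- Mean value bound for a mixed second difference `φ a - φ b - φ c + φ e`. -/
theorem abs_fourPoint_le {s : Set ℝ} (hs : Convex ℝ s) {f f' f'' : ℝ → ℝ} {M₁ M₂ : ℝ}
    (hf : ∀ x ∈ s, HasDerivAt f (f' x) x) (hf' : ∀ x ∈ s, HasDerivAt f' (f'' x) x)
    (h₁ : ∀ x ∈ s, |f' x| ≤ M₁) (h₂ : ∀ x ∈ s, |f'' x| ≤ M₂)
    {a b c e : ℝ} (ha : a ∈ s) (hb : b ∈ s) (hc : c ∈ s) (he : e ∈ s) :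
    |f a - f b - f c + f e| ≤ M₁ * |a - b - c + e| + M₂ * (|b - e| + |a - c|) * |c - e| := by
  have hX : ∀ t ∈ Icc (0 : ℝ) 1, b + t * (a - b) ∈ s := by
    intro t ht
    have := hs hb ha (a := 1 - t) (b := t) (by linarith [ht.2]) ht.1 (by ring)
    simpa [smul_eq_mul, show (1 - t) * b + t * a = b + t * (a - b) by ring] using this
  have hY : ∀ t ∈ Icc (0 : ℝ) 1, e + t * (c - e) ∈ s := by
    intro t ht
    have := hs he hc (a := 1 - t) (b := t) (by linarith [ht.2]) ht.1 (by ring)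
    simpa [smul_eq_mul, show (1 - t) * e + t * c = e + t * (c - e) by ring] using this
  have hd : ∀ t ∈ Icc (0 : ℝ) 1,
      HasDerivAt (fun t => f (b + t * (a - b)) - f (e + t * (c - e)))
        (f' (b + t * (a - b)) * (a - b) - f' (e + t * (c - e)) * (c - e)) t := by
    intro t ht
    have e1 : HasDerivAt (fun t : ℝ => b + t * (a - b)) (a - b) t := by
      simpa using ((hasDerivAt_id t).mul_const (a - b)).const_add b
    have e2 : HasDerivAt (fun t : ℝ => e + t * (c - e)) (c - e) t := by
      simpa using ((hasDerivAt_id t).mul_const (c - e)).const_add e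
    exact ((hf _ (hX t ht)).comp t e1).sub ((hf _ (hY t ht)).comp t e2)
  obtain ⟨t, ht, hteq⟩ := exists_hasDerivAt_eq_slope
    (fun t => f (b + t * (a - b)) - f (e + t * (c - e)))
    (fun t => f' (b + t * (a - b)) * (a - b) - f' (e + t * (c - e)) * (c - e))
    (zero_lt_one) (fun t ht => (hd t ht).continuousAt.continuousWithinAt)
    (fun t ht => hd t (Ioo_subset_Icc_self ht))
  have ht' := Ioo_subset_Icc_self ht
  simp only [one_mul, zero_mul, add_zero, sub_zero, div_one, add_sub_cancel] at hteq
  have hLip : |f' (b + t * (a - b)) - f' (e + t * (c - e))| ≤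
      M₂ * |(b + t * (a - b)) - (e + t * (c - e))| := by
    have := hs.norm_image_sub_le_of_norm_hasDerivWithin_le (f := f') (f' := f'') (C := M₂)
      (fun x hx => (hf' x hx).hasDerivWithinAt) (fun x hx => h₂ x hx) (hY t ht') (hX t ht')
    simpa using this
  have hM₂ : 0 ≤ M₂ := (abs_nonneg _).trans (h₂ a ha)
  have hdist : |(b + t * (a - b)) - (e + t * (c - e))| ≤ |b - e| + |a - c| := by
    have : (b + t * (a - b)) - (e + t * (c - e)) = (1 - t) * (b - e) + t * (a - c) := by ring
    rw [this]
    refine (abs_add_le _ _).trans ?_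
    rw [abs_mul, abs_mul, abs_of_nonneg ht'.1, abs_of_nonneg (by linarith [ht'.2] : 0 ≤ 1 - t)]
    gcongr
    · exact mul_le_of_le_one_left (abs_nonneg _) (by linarith [ht'.1])
    · exact mul_le_of_le_one_left (abs_nonneg _) ht'.2
  have key : f a - f b - f c + f e = f' (b + t * (a - b)) * (a - b - c + e) +
      (f' (b + t * (a - b)) - f' (e + t * (c - e))) * (c - e) := by
    linear_combination -hteq
  rw [key]
  refine (abs_add_le _ _).trans ?_
  rw [abs_mul, abs_mul]
  gcongr
  · exact h₁ _ (hX t ht')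
  · exact hLip.trans (by gcongr)

/-- The function `t ↦ t ^ b` is Lipschitz away from zero, in a scale invariant form. -/
theorem abs_rpow_sub_rpow_le {b : ℝ} (hb : b ≤ 1) {x y : ℝ} (hx : 0 < x) (hy : 0 < y) :
    |x ^ b - y ^ b| ≤ |b| * |x - y| * (x ^ (b - 1) + y ^ (b - 1)) := by
  have key : ∀ {x y : ℝ}, 0 < x → x ≤ y →
      |y ^ b - x ^ b| ≤ |b| * x ^ (b - 1) * |y - x| := by
    intro x y hx hxy
    have hs : Convex ℝ (Icc x y) := convex_Icc x y
    have := hs.norm_image_sub_le_of_norm_hasDerivWithin_le (f := fun t : ℝ => t ^ b)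
      (f' := fun t => b * t ^ (b - 1)) (C := |b| * x ^ (b - 1)) (x := x) (y := y)
      (fun t ht => (hasDerivAt_rpow_const (Or.inl (hx.trans_le ht.1).ne')).hasDerivWithinAt)
      (fun t ht => by
        have ht0 : 0 < t := hx.trans_le ht.1
        rw [norm_mul, norm_eq_abs, norm_eq_abs,
          abs_of_nonneg (rpow_nonneg ht0.le _)]
        gcongr ?_ * ?_
        exact rpow_le_rpow_of_nonpos hx ht.1 (by linarith))
      ⟨le_rfl, hxy⟩ ⟨hxy, le_rfl⟩
    simpa using this
  have px : 0 ≤ x ^ (b - 1) := by positivity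
  have py : 0 ≤ y ^ (b - 1) := by positivity
  rcases le_total x y with h | h
  · have := key hx h
    rw [abs_sub_comm, abs_sub_comm x y]
    refine this.trans ?_
    have : 0 ≤ |b| * |y - x| * y ^ (b - 1) := by positivity
    nlinarith
  · have := key hy h
    refine this.trans ?_
    have : 0 ≤ |b| * |x - y| * x ^ (b - 1) := by positivity
    nlinarith

end Scalar

section Sphere

variable {E : Type*} [NormedAddCommGroup E] [InnerProductSpace ℝ E] [FiniteDimensional ℝ E]
  [MeasurableSpace E] [BorelSpace E] {α : ℝ} {θ : E}

theorem nontrivial_of_two_le (hN : 2 ≤ finrank ℝ E) : Nontrivial E :=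
  Module.nontrivial_of_finrank_pos (R := ℝ) (by omega)

theorem abs_norm_rpow_sub_le {b : ℝ} (hb : b ≤ 1) {x y : E} (hx : x ≠ 0) (hy : y ≠ 0) :
    |‖x‖ ^ b - ‖y‖ ^ b| ≤ |b| * ‖x - y‖ * (‖x‖ ^ (b - 1) + ‖y‖ ^ (b - 1)) := by
  refine (abs_rpow_sub_rpow_le hb (norm_pos_iff.2 hx) (norm_pos_iff.2 hy)).trans ?_
  gcongr
  exact abs_norm_sub_norm_le x y

/-- Mixed second differences of a power of the norm, for points of comparable size. -/
theorem abs_norm_rpow_fourPoint_le (b K : ℝ) (hK : 1 ≤ K) :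
    ∃ C, 0 ≤ C ∧ ∀ (ρ : ℝ) (x₁ x₂ x₃ x₄ : E), 0 < ρ →
      (ρ ≤ ‖x₁‖ ∧ ‖x₁‖ ≤ K * ρ) → (ρ ≤ ‖x₂‖ ∧ ‖x₂‖ ≤ K * ρ) →
      (ρ ≤ ‖x₃‖ ∧ ‖x₃‖ ≤ K * ρ) → (ρ ≤ ‖x₄‖ ∧ ‖x₄‖ ≤ K * ρ) →
      |‖x₁‖ ^ b - ‖x₂‖ ^ b - ‖x₃‖ ^ b + ‖x₄‖ ^ b| ≤
        C * (ρ ^ (b - 1) * ‖x₁ - x₂ - x₃ + x₄‖ +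
          ρ ^ (b - 2) * ((‖x₁ - x₃‖ + ‖x₂ - x₄‖) * ‖x₃ - x₄‖)) := by
  set q := b / 2 with hq
  set A := |q| * (1 + (K ^ 2) ^ (q - 1)) with hA
  set B := |q * (q - 1)| * (1 + (K ^ 2) ^ (q - 2)) with hB
  have hA0 : 0 ≤ A := by positivity
  have hB0 : 0 ≤ B := by positivity
  have hmon : ∀ e : ℝ, ∀ t ∈ Icc (1 : ℝ) (K ^ 2), t ^ e ≤ 1 + (K ^ 2) ^ e := by
    intro e t ht
    have h1 : (0 : ℝ) < t := by linarith [ht.1]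
    have hK2 : 0 ≤ (K ^ 2 : ℝ) ^ e := by positivity
    rcases le_total 0 e with he | he
    · linarith [rpow_le_rpow h1.le ht.2 he]
    · linarith [rpow_le_one_of_one_le_of_nonpos ht.1 he]
  have one : ∀ x₁ x₂ x₃ x₄ : E,
      (1 ≤ ‖x₁‖ ∧ ‖x₁‖ ≤ K) → (1 ≤ ‖x₂‖ ∧ ‖x₂‖ ≤ K) →
      (1 ≤ ‖x₃‖ ∧ ‖x₃‖ ≤ K) → (1 ≤ ‖x₄‖ ∧ ‖x₄‖ ≤ K) →
      |‖x₁‖ ^ b - ‖x₂‖ ^ b - ‖x₃‖ ^ b + ‖x₄‖ ^ b| ≤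
        (2 * K * A + 4 * K ^ 2 * B + A) * (‖x₁ - x₂ - x₃ + x₄‖ +
          ((‖x₁ - x₃‖ + ‖x₂ - x₄‖) * ‖x₃ - x₄‖)) := by
    intro x₁ x₂ x₃ x₄ h₁ h₂ h₃ h₄
    have hpow : ∀ x : E, ‖x‖ ^ b = (‖x‖ ^ 2) ^ q := by
      intro x
      rw [← rpow_natCast, ← rpow_mul (norm_nonneg x)]
      congr 1
      rw [hq]; push_cast; ring
    have hmem : ∀ x : E, (1 ≤ ‖x‖ ∧ ‖x‖ ≤ K) → ‖x‖ ^ 2 ∈ Icc (1 : ℝ) (K ^ 2) := by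
      intro x hx
      exact ⟨by nlinarith [hx.1], by nlinarith [hx.1, hx.2]⟩
    have hsq : ∀ x y : E, ‖x‖ ≤ K → ‖y‖ ≤ K → |‖x‖ ^ 2 - ‖y‖ ^ 2| ≤ 2 * K * ‖x - y‖ := by
      intro x y hx hy
      rw [sq_sub_sq, abs_mul, abs_of_nonneg (by positivity)]
      exact mul_le_mul (by linarith) (abs_norm_sub_norm_le x y) (abs_nonneg _) (by linarith)
    have hpos : ∀ t ∈ Icc (1 : ℝ) (K ^ 2), 0 < t := fun t ht => by linarith [ht.1]
    have h4 := abs_fourPoint_le (convex_Icc (1 : ℝ) (K ^ 2)) (f := fun t => t ^ q)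
      (f' := fun t => q * t ^ (q - 1)) (f'' := fun t => q * ((q - 1) * t ^ (q - 1 - 1)))
      (M₁ := A) (M₂ := B)
      (fun t ht => hasDerivAt_rpow_const (Or.inl (hpos t ht).ne'))
      (fun t ht => (hasDerivAt_rpow_const (Or.inl (hpos t ht).ne')).const_mul q)
      (fun t ht => by
        rw [abs_mul, abs_of_nonneg (rpow_nonneg (hpos t ht).le _)]
        exact mul_le_mul_of_nonneg_left (hmon _ t ht) (abs_nonneg _))
      (fun t ht => by
        rw [← mul_assoc, abs_mul, abs_of_nonneg (rpow_nonneg (hpos t ht).le _),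
          show q - 1 - 1 = q - 2 by ring]
        exact mul_le_mul_of_nonneg_left (hmon _ t ht) (abs_nonneg _))
      (hmem x₁ h₁) (hmem x₂ h₂) (hmem x₃ h₃) (hmem x₄ h₄)
    simp only [← hpow] at h4
    refine h4.trans ?_
    have e1 : |‖x₁‖ ^ 2 - ‖x₂‖ ^ 2 - ‖x₃‖ ^ 2 + ‖x₄‖ ^ 2| ≤
        2 * K * ‖x₁ - x₂ - x₃ + x₄‖ + ‖x₃ - x₄‖ * (‖x₁ - x₃‖ + ‖x₂ - x₄‖) := by
      have : ‖x₁‖ ^ 2 - ‖x₂‖ ^ 2 - ‖x₃‖ ^ 2 + ‖x₄‖ ^ 2 =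
          inner ℝ (x₁ - x₂ - x₃ + x₄) (x₁ + x₂) +
            inner ℝ (x₃ - x₄) ((x₁ - x₃) + (x₂ - x₄)) := by
        simp only [← real_inner_self_eq_norm_sq, inner_sub_left, inner_sub_right, inner_add_left,
          inner_add_right, real_inner_comm x₁ x₂, real_inner_comm x₃ x₄, real_inner_comm x₁ x₃,
          real_inner_comm x₁ x₄, real_inner_comm x₂ x₃, real_inner_comm x₂ x₄]
        ring
      rw [this]
      refine (abs_add_le _ _).trans (add_le_add ?_ ?_)
      · refine (abs_real_inner_le_norm _ _).trans ?_
        rw [mul_comm]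
        gcongr
        exact (norm_add_le _ _).trans (by linarith [h₁.2, h₂.2])
      · refine (abs_real_inner_le_norm _ _).trans ?_
        gcongr
        exact norm_add_le _ _
    have e2 := hsq x₂ x₄ h₂.2 h₄.2
    have e3 := hsq x₁ x₃ h₁.2 h₃.2
    have e4 := hsq x₃ x₄ h₃.2 h₄.2
    have m1 := mul_le_mul_of_nonneg_left e1 hA0
    have m2 : B * (|‖x₂‖ ^ 2 - ‖x₄‖ ^ 2| + |‖x₁‖ ^ 2 - ‖x₃‖ ^ 2|) * |‖x₃‖ ^ 2 - ‖x₄‖ ^ 2| ≤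
        B * (2 * K * ‖x₂ - x₄‖ + 2 * K * ‖x₁ - x₃‖) * (2 * K * ‖x₃ - x₄‖) := by
      gcongr
    have p1 : 0 ≤ (4 * K ^ 2 * B + A) * ‖x₁ - x₂ - x₃ + x₄‖ := by positivity
    have p2 : 0 ≤ 2 * K * A * ((‖x₁ - x₃‖ + ‖x₂ - x₄‖) * ‖x₃ - x₄‖) := by positivity
    nlinarith
  refine ⟨2 * K * A + 4 * K ^ 2 * B + A, by positivity, ?_⟩
  intro ρ x₁ x₂ x₃ x₄ hρ h₁ h₂ h₃ h₄
  have hn : ∀ x : E, ‖ρ⁻¹ • x‖ = ρ⁻¹ * ‖x‖ := fun x => by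
    rw [norm_smul, norm_of_nonneg (inv_nonneg.2 hρ.le)]
  have hm : ∀ x : E, (ρ ≤ ‖x‖ ∧ ‖x‖ ≤ K * ρ) → (1 ≤ ‖ρ⁻¹ • x‖ ∧ ‖ρ⁻¹ • x‖ ≤ K) := by
    intro x hx
    rw [hn, inv_mul_eq_div, le_div_iff₀ hρ, div_le_iff₀ hρ, one_mul]
    exact hx
  have h := one _ _ _ _ (hm _ h₁) (hm _ h₂) (hm _ h₃) (hm _ h₄)
  simp only [← smul_sub, ← smul_add] at h
  simp only [hn, mul_rpow (inv_nonneg.2 hρ.le) (norm_nonneg _)] at h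
  have e : ρ⁻¹ ^ b * (‖x₁‖ ^ b - ‖x₂‖ ^ b - ‖x₃‖ ^ b + ‖x₄‖ ^ b) =
      ρ⁻¹ ^ b * ‖x₁‖ ^ b - ρ⁻¹ ^ b * ‖x₂‖ ^ b - ρ⁻¹ ^ b * ‖x₃‖ ^ b + ρ⁻¹ ^ b * ‖x₄‖ ^ b := by ring
  have hb0 : 0 < ρ ^ b := rpow_pos_of_pos hρ b
  rw [← e, abs_mul, inv_rpow hρ.le, abs_of_pos (inv_pos.2 hb0), inv_mul_le_iff₀ hb0] at h
  refine h.trans (le_of_eq ?_)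
  have r1 : ρ ^ (b - 1) = ρ ^ b * ρ⁻¹ := by
    rw [rpow_sub hρ, rpow_one, div_eq_mul_inv]
  have r2 : ρ ^ (b - 2) = ρ ^ b * (ρ⁻¹ * ρ⁻¹) := by
    rw [rpow_sub hρ, rpow_two, div_eq_mul_inv, sq, mul_inv]
  rw [r1, r2]
  ring

section Growth

/-- The measure of balls of radius `r` is at most `C * r ^ n`. -/
def BallGrowth (ν : Measure E) (n C : ℝ) : Prop :=
  ∀ x : E, ∀ r : ℝ, 0 < r → ν (closedBall x r) ≤ ofReal (C * r ^ n)

variable {ν : Measure E} {n C : ℝ}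

theorem BallGrowth.singleton (h : BallGrowth ν n C) (hn : 0 < n) (x : E) : ν {x} = 0 := by
  have h1 : Tendsto (fun r : ℝ => ofReal (C * r ^ n)) (𝓝[>] 0)
      (nhds 0) := by
    have : Tendsto (fun r : ℝ => C * r ^ n) (nhds 0) (nhds (C * (0 : ℝ) ^ n)) :=
      ((continuousAt_rpow_const 0 n (Or.inr hn.le)).tendsto).const_mul C
    rw [zero_rpow hn.ne', mul_zero] at this
    have := ENNReal.tendsto_ofReal
      (this.mono_left (nhdsWithin_le_nhds (s := Ioi (0 : ℝ))))
    simpa using this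
  refine le_antisymm (ge_of_tendsto h1 ?_) zero_le
  filter_upwards [self_mem_nhdsWithin] with r hr
  exact (measure_mono (by simpa using (mem_Ioi.1 hr).le)).trans (h x r hr)

theorem BallGrowth.annulus (h : BallGrowth ν n C) (e : ℝ) (x : E) {R : ℝ}
    (hR : 0 < R) :
    ∫⁻ y in {y : E | R ≤ ‖y - x‖ ∧ ‖y - x‖ ≤ 2 * R}, ofReal (‖y - x‖ ^ e) ∂ν ≤
      ofReal ((1 + 2 ^ e) * C * 2 ^ n * R ^ (e + n)) := by
  have hpt : ∀ y ∈ {y : E | R ≤ ‖y - x‖ ∧ ‖y - x‖ ≤ 2 * R},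
      ofReal (‖y - x‖ ^ e) ≤ ofReal ((1 + 2 ^ e) * R ^ e) := by
    intro y hy
    apply ENNReal.ofReal_le_ofReal
    have hy0 : 0 < ‖y - x‖ := hR.trans_le hy.1
    have p : 0 ≤ (2 : ℝ) ^ e * R ^ e := by positivity
    have p' : 0 ≤ R ^ e := by positivity
    rcases le_total 0 e with he | he
    · have := rpow_le_rpow hy0.le hy.2 he
      rw [mul_rpow zero_le_two hR.le] at this
      linarith
    · have := rpow_le_rpow_of_nonpos hR hy.1 he
      linarith
  have hms : MeasurableSet {y : E | R ≤ ‖y - x‖ ∧ ‖y - x‖ ≤ 2 * R} := by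
    apply IsClosed.measurableSet
    have hc : Continuous fun y : E => ‖y - x‖ := by fun_prop
    exact (isClosed_le continuous_const hc).inter (isClosed_le hc continuous_const)
  refine (setLIntegral_mono measurable_const hpt).trans ?_
  rw [setLIntegral_const]
  have hsub : {y : E | R ≤ ‖y - x‖ ∧ ‖y - x‖ ≤ 2 * R} ⊆ closedBall x (2 * R) := by
    intro y hy
    rw [mem_closedBall_iff_norm]; exact hy.2
  have := (measure_mono hsub).trans (h x (2 * R) (by positivity))
  refine (mul_le_mul_right this _).trans ?_
  rw [← ofReal_mul (by positivity)]
  apply ENNReal.ofReal_le_ofReal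
  rw [mul_rpow zero_le_two hR.le, rpow_add hR]
  apply le_of_eq; ring

theorem tsum_ofReal_geometric {A q : ℝ} (hA : 0 ≤ A) (hq : 0 ≤ q) (hq1 : q < 1) :
    ∑' k : ℕ, ofReal (A * q ^ k) = ofReal (A * (1 - q)⁻¹) := by
  rw [← ENNReal.ofReal_tsum_of_nonneg (fun k => by positivity)
    ((summable_geometric_of_lt_one hq hq1).mul_left A), tsum_mul_left,
    tsum_geometric_of_lt_one hq hq1]

theorem integrableOn_of_lintegral_le {s : Set E} {f : E → ℝ}
    (hf : Measurable f) (hf0 : ∀ y, 0 ≤ f y) {A : ℝ} (hA : 0 ≤ A)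
    (h : ∫⁻ y in s, ofReal (f y) ∂ν ≤ ofReal A) :
    IntegrableOn f s ν ∧ ∫ y in s, f y ∂ν ≤ A := by
  have hlt : ∫⁻ y in s, ofReal (f y) ∂ν < ⊤ := h.trans_lt ofReal_lt_top
  refine ⟨⟨hf.aestronglyMeasurable, ?_⟩, ?_⟩
  · rw [hasFiniteIntegral_iff_ofReal (Eventually.of_forall hf0)]
    exact hlt
  · rw [integral_eq_lintegral_of_nonneg_ae (Eventually.of_forall hf0) hf.aestronglyMeasurable]
    exact ENNReal.toReal_le_of_le_ofReal hA h

/-- Integrability of a power of the distance near its singularity. -/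
theorem BallGrowth.near (h : BallGrowth ν n C) (hn : 0 < n) (hC : 0 ≤ C) {e : ℝ}
    (he : 0 < e + n) :
    ∃ A, 0 ≤ A ∧ ∀ x : E, ∀ r : ℝ, 0 < r →
      IntegrableOn (fun y => ‖y - x‖ ^ e) (closedBall x r) ν ∧
        ∫ y in closedBall x r, ‖y - x‖ ^ e ∂ν ≤ A * r ^ (e + n) := by
  set q : ℝ := (2⁻¹ : ℝ) ^ (e + n) with hq
  have hq0 : 0 ≤ q := by positivity
  have hq1 : q < 1 := rpow_lt_one (by norm_num) (by norm_num) he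
  set M : ℝ := (1 + 2 ^ e) * C * 2 ^ n with hM
  have hM0 : 0 ≤ M := by positivity
  have hinv : 0 ≤ (1 - q)⁻¹ := inv_nonneg.2 (by linarith)
  refine ⟨M * q * (1 - q)⁻¹, by positivity, ?_⟩
  intro x r hr
  have hmeas : Measurable (fun y : E => ‖y - x‖ ^ e) := by fun_prop
  refine integrableOn_of_lintegral_le hmeas (fun y => by positivity)
    (by positivity) ?_
  let S (k : ℕ) : Set E := {y | r * 2⁻¹ ^ (k + 1) ≤ ‖y - x‖ ∧ ‖y - x‖ ≤ 2 * (r * 2⁻¹ ^ (k + 1))}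
  have hcover : closedBall x r ⊆ {x} ∪ ⋃ k, S k := by
    intro y hy
    rw [mem_closedBall_iff_norm] at hy
    by_cases hyx : y = x
    · left; exact hyx
    right
    have hpos : 0 < ‖y - x‖ := norm_pos_iff.2 (sub_ne_zero.2 hyx)
    obtain ⟨k, hk1, hk2⟩ := exists_nat_pow_near_of_lt_one (x := ‖y - x‖ / r) (y := (2⁻¹ : ℝ))
      (by positivity) ((div_le_one hr).2 hy) (by norm_num) (by norm_num)
    refine mem_iUnion.2 ⟨k, ?_, ?_⟩
    · rw [lt_div_iff₀ hr] at hk1; linarith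
    · rw [div_le_iff₀ hr] at hk2
      rw [pow_succ]; linarith
  calc ∫⁻ y in closedBall x r, ofReal (‖y - x‖ ^ e) ∂ν
      ≤ ∫⁻ y in {x} ∪ ⋃ k, S k, ofReal (‖y - x‖ ^ e) ∂ν := lintegral_mono_set hcover
    _ ≤ ∫⁻ y in {x}, ofReal (‖y - x‖ ^ e) ∂ν + ∫⁻ y in ⋃ k, S k, ofReal (‖y - x‖ ^ e) ∂ν :=
        lintegral_union_le _ _ _
    _ = ∫⁻ y in ⋃ k, S k, ofReal (‖y - x‖ ^ e) ∂ν := by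
          rw [setLIntegral_measure_zero _ _ (h.singleton hn x), zero_add]
    _ ≤ ∑' k, ∫⁻ y in S k, ofReal (‖y - x‖ ^ e) ∂ν := lintegral_iUnion_le _ _
    _ ≤ ∑' k : ℕ, ofReal (M * q * r ^ (e + n) * q ^ k) := by
          refine ENNReal.tsum_le_tsum fun k => ?_
          refine (h.annulus e x (R := r * 2⁻¹ ^ (k + 1)) (by positivity)).trans (le_of_eq ?_)
          congr 1
          rw [mul_rpow hr.le (by positivity), ← rpow_natCast, ← rpow_mul
            (by positivity), mul_comm ((k + 1 : ℕ) : ℝ), rpow_mul (by positivity),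
            rpow_natCast, ← hq, pow_succ]
          ring
    _ = ofReal (M * q * (1 - q)⁻¹ * r ^ (e + n)) := by
          rw [tsum_ofReal_geometric (by positivity) hq0 hq1]
          congr 1; ring

/-- Integrability of a negative power of the distance at infinity. -/
theorem BallGrowth.far (h : BallGrowth ν n C) (hC : 0 ≤ C) {e : ℝ}
    (he : e + n < 0) :
    ∃ A, 0 ≤ A ∧ ∀ x : E, ∀ r : ℝ, 0 < r →
      IntegrableOn (fun y => ‖y - x‖ ^ e) {y | r ≤ ‖y - x‖} ν ∧
        ∫ y in {y | r ≤ ‖y - x‖}, ‖y - x‖ ^ e ∂ν ≤ A * r ^ (e + n) := by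
  set q : ℝ := (2 : ℝ) ^ (e + n) with hq
  have hq0 : 0 ≤ q := by positivity
  have hq1 : q < 1 := rpow_lt_one_of_one_lt_of_neg (by norm_num) he
  set M : ℝ := (1 + 2 ^ e) * C * 2 ^ n with hM
  have hM0 : 0 ≤ M := by positivity
  have hinv : 0 ≤ (1 - q)⁻¹ := inv_nonneg.2 (by linarith)
  refine ⟨M * (1 - q)⁻¹, by positivity, ?_⟩
  intro x r hr
  have hmeas : Measurable (fun y : E => ‖y - x‖ ^ e) := by fun_prop
  refine integrableOn_of_lintegral_le hmeas (fun y => by positivity)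
    (by positivity) ?_
  have hcover : {y : E | r ≤ ‖y - x‖} ⊆ ⋃ k : ℕ,
      {y : E | r * 2 ^ k ≤ ‖y - x‖ ∧ ‖y - x‖ ≤ 2 * (r * 2 ^ k)} := by
    intro y hy
    obtain ⟨k, hk1, hk2⟩ := exists_nat_pow_near (x := ‖y - x‖ / r) (y := (2 : ℝ))
      ((one_le_div hr).2 hy) (by norm_num)
    refine mem_iUnion.2 ⟨k, ?_, ?_⟩
    · rw [le_div_iff₀ hr] at hk1; linarith
    · rw [div_lt_iff₀ hr, pow_succ] at hk2
      linarith
  calc ∫⁻ y in {y | r ≤ ‖y - x‖}, ofReal (‖y - x‖ ^ e) ∂ν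
      ≤ ∫⁻ y in ⋃ k : ℕ,
      {y : E | r * 2 ^ k ≤ ‖y - x‖ ∧ ‖y - x‖ ≤ 2 * (r * 2 ^ k)},
        ofReal (‖y - x‖ ^ e) ∂ν := lintegral_mono_set hcover
    _ ≤ ∑' k : ℕ, ∫⁻ y in
      {y : E | r * 2 ^ k ≤ ‖y - x‖ ∧ ‖y - x‖ ≤ 2 * (r * 2 ^ k)},
        ofReal (‖y - x‖ ^ e) ∂ν := lintegral_iUnion_le _ _
    _ ≤ ∑' k : ℕ, ofReal (M * r ^ (e + n) * q ^ k) := by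
          refine ENNReal.tsum_le_tsum fun k => ?_
          refine (h.annulus e x (R := r * 2 ^ k) (by positivity)).trans (le_of_eq ?_)
          congr 1
          rw [mul_rpow hr.le (by positivity), ← rpow_natCast, ← rpow_mul
            (by positivity), mul_comm (k : ℝ), rpow_mul (by positivity),
            rpow_natCast, ← hq]
          ring
    _ = ofReal (M * (1 - q)⁻¹ * r ^ (e + n)) := by
          rw [tsum_ofReal_geometric (by positivity) hq0 hq1]
          congr 1; ring

end Growth

section Surf

open Pointwise

variable (E) in
/-- Surface measure of the unit sphere, as a measure on the ambient space. -/
noncomputable def surf : Measure E :=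
  (volume : Measure E).toSphere.map Subtype.val

instance : IsFiniteMeasure (surf E) := by unfold surf; infer_instance

theorem surf_apply {A : Set E} (hA : MeasurableSet A) :
    surf E A = finrank ℝ E *
      volume (Ioo (0 : ℝ) 1 • (A ∩ sphere (0 : E) 1)) := by
  rw [surf, Measure.map_apply measurable_subtype_coe hA,
    Measure.toSphere_apply' _ (measurable_subtype_coe hA), Subtype.image_preimage_coe,
    inter_comm]

theorem ae_surf_norm : ∀ᵐ σ ∂surf E, ‖σ‖ = 1 := by
  rw [surf, ae_map_iff measurable_subtype_coe.aemeasurable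
    (measurableSet_eq_fun measurable_norm measurable_const)]
  exact Eventually.of_forall fun σ => by simp

theorem surf_restrict_sphere : (surf E).restrict (sphere (0 : E) 1) = surf E := by
  apply Measure.restrict_eq_self_of_ae_mem
  filter_upwards [ae_surf_norm (E := E)] with σ hσ
  simpa using hσ

theorem surf_measurePreserving (R : E ≃ₗᵢ[ℝ] E) : MeasurePreserving R (surf E) (surf E) := by
  refine ⟨R.continuous.measurable, ?_⟩
  ext A hA
  rw [Measure.map_apply R.continuous.measurable hA, surf_apply hA,
    surf_apply (R.continuous.measurable hA)]
  have hset : Ioo (0 : ℝ) 1 • (R ⁻¹' A ∩ sphere (0 : E) 1) =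
      R ⁻¹' (Ioo (0 : ℝ) 1 • (A ∩ sphere (0 : E) 1)) := by
    ext x
    simp only [Set.mem_smul, mem_preimage, mem_inter_iff, mem_sphere_zero_iff_norm]
    constructor
    · rintro ⟨t, ht, y, ⟨hy, hy1⟩, rfl⟩
      exact ⟨t, ht, R y, ⟨hy, by rw [R.norm_map]; exact hy1⟩, by simp⟩
    · rintro ⟨t, ht, y, ⟨hy, hy1⟩, hx⟩
      exact ⟨t, ht, R.symm y, ⟨by simpa using hy, by rw [R.symm.norm_map]; exact hy1⟩, by
        rw [← map_smul, hx, R.symm_apply_apply]⟩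
  rw [hset, R.measurePreserving.measure_preimage_emb R.toHomeomorph.measurableEmbedding]

theorem surf_pos_of_isOpen {U : Set E} (hU : IsOpen U) {σ : E} (hσ : ‖σ‖ = 1) (hσU : σ ∈ U) :
    0 < surf E U := by
  rw [surf, Measure.map_apply measurable_subtype_coe hU.measurableSet]
  exact (hU.preimage continuous_subtype_val).measure_pos _ ⟨⟨σ, by simpa using hσ⟩, hσU⟩

theorem surf_ballGrowth [Nontrivial E] : ∃ C, 0 ≤ C ∧
    BallGrowth (surf E) (finrank ℝ E - 1) C := by
  set N := finrank ℝ E with hN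
  have hN1 : 1 ≤ N := Module.finrank_pos
  set v := (volume : Measure E).real (closedBall 0 1) with hv
  refine ⟨N * 3 ^ N * v + (surf E).real univ, by positivity, ?_⟩
  intro x r hr
  have hreal : ((surf E) (closedBall x r)) =
      ofReal ((surf E).real (closedBall x r)) := by simp
  rw [hreal]
  apply ENNReal.ofReal_le_ofReal
  have hv0 : 0 ≤ v := measureReal_nonneg
  rcases le_or_gt 1 r with h1 | h1
  · have hmono : (surf E).real (closedBall x r) ≤ (surf E).real univ :=
      measureReal_mono (subset_univ _)
    have h1' : (1 : ℝ) ≤ r ^ ((N : ℝ) - 1) :=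
      one_le_rpow h1 (sub_nonneg.2 (by exact_mod_cast hN1))
    have hT : 0 ≤ (surf E).real univ := measureReal_nonneg
    have h3 : 0 ≤ N * 3 ^ N * v := by positivity
    nlinarith
  · set A := closedBall x r ∩ sphere (0 : E) 1 with hA
    set T := Ioo (0 : ℝ) 1 • A with hT
    have hTsub : T ⊆ closedBall 0 1 := by
      rintro _ ⟨t, ht, y, hy, rfl⟩
      rw [mem_closedBall_zero_iff, norm_smul, mem_sphere_zero_iff_norm.1 hy.2, mul_one,
        norm_of_nonneg ht.1.le]
      exact ht.2.le
    have hTfin : volume T ≠ ⊤ :=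
      ((measure_mono hTsub).trans_lt measure_closedBall_lt_top).ne
    have hsurf : (surf E).real (closedBall x r) = N * volume.real T := by
      rw [measureReal_def, surf_apply measurableSet_closedBall, toReal_mul,
        ENNReal.toReal_natCast]
      rfl
    have hcov : T ⊆ ((1 - r) • T) ∪ closedBall x (3 * r) := by
      rintro _ ⟨t, ht, y, hy, rfl⟩
      rcases lt_or_ge t (1 - r) with h | h
      · left
        refine ⟨(t / (1 - r)) • y, ⟨t / (1 - r), ⟨div_pos ht.1 (by linarith), ?_⟩, y, hy, rfl⟩, ?_⟩
        · rw [div_lt_one (by linarith)]; exact h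
        · simp only [smul_smul]
          rw [mul_div_cancel₀ _ (by linarith : (1 - r) ≠ 0)]
      · right
        rw [mem_closedBall_iff_norm]
        have hy1 : ‖y - x‖ ≤ r := mem_closedBall_iff_norm.1 hy.1
        have : t • y - x = (t - 1) • y + (y - x) := by rw [sub_smul, one_smul]; abel
        simp only [this]
        refine (norm_add_le _ _).trans ?_
        rw [norm_smul, mem_sphere_zero_iff_norm.1 hy.2, norm_eq_abs, abs_of_nonpos
          (by linarith [ht.2])]
        linarith
    have hvol : volume.real T ≤ (1 - r) ^ N * volume.real T + (3 * r) ^ N * v := by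
      have h1 : volume.real T ≤ volume.real ((1 - r) • T) +
          volume.real (closedBall x (3 * r)) :=
        (measureReal_mono hcov (measure_union_lt_top
          ((measure_mono (smul_set_mono hTsub)).trans_lt
            ((isCompact_closedBall (0 : E) 1).smul (1 - r)).measure_lt_top)
          measure_closedBall_lt_top).ne).trans (measureReal_union_le _ _)
      rw [measureReal_def volume ((1 - r) • T), Measure.addHaar_smul,
        measureReal_def volume (closedBall x (3 * r)),
        Measure.addHaar_closedBall _ _ (by positivity : 0 ≤ 3 * r)] at h1
      rw [toReal_mul, toReal_mul, toReal_ofReal (abs_nonneg _),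
        toReal_ofReal (by positivity), abs_of_nonneg (by
          have : 0 ≤ 1 - r := by linarith
          positivity)] at h1
      have h2 : (volume (ball (0 : E) 1)).toReal ≤ v := by
        rw [hv, measureReal_def]
        exact ENNReal.toReal_mono measure_closedBall_lt_top.ne
          (measure_mono Metric.ball_subset_closedBall)
      refine h1.trans ?_
      gcongr
      rfl
    have hpow : (1 - r) ^ N ≤ 1 - r := by
      have := pow_le_pow_of_le_one (by linarith : 0 ≤ 1 - r) (by linarith) hN1
      simpa using this
    have hT0 : 0 ≤ volume.real T := measureReal_nonneg
    have hk : r * volume.real T ≤ (3 * r) ^ N * v := by nlinarith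
    have hrN : r ^ N = r * r ^ ((N : ℝ) - 1) := by
      rw [rpow_sub_one hr.ne', rpow_natCast]; field_simp
    have hk2 : volume.real T ≤ 3 ^ N * v * r ^ ((N : ℝ) - 1) := by
      rw [mul_pow, hrN] at hk
      have : r * volume.real T ≤ r * (3 ^ N * v * r ^ ((N : ℝ) - 1)) := by linarith
      exact le_of_mul_le_mul_left this hr
    rw [hsurf]
    have hp : 0 ≤ r ^ ((N : ℝ) - 1) := by positivity
    have hS : 0 ≤ (surf E).real univ := measureReal_nonneg
    have := mul_le_mul_of_nonneg_left hk2 (Nat.cast_nonneg (α := ℝ) N)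
    nlinarith [mul_nonneg hS hp]

variable (E) in
/-- The radial measure in logarithmic polar coordinates. -/
noncomputable def logRadial : Measure ℝ :=
  (volume : Measure ℝ).withDensity
    (fun τ => ofReal (exp (finrank ℝ E * τ)))

instance : SFinite (logRadial E) := by unfold logRadial; infer_instance

theorem lintegral_logRadial {f : ℝ → ENNReal} (hf : Measurable f) :
    ∫⁻ τ, f τ ∂logRadial E = ∫⁻ τ, ofReal (exp (finrank ℝ E * τ)) * f τ := by
  rw [logRadial, lintegral_withDensity_eq_lintegral_mul _ (by fun_prop) hf]
  rfl

theorem lintegral_polar_log [Nontrivial E] {F : E → ENNReal} (hF : Measurable F) :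
    ∫⁻ x, F x = ∫⁻ σ, ∫⁻ τ, F (exp τ • σ) ∂logRadial E ∂surf E := by
  set N := finrank ℝ E with hN
  have hN1 : 1 ≤ N := Module.finrank_pos
  have step1 : ∫⁻ x, F x = ∫⁻ p : sphere (0 : E) 1 × Ioi (0 : ℝ), F (p.2.1 • p.1.1)
      ∂((volume : Measure E).toSphere.prod (Measure.volumeIoiPow (N - 1))) := by
    have h := (volume : Measure E).measurePreserving_homeomorphUnitSphereProd.lintegral_comp_emb
      (Homeomorph.measurableEmbedding _) (fun p => F (p.2.1 • p.1.1))
    rw [← h]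
    have h0 : ∫⁻ x, F x = ∫⁻ x in ({0}ᶜ : Set E), F x := by
      rw [restrict_compl_singleton]
    rw [h0, ← lintegral_subtype_comap (measurableSet_singleton _).compl]
    refine lintegral_congr fun x => ?_
    congr 1
    have := (homeomorphUnitSphereProd E).symm_apply_apply x
    rw [← homeomorphUnitSphereProd_symm_apply_coe, this]
  have hmeas : Measurable fun p : sphere (0 : E) 1 × Ioi (0 : ℝ) =>
      F (p.2.1 • p.1.1) := by
    apply hF.comp
    fun_prop
  rw [step1, lintegral_prod _ hmeas.aemeasurable, surf]
  have hmeas2 : Measurable fun σ : E => ∫⁻ τ, F (exp τ • σ) ∂logRadial E := by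
    apply Measurable.lintegral_prod_right' (f := fun p : E × ℝ => F (exp p.2 • p.1))
    apply hF.comp
    fun_prop
  rw [lintegral_map hmeas2 measurable_subtype_coe]
  refine lintegral_congr fun σ => ?_
  have hF1 : Measurable fun τ : ℝ => F (exp τ • σ.1) := hF.comp (by fun_prop)
  have hF2 : Measurable fun r : Ioi (0 : ℝ) => F (r.1 • σ.1) := hF.comp (by fun_prop)
  rw [lintegral_logRadial hF1, Measure.volumeIoiPow,
    lintegral_withDensity_eq_lintegral_mul _ (by fun_prop) hF2]
  simp only [Pi.mul_apply]
  rw [lintegral_subtype_comap measurableSet_Ioi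
    (fun r : ℝ => ofReal (r ^ (N - 1)) * F (r • σ.1))]
  have himg : exp '' univ = Ioi 0 := by rw [image_univ, range_exp]
  rw [← himg, lintegral_image_eq_lintegral_abs_deriv_mul MeasurableSet.univ
    (fun x _ => (Real.hasDerivAt_exp x).hasDerivWithinAt) exp_injective.injOn]
  rw [Measure.restrict_univ]
  refine lintegral_congr fun τ => ?_
  rw [← mul_assoc, ← ofReal_mul (abs_nonneg _), abs_of_pos (exp_pos τ), ← pow_succ',
    Nat.sub_add_cancel hN1, ← exp_nat_mul]

theorem measurePreserving_polar_log [Nontrivial E] :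
    MeasurePreserving (fun p : E × ℝ => exp p.2 • p.1) ((surf E).prod (logRadial E))
      volume := by
  have hm : Measurable (fun p : E × ℝ => exp p.2 • p.1) := by fun_prop
  refine ⟨hm, ?_⟩
  refine Measure.ext_of_lintegral _ fun F hF => ?_
  have hFm : Measurable fun p : E × ℝ => F (exp p.2 • p.1) := hF.comp hm
  rw [lintegral_map hF hm, lintegral_prod _ hFm.aemeasurable, lintegral_polar_log hF]

end Surf

/-- Orthogonal projection onto the complement of a unit vector `θ`. -/
noncomputable def perp (θ : E) : E →L[ℝ] E :=
  ContinuousLinearMap.id ℝ E - (innerSL ℝ θ).smulRight θ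

theorem perp_apply (θ x : E) : perp θ x = x - inner ℝ θ x • θ := by
  simp [perp]

theorem inner_perp (hθ : ‖θ‖ = 1) (x : E) : inner ℝ θ (perp θ x) = 0 := by
  rw [perp_apply, inner_sub_right, inner_smul_right, real_inner_self_eq_norm_sq, hθ]
  ring

theorem perp_of_inner_eq_zero {θ x : E} (h : inner ℝ θ x = 0) : perp θ x = x := by
  rw [perp_apply, h, zero_smul, sub_zero]

theorem perp_self (hθ : ‖θ‖ = 1) : perp θ θ = 0 := by
  rw [perp_apply, real_inner_self_eq_norm_sq, hθ]; simp

/-- Stereographic parametrisation of the unit sphere from the pole `θ`. -/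
noncomputable def stereo (θ y : E) : E :=
  θ + (‖y‖ ^ 2 + 1 / 4)⁻¹ • (y - (1 / 2 : ℝ) • θ)

theorem norm_sub_half_sq {y : E} (hθ : ‖θ‖ = 1) (hy : inner ℝ θ y = 0) :
    ‖y - (1 / 2 : ℝ) • θ‖ ^ 2 = ‖y‖ ^ 2 + 1 / 4 := by
  rw [norm_sub_sq_real, inner_smul_right, real_inner_comm, hy, norm_smul, hθ]
  norm_num

theorem stereo_eq_inversion {y : E} (hθ : ‖θ‖ = 1) (hy : inner ℝ θ y = 0) :
    stereo θ y = EuclideanGeometry.inversion θ 1 (y + (1 / 2 : ℝ) • θ) := by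
  have e : y + (1 / 2 : ℝ) • θ - θ = y - (1 / 2 : ℝ) • θ := by module
  rw [EuclideanGeometry.inversion, dist_eq_norm, vsub_eq_sub, vadd_eq_add, e, div_pow,
    norm_sub_half_sq hθ hy, one_pow, one_div, stereo, add_comm]

theorem norm_stereo {y : E} (hθ : ‖θ‖ = 1) (hy : inner ℝ θ y = 0) : ‖stereo θ y‖ = 1 := by
  have hp : 0 < ‖y‖ ^ 2 + 1 / 4 := by positivity
  have h : ‖stereo θ y‖ ^ 2 = 1 := by
    rw [stereo, norm_add_sq_real, inner_smul_right, inner_sub_right, hy, inner_smul_right,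
      real_inner_self_eq_norm_sq, hθ, norm_smul, mul_pow, norm_sub_half_sq hθ hy,
      norm_of_nonneg (inv_nonneg.2 hp.le)]
    field_simp
    ring
  nlinarith [norm_nonneg (stereo θ y)]

theorem norm_stereo_sub_pole {y : E} (hθ : ‖θ‖ = 1) (hy : inner ℝ θ y = 0) :
    ‖stereo θ y - θ‖ = (‖y‖ ^ 2 + 1 / 4) ^ (-(1 / 2) : ℝ) := by
  have hp : 0 < ‖y‖ ^ 2 + 1 / 4 := by positivity
  rw [stereo, add_sub_cancel_left, norm_smul, norm_of_nonneg (inv_nonneg.2 hp.le)]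
  have hz : ‖y - (1 / 2 : ℝ) • θ‖ = (‖y‖ ^ 2 + 1 / 4) ^ (1 / 2 : ℝ) := by
    rw [← norm_sub_half_sq hθ hy, ← sqrt_eq_rpow, sqrt_sq (norm_nonneg _)]
  rw [hz, ← rpow_neg_one, ← rpow_add hp]
  norm_num

theorem norm_stereo_sub_stereo {θ y z : E} (hθ : ‖θ‖ = 1) (hy : inner ℝ θ y = 0)
    (hz : inner ℝ θ z = 0) :
    ‖stereo θ y - stereo θ z‖ =
      ‖y - z‖ * (‖y‖ ^ 2 + 1 / 4) ^ (-(1 / 2) : ℝ) * (‖z‖ ^ 2 + 1 / 4) ^ (-(1 / 2) : ℝ) := by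
  have hne : ∀ y : E, inner ℝ θ y = 0 → ‖y + (1 / 2 : ℝ) • θ - θ‖ =
      (‖y‖ ^ 2 + 1 / 4) ^ (1 / 2 : ℝ) ∧ y + (1 / 2 : ℝ) • θ ≠ θ := by
    intro y hy
    have e : y + (1 / 2 : ℝ) • θ - θ = y - (1 / 2 : ℝ) • θ := by module
    have h := norm_sub_half_sq hθ hy
    rw [← e] at h
    have hp : 0 < ‖y‖ ^ 2 + 1 / 4 := by positivity
    constructor
    · rw [← h, ← sqrt_eq_rpow, sqrt_sq (norm_nonneg _)]
    · intro h0
      rw [h0, sub_self, norm_zero] at h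
      linarith
  obtain ⟨n1, d1⟩ := hne y hy
  obtain ⟨n2, d2⟩ := hne z hz
  have hpy : 0 < ‖y‖ ^ 2 + 1 / 4 := by positivity
  have hpz : 0 < ‖z‖ ^ 2 + 1 / 4 := by positivity
  rw [stereo_eq_inversion hθ hy, stereo_eq_inversion hθ hz, ← dist_eq_norm,
    EuclideanGeometry.dist_inversion_inversion d1 d2, dist_eq_norm, dist_eq_norm, dist_eq_norm,
    n1, n2, add_sub_add_right_eq_sub, rpow_neg hpy.le, rpow_neg hpz.le]
  field_simp

theorem stereo_neg {y : E} (hθ : ‖θ‖ = 1) (hy : inner ℝ θ y = 0) :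
    stereo θ (-y) = (2 * inner ℝ (stereo θ y) θ) • θ - stereo θ y := by
  have hp : 0 < ‖y‖ ^ 2 + 1 / 4 := by positivity
  have hi : inner ℝ (stereo θ y) θ = 1 - (‖y‖ ^ 2 + 1 / 4)⁻¹ / 2 := by
    rw [stereo, inner_add_left, inner_smul_left, inner_sub_left, inner_smul_left,
      real_inner_comm θ y, hy, real_inner_self_eq_norm_sq, hθ]
    simp
    ring
  rw [hi]
  simp only [stereo, norm_neg]
  module

theorem stereo_surjective {θ σ : E} (hθ : ‖θ‖ = 1) (hσ : ‖σ‖ = 1) (h : σ ≠ θ) :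
    ∃ y, inner ℝ θ y = 0 ∧ stereo θ y = σ := by
  have hd : ‖σ - θ‖ ^ 2 = 2 - 2 * inner ℝ θ σ := by
    rw [norm_sub_sq_real, hσ, hθ, real_inner_comm]; ring
  have hd0 : ‖σ - θ‖ ^ 2 ≠ 0 := by
    simpa [sub_eq_zero] using h
  set p := EuclideanGeometry.inversion θ 1 σ with hp
  have hpe : p = (‖σ - θ‖ ^ 2)⁻¹ • (σ - θ) + θ := by
    rw [hp, EuclideanGeometry.inversion, dist_eq_norm, vsub_eq_sub, vadd_eq_add, div_pow, one_pow,
      one_div]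
  have hip : inner ℝ θ p = 1 / 2 := by
    rw [hpe, inner_add_right, inner_smul_right, inner_sub_right, real_inner_self_eq_norm_sq, hθ]
    have : inner ℝ θ σ = 1 - ‖σ - θ‖ ^ 2 / 2 := by linarith
    rw [this]
    generalize ‖σ - θ‖ ^ 2 = D at hd0
    field_simp
    ring
  have hy : inner ℝ θ (p - (1 / 2 : ℝ) • θ) = 0 := by
    rw [inner_sub_right, inner_smul_right, real_inner_self_eq_norm_sq, hθ, hip]; norm_num
  refine ⟨p - (1 / 2 : ℝ) • θ, hy, ?_⟩
  rw [stereo_eq_inversion hθ hy, sub_add_cancel, hp, EuclideanGeometry.inversion_inversion _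
    one_ne_zero]

theorem stereo_injective {θ y z : E} (hθ : ‖θ‖ = 1) (hy : inner ℝ θ y = 0)
    (hz : inner ℝ θ z = 0) (h : stereo θ y = stereo θ z) : y = z := by
  have := norm_stereo_sub_stereo hθ hy hz
  rw [h, sub_self, norm_zero] at this
  have hpy : 0 < (‖y‖ ^ 2 + 1 / 4) ^ (-(1 / 2) : ℝ) := by positivity
  have hpz : 0 < (‖z‖ ^ 2 + 1 / 4) ^ (-(1 / 2) : ℝ) := by positivity
  have h0 : ‖y - z‖ = 0 := by
    rcases mul_eq_zero.1 this.symm with h1 | h1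
    · rcases mul_eq_zero.1 h1 with h2 | h2
      · exact h2
      · exact absurd h2 hpy.ne'
    · exact absurd h1 hpz.ne'
  exact sub_eq_zero.1 (norm_eq_zero.1 h0)

theorem continuous_stereo (θ : E) : Continuous (stereo θ) := by
  unfold stereo
  have : ∀ y : E, ‖y‖ ^ 2 + 1 / 4 ≠ 0 := fun y => by positivity
  fun_prop (disch := assumption)

/-- Determinant of a rank one perturbation of the identity. -/
theorem det_id_add_smulRight (θ w : E) :
    (ContinuousLinearMap.id ℝ E + (innerSL ℝ θ).smulRight w).det = 1 + inner ℝ θ w := by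
  have h := LinearMap.transvection.det (R := ℝ) (innerSL ℝ θ : E →L[ℝ] ℝ).toLinearMap w
  rw [show (1 : ℝ) + inner ℝ θ w = 1 + (innerSL ℝ θ : E →L[ℝ] ℝ).toLinearMap w by simp, ← h]
  rw [ContinuousLinearMap.det]
  congr 1

theorem abs_det_linearIsometryEquiv_of_involutive (R : E ≃ₗᵢ[ℝ] E) (hR : ∀ x, R (R x) = x) :
    |((R : E →L[ℝ] E)).det| = 1 := by
  have h : ((R : E →L[ℝ] E) : E →ₗ[ℝ] E) * ((R : E →L[ℝ] E) : E →ₗ[ℝ] E) = 1 := by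
    ext x; simp [hR]
  have h2 := congrArg LinearMap.det h
  rw [map_mul, map_one] at h2
  rw [ContinuousLinearMap.det]
  have : |LinearMap.det ((R : E →L[ℝ] E) : E →ₗ[ℝ] E)| ^ 2 = 1 := by
    rw [sq_abs, sq]; exact h2
  have h0 := abs_nonneg (LinearMap.det ((R : E →L[ℝ] E) : E →ₗ[ℝ] E))
  nlinarith

/-- The slab `0 < ⟨θ, x⟩ < 1`. -/
def slab (θ : E) : Set E := {x | 0 < inner ℝ θ x ∧ inner ℝ θ x < 1}

theorem isOpen_slab (θ : E) : IsOpen (slab θ) := by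
  have h : Continuous fun x : E => inner ℝ θ x := by fun_prop
  exact (isOpen_lt continuous_const h).inter (isOpen_lt h continuous_const)

/-- Lebesgue measure on the hyperplane orthogonal to the unit vector `θ`, viewed as a measure
on the whole space. -/
noncomputable def flat (θ : E) : Measure E := (volume.restrict (slab θ)).map (perp θ)

theorem lintegral_flat (θ : E) {F : E → ENNReal} (hF : Measurable F) :
    ∫⁻ y, F y ∂flat θ = ∫⁻ x in slab θ, F (perp θ x) :=
  lintegral_map hF (perp θ).continuous.measurable

theorem ae_flat_inner (hθ : ‖θ‖ = 1) : ∀ᵐ y ∂flat θ, inner ℝ θ y = 0 := by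
  rw [flat, ae_map_iff (perp θ).continuous.measurable.aemeasurable]
  · exact Eventually.of_forall fun x => inner_perp hθ x
  · have h : Continuous fun x : E => inner ℝ θ x := by fun_prop
    exact h.measurable (measurableSet_singleton 0)

theorem lintegral_flat_prod (hθ : ‖θ‖ = 1) {F : E → ENNReal} (hF : Measurable F) :
    ∫⁻ y, (∫⁻ t : ℝ, F (y + t • θ)) ∂flat θ = ∫⁻ x, F x := by
  have hm : Measurable fun p : E × ℝ => F (p.1 + p.2 • θ) := hF.comp (by fun_prop)
  have hs := (isOpen_slab θ).measurableSet
  have h1 : Measurable fun y : E => ∫⁻ t : ℝ, F (y + t • θ) := hm.lintegral_prod_right'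
  rw [lintegral_flat θ h1]
  have h2 : ∀ x : E, ∫⁻ t : ℝ, F (perp θ x + t • θ) = ∫⁻ t : ℝ, F (x + t • θ) := by
    intro x
    rw [← lintegral_add_right_eq_self (fun t : ℝ => F (perp θ x + t • θ)) (inner ℝ θ x)]
    refine lintegral_congr fun t => ?_
    congr 1
    rw [perp_apply]; module
  simp_rw [h2]
  rw [lintegral_lintegral_swap hm.aemeasurable]
  have h3 : ∀ t : ℝ, ∫⁻ x in slab θ, F (x + t • θ) =
      ∫⁻ x, (slab θ).indicator (fun _ => F x) (x - t • θ) := by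
    intro t
    rw [← lintegral_indicator hs,
      ← lintegral_add_right_eq_self (fun x => (slab θ).indicator (fun _ => F x) (x - t • θ)) (t • θ)]
    refine lintegral_congr fun x => ?_
    rw [add_sub_cancel_right]
    by_cases hx : x ∈ slab θ <;> simp [hx]
  simp_rw [h3]
  have hm2 : Measurable (uncurry
      fun (t : ℝ) (x : E) => (slab θ).indicator (fun _ => F x) (x - t • θ)) := by
    have : (uncurry fun (t : ℝ) (x : E) => (slab θ).indicator (fun _ => F x) (x - t • θ)) =
        ((fun p : ℝ × E => p.2 - p.1 • θ) ⁻¹' slab θ).indicator (fun p => F p.2) := by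
      ext p
      by_cases h : p.2 - p.1 • θ ∈ slab θ <;> simp [uncurry, h]
    rw [this]
    refine (hF.comp measurable_snd).indicator ?_
    exact (show Continuous fun p : ℝ × E => p.2 - p.1 • θ by fun_prop).measurable hs
  rw [lintegral_lintegral_swap hm2.aemeasurable]
  refine lintegral_congr fun x => ?_
  have h4 : ∀ t : ℝ, (slab θ).indicator (fun _ => F x) (x - t • θ) =
      (Ioo (inner ℝ θ x - 1) (inner ℝ θ x)).indicator (fun _ => F x) t := by
    intro t
    have : inner ℝ θ (x - t • θ) = inner ℝ θ x - t := by
      rw [inner_sub_right, inner_smul_right, real_inner_self_eq_norm_sq, hθ]; ring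
    by_cases h : x - t • θ ∈ slab θ
    · have h' : t ∈ Ioo (inner ℝ θ x - 1) (inner ℝ θ x) := by
        simp only [slab, mem_ofPred_eq, this] at h
        constructor <;> linarith [h.1, h.2]
      rw [indicator_of_mem h, indicator_of_mem h']
    · have h' : t ∉ Ioo (inner ℝ θ x - 1) (inner ℝ θ x) := by
        intro h'
        apply h
        simp only [slab, mem_ofPred_eq, this]
        constructor <;> linarith [h'.1, h'.2]
      rw [indicator_of_notMem h, indicator_of_notMem h']
  simp_rw [h4]
  rw [lintegral_indicator measurableSet_Ioo, lintegral_const]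
  simp

theorem lintegral_flat_add {θ v : E} (hv : inner ℝ θ v = 0) {F : E → ENNReal}
    (hF : Measurable F) : ∫⁻ y, F (y + v) ∂flat θ = ∫⁻ y, F y ∂flat θ := by
  have hs := (isOpen_slab θ).measurableSet
  rw [lintegral_flat θ (F := fun y => F (y + v)) (hF.comp (measurable_add_const v)),
    lintegral_flat θ hF,
    ← lintegral_indicator hs, ← lintegral_indicator hs,
    ← lintegral_add_right_eq_self (fun x => (slab θ).indicator (fun x => F (perp θ x)) x) v]
  refine lintegral_congr fun x => ?_
  have h1 : x + v ∈ slab θ ↔ x ∈ slab θ := by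
    simp [slab, inner_add_right, hv]
  have h2 : perp θ (x + v) = perp θ x + v := by
    rw [map_add, perp_of_inner_eq_zero hv]
  by_cases hx : x ∈ slab θ
  · rw [indicator_of_mem hx, indicator_of_mem (h1.2 hx), h2]
  · rw [indicator_of_notMem hx, indicator_of_notMem (fun h => hx (h1.1 h))]

theorem lintegral_flat_slice (hθ : ‖θ‖ = 1) {F : E → ENNReal} (hF : Measurable F)
    (c : ℝ) :
    ∫⁻ x in {x : E | 0 < inner ℝ θ x ∧ inner ℝ θ x < c}, F (perp θ x) =
      ofReal c * ∫⁻ y, F y ∂flat θ := by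
  have hi : Continuous fun x : E => inner ℝ θ x := by fun_prop
  have hs : MeasurableSet {x : E | 0 < inner ℝ θ x ∧ inner ℝ θ x < c} :=
    ((isOpen_lt continuous_const hi).inter (isOpen_lt hi continuous_const)).measurableSet
  rw [← lintegral_indicator hs, ← lintegral_flat_prod hθ
    (F := {x : E | 0 < inner ℝ θ x ∧ inner ℝ θ x < c}.indicator fun x => F (perp θ x))
    ((hF.comp (perp θ).continuous.measurable).indicator hs), ← lintegral_const_mul _ hF]
  refine lintegral_congr_ae ?_
  filter_upwards [ae_flat_inner hθ] with y hy
  have h4 : ∀ t : ℝ, ({x : E | 0 < inner ℝ θ x ∧ inner ℝ θ x < c}.indicator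
      (fun x => F (perp θ x))) (y + t • θ) = (Ioo 0 c).indicator (fun _ => F y) t := by
    intro t
    have h1 : inner ℝ θ (y + t • θ) = t := by
      rw [inner_add_right, inner_smul_right, real_inner_self_eq_norm_sq, hθ, hy]; ring
    have h2 : perp θ (y + t • θ) = y := by
      rw [map_add, map_smul, perp_self hθ, perp_of_inner_eq_zero hy, smul_zero, add_zero]
    simp only [indicator, mem_ofPred_eq, h1, h2, mem_Ioo]
  simp_rw [h4]
  rw [lintegral_indicator measurableSet_Ioo, lintegral_const]
  simp [mul_comm]

theorem lintegral_comp_smul {c : ℝ} (hc : 0 < c) {F : E → ENNReal} (hF : Measurable F) :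
    ofReal (c ^ finrank ℝ E) * ∫⁻ x : E, F (c • x) = ∫⁻ x, F x := by
  have h := Measure.map_addHaar_smul (volume : Measure E) hc.ne'
  have h2 : ∫⁻ x : E, F (c • x) = ∫⁻ x, F x ∂(Measure.map (c • ·) (volume : Measure E)) :=
    (lintegral_map hF (measurable_const_smul c)).symm
  rw [h2, h, lintegral_smul_measure, smul_eq_mul, ← mul_assoc,
    ← ofReal_mul (by positivity), abs_of_pos (by positivity), mul_inv_cancel₀ (by positivity)]
  simp

theorem lintegral_flat_smul (hθ : ‖θ‖ = 1) {c : ℝ} (hc : 0 < c) {F : E → ENNReal}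
    (hF : Measurable F) :
    ofReal (c ^ finrank ℝ E) * ∫⁻ y, F (c • y) ∂flat θ =
      ofReal c * ∫⁻ y, F y ∂flat θ := by
  have hi : Continuous fun x : E => inner ℝ θ x := by fun_prop
  have hs : MeasurableSet {x : E | 0 < inner ℝ θ x ∧ inner ℝ θ x < c} :=
    ((isOpen_lt continuous_const hi).inter (isOpen_lt hi continuous_const)).measurableSet
  have hm : Measurable fun x => F (perp θ x) := hF.comp (perp θ).continuous.measurable
  rw [lintegral_flat θ (F := fun y => F (c • y)) (hF.comp (measurable_const_smul c)),
    ← lintegral_flat_slice hθ hF c,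
    ← lintegral_indicator hs, ← lintegral_comp_smul hc (hm.indicator hs),
    ← lintegral_indicator (isOpen_slab θ).measurableSet]
  congr 1
  refine lintegral_congr fun x => ?_
  have h1 : c • x ∈ {x : E | 0 < inner ℝ θ x ∧ inner ℝ θ x < c} ↔ x ∈ slab θ := by
    simp only [mem_ofPred_eq, slab, inner_smul_right]
    constructor
    · rintro ⟨h1, h2⟩
      exact ⟨(mul_pos_iff_of_pos_left hc).1 h1, by nlinarith⟩
    · rintro ⟨h1, h2⟩
      exact ⟨mul_pos hc h1, by nlinarith⟩
  by_cases hx : x ∈ slab θ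
  · rw [indicator_of_mem hx, indicator_of_mem (h1.2 hx)]
    simp
  · rw [indicator_of_notMem hx, indicator_of_notMem (fun h => hx (h1.1 h))]

theorem flat_ballGrowth : ∃ C, 0 ≤ C ∧
    ∀ θ : E, ‖θ‖ = 1 → BallGrowth (flat θ) (finrank ℝ E - 1) C := by
  have hfin : volume (closedBall (0 : E) 2) ≠ ⊤ :=
    (isCompact_closedBall _ _).measure_lt_top.ne
  refine ⟨(volume (closedBall (0 : E) 2)).toReal, toReal_nonneg, ?_⟩
  intro θ hθ x r hr
  have hind : ∀ (z : E) (t : ℝ), Measurable fun y : E =>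
      (closedBall z t).indicator (fun _ => (1 : ENNReal)) y := fun z t =>
    measurable_const.indicator Metric.isClosed_closedBall.measurableSet
  have h1 : flat θ (closedBall x r) ≤
      ∫⁻ y, (closedBall (0 : E) r).indicator (fun _ => 1) y ∂flat θ := by
    have hv : inner ℝ θ (-perp θ x) = 0 := by rw [inner_neg_right, inner_perp hθ, neg_zero]
    rw [← lintegral_flat_add hv (hind 0 r)]
    rw [← lintegral_indicator_one Metric.isClosed_closedBall.measurableSet]
    refine lintegral_mono_ae ?_
    filter_upwards [ae_flat_inner hθ] with y hy
    by_cases h : y ∈ closedBall x r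
    · have : y + -perp θ x ∈ closedBall (0 : E) r := by
        rw [mem_closedBall_zero_iff]
        rw [mem_closedBall_iff_norm] at h
        refine le_trans ?_ h
        have e : y + -perp θ x = perp θ (y - x) := by
          rw [map_sub, perp_of_inner_eq_zero hy]; abel
        have e2 : y - x = perp θ (y - x) + inner ℝ θ (y - x) • θ := by rw [perp_apply]; abel
        have e3 : ‖y - x‖ ^ 2 = ‖perp θ (y - x)‖ ^ 2 + (inner ℝ θ (y - x)) ^ 2 := by
          conv_lhs => rw [e2]
          rw [norm_add_sq_real, inner_smul_right, real_inner_comm θ (perp θ (y - x)), inner_perp hθ,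
            norm_smul, hθ]
          simp
        rw [e]
        have := norm_nonneg (perp θ (y - x))
        have := norm_nonneg (y - x)
        nlinarith [sq_nonneg (inner ℝ θ (y - x))]
      rw [indicator_of_mem this]
      exact indicator_le_self' (by simp) y
    · rw [indicator_of_notMem h]; exact zero_le
  have h2 := lintegral_flat_smul hθ hr (hind 0 r)
  have h3 : ∫⁻ y, (closedBall (0 : E) r).indicator (fun _ => (1 : ENNReal)) (r • y) ∂flat θ
      ≤ volume (closedBall (0 : E) 2) := by
    rw [lintegral_flat θ
        (F := fun y => (closedBall (0 : E) r).indicator (fun _ => (1 : ENNReal)) (r • y))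
        ((hind 0 r).comp (measurable_const_smul r)),
      ← lintegral_indicator (isOpen_slab θ).measurableSet,
      ← lintegral_indicator_one Metric.isClosed_closedBall.measurableSet]
    refine lintegral_mono fun x => ?_
    by_cases hx : x ∈ slab θ
    · rw [indicator_of_mem hx]
      by_cases hp : r • perp θ x ∈ closedBall (0 : E) r
      · have : x ∈ closedBall (0 : E) 2 := by
          rw [mem_closedBall_zero_iff] at hp ⊢
          rw [norm_smul, norm_of_nonneg hr.le] at hp
          have hp' : ‖perp θ x‖ ≤ 1 := by
            by_contra hcon
            push Not at hcon
            nlinarith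
          have e2 : x = perp θ x + inner ℝ θ x • θ := by rw [perp_apply]; abel
          rw [e2]
          refine (norm_add_le _ _).trans ?_
          rw [norm_smul, hθ, norm_of_nonneg hx.1.le]
          have := hx.2
          linarith
        rw [indicator_of_mem hp, indicator_of_mem this]; simp
      · rw [indicator_of_notMem hp]; exact zero_le
    · rw [indicator_of_notMem hx]; exact zero_le
  refine h1.trans ?_
  have h4 : ofReal r * ∫⁻ y, (closedBall (0 : E) r).indicator (fun _ => 1) y ∂flat θ ≤
      ofReal r * ofReal
        ((volume (closedBall (0 : E) 2)).toReal * r ^ ((finrank ℝ E : ℝ) - 1)) := by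
    rw [← h2, ← ofReal_mul hr.le]
    calc _ ≤ ofReal (r ^ finrank ℝ E) * volume (closedBall (0 : E) 2) := by
          gcongr
      _ = _ := by
          conv_lhs => rw [← ENNReal.ofReal_toReal hfin, ← ofReal_mul (by positivity)]
          congr 1
          rw [rpow_sub_one hr.ne', rpow_natCast]
          field_simp
  have hr0 : ofReal r ≠ 0 := by simpa using hr
  exact (ENNReal.mul_le_mul_iff_right hr0 ofReal_ne_top).1 h4

instance (θ : E) : SFinite (flat θ) := by unfold flat; infer_instance

/-- The map from the slab over `θ` onto the shell `1 < ‖x‖ < e` built from the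
stereographic parametrisation. -/
noncomputable def slabMap (θ x : E) : E := exp (inner ℝ θ x) • stereo θ (perp θ x)

theorem hasFDerivAt_slabMap (hθ : ‖θ‖ = 1) (x : E) :
    ∃ D : E →L[ℝ] E, HasFDerivAt (slabMap θ) D x ∧
      |D.det| = exp (inner ℝ θ x) ^ finrank ℝ E *
        ((‖perp θ x‖ ^ 2 + 1 / 4)⁻¹ ^ finrank ℝ E * (‖perp θ x‖ ^ 2 + 1 / 4)) := by
  set t := inner ℝ θ x with ht
  set y := perp θ x with hy
  have hyo : inner ℝ θ y = 0 := inner_perp hθ x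
  set p : ℝ := ‖y‖ ^ 2 + 1 / 4 with hp
  have hp0 : 0 < p := by positivity
  set z := y - (1 / 2 : ℝ) • θ with hz
  have hzn : ‖z‖ ^ 2 = p := norm_sub_half_sq hθ hyo
  have hz0 : z ≠ 0 := by
    intro h; rw [h, norm_zero] at hzn; simp at hzn; exact hp0.ne hzn
  have ez : y + (1 / 2 : ℝ) • θ - θ = z := by rw [hz]; module
  have hne : y + (1 / 2 : ℝ) • θ ≠ θ := by
    intro h; rw [h, sub_self] at ez; exact hz0 ez.symm
  have h1 := EuclideanGeometry.hasFDerivAt_inversion (R := 1) hne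
  rw [dist_eq_norm, ez, div_pow, one_pow, hzn, one_div] at h1
  have h2 : HasFDerivAt (fun x => perp θ x + (1 / 2 : ℝ) • θ) (perp θ) x :=
    (perp θ).hasFDerivAt.add_const _
  have h3 := HasFDerivAt.comp x h1 h2
  have h4 : HasFDerivAt (fun x => exp (inner ℝ θ x)) (exp t • (innerSL ℝ θ)) x := by
    have : HasFDerivAt (fun x : E => inner ℝ θ x) (innerSL ℝ θ) x := (innerSL ℝ θ).hasFDerivAt
    exact this.exp
  have h5 := h4.smul h3
  have hfun : slabMap θ = fun x => exp (inner ℝ θ x) •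
      (EuclideanGeometry.inversion θ 1 ∘ fun x => perp θ x + (1 / 2 : ℝ) • θ) x := by
    funext w
    rw [slabMap, stereo_eq_inversion hθ (inner_perp hθ w)]; rfl
  have hst : (EuclideanGeometry.inversion θ 1 ∘ fun x => perp θ x + (1 / 2 : ℝ) • θ) x =
      stereo θ y := by
    rw [stereo_eq_inversion hθ hyo]; rfl
  rw [hst] at h5
  set R := (ℝ ∙ z)ᗮ.reflection with hR
  have hRθ : R θ = stereo θ y := by
    have h : R θ = -((ℝ ∙ z).reflection θ) := Submodule.reflection_orthogonal_apply _ _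
    rw [h, Submodule.reflection_singleton_apply]
    have hzi : inner ℝ z θ = - (1 / 2) := by
      rw [hz, inner_sub_left, inner_smul_left, real_inner_comm, hyo, real_inner_self_eq_norm_sq, hθ]
      norm_num
    simp only [hzi, stereo, ← hp, ← hz, RCLike.ofReal_real_eq_id, id, hzn]
    module
  have h6 := h5
  change HasFDerivAt (fun x => exp (inner ℝ θ x) •
      (EuclideanGeometry.inversion θ 1 ∘ fun x => perp θ x + (1 / 2 : ℝ) • θ) x) _ x at h6
  rw [← hfun] at h6
  refine ⟨_, h6, ?_⟩
  have hD : exp (inner ℝ θ x) • (p⁻¹ • (R : E →L[ℝ] E)).comp (perp θ) +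
      (exp t • (innerSL ℝ θ)).smulRight (stereo θ y) =
      (exp t * p⁻¹) • ((R : E →L[ℝ] E) *
        (ContinuousLinearMap.id ℝ E + (innerSL ℝ θ).smulRight ((p - 1) • θ))) := by
    ext v
    simp [← hRθ, perp_apply, ← ht]
    rw [← sub_eq_zero]
    match_scalars <;> field_simp <;> ring
  rw [hD]
  rw [ContinuousLinearMap.det, ContinuousLinearMap.toLinearMap_smul, LinearMap.det_smul, abs_mul, abs_pow,
    abs_of_pos (by positivity : 0 < exp t * p⁻¹)]
  have hdet : |LinearMap.det (((R : E →L[ℝ] E) *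
      (ContinuousLinearMap.id ℝ E + (innerSL ℝ θ).smulRight ((p - 1) • θ)) : E →L[ℝ] E) : E →ₗ[ℝ] E)|
      = p := by
    have e : (((R : E →L[ℝ] E) *
      (ContinuousLinearMap.id ℝ E + (innerSL ℝ θ).smulRight ((p - 1) • θ)) : E →L[ℝ] E) : E →ₗ[ℝ] E)
      = ((R : E →L[ℝ] E) : E →ₗ[ℝ] E) * ((ContinuousLinearMap.id ℝ E +
        (innerSL ℝ θ).smulRight ((p - 1) • θ) : E →L[ℝ] E) : E →ₗ[ℝ] E) := rfl
    rw [e, map_mul, abs_mul]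
    have a1 := abs_det_linearIsometryEquiv_of_involutive R (Submodule.reflection_reflection _)
    have a2 := det_id_add_smulRight θ ((p - 1) • θ)
    rw [ContinuousLinearMap.det] at a1 a2
    rw [a1, a2, inner_smul_right, real_inner_self_eq_norm_sq, hθ]
    rw [show 1 + (p - 1) * 1 ^ 2 = p by ring, abs_of_pos hp0, one_mul]
  rw [hdet, mul_pow]
  ring

theorem slabMap_injOn (hθ : ‖θ‖ = 1) : InjOn (slabMap θ) (slab θ) := by
  intro x _ y _ h
  have hn : ∀ x, ‖slabMap θ x‖ = exp (inner ℝ θ x) := fun x => by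
    rw [slabMap, norm_smul, norm_stereo hθ (inner_perp hθ x), norm_of_nonneg (exp_pos _).le,
      mul_one]
  have h1 : inner ℝ θ x = inner ℝ θ y := by
    apply exp_injective; rw [← hn, ← hn, h]
  have h2 : stereo θ (perp θ x) = stereo θ (perp θ y) := by
    rw [slabMap, slabMap, h1] at h
    exact smul_right_injective E (exp_pos _).ne' h
  have h3 := stereo_injective hθ (inner_perp hθ x) (inner_perp hθ y) h2
  rw [perp_apply, perp_apply, h1] at h3
  exact sub_left_injective h3

theorem surf_singleton (hN : 2 ≤ finrank ℝ E) (x : E) : surf E {x} = 0 := by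
  have := nontrivial_of_two_le hN
  obtain ⟨C, -, h⟩ := surf_ballGrowth (E := E)
  refine h.singleton ?_ x
  have : (2 : ℝ) ≤ finrank ℝ E := by exact_mod_cast hN
  linarith

theorem lintegral_surf_stereo (hN : 2 ≤ finrank ℝ E) (hθ : ‖θ‖ = 1)
    {F : E → ENNReal} (hF : Measurable F) :
    ∫⁻ σ, F σ ∂surf E = ∫⁻ y, ofReal
      ((‖y‖ ^ 2 + 1 / 4)⁻¹ ^ finrank ℝ E * (‖y‖ ^ 2 + 1 / 4)) * F (stereo θ y) ∂flat θ := by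
  have := nontrivial_of_two_le hN
  have hs := (isOpen_slab θ).measurableSet
  choose D hD hdet using fun x => hasFDerivAt_slabMap hθ x
  set G : E → ENNReal := fun x => ofReal (‖x‖⁻¹ ^ finrank ℝ E) * F (‖x‖⁻¹ • x) with hG
  have hGm : Measurable G := by
    refine Measurable.mul ?_ (hF.comp ?_)
    · exact (measurable_norm.inv.pow_const _).ennreal_ofReal
    · exact measurable_norm.inv.smul measurable_id
  have key := lintegral_image_eq_lintegral_abs_det_fderiv_mul volume hs
    (fun x _ => (hD x).hasFDerivWithinAt) (slabMap_injOn hθ) G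
  have hm1 : Measurable fun y : E => ofReal
      ((‖y‖ ^ 2 + 1 / 4)⁻¹ ^ finrank ℝ E * (‖y‖ ^ 2 + 1 / 4)) * F (stereo θ y) := by
    refine Measurable.mul ?_ (hF.comp (continuous_stereo θ).measurable)
    exact ((((measurable_norm.pow_const 2).add_const _).inv.pow_const _).mul
      ((measurable_norm.pow_const 2).add_const _)).ennreal_ofReal
  rw [lintegral_flat θ hm1]
  have hn : ∀ x, ‖slabMap θ x‖ = exp (inner ℝ θ x) := fun x => by
    rw [slabMap, norm_smul, norm_stereo hθ (inner_perp hθ x), norm_of_nonneg (exp_pos _).le,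
      mul_one]
  have e1 : ∀ x, ofReal |(D x).det| * G (slabMap θ x) = ofReal
      ((‖perp θ x‖ ^ 2 + 1 / 4)⁻¹ ^ finrank ℝ E * (‖perp θ x‖ ^ 2 + 1 / 4)) *
        F (stereo θ (perp θ x)) := by
    intro x
    rw [hdet, hG]
    simp only [hn]
    rw [← mul_assoc, ← ofReal_mul (by positivity)]
    have hx : exp (inner ℝ θ x) ≠ 0 := (exp_pos _).ne'
    congr 2
    · rw [mul_right_comm, ← mul_pow, mul_inv_cancel₀ hx, one_pow, one_mul]
    · rw [slabMap, smul_smul, inv_mul_cancel₀ hx, one_smul]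
  simp_rw [e1] at key
  rw [← key, ← lintegral_indicator]
  swap
  · exact (measurable_image_of_fderivWithin hs (fun x _ => (hD x).hasFDerivWithinAt)
      (slabMap_injOn hθ))
  rw [lintegral_polar_log]
  swap
  · exact hGm.indicator (measurable_image_of_fderivWithin hs
      (fun x _ => (hD x).hasFDerivWithinAt) (slabMap_injOn hθ))
  refine lintegral_congr_ae ?_
  have hne : ∀ᵐ σ ∂surf E, σ ≠ θ := by
    rw [ae_iff]; simpa using surf_singleton hN θ
  filter_upwards [ae_surf_norm, hne] with σ hσ hσθ
  have hmem : ∀ τ : ℝ, exp τ • σ ∈ slabMap θ '' slab θ ↔ τ ∈ Ioo (0 : ℝ) 1 := by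
    intro τ
    constructor
    · rintro ⟨x, hx, he⟩
      have := congrArg norm he
      rw [hn, norm_smul, hσ, mul_one, norm_of_nonneg (exp_pos _).le] at this
      have := exp_injective this
      rw [← this]; exact hx
    · intro h
      obtain ⟨y, hy, rfl⟩ := stereo_surjective hθ hσ hσθ
      have i1 : inner ℝ θ (y + τ • θ) = τ := by
        rw [inner_add_right, inner_smul_right, real_inner_self_eq_norm_sq, hθ, hy]; ring
      refine ⟨y + τ • θ, ?_, ?_⟩
      · rw [slab, mem_ofPred_eq, i1]; exact h
      · rw [slabMap, i1, map_add, map_smul, perp_self hθ, perp_of_inner_eq_zero hy, smul_zero,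
          add_zero]
  have e2 : ∀ τ : ℝ, (slabMap θ '' slab θ).indicator G (exp τ • σ) =
      (Ioo (0 : ℝ) 1).indicator (fun τ => ofReal
        ((exp τ)⁻¹ ^ finrank ℝ E) * F σ) τ := by
    intro τ
    by_cases h : τ ∈ Ioo (0 : ℝ) 1
    · rw [indicator_of_mem h, indicator_of_mem ((hmem τ).2 h), hG]
      simp only [norm_smul, hσ, mul_one, norm_of_nonneg (exp_pos τ).le]
      rw [smul_smul, inv_mul_cancel₀ (exp_pos _).ne', one_smul]
    · rw [indicator_of_notMem h, indicator_of_notMem (fun h' => h ((hmem τ).1 h'))]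
  simp_rw [e2]
  rw [lintegral_logRadial]
  swap
  · refine Measurable.indicator ?_ measurableSet_Ioo
    exact (((measurable_exp.inv.pow_const _).ennreal_ofReal)).mul_const _
  have e3 : ∀ τ : ℝ, ofReal (exp (finrank ℝ E * τ)) *
      (Ioo (0 : ℝ) 1).indicator (fun τ => ofReal
        ((exp τ)⁻¹ ^ finrank ℝ E) * F σ) τ =
      (Ioo (0 : ℝ) 1).indicator (fun _ => F σ) τ := by
    intro τ
    by_cases h : τ ∈ Ioo (0 : ℝ) 1
    · rw [indicator_of_mem h, indicator_of_mem h, ← mul_assoc, ← ofReal_mul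
        (exp_pos _).le, exp_nat_mul, ← mul_pow, mul_inv_cancel₀ (exp_pos _).ne']
      simp
    · rw [indicator_of_notMem h, indicator_of_notMem h, mul_zero]
  simp_rw [e3]
  rw [lintegral_indicator measurableSet_Ioo, lintegral_const]
  simp

section NearFar

variable {ν : Measure E} {n C : ℝ}

/-- Splitting an integral into a part near `x`, controlled by singularities at the points `c i`,
and a part far from `x`. -/
theorem BallGrowth.nearFar (h : BallGrowth ν n C) (hn : 0 < n) (hC : 0 ≤ C) {e₁ e₂ : ℝ}
    (he₁ : 0 < e₁ + n) (he₂ : e₂ + n < 0) :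
    ∃ K, 0 ≤ K ∧ ∀ (x : E) (ρ : ℝ) (c : Fin 4 → E) (A₁ A₂ : ℝ) (f : E → ℝ), 0 < ρ → 0 ≤ A₁ →
      0 ≤ A₂ → AEStronglyMeasurable f ν → (∀ i, ‖c i - x‖ ≤ ρ) →
      (∀ᵐ y ∂ν, ‖y - x‖ ≤ ρ → |f y| ≤ A₁ * ∑ i, ‖y - c i‖ ^ e₁) →
      (∀ᵐ y ∂ν, ρ < ‖y - x‖ → |f y| ≤ A₂ * ‖y - x‖ ^ e₂) →
      Integrable f ν ∧ ∫ y, |f y| ∂ν ≤ K * (A₁ * ρ ^ (e₁ + n) + A₂ * ρ ^ (e₂ + n)) := by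
  obtain ⟨P, hP0, hP⟩ := h.near hn hC he₁
  obtain ⟨Q, hQ0, hQ⟩ := h.far hC he₂
  refine ⟨4 * P * 2 ^ (e₁ + n) + Q, by positivity, ?_⟩
  intro x ρ c A₁ A₂ f hρ hA₁ hA₂ hf hc h1 h2
  have hsub : ∀ i, closedBall x ρ ⊆ closedBall (c i) (2 * ρ) := by
    intro i y hy
    rw [mem_closedBall_iff_norm] at hy ⊢
    have : y - c i = (y - x) - (c i - x) := by abel
    rw [this]
    exact (norm_sub_le _ _).trans (by linarith [hc i])
  have hms : MeasurableSet (closedBall x ρ) := Metric.isClosed_closedBall.measurableSet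
  have hint1 : ∀ i, IntegrableOn (fun y => ‖y - c i‖ ^ e₁) (closedBall x ρ) ν := fun i =>
    (hP (c i) (2 * ρ) (by linarith)).1.mono_set (hsub i)
  have hsumint : IntegrableOn (fun y => A₁ * ∑ i, ‖y - c i‖ ^ e₁) (closedBall x ρ) ν :=
    (integrable_finsetSum _ fun i _ => hint1 i).const_mul A₁
  have hcs : (closedBall x ρ)ᶜ ⊆ {y | ρ ≤ ‖y - x‖} := by
    intro y hy
    rw [mem_compl_iff, mem_closedBall_iff_norm, not_le] at hy
    exact hy.le
  have hint2 : IntegrableOn (fun y => A₂ * ‖y - x‖ ^ e₂) (closedBall x ρ)ᶜ ν :=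
    ((hQ x ρ hρ).1.mono_set hcs).const_mul A₂
  have b1 : ∀ᵐ y ∂ν.restrict (closedBall x ρ), |f y| ≤ A₁ * ∑ i, ‖y - c i‖ ^ e₁ := by
    rw [ae_restrict_iff' hms]
    filter_upwards [h1] with y hy hy2
    exact hy (mem_closedBall_iff_norm.1 hy2)
  have b2 : ∀ᵐ y ∂ν.restrict (closedBall x ρ)ᶜ, |f y| ≤ A₂ * ‖y - x‖ ^ e₂ := by
    rw [ae_restrict_iff' hms.compl]
    filter_upwards [h2] with y hy hy2
    rw [mem_compl_iff, mem_closedBall_iff_norm, not_le] at hy2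
    exact hy hy2
  have i1 : IntegrableOn f (closedBall x ρ) ν := Integrable.mono' hsumint hf.restrict b1
  have i2 : IntegrableOn f (closedBall x ρ)ᶜ ν := Integrable.mono' hint2 hf.restrict b2
  have hi : Integrable f ν := by
    rw [← integrableOn_univ, ← union_compl_self (closedBall x ρ)]
    exact i1.union i2
  refine ⟨hi, ?_⟩
  rw [← integral_add_compl hms hi.abs]
  have k1 : ∫ y in closedBall x ρ, |f y| ∂ν ≤ A₁ * (4 * (P * (2 * ρ) ^ (e₁ + n))) := by
    refine (integral_mono_ae i1.abs hsumint b1).trans ?_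
    rw [integral_const_mul, integral_finsetSum _ fun i _ => hint1 i]
    gcongr
    have : ∀ i ∈ (Finset.univ : Finset (Fin 4)), ∫ y in closedBall x ρ, ‖y - c i‖ ^ e₁ ∂ν ≤
        P * (2 * ρ) ^ (e₁ + n) := fun i _ =>
      (setIntegral_mono_set (hP (c i) (2 * ρ) (by linarith)).1
        (Eventually.of_forall fun y => by positivity) (hsub i).eventuallyLE).trans
        (hP (c i) (2 * ρ) (by linarith)).2
    refine (Finset.sum_le_card_nsmul _ _ _ this).trans ?_
    simp
  have k2 : ∫ y in (closedBall x ρ)ᶜ, |f y| ∂ν ≤ A₂ * (Q * ρ ^ (e₂ + n)) := by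
    refine (integral_mono_ae i2.abs hint2 b2).trans ?_
    rw [integral_const_mul]
    gcongr
    exact (setIntegral_mono_set (hQ x ρ hρ).1
        (Eventually.of_forall fun y => by positivity) hcs.eventuallyLE).trans (hQ x ρ hρ).2
  rw [mul_rpow (by norm_num) hρ.le] at k1
  have q1 : 0 ≤ A₁ * ρ ^ (e₁ + n) := by positivity
  have q2 : 0 ≤ A₂ * ρ ^ (e₂ + n) := by positivity
  have q3 : (0 : ℝ) ≤ 4 * P * 2 ^ (e₁ + n) := by positivity
  calc _ ≤ A₁ * (4 * (P * (2 ^ (e₁ + n) * ρ ^ (e₁ + n)))) + A₂ * (Q * ρ ^ (e₂ + n)) :=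
        add_le_add k1 k2
    _ = (4 * P * 2 ^ (e₁ + n)) * (A₁ * ρ ^ (e₁ + n)) + Q * (A₂ * ρ ^ (e₂ + n)) := by ring
    _ ≤ _ := by nlinarith [mul_nonneg q3 q2, mul_nonneg hQ0 q1]

end NearFar

/-- The dimension of `E` as a real number. -/
noncomputable abbrev dim (E : Type*) [NormedAddCommGroup E] [InnerProductSpace ℝ E] : ℝ :=
  (finrank ℝ E : ℝ)

theorem aestronglyMeasurable_surf {f : E → ℝ} (hf : ContinuousOn f (sphere 0 1)) :
    AEStronglyMeasurable f (surf E) := by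
  rw [← surf_restrict_sphere]
  exact hf.aestronglyMeasurable (isCompact_sphere (0 : E) 1).isClosed.measurableSet

theorem surf_growth (hN : 2 ≤ finrank ℝ E) : ∃ C, 0 ≤ C ∧ BallGrowth (surf E) (dim E - 1) C := by
  have := nontrivial_of_two_le hN
  exact surf_ballGrowth

theorem dim_ge (hN : 2 ≤ finrank ℝ E) : 2 ≤ dim E := by
  exact_mod_cast hN

theorem ae_surf_ne (hN : 2 ≤ finrank ℝ E) (x : E) : ∀ᵐ σ ∂surf E, σ ≠ x := by
  rw [ae_iff]; simpa using surf_singleton hN x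

/-- Uniform bound for the integral of a weak singularity over the sphere. -/
theorem surf_rpow_integrable (hN : 2 ≤ finrank ℝ E) {e : ℝ} (he : 0 < e + (dim E - 1)) :
    ∃ A, 0 ≤ A ∧ ∀ x : E, ‖x‖ = 1 → Integrable (fun y => ‖y - x‖ ^ e) (surf E) ∧
      ∫ y, ‖y - x‖ ^ e ∂surf E ≤ A := by
  obtain ⟨C, hC, h⟩ := surf_growth hN
  have := dim_ge hN
  obtain ⟨A, hA, hAx⟩ := h.near (by linarith) hC he
  refine ⟨A * 2 ^ (e + (dim E - 1)), by positivity, fun x hx => ?_⟩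
  have hr : (surf E).restrict (closedBall x 2) = surf E := by
    apply Measure.restrict_eq_self_of_ae_mem
    filter_upwards [ae_surf_norm (E := E)] with σ hσ
    rw [mem_closedBall_iff_norm]
    refine (norm_sub_le _ _).trans ?_
    rw [hσ, hx]; norm_num
  have := hAx x 2 two_pos
  rwa [IntegrableOn, hr] at this

/-- Hölder functions of exponent `(1 - α) / 2` on the unit sphere, of size at most `C`. -/
structure HB (α C : ℝ) (f : E → ℝ) : Prop where
  bound : ∀ x, ‖x‖ = 1 → |f x| ≤ C
  holder : ∀ x y, ‖x‖ = 1 → ‖y‖ = 1 → |f x - f y| ≤ C * ‖x - y‖ ^ ((1 - α) / 2)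

/-- Reflection across the axis `ℝ θ`. -/
noncomputable def axisRefl (θ σ : E) : E := (2 * inner ℝ σ θ) • θ - σ

/-- Functions of regularity `1 + (1 + α) / 2` on the unit sphere, of size at most `η`. -/
structure XB (α η : ℝ) (u : E → ℝ) : Prop where
  bound : ∀ x, ‖x‖ = 1 → |u x| ≤ η
  lip : ∀ x y, ‖x‖ = 1 → ‖y‖ = 1 → |u x - u y| ≤ η * ‖x - y‖
  second : ∀ σ θ, ‖σ‖ = 1 → ‖θ‖ = 1 →
    |u σ + u (axisRefl θ σ) - 2 * u θ| ≤ η * ‖σ - θ‖ ^ ((3 + α) / 2)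
  rot : ∀ (R : E ≃ₗᵢ[ℝ] E) (δ : ℝ), 0 ≤ δ → (∀ x, ‖R x - x‖ ≤ δ * ‖x‖) →
    ∀ σ θ, ‖σ‖ = 1 → ‖θ‖ = 1 → δ ≤ ‖σ - θ‖ →
      |u (R σ) - u σ - u (R θ) + u θ| ≤ η * (δ * ‖σ - θ‖ ^ ((1 + α) / 2))

theorem HB.nonneg {α C : ℝ} {f : E → ℝ} (h : HB α C f) {x : E} (hx : ‖x‖ = 1) : 0 ≤ C :=
  (abs_nonneg _).trans (h.bound x hx)

theorem XB.nonneg {α C : ℝ} {f : E → ℝ} (h : XB α C f) {x : E} (hx : ‖x‖ = 1) : 0 ≤ C :=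
  (abs_nonneg _).trans (h.bound x hx)

theorem HB.mono {α C C' : ℝ} {f : E → ℝ} (h : HB α C f) (hC : C ≤ C') : HB α C' f :=
  ⟨fun x hx => (h.bound x hx).trans hC, fun x y hx hy => (h.holder x y hx hy).trans (by gcongr)⟩

theorem HB.congr {α C : ℝ} {f g : E → ℝ} (h : HB α C f) (hfg : ∀ x, ‖x‖ = 1 → f x = g x) :
    HB α C g :=
  ⟨fun x hx => by rw [← hfg x hx]; exact h.bound x hx,
    fun x y hx hy => by rw [← hfg x hx, ← hfg y hy]; exact h.holder x y hx hy⟩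

theorem HB.add {α C C' : ℝ} {f g : E → ℝ} (h : HB α C f) (h' : HB α C' g) :
    HB α (C + C') (fun x => f x + g x) := by
  refine ⟨fun x hx => (abs_add_le _ _).trans (add_le_add (h.bound x hx) (h'.bound x hx)),
    fun x y hx hy => ?_⟩
  rw [show f x + g x - (f y + g y) = (f x - f y) + (g x - g y) by ring, add_mul]
  exact (abs_add_le _ _).trans (add_le_add (h.holder x y hx hy) (h'.holder x y hx hy))

theorem HB.const_mul {α C : ℝ} {f : E → ℝ} (h : HB α C f) (c : ℝ) :
    HB α (|c| * C) (fun x => c * f x) := by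
  refine ⟨fun x hx => ?_, fun x y hx hy => ?_⟩
  · rw [abs_mul]; gcongr; exact h.bound x hx
  · rw [← mul_sub, abs_mul, mul_assoc]; gcongr; exact h.holder x y hx hy

theorem HB.sub {α C C' : ℝ} {f g : E → ℝ} (h : HB α C f) (h' : HB α C' g) :
    HB α (C + C') (fun x => f x - g x) := by
  have := h.add (h'.const_mul (-1))
  rw [abs_neg, abs_one, one_mul] at this
  exact this.congr fun x _ => by ring

theorem HB.mul {α C C' : ℝ} {f g : E → ℝ} (h : HB α C f) (h' : HB α C' g) :
    HB α (2 * (C * C')) (fun x => f x * g x) := by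
  refine ⟨fun x hx => ?_, fun x y hx hy => ?_⟩
  · have h0 := h.nonneg hx
    have h1 := h'.nonneg hx
    rw [abs_mul]
    have := mul_le_mul (h.bound x hx) (h'.bound x hx) (abs_nonneg _) h0
    nlinarith [mul_nonneg h0 h1]
  · have h0 := h.nonneg hx
    have h1 := h'.nonneg hx
    rw [show f x * g x - f y * g y = f x * (g x - g y) + (f x - f y) * g y by ring]
    refine (abs_add_le _ _).trans ?_
    rw [abs_mul, abs_mul]
    have e1 := mul_le_mul (h.bound x hx) (h'.holder x y hx hy) (abs_nonneg _) h0
    have e2 := mul_le_mul (h.holder x y hx hy) (h'.bound y hy) (abs_nonneg _) (by positivity)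
    linarith

theorem HB.continuousOn {α C : ℝ} (hα : α < 1) {f : E → ℝ} (h : HB α C f) :
    ContinuousOn f (sphere 0 1) := by
  intro x hx
  rw [mem_sphere_zero_iff_norm] at hx
  rw [ContinuousWithinAt, tendsto_iff_dist_tendsto_zero]
  have h1 : Tendsto (fun y => C * ‖y - x‖ ^ ((1 - α) / 2)) (nhdsWithin x (sphere 0 1))
      (nhds 0) := by
    have h2 : Tendsto (fun y => C * ‖y - x‖ ^ ((1 - α) / 2)) (nhds x)
        (nhds (C * ‖x - x‖ ^ ((1 - α) / 2))) := by
      refine Tendsto.const_mul _ (Tendsto.rpow_const ?_ (Or.inr (by linarith)))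
      exact (continuous_id.sub continuous_const).norm.tendsto x
    rw [sub_self, norm_zero, zero_rpow (by linarith), mul_zero] at h2
    exact h2.mono_left nhdsWithin_le_nhds
  refine squeeze_zero' (Eventually.of_forall fun _ => dist_nonneg) ?_ h1
  filter_upwards [self_mem_nhdsWithin] with y hy
  rw [mem_sphere_zero_iff_norm] at hy
  rw [dist_eq]
  exact h.holder y x hy hx

theorem XB.continuousOn {α η : ℝ} {u : E → ℝ} (h : XB α η u) :
    ContinuousOn u (sphere 0 1) := by
  intro x hx
  rw [mem_sphere_zero_iff_norm] at hx
  rw [ContinuousWithinAt, tendsto_iff_dist_tendsto_zero]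
  have h1 : Tendsto (fun y => η * ‖y - x‖) (nhdsWithin x (sphere 0 1)) (nhds 0) := by
    have h2 : Tendsto (fun y => η * ‖y - x‖) (nhds x) (nhds (η * ‖x - x‖)) :=
      ((continuous_id.sub continuous_const).norm.tendsto x).const_mul _
    rw [sub_self, norm_zero, mul_zero] at h2
    exact h2.mono_left nhdsWithin_le_nhds
  refine squeeze_zero' (Eventually.of_forall fun _ => dist_nonneg) ?_ h1
  filter_upwards [self_mem_nhdsWithin] with y hy
  rw [mem_sphere_zero_iff_norm] at hy
  rw [dist_eq]
  exact h.lip y x hy hx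

theorem norm_axisRefl {θ σ : E} (hθ : ‖θ‖ = 1) : ‖axisRefl θ σ‖ = ‖σ‖ := by
  have h : ‖axisRefl θ σ‖ ^ 2 = ‖σ‖ ^ 2 := by
    rw [axisRefl, norm_sub_sq_real, inner_smul_left, norm_smul, mul_pow, hθ, real_inner_comm σ θ,
      norm_eq_abs, sq_abs]
    simp
    ring
  nlinarith [norm_nonneg (axisRefl θ σ), norm_nonneg σ]

theorem axisRefl_self (hθ : ‖θ‖ = 1) : axisRefl θ θ = θ := by
  rw [axisRefl, real_inner_self_eq_norm_sq, hθ]; module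

theorem axisRefl_sub (θ σ τ : E) : axisRefl θ σ - axisRefl θ τ = axisRefl θ (σ - τ) := by
  simp only [axisRefl, inner_sub_left]; module

theorem norm_axisRefl_sub_pole {θ σ : E} (hθ : ‖θ‖ = 1) : ‖axisRefl θ σ - θ‖ = ‖σ - θ‖ := by
  conv_lhs => rw [← axisRefl_self hθ, axisRefl_self hθ]
  nth_rewrite 2 [← axisRefl_self hθ]
  rw [axisRefl_sub, norm_axisRefl hθ]

theorem add_axisRefl {θ σ : E} (hθ : ‖θ‖ = 1) (hσ : ‖σ‖ = 1) :
    σ + axisRefl θ σ - (2 : ℝ) • θ = -(‖σ - θ‖ ^ 2) • θ := by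
  rw [norm_sub_sq_real, hσ, hθ, axisRefl]; module

theorem axisRefl_isometry (hθ : ‖θ‖ = 1) :
    ∃ R : E ≃ₗᵢ[ℝ] E, ∀ x, R x = axisRefl θ x := by
  refine ⟨(ℝ ∙ θ).reflection, fun x => ?_⟩
  rw [Submodule.reflection_singleton_apply, hθ, axisRefl, real_inner_comm]
  simp [two_smul, two_mul, add_smul]

theorem norm_rpow_fourPoint_far (b : ℝ) :
    ∃ K, 0 ≤ K ∧ ∀ (ρ A B : ℝ) (x₁ x₂ x₃ x₄ : E), 0 < ρ → ρ ≤ 2 →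
      (ρ / 2 ≤ ‖x₁‖ ∧ ‖x₁‖ ≤ 2 * ρ) → (ρ / 2 ≤ ‖x₂‖ ∧ ‖x₂‖ ≤ 2 * ρ) →
      (ρ / 2 ≤ ‖x₃‖ ∧ ‖x₃‖ ≤ 2 * ρ) → (ρ / 2 ≤ ‖x₄‖ ∧ ‖x₄‖ ≤ 2 * ρ) →
      ‖x₁ - x₂ - x₃ + x₄‖ ≤ A → (‖x₁ - x₃‖ + ‖x₂ - x₄‖) * ‖x₃ - x₄‖ ≤ B →
      |‖x₁‖ ^ b - ‖x₂‖ ^ b - ‖x₃‖ ^ b + ‖x₄‖ ^ b| ≤ K * (A + B) * ρ ^ (b - 2) := by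
  obtain ⟨C, hC, h⟩ := abs_norm_rpow_fourPoint_le (E := E) b 4 (by norm_num)
  refine ⟨C * 2 ^ (2 - b), by positivity, ?_⟩
  intro ρ A B x₁ x₂ x₃ x₄ hρ hρ2 h1 h2 h3 h4 hA hB
  have hρ' : 0 < ρ / 2 := by positivity
  refine (h (ρ / 2) x₁ x₂ x₃ x₄ hρ' ⟨h1.1, by linarith⟩ ⟨h2.1, by linarith⟩ ⟨h3.1, by linarith⟩
    ⟨h4.1, by linarith⟩).trans ?_
  have e1 : (ρ / 2) ^ (b - 1) ≤ (ρ / 2) ^ (b - 2) :=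
    rpow_le_rpow_of_exponent_ge hρ' (by linarith) (by linarith)
  have e2 : (ρ / 2) ^ (b - 2) = 2 ^ (2 - b) * ρ ^ (b - 2) := by
    rw [div_rpow hρ.le (by norm_num), show b - 2 = -(2 - b) by ring,
      rpow_neg (by norm_num : (0 : ℝ) ≤ 2)]
    field_simp
  have hA0 : 0 ≤ A := (norm_nonneg _).trans hA
  calc _ ≤ C * ((ρ / 2) ^ (b - 2) * A + (ρ / 2) ^ (b - 2) * B) := by gcongr
    _ = _ := by rw [e2]; ring

/-- The weakly singular integral operator with kernel `‖η - θ‖ ^ (α + 2 - N)`. -/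
noncomputable def riesz (α : ℝ) (f : E → ℝ) (θ : E) : ℝ :=
  ∫ η, ‖η - θ‖ ^ (α + 2 - dim E) * f η ∂surf E

theorem measurable_norm_sub_rpow (e : ℝ) (θ : E) : Measurable fun η : E => ‖η - θ‖ ^ e :=
  ((measurable_id.sub_const θ).norm).pow_const _

theorem integrable_rpow_mul (hN : 2 ≤ finrank ℝ E) {e : ℝ} (he : 0 < e + (dim E - 1))
    {f : E → ℝ}
    (hf : AEStronglyMeasurable f (surf E)) {B : ℝ} (hB : ∀ x, ‖x‖ = 1 → |f x| ≤ B) 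
    (hθ : ‖θ‖ = 1) : Integrable (fun η => ‖η - θ‖ ^ e * f η) (surf E) := by
  obtain ⟨A, hA, h⟩ := surf_rpow_integrable hN he
  refine Integrable.mono' ((h θ hθ).1.mul_const B)
    ((measurable_norm_sub_rpow _ θ).aestronglyMeasurable.mul hf) ?_
  filter_upwards [ae_surf_norm] with η hη
  rw [norm_mul, norm_of_nonneg (by positivity), norm_eq_abs]
  gcongr
  exact hB η hη

theorem riesz_integrable (hN : 2 ≤ finrank ℝ E) (hα : 0 < α) {f : E → ℝ}
    (hf : AEStronglyMeasurable f (surf E)) {B : ℝ} (hB : ∀ x, ‖x‖ = 1 → |f x| ≤ B) 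
    (hθ : ‖θ‖ = 1) : Integrable (fun η => ‖η - θ‖ ^ (α + 2 - dim E) * f η) (surf E) :=
  integrable_rpow_mul hN (by linarith) hf hB hθ

theorem surf_integral_comp (R : E ≃ₗᵢ[ℝ] E) (F : E → ℝ) :
    ∫ η, F (R η) ∂surf E = ∫ η, F η ∂surf E :=
  (surf_measurePreserving R).integral_comp R.toHomeomorph.measurableEmbedding F

theorem riesz_comp (R : E ≃ₗᵢ[ℝ] E) (f : E → ℝ) (θ : E) :
    riesz α f (R θ) = riesz α (fun x => f (R x)) θ := by
  rw [riesz, riesz, ← surf_integral_comp R]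
  refine integral_congr_ae (Eventually.of_forall fun η => ?_)
  simp only
  rw [← map_sub, R.norm_map]

theorem exists_isometry_map {x y : E} (h : ‖x‖ = ‖y‖) : ∃ R : E ≃ₗᵢ[ℝ] E, R x = y :=
  ⟨(ℝ ∙ (x - y))ᗮ.reflection, Submodule.reflection_sub h⟩

theorem riesz_one_const {x y : E} (hx : ‖x‖ = 1) (hy : ‖y‖ = 1) :
    riesz α (fun _ : E => 1) x = riesz α (fun _ : E => 1) y := by
  obtain ⟨R, hR⟩ := exists_isometry_map (hx.trans hy.symm)
  rw [← hR, riesz_comp]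

theorem riesz_lip (hN : 2 ≤ finrank ℝ E) (hα : 0 < α) (hα1 : α < 1) :
    ∃ K, 0 ≤ K ∧ ∀ (f : E → ℝ) (B : ℝ), AEStronglyMeasurable f (surf E) →
      (∀ x, ‖x‖ = 1 → |f x| ≤ B) →
      (∀ x, ‖x‖ = 1 → |riesz α f x| ≤ K * B) ∧
      ∀ x y, ‖x‖ = 1 → ‖y‖ = 1 → |riesz α f x - riesz α f y| ≤ K * B * ‖x - y‖ := by
  have hd := dim_ge hN
  obtain ⟨A, hA, h⟩ := surf_rpow_integrable hN (e := α + 2 - dim E) (by linarith)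
  obtain ⟨A', hA', h'⟩ := surf_rpow_integrable hN (e := α + 2 - dim E - 1) (by linarith)
  set a := α + 2 - dim E with ha
  refine ⟨A + |a| * (2 * A'), by positivity, ?_⟩
  intro f B hf hB
  have hi := fun θ (hθ : ‖θ‖ = 1) => riesz_integrable hN hα hf hB hθ
  refine ⟨fun x hx => ?_, fun x y hx hy => ?_⟩
  · have hB0 : 0 ≤ B := (abs_nonneg _).trans (hB x hx)
    calc |riesz α f x| ≤ ∫ η, ‖η - x‖ ^ a * B ∂surf E := by
          rw [riesz, ← norm_eq_abs]
          refine norm_integral_le_of_norm_le ((h x hx).1.mul_const B) ?_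
          filter_upwards [ae_surf_norm] with η hη
          rw [norm_mul, norm_of_nonneg (by positivity), norm_eq_abs]
          gcongr
          exact hB η hη
      _ ≤ A * B := by rw [integral_mul_const]; gcongr; exact (h x hx).2
      _ ≤ _ := by gcongr; linarith [show 0 ≤ |a| * (2 * A') by positivity]
  · have hB0 : 0 ≤ B := (abs_nonneg _).trans (hB x hx)
    rw [riesz, riesz, ← integral_sub (hi x hx) (hi y hy)]
    calc _ ≤ ∫ η, |a| * ‖x - y‖ * (‖η - x‖ ^ (a - 1) + ‖η - y‖ ^ (a - 1)) * B ∂surf E := by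
          rw [← norm_eq_abs]
          refine norm_integral_le_of_norm_le
            ((((h' x hx).1.add (h' y hy).1).const_mul _).mul_const B) ?_
          filter_upwards [ae_surf_norm, ae_surf_ne hN x, ae_surf_ne hN y] with η hη h1 h2
          rw [← sub_mul, norm_mul, norm_eq_abs, norm_eq_abs]
          have := abs_norm_rpow_sub_le (b := a) (by linarith) (sub_ne_zero.2 h1) (sub_ne_zero.2 h2)
          rw [show η - x - (η - y) = -(x - y) by abel, norm_neg] at this
          exact mul_le_mul this (hB η hη) (abs_nonneg _) (by positivity)
      _ = |a| * ‖x - y‖ * (∫ η, ‖η - x‖ ^ (a - 1) ∂surf E + ∫ η, ‖η - y‖ ^ (a - 1) ∂surf E) * B := by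
          rw [integral_mul_const, integral_const_mul, integral_add (h' x hx).1 (h' y hy).1]
      _ ≤ |a| * ‖x - y‖ * (A' + A') * B := by
          gcongr
          · exact (h' x hx).2
          · exact (h' y hy).2
      _ ≤ _ := by
          have : 0 ≤ A * B * ‖x - y‖ := by positivity
          nlinarith

/-- Cancellation in the symmetric second difference of the kernel. -/
theorem riesz_second (hN : 2 ≤ finrank ℝ E) (hα : 0 < α) (hα1 : α < 1) :
    ∃ K, 0 ≤ K ∧ ∀ (f : E → ℝ) (C : ℝ), HB α C f → ∀ σ θ : E, ‖σ‖ = 1 → ‖θ‖ = 1 →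
      Integrable (fun η => (‖η - σ‖ ^ (α + 2 - dim E) + ‖η - axisRefl θ σ‖ ^ (α + 2 - dim E) -
        2 * ‖η - θ‖ ^ (α + 2 - dim E)) * (f η - f θ)) (surf E) ∧
      ∫ η, |(‖η - σ‖ ^ (α + 2 - dim E) + ‖η - axisRefl θ σ‖ ^ (α + 2 - dim E) -
        2 * ‖η - θ‖ ^ (α + 2 - dim E)) * (f η - f θ)| ∂surf E ≤
          K * C * ‖σ - θ‖ ^ ((3 + α) / 2) := by
  have hd := dim_ge hN
  obtain ⟨C0, hC0, hg⟩ := surf_growth hN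
  set a := α + 2 - dim E with ha
  obtain ⟨K, hK, hnf⟩ := hg.nearFar (by linarith) hC0 (e₁ := a) (e₂ := a - 2 + (1 - α) / 2)
    (by linarith) (by linarith)
  obtain ⟨P, hP, hfar⟩ := norm_rpow_fourPoint_far (E := E) a
  refine ⟨K * (2 ^ ((3 + α) / 2) + P * 3 * 2 ^ ((α - 1) / 2)), by positivity, ?_⟩
  intro f C hf σ θ hσ hθ
  have hC := hf.nonneg hθ
  have hmf := aestronglyMeasurable_surf (hf.continuousOn hα1)
  set d := ‖σ - θ‖ with hdd
  set σ' := axisRefl θ σ with hσ'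
  have hd' : ‖σ' - θ‖ = d := norm_axisRefl_sub_pole hθ
  have hm : AEStronglyMeasurable (fun η => (‖η - σ‖ ^ a + ‖η - σ'‖ ^ a - 2 * ‖η - θ‖ ^ a) *
      (f η - f θ)) (surf E) :=
    (((measurable_norm_sub_rpow a σ).add (measurable_norm_sub_rpow a σ')).sub
      ((measurable_norm_sub_rpow a θ).const_mul 2)).aestronglyMeasurable.mul
      (hmf.sub aestronglyMeasurable_const)
  rcases eq_or_ne σ θ with hst | hst
  · have h0 : (fun η => (‖η - σ‖ ^ a + ‖η - σ'‖ ^ a - 2 * ‖η - θ‖ ^ a) * (f η - f θ)) =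
        fun _ => 0 := by
      funext η
      rw [hσ', hst, axisRefl_self hθ]; ring
    have h0' : (fun η => |(‖η - σ‖ ^ a + ‖η - σ'‖ ^ a - 2 * ‖η - θ‖ ^ a) * (f η - f θ)|) =
        fun _ => 0 := by
      funext η; rw [congrFun h0 η, abs_zero]
    rw [h0, h0']
    refine ⟨integrable_zero _ _ _, ?_⟩
    simp only [integral_zero]
    positivity
  have hd0 : 0 < d := norm_pos_iff.2 (sub_ne_zero.2 hst)
  have key := hnf θ (2 * d) ![σ, σ', θ, θ] (C * (2 * d) ^ ((1 - α) / 2)) (P * (3 * d ^ 2) * C)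
    _ (by positivity) (by positivity) (by positivity) hm ?_ ?_ ?_
  · refine ⟨key.1, key.2.trans (le_of_eq ?_)⟩
    rw [mul_assoc C, ← rpow_add (by positivity),
      show (1 - α) / 2 + (a + (dim E - 1)) = (3 + α) / 2 by rw [ha]; ring,
      show a - 2 + (1 - α) / 2 + (dim E - 1) = (α - 1) / 2 by rw [ha]; ring,
      mul_rpow (by norm_num) hd0.le, mul_rpow (by norm_num) hd0.le]
    have : d ^ ((3 + α) / 2) = d ^ 2 * d ^ ((α - 1) / 2) := by
      rw [← rpow_natCast, ← rpow_add hd0]; congr 1; push_cast; ring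
    rw [this]
    ring
  · intro i
    fin_cases i
    · simpa [← hdd] using by linarith
    · simpa [hd'] using by linarith
    · simpa using by linarith
    · simpa using by linarith
  · filter_upwards [ae_surf_norm] with η hη hle
    rw [abs_mul, mul_comm C, mul_assoc, mul_comm, mul_comm _ (C * _)]
    have h1 : |f η - f θ| ≤ C * (2 * d) ^ ((1 - α) / 2) := by
      refine (hf.holder η θ hη hθ).trans ?_
      gcongr
    have h2 : |‖η - σ‖ ^ a + ‖η - σ'‖ ^ a - 2 * ‖η - θ‖ ^ a| ≤
        ∑ i, ‖η - (![σ, σ', θ, θ] : Fin 4 → E) i‖ ^ a := by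
      simp only [Fin.sum_univ_four, Matrix.cons_val]
      have p1 : 0 ≤ ‖η - σ‖ ^ a := by positivity
      have p2 : 0 ≤ ‖η - σ'‖ ^ a := by positivity
      have p3 : 0 ≤ ‖η - θ‖ ^ a := by positivity
      rw [abs_le]; constructor <;> linarith
    calc _ ≤ (C * (2 * d) ^ ((1 - α) / 2)) *
          ∑ i, ‖η - (![σ, σ', θ, θ] : Fin 4 → E) i‖ ^ a :=
        mul_le_mul h1 h2 (abs_nonneg _) (by positivity)
      _ = _ := by ring
  · filter_upwards [ae_surf_norm] with η hη hlt
    have hη2 : ‖η - θ‖ ≤ 2 := (norm_sub_le _ _).trans (by rw [hη, hθ]; norm_num)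
    have hpos : 0 < ‖η - θ‖ := by linarith
    have near : ∀ p : E, ‖p - θ‖ ≤ d → ‖η - θ‖ / 2 ≤ ‖η - p‖ ∧ ‖η - p‖ ≤ 2 * ‖η - θ‖ := by
      intro p hp
      have e1 : ‖η - θ‖ ≤ ‖η - p‖ + ‖p - θ‖ := norm_sub_le_norm_sub_add_norm_sub η p θ
      have e2 : ‖η - p‖ ≤ ‖η - θ‖ + ‖θ - p‖ := norm_sub_le_norm_sub_add_norm_sub η θ p
      rw [norm_sub_rev θ p] at e2
      constructor <;> linarith
    have hfp := hfar ‖η - θ‖ (d ^ 2) (2 * d ^ 2) (η - σ) (η - θ) (η - θ) (η - σ') hpos hη2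
      (near σ le_rfl) (near θ (by simpa using hd0.le)) (near θ (by simpa using hd0.le))
      (near σ' hd'.le) ?_ ?_
    · rw [abs_mul]
      have h1 := hf.holder η θ hη hθ
      rw [rpow_add hpos]
      calc _ ≤ (P * (d ^ 2 + 2 * d ^ 2) * ‖η - θ‖ ^ (a - 2)) * (C * ‖η - θ‖ ^ ((1 - α) / 2)) := by
            refine mul_le_mul ?_ h1 (abs_nonneg _) (by positivity)
            refine le_trans (le_of_eq ?_) hfp
            congr 1; ring
        _ = _ := by ring
    · rw [show η - σ - (η - θ) - (η - θ) + (η - σ') = -(σ + σ' - (2 : ℝ) • θ) by module, norm_neg,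
        add_axisRefl hθ hσ, norm_smul, hθ, mul_one, norm_neg, ← hdd, norm_of_nonneg (by positivity)]
    · rw [show η - σ - (η - θ) = -(σ - θ) by abel, show η - θ - (η - σ') = σ' - θ by abel, norm_neg, hd',
        ← hdd]
      apply le_of_eq; ring

theorem riesz_rot (hN : 2 ≤ finrank ℝ E) (hα : 0 < α) (hα1 : α < 1) :
    ∃ K, 0 ≤ K ∧ ∀ (f : E → ℝ) (C : ℝ), HB α C f → ∀ (R : E ≃ₗᵢ[ℝ] E) (δ : ℝ), 0 ≤ δ →
      (∀ x, ‖R x - x‖ ≤ δ * ‖x‖) → ∀ σ θ : E, ‖σ‖ = 1 → ‖θ‖ = 1 → δ ≤ ‖σ - θ‖ →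
      Integrable (fun η => (‖η - R σ‖ ^ (α + 2 - dim E) - ‖η - σ‖ ^ (α + 2 - dim E) -
        ‖η - R θ‖ ^ (α + 2 - dim E) + ‖η - θ‖ ^ (α + 2 - dim E)) * (f η - f θ)) (surf E) ∧
      ∫ η, |(‖η - R σ‖ ^ (α + 2 - dim E) - ‖η - σ‖ ^ (α + 2 - dim E) -
        ‖η - R θ‖ ^ (α + 2 - dim E) + ‖η - θ‖ ^ (α + 2 - dim E)) * (f η - f θ)| ∂surf E ≤
          K * C * (δ * ‖σ - θ‖ ^ ((1 + α) / 2)) := by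
  have hd := dim_ge hN
  obtain ⟨C0, hC0, hg⟩ := surf_growth hN
  set a := α + 2 - dim E with ha
  obtain ⟨K, hK, hnf⟩ := hg.nearFar (by linarith) hC0 (e₁ := a - 1) (e₂ := a - 2 + (1 - α) / 2)
    (by linarith) (by linarith)
  obtain ⟨P, hP, hfar⟩ := norm_rpow_fourPoint_far (E := E) a
  refine ⟨K * (|a| * 4 ^ ((1 + α) / 2) + P * 3 * 4 ^ ((α - 1) / 2)), by positivity, ?_⟩
  intro f C hf R δ hδ hR σ θ hσ hθ hδd
  have hC := hf.nonneg hθ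
  have hmf := aestronglyMeasurable_surf (hf.continuousOn hα1)
  set d := ‖σ - θ‖ with hdd
  have hm : AEStronglyMeasurable (fun η => (‖η - R σ‖ ^ a - ‖η - σ‖ ^ a - ‖η - R θ‖ ^ a +
      ‖η - θ‖ ^ a) * (f η - f θ)) (surf E) :=
    ((((measurable_norm_sub_rpow a (R σ)).sub (measurable_norm_sub_rpow a σ)).sub
      (measurable_norm_sub_rpow a (R θ))).add (measurable_norm_sub_rpow a θ)).aestronglyMeasurable.mul
      (hmf.sub aestronglyMeasurable_const)
  have hd0 : 0 ≤ d := norm_nonneg _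
  rcases hd0.eq_or_lt with hst | hd0
  · have hst : σ = θ := by rwa [hdd, eq_comm, norm_eq_zero, sub_eq_zero] at hst
    have h0 : (fun η => (‖η - R σ‖ ^ a - ‖η - σ‖ ^ a - ‖η - R θ‖ ^ a +
      ‖η - θ‖ ^ a) * (f η - f θ)) = fun _ => 0 := by
      funext η
      rw [hst]; ring
    have h0' : (fun η => |(‖η - R σ‖ ^ a - ‖η - σ‖ ^ a - ‖η - R θ‖ ^ a +
      ‖η - θ‖ ^ a) * (f η - f θ)|) = fun _ => 0 := by
      funext η; rw [congrFun h0 η, abs_zero]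
    rw [h0, h0']
    refine ⟨integrable_zero _ _ _, ?_⟩
    simp only [integral_zero]
    positivity
  have hRσ : ‖R σ - σ‖ ≤ δ := by simpa [hσ] using hR σ
  have hRθ : ‖R θ - θ‖ ≤ δ := by simpa [hθ] using hR θ
  have c1 : ‖R σ - θ‖ ≤ 2 * d := by
    have := norm_sub_le_norm_sub_add_norm_sub (R σ) σ θ
    linarith
  have c2 : ‖σ - θ‖ ≤ 2 * d := by linarith
  have c3 : ‖R θ - θ‖ ≤ 2 * d := by linarith
  have c4 : ‖θ - θ‖ ≤ 2 * d := by simp; linarith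
  have key := hnf θ (4 * d) ![R σ, σ, R θ, θ] (|a| * δ * (C * (4 * d) ^ ((1 - α) / 2)))
    (P * (3 * (d * δ)) * C) _ (by positivity) (by positivity) (by positivity) hm ?_ ?_ ?_
  · refine ⟨key.1, key.2.trans (le_of_eq ?_)⟩
    have e1 : (4 * d) ^ ((1 - α) / 2) * (4 * d) ^ (a - 1 + (dim E - 1)) =
        4 ^ ((1 + α) / 2) * d ^ ((1 + α) / 2) := by
      rw [← rpow_add (by positivity), ← mul_rpow (by norm_num) hd0.le]
      congr 1; rw [ha]; ring
    have e2 : d * (4 * d) ^ (a - 2 + (1 - α) / 2 + (dim E - 1)) =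
        4 ^ ((α - 1) / 2) * d ^ ((1 + α) / 2) := by
      rw [show a - 2 + (1 - α) / 2 + (dim E - 1) = (α - 1) / 2 by rw [ha]; ring,
        mul_rpow (by norm_num) hd0.le, show (1 + α) / 2 = 1 + (α - 1) / 2 by ring,
        rpow_add hd0, rpow_one]
      ring
    calc _ = K * (|a| * δ * C * ((4 * d) ^ ((1 - α) / 2) * (4 * d) ^ (a - 1 + (dim E - 1))) +
          P * 3 * δ * C * (d * (4 * d) ^ (a - 2 + (1 - α) / 2 + (dim E - 1)))) := by ring
      _ = _ := by rw [e1, e2]; ring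
  · intro i
    fin_cases i
    · simpa using by linarith
    · simpa using by linarith
    · simpa using by linarith
    · simpa using by linarith
  · filter_upwards [ae_surf_norm, ae_surf_ne hN (R σ), ae_surf_ne hN σ, ae_surf_ne hN (R θ),
      ae_surf_ne hN θ] with η hη n1 n2 n3 n4 hle
    have ha1 : a ≤ 1 := by rw [ha]; linarith
    have h1 : |f η - f θ| ≤ C * (4 * d) ^ ((1 - α) / 2) := by
      refine (hf.holder η θ hη hθ).trans ?_
      gcongr
    have g1 := abs_norm_rpow_sub_le ha1 (sub_ne_zero.2 n1) (sub_ne_zero.2 n2)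
    have g2 := abs_norm_rpow_sub_le ha1 (sub_ne_zero.2 n3) (sub_ne_zero.2 n4)
    rw [sub_sub_sub_cancel_left, norm_sub_rev σ] at g1
    rw [sub_sub_sub_cancel_left, norm_sub_rev θ] at g2
    have p1 : 0 ≤ ‖η - R σ‖ ^ (a - 1) := by positivity
    have p2 : 0 ≤ ‖η - σ‖ ^ (a - 1) := by positivity
    have p3 : 0 ≤ ‖η - R θ‖ ^ (a - 1) := by positivity
    have p4 : 0 ≤ ‖η - θ‖ ^ (a - 1) := by positivity
    have h2 : |‖η - R σ‖ ^ a - ‖η - σ‖ ^ a - ‖η - R θ‖ ^ a + ‖η - θ‖ ^ a| ≤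
        |a| * δ * ∑ i, ‖η - (![R σ, σ, R θ, θ] : Fin 4 → E) i‖ ^ (a - 1) := by
      simp only [Fin.sum_univ_four, Matrix.cons_val]
      have g1' : |‖η - R σ‖ ^ a - ‖η - σ‖ ^ a| ≤
          |a| * δ * (‖η - R σ‖ ^ (a - 1) + ‖η - σ‖ ^ (a - 1)) := g1.trans (by gcongr)
      have g2' : |‖η - R θ‖ ^ a - ‖η - θ‖ ^ a| ≤
          |a| * δ * (‖η - R θ‖ ^ (a - 1) + ‖η - θ‖ ^ (a - 1)) := g2.trans (by gcongr)
      rw [show ‖η - R σ‖ ^ a - ‖η - σ‖ ^ a - ‖η - R θ‖ ^ a + ‖η - θ‖ ^ a =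
        (‖η - R σ‖ ^ a - ‖η - σ‖ ^ a) - (‖η - R θ‖ ^ a - ‖η - θ‖ ^ a) by ring]
      refine (abs_sub _ _).trans ((add_le_add g1' g2').trans (le_of_eq (by ring)))
    rw [abs_mul]
    calc _ ≤ (|a| * δ * ∑ i, ‖η - (![R σ, σ, R θ, θ] : Fin 4 → E) i‖ ^ (a - 1)) *
          (C * (4 * d) ^ ((1 - α) / 2)) := mul_le_mul h2 h1 (abs_nonneg _) ((abs_nonneg _).trans h2)
      _ = _ := by ring
  · filter_upwards [ae_surf_norm] with η hη hlt
    have hη2 : ‖η - θ‖ ≤ 2 := (norm_sub_le _ _).trans (by rw [hη, hθ]; norm_num)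
    have hpos : 0 < ‖η - θ‖ := by linarith
    have near : ∀ p : E, ‖p - θ‖ ≤ 2 * d → ‖η - θ‖ / 2 ≤ ‖η - p‖ ∧ ‖η - p‖ ≤ 2 * ‖η - θ‖ := by
      intro p hp
      have e1 : ‖η - θ‖ ≤ ‖η - p‖ + ‖p - θ‖ := norm_sub_le_norm_sub_add_norm_sub η p θ
      have e2 : ‖η - p‖ ≤ ‖η - θ‖ + ‖θ - p‖ := norm_sub_le_norm_sub_add_norm_sub η θ p
      rw [norm_sub_rev θ p] at e2
      constructor <;> linarith
    have hfp := hfar ‖η - θ‖ (d * δ) (2 * (d * δ)) (η - R σ) (η - σ) (η - R θ) (η - θ) hpos hη2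
      (near _ c1) (near _ c2) (near _ c3) (near _ c4) ?_ ?_
    · rw [abs_mul]
      have h1 := hf.holder η θ hη hθ
      rw [rpow_add hpos]
      calc _ ≤ (P * (d * δ + 2 * (d * δ)) * ‖η - θ‖ ^ (a - 2)) *
            (C * ‖η - θ‖ ^ ((1 - α) / 2)) :=
            mul_le_mul hfp h1 (abs_nonneg _) (by positivity)
        _ = _ := by ring
    · rw [show η - R σ - (η - σ) - (η - R θ) + (η - θ) = -(R (σ - θ) - (σ - θ)) by
        rw [map_sub]; abel, norm_neg]
      exact (hR _).trans (le_of_eq (by rw [← hdd]; ring))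
    · rw [sub_sub_sub_cancel_left, sub_sub_sub_cancel_left, sub_sub_sub_cancel_left,
        ← map_sub, R.norm_map, norm_sub_rev θ σ, ← hdd, norm_sub_rev θ (R θ)]
      nlinarith

theorem sum_riesz {ι : Type*} [Fintype ι] (hN : 2 ≤ finrank ℝ E) (hα : 0 < α)
    {f : E → ℝ} (hf : AEStronglyMeasurable f (surf E)) {B : ℝ} (hB : ∀ x, ‖x‖ = 1 → |f x| ≤ B)
    (p : ι → E) (hp : ∀ i, ‖p i‖ = 1) (c : ι → ℝ) (hc : ∑ i, c i = 0) (t : ℝ) :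
    ∑ i, c i * riesz α f (p i) =
      ∫ η, (∑ i, c i * ‖η - p i‖ ^ (α + 2 - dim E)) * (f η - t) ∂surf E := by
  have hInt : ∀ i, Integrable (fun η => ‖η - p i‖ ^ (α + 2 - dim E) * f η) (surf E) :=
    fun i => riesz_integrable hN hα hf hB (hp i)
  have hint1 : ∀ i, Integrable (fun η => ‖η - p i‖ ^ (α + 2 - dim E)) (surf E) := by
    intro i
    simpa using riesz_integrable hN hα (f := fun _ : E => 1) (B := 1)
      aestronglyMeasurable_const (by simp) (hp i)
  have e : (fun η => (∑ i, c i * ‖η - p i‖ ^ (α + 2 - dim E)) * (f η - t)) = fun η =>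
      ∑ i, c i * (‖η - p i‖ ^ (α + 2 - dim E) * f η) -
        ∑ i, (c i * t) * ‖η - p i‖ ^ (α + 2 - dim E) := by
    funext η
    rw [mul_sub, Finset.sum_mul, Finset.sum_mul]
    congr 1 <;> exact Finset.sum_congr rfl fun i _ => by ring
  rw [e, integral_sub (integrable_finsetSum _ fun i _ => (hInt i).const_mul _)
    (integrable_finsetSum _ fun i _ => (hint1 i).const_mul _),
    integral_finsetSum _ fun i _ => (hInt i).const_mul _,
    integral_finsetSum _ fun i _ => (hint1 i).const_mul _]
  simp only [integral_const_mul]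
  have : ∑ i, c i * t * ∫ η, ‖η - p i‖ ^ (α + 2 - dim E) ∂surf E = 0 := by
    rcases isEmpty_or_nonempty ι with hι | ⟨⟨j⟩⟩
    · simp
    have hone : ∀ i, ∫ η, ‖η - p i‖ ^ (α + 2 - dim E) ∂surf E =
        ∫ η, ‖η - p j‖ ^ (α + 2 - dim E) ∂surf E := by
      intro i
      simpa [riesz] using riesz_one_const (α := α) (hp i) (hp j)
    simp only [hone]
    rw [← Finset.sum_mul, ← Finset.sum_mul, hc, zero_mul, zero_mul]
  rw [this, sub_zero]
  rfl

theorem riesz_XB (hN : 2 ≤ finrank ℝ E) (hα : 0 < α) (hα1 : α < 1) :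
    ∃ K, 0 ≤ K ∧ ∀ (f : E → ℝ) (C : ℝ), HB α C f → XB α (K * C) (riesz α f) := by
  have hd := dim_ge hN
  obtain ⟨K1, hK1, h1⟩ := riesz_lip hN hα hα1
  obtain ⟨K2, hK2, h2⟩ := riesz_second hN hα hα1
  obtain ⟨K3, hK3, h3⟩ := riesz_rot hN hα hα1
  refine ⟨K1 + K2 + K3, by positivity, fun f C hf => ?_⟩
  have hmf := aestronglyMeasurable_surf (hf.continuousOn hα1)
  have hl := h1 f C hmf hf.bound
  refine ⟨fun x hx => (hl.1 x hx).trans ?_, fun x y hx hy => (hl.2 x y hx hy).trans ?_, ?_, ?_⟩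
  · have := hf.nonneg hx
    gcongr; linarith
  · have := hf.nonneg hx
    gcongr; linarith
  · intro σ θ hσ hθ
    have hC := hf.nonneg hθ
    have hσ' : ‖axisRefl θ σ‖ = 1 := by rw [norm_axisRefl hθ, hσ]
    have h := h2 f C hf σ θ hσ hθ
    have e : riesz α f σ + riesz α f (axisRefl θ σ) - 2 * riesz α f θ =
        ∫ η, (‖η - σ‖ ^ (α + 2 - dim E) + ‖η - axisRefl θ σ‖ ^ (α + 2 - dim E) -
          2 * ‖η - θ‖ ^ (α + 2 - dim E)) * (f η - f θ) ∂surf E := by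
      have := sum_riesz hN hα hmf hf.bound ![σ, axisRefl θ σ, θ]
        (by intro i; fin_cases i <;> simp [hσ, hσ', hθ]) ![1, 1, -2]
        (by simp [Fin.sum_univ_three]; norm_num) (f θ)
      simp only [Fin.sum_univ_three, Matrix.cons_val] at this
      refine Eq.trans (by ring) (this.trans ?_)
      congr 1; funext η; ring
    rw [e]
    refine (abs_integral_le_integral_abs).trans (h.2.trans ?_)
    gcongr; linarith
  · intro R δ hδ hR σ θ hσ hθ hδd
    have hC := hf.nonneg hθ
    have hσ' : ‖R σ‖ = 1 := by rw [R.norm_map, hσ]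
    have hθ' : ‖R θ‖ = 1 := by rw [R.norm_map, hθ]
    have h := h3 f C hf R δ hδ hR σ θ hσ hθ hδd
    have e : riesz α f (R σ) - riesz α f σ - riesz α f (R θ) + riesz α f θ =
        ∫ η, (‖η - R σ‖ ^ (α + 2 - dim E) - ‖η - σ‖ ^ (α + 2 - dim E) -
        ‖η - R θ‖ ^ (α + 2 - dim E) + ‖η - θ‖ ^ (α + 2 - dim E)) * (f η - f θ) ∂surf E := by
      have := sum_riesz hN hα hmf hf.bound ![R σ, σ, R θ, θ]
        (by intro i; fin_cases i <;> simp [hσ, hθ]) ![1, -1, -1, 1]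
        (by simp [Fin.sum_univ_four]) (f θ)
      simp only [Fin.sum_univ_four, Matrix.cons_val] at this
      refine Eq.trans (by ring) (this.trans ?_)
      congr 1; funext η; ring
    rw [e]
    refine (abs_integral_le_integral_abs).trans (h.2.trans ?_)
    gcongr; linarith

section Perron

variable {X : Type*} [MeasurableSpace X] {μ : Measure X} [IsFiniteMeasure μ]

theorem integrable_kernel_mul {k : X → X → ℝ} {A : ℝ} (hk : Measurable (uncurry k))
    (hnn : ∀ x y, 0 ≤ k x y) (hA : ∀ᵐ x ∂μ, Integrable (k x) μ ∧ ∫ y, k x y ∂μ ≤ A)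
    {f g : X → ℝ} (hf : AEStronglyMeasurable f μ) (hg : AEStronglyMeasurable g μ) {B B' : ℝ}
    (hfb : ∀ᵐ x ∂μ, |f x| ≤ B) (hgb : ∀ᵐ x ∂μ, |g x| ≤ B') :
    Integrable (fun z : X × X => f z.1 * (k z.1 z.2 * g z.2)) (μ.prod μ) := by
  have hk' : Integrable (uncurry k) (μ.prod μ) := by
    rw [integrable_prod_iff hk.aestronglyMeasurable]
    refine ⟨hA.mono fun x hx => hx.1, ?_⟩
    refine Integrable.mono' (integrable_const A)
      hk.aestronglyMeasurable.norm.integral_prod_right' ?_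
    filter_upwards [hA] with x hx
    rw [norm_of_nonneg (integral_nonneg fun _ => norm_nonneg _)]
    simpa [uncurry, abs_of_nonneg (hnn _ _)] using hx.2
  have h1 : ∀ᵐ z ∂μ.prod μ, |f z.1| ≤ B := Measure.quasiMeasurePreserving_fst.ae hfb
  have h2 : ∀ᵐ z ∂μ.prod μ, |g z.2| ≤ B' := Measure.quasiMeasurePreserving_snd.ae hgb
  refine Integrable.mono' (hk'.const_mul (|B| * |B'|)) ?_ ?_
  · exact hf.comp_fst.mul (hk.aestronglyMeasurable.mul hg.comp_snd)
  · filter_upwards [h1, h2] with z hz1 hz2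
    rw [norm_eq_abs, abs_mul, abs_mul, abs_of_nonneg (hnn _ _)]
    have e1 := hz1.trans (le_abs_self B)
    have e2 := hz2.trans (le_abs_self B')
    calc _ ≤ |B| * (k z.1 z.2 * |B'|) := by
          have := hnn z.1 z.2
          gcongr
      _ = _ := by simp only [uncurry]; ring

theorem perron_sign {k : X → X → ℝ} {A : ℝ} (hk : Measurable (uncurry k))
    (hμ : μ ≠ 0) (hnn : ∀ x y, 0 ≤ k x y) (hsymm : ∀ x y, k x y = k y x)
    (hA : ∀ᵐ x ∂μ, Integrable (k x) μ ∧ ∫ y, k x y ∂μ ≤ A)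
    (hpos : ∀ᵐ x ∂μ, ∀ᵐ y ∂μ, 0 < k x y)
    {h v : X → ℝ} (hh : AEStronglyMeasurable h μ) (hv : AEStronglyMeasurable v μ) {B B' c : ℝ}
    (hc : 0 ≤ c) (hhpos : ∀ᵐ x ∂μ, 0 < h x) (hhb : ∀ᵐ x ∂μ, |h x| ≤ B)
    (hvb : ∀ᵐ x ∂μ, |v x| ≤ B')
    (hhe : ∀ᵐ x ∂μ, ∫ y, k x y * h y ∂μ = c * h x)
    (hve : ∀ᵐ x ∂μ, ∫ y, k x y * v y ∂μ = c * v x) :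
    (∀ᵐ x ∂μ, 0 ≤ v x) ∨ ∀ᵐ x ∂μ, v x ≤ 0 := by
  have hva : AEStronglyMeasurable (fun x => |v x|) μ := hv.norm
  have hvab : ∀ᵐ x ∂μ, |(|v x|)| ≤ B' := by simpa using hvb
  have hone : ∀ᵐ x ∂μ, |(1 : ℝ)| ≤ 1 := by simp
  have hkv : ∀ᵐ x ∂μ, Integrable (fun y => k x y * v y) μ := by
    have := (integrable_kernel_mul hk hnn hA (f := fun _ => 1) aestronglyMeasurable_const hv
      hone hvb).prod_right_ae
    simpa using this
  have hkva : ∀ᵐ x ∂μ, Integrable (fun y => k x y * |v y|) μ := by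
    have := (integrable_kernel_mul hk hnn hA (f := fun _ => 1) aestronglyMeasurable_const hva
      hone hvab).prod_right_ae
    simpa using this
  have hI := integrable_kernel_mul hk hnn hA hh hva hhb hvab
  have hI' := integrable_kernel_mul hk hnn hA hva hh hvab hhb
  have hswap : ∫ x, h x * ∫ y, k x y * |v y| ∂μ ∂μ = ∫ x, c * (h x * |v x|) ∂μ := by
    have e1 : ∫ x, h x * ∫ y, k x y * |v y| ∂μ ∂μ = ∫ x, ∫ y, h x * (k x y * |v y|) ∂μ ∂μ := by
      simp only [integral_const_mul]
    rw [e1, integral_integral_swap hI]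
    refine integral_congr_ae ?_
    filter_upwards [hhe] with x hx
    have : ∀ y, h y * (k y x * |v x|) = |v x| * (k x y * h y) := fun y => by rw [hsymm y x]; ring
    simp only [this]
    rw [integral_const_mul, hx]; ring
  have hi1 : Integrable (fun x => h x * ∫ y, k x y * |v y| ∂μ) μ := by
    have := hI.integral_prod_left
    simpa only [integral_const_mul] using this
  have hi2 : Integrable (fun x => c * (h x * |v x|)) μ := by
    refine (Integrable.mono' (integrable_const (B * B')) (hh.mul hva) ?_).const_mul c
    filter_upwards [hhb, hvb] with x h1 h2
    change ‖h x * |v x|‖ ≤ _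
    rw [norm_mul, norm_eq_abs, norm_eq_abs, abs_abs]
    exact mul_le_mul h1 h2 (abs_nonneg _) ((abs_nonneg _).trans h1)
  have hge : ∀ᵐ x ∂μ, c * |v x| ≤ ∫ y, k x y * |v y| ∂μ := by
    filter_upwards [hve] with x hx
    rw [← abs_of_nonneg hc, ← abs_mul, ← hx]
    refine abs_integral_le_integral_abs.trans (le_of_eq ?_)
    congr 1; funext y
    rw [abs_mul, abs_of_nonneg (hnn _ _)]
  have hzero : (fun x => h x * (∫ y, k x y * |v y| ∂μ) - c * (h x * |v x|)) =ᵐ[μ] 0 := by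
    refine (integral_eq_zero_iff_of_nonneg_ae ?_ (hi1.sub hi2)).1 ?_
    rotate_left
    · change ∫ x, h x * (∫ y, k x y * |v y| ∂μ) - c * (h x * |v x|) ∂μ = 0
      rw [integral_sub hi1 hi2, hswap, sub_self]
    · filter_upwards [hge, hhpos] with x h1 h2
      have := mul_le_mul_of_nonneg_left h1 h2.le
      simp only [Pi.zero_apply, Pi.sub_apply]; linarith
  have hne : (ae μ).NeBot := ae_neBot.2 hμ
  obtain ⟨x, hx0, hxpos, hxk, hxve, hxv, hxva⟩ :=
    (hzero.and (hhpos.and (hpos.and (hve.and (hkv.and hkva))))).exists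
  have heq : ∫ y, k x y * |v y| ∂μ = c * |v x| := by
    simp only [Pi.zero_apply] at hx0
    have : h x * ((∫ y, k x y * |v y| ∂μ) - c * |v x|) = 0 := by linarith
    rcases mul_eq_zero.1 this with h0 | h0
    · exact absurd h0 hxpos.ne'
    · linarith
  have fin : ∀ s : ℝ, |s| = 1 → |v x| = s * v x → ∀ᵐ y ∂μ, |v y| = s * v y := by
    intro s hs hsx
    have hi : Integrable (fun y => k x y * |v y| - s * (k x y * v y)) μ := hxva.sub (hxv.const_mul s)
    have : (fun y => k x y * |v y| - s * (k x y * v y)) =ᵐ[μ] 0 := by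
      rw [← integral_eq_zero_iff_of_nonneg _ hi]
      · rw [integral_sub hxva (hxv.const_mul s), integral_const_mul, heq, hxve, hsx]; ring
      · intro y
        have h1 : s * v y ≤ |v y| := by
          refine (le_abs_self _).trans ?_
          rw [abs_mul, hs, one_mul]
        have := mul_le_mul_of_nonneg_left h1 (hnn x y)
        simp only [Pi.zero_apply]; linarith
    filter_upwards [this, hxk] with y h1 h2
    simp only [Pi.zero_apply] at h1
    have : k x y * (|v y| - s * v y) = 0 := by linarith
    rcases mul_eq_zero.1 this with h0 | h0
    · exact absurd h0 h2.ne'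
    · linarith
  rcases le_total 0 (v x) with hvx | hvx
  · left
    filter_upwards [fin 1 (by simp) (by rw [abs_of_nonneg hvx, one_mul])] with y hy
    rw [one_mul] at hy; rw [← hy]; exact abs_nonneg _
  · right
    filter_upwards [fin (-1) (by simp) (by rw [abs_of_nonpos hvx]; ring)] with y hy
    have := abs_nonneg (v y); linarith

theorem perron_unique {k : X → X → ℝ} {A : ℝ} (hk : Measurable (uncurry k))
    (hμ : μ ≠ 0) (hnn : ∀ x y, 0 ≤ k x y) (hsymm : ∀ x y, k x y = k y x)
    (hA : ∀ᵐ x ∂μ, Integrable (k x) μ ∧ ∫ y, k x y ∂μ ≤ A)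
    (hpos : ∀ᵐ x ∂μ, ∀ᵐ y ∂μ, 0 < k x y)
    {h v : X → ℝ} (hh : AEStronglyMeasurable h μ) (hv : AEStronglyMeasurable v μ) {B B' c : ℝ}
    (hc : 0 ≤ c) (hhpos : ∀ᵐ x ∂μ, 0 < h x) (hhb : ∀ᵐ x ∂μ, |h x| ≤ B)
    (hvb : ∀ᵐ x ∂μ, |v x| ≤ B')
    (hhe : ∀ᵐ x ∂μ, ∫ y, k x y * h y ∂μ = c * h x)
    (hve : ∀ᵐ x ∂μ, ∫ y, k x y * v y ∂μ = c * v x) :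
    ∃ t : ℝ, ∀ᵐ x ∂μ, v x = t * h x := by
  have hone : ∀ᵐ x ∂μ, |(1 : ℝ)| ≤ 1 := by simp
  have hih : Integrable h μ := Integrable.mono' (integrable_const B) hh (by simpa using hhb)
  have hiv : Integrable v μ := Integrable.mono' (integrable_const B') hv (by simpa using hvb)
  have hkh : ∀ᵐ x ∂μ, Integrable (fun y => k x y * h y) μ := by
    have := (integrable_kernel_mul hk hnn hA (f := fun _ => 1) aestronglyMeasurable_const hh
      hone hhb).prod_right_ae
    simpa using this
  have hkv : ∀ᵐ x ∂μ, Integrable (fun y => k x y * v y) μ := by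
    have := (integrable_kernel_mul hk hnn hA (f := fun _ => 1) aestronglyMeasurable_const hv
      hone hvb).prod_right_ae
    simpa using this
  have hne : (ae μ).NeBot := ae_neBot.2 hμ
  have hInt : ∫ x, h x ∂μ ≠ 0 := by
    intro h0
    rw [integral_eq_zero_iff_of_nonneg_ae (hhpos.mono fun x hx => hx.le) hih] at h0
    obtain ⟨x, h1, h2⟩ := (h0.and hhpos).exists
    simp only [Pi.zero_apply] at h1
    linarith
  set t := (∫ x, v x ∂μ) / ∫ x, h x ∂μ with ht
  refine ⟨t, ?_⟩
  have hz : ∫ x, v x - t * h x ∂μ = 0 := by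
    rw [integral_sub hiv (hih.const_mul t), integral_const_mul, ht, div_mul_cancel₀ _ hInt, sub_self]
  have hi : Integrable (fun x => v x - t * h x) μ := hiv.sub (hih.const_mul t)
  have hs := perron_sign hk hμ hnn hsymm hA hpos hh (v := fun x => v x - t * h x)
    (hv.sub (hh.const_mul t)) (B := B) (B' := B' + |t| * B) hc hhpos hhb ?_ hhe ?_
  · rcases hs with hs | hs
    · have := (integral_eq_zero_iff_of_nonneg_ae hs hi).1 hz
      filter_upwards [this] with x hx
      simp only [Pi.zero_apply] at hx; linarith
    · have hn : ∫ x, -(v x - t * h x) ∂μ = 0 := by rw [integral_neg, hz, neg_zero]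
      have := (integral_eq_zero_iff_of_nonneg_ae (hs.mono fun x hx => by
        simp only [Pi.zero_apply, Pi.neg_apply]; linarith) hi.neg).1 hn
      filter_upwards [this] with x hx
      simp only [Pi.zero_apply, Pi.neg_apply] at hx; linarith
  · filter_upwards [hhb, hvb] with x h1 h2
    refine (abs_sub _ _).trans ?_
    rw [abs_mul]
    gcongr
  · filter_upwards [hhe, hve, hkh, hkv] with x h1 h2 h3 h4
    have : ∀ y, k x y * (v y - t * h y) = k x y * v y - t * (k x y * h y) := fun y => by ring
    simp only [this]
    rw [integral_sub h4 (h3.const_mul t), integral_const_mul, h1, h2]; ring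

end Perron

theorem exists_unit (hN : 2 ≤ finrank ℝ E) : ∃ x : E, ‖x‖ = 1 := by
  have := nontrivial_of_two_le hN
  exact exists_norm_eq E zero_le_one

theorem surf_ne_zero (hN : 2 ≤ finrank ℝ E) : surf E ≠ 0 := by
  obtain ⟨x, hx⟩ := exists_unit hN
  intro h
  have := surf_pos_of_isOpen isOpen_univ hx (mem_univ x)
  rw [h] at this
  simp at this

theorem ae_surf_inner_ne {e : E} (he : ‖e‖ = 1) :
    ∀ᵐ η ∂surf E, inner ℝ η e ≠ 0 := by
  rw [ae_iff]
  simp only [not_not]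
  rw [surf_apply (measurableSet_eq_fun (by fun_prop) measurable_const)]
  have h0 : volume ((ℝ ∙ e)ᗮ : Set E) = 0 := by
    apply Measure.addHaar_submodule
    intro h
    have : e ∈ (ℝ ∙ e)ᗮ := by rw [h]; trivial
    rw [Submodule.mem_orthogonal_singleton_iff_inner_right, real_inner_self_eq_norm_sq, he] at this
    norm_num at this
  rw [measure_mono_null _ h0, mul_zero]
  rintro x ⟨t, ht, y, hy, rfl⟩
  change t • y ∈ (ℝ ∙ e)ᗮ
  rw [Submodule.mem_orthogonal_singleton_iff_inner_left, inner_smul_left]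
  rw [show inner ℝ y e = 0 from hy.1, mul_zero]

theorem abs_inner_le_one {x y : E} (hx : ‖x‖ = 1) (hy : ‖y‖ = 1) : |inner ℝ x y| ≤ 1 := by
  simpa [hx, hy] using abs_real_inner_le_norm x y

theorem riesz_add (hN : 2 ≤ finrank ℝ E) (hα : 0 < α) {f g : E → ℝ}
    (hf : AEStronglyMeasurable f (surf E)) (hg : AEStronglyMeasurable g (surf E)) {B B' : ℝ}
    (hB : ∀ x, ‖x‖ = 1 → |f x| ≤ B) (hB' : ∀ x, ‖x‖ = 1 → |g x| ≤ B') (hθ : ‖θ‖ = 1) :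
    riesz α (fun x => f x + g x) θ = riesz α f θ + riesz α g θ := by
  simp only [riesz, mul_add]
  exact integral_add (riesz_integrable hN hα hf hB hθ) (riesz_integrable hN hα hg hB' hθ)

theorem riesz_const_mul (c : ℝ) (f : E → ℝ) (θ : E) :
    riesz α (fun x => c * f x) θ = c * riesz α f θ := by
  simp only [riesz, mul_left_comm _ c]
  exact integral_const_mul _ _

theorem riesz_sub (hN : 2 ≤ finrank ℝ E) (hα : 0 < α) {f g : E → ℝ}
    (hf : AEStronglyMeasurable f (surf E)) (hg : AEStronglyMeasurable g (surf E)) {B B' : ℝ}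
    (hB : ∀ x, ‖x‖ = 1 → |f x| ≤ B) (hB' : ∀ x, ‖x‖ = 1 → |g x| ≤ B') (hθ : ‖θ‖ = 1) :
    riesz α (fun x => f x - g x) θ = riesz α f θ - riesz α g θ := by
  simp only [riesz, mul_sub]
  exact integral_sub (riesz_integrable hN hα hf hB hθ) (riesz_integrable hN hα hg hB' hθ)

theorem riesz_congr {f g : E → ℝ} (h : f =ᵐ[surf E] g) (θ : E) : riesz α f θ = riesz α g θ :=
  integral_congr_ae (h.mono fun x hx => by simp only [hx])

theorem riesz_inner (hN : 2 ≤ finrank ℝ E) (hα : 0 < α) : ∃ c : ℝ, ∀ θ e : E, ‖θ‖ = 1 →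
    riesz α (fun η => inner ℝ η e) θ = c * inner ℝ θ e := by
  obtain ⟨θ₀, hθ₀⟩ := exists_unit hN
  refine ⟨riesz α (fun η => inner ℝ η θ₀) θ₀, fun θ e hθ => ?_⟩
  have hm : ∀ e : E, AEStronglyMeasurable (fun η : E => inner ℝ η e) (surf E) :=
    fun e => Continuous.aestronglyMeasurable (by fun_prop)
  have hb : ∀ e : E, ∀ x : E, ‖x‖ = 1 → |inner ℝ x e| ≤ ‖e‖ := fun e x hx => by
    simpa [hx] using abs_real_inner_le_norm x e
  obtain ⟨R, hR⟩ := exists_isometry_map (hθ₀.trans hθ.symm)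
  have h1 : riesz α (fun η => inner ℝ η θ) θ = riesz α (fun η => inner ℝ η θ₀) θ₀ := by
    conv_lhs => rw [← hR]
    rw [riesz_comp]
    simp only [R.inner_map_map]
  obtain ⟨Q, hQ⟩ := axisRefl_isometry hθ
  have h2 : riesz α (fun η => inner ℝ η e) θ =
      riesz α (fun η => (2 * inner ℝ θ e) * inner ℝ η θ - inner ℝ η e) θ := by
    conv_lhs => rw [show θ = Q θ by rw [hQ, axisRefl_self hθ]]
    rw [riesz_comp]
    congr 1; funext η
    rw [hQ, axisRefl, inner_sub_left, inner_smul_left]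
    simp only [RCLike.conj_to_real]; ring
  rw [riesz_sub hN hα ((hm θ).const_mul _) (hm e) (B := |2 * inner ℝ θ e| * ‖θ‖) (B' := ‖e‖) ?_ (hb e)
    hθ, riesz_const_mul, h1] at h2
  · linarith
  · intro x hx
    rw [abs_mul]
    gcongr
    exact hb θ x hx

theorem riesz_inner_lt_one (hN : 2 ≤ finrank ℝ E) (hα : 0 < α) (hθ : ‖θ‖ = 1) :
    0 < riesz α (fun _ => 1) θ ∧
      riesz α (fun η => inner ℝ η θ) θ < riesz α (fun _ => 1) θ := by
  have hm : AEStronglyMeasurable (fun η : E => inner ℝ η θ) (surf E) :=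
    Continuous.aestronglyMeasurable (by fun_prop)
  have hb : ∀ x : E, ‖x‖ = 1 → |inner ℝ x θ| ≤ 1 := fun x hx => abs_inner_le_one hx hθ
  have hne : (ae (surf E)).NeBot := ae_neBot.2 (surf_ne_zero hN)
  have hi1 := riesz_integrable hN hα (f := fun _ => 1) (B := 1)
    aestronglyMeasurable_const (by simp) hθ
  have hi2 := riesz_integrable hN hα hm hb hθ
  have pos : ∀ F : E → ℝ, Integrable F (surf E) → (∀ᵐ x ∂surf E, 0 < F x) →
      0 < ∫ x, F x ∂surf E := by
    intro F hF hpos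
    refine lt_of_le_of_ne (integral_nonneg_of_ae (hpos.mono fun x hx => hx.le)) fun h0 => ?_
    rw [eq_comm, integral_eq_zero_iff_of_nonneg_ae (hpos.mono fun x hx => hx.le) hF] at h0
    obtain ⟨x, h1, h2⟩ := (h0.and hpos).exists
    simp only [Pi.zero_apply] at h1
    linarith
  constructor
  · refine pos _ hi1 ?_
    filter_upwards [ae_surf_ne hN θ] with η hη
    have := norm_pos_iff.2 (sub_ne_zero.2 hη)
    positivity
  · rw [← sub_pos, riesz, riesz, ← integral_sub hi1 hi2]
    refine pos _ (hi1.sub hi2) ?_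
    filter_upwards [ae_surf_ne hN θ, ae_surf_norm] with η hη hη1
    have := norm_pos_iff.2 (sub_ne_zero.2 hη)
    have h1 : inner ℝ η θ < 1 := (inner_lt_one_iff_real_of_norm_eq_one hη1 hθ).2 hη
    have : 0 < ‖η - θ‖ ^ (α + 2 - dim E) := by positivity
    nlinarith

theorem norm_sub_reflection_sq {e θ η : E} (he : ‖e‖ = 1) :
    ‖η - (ℝ ∙ e)ᗮ.reflection θ‖ ^ 2 = ‖η - θ‖ ^ 2 + 4 * (inner ℝ η e * inner ℝ θ e) := by
  have hR : (ℝ ∙ e)ᗮ.reflection θ = θ - (2 * inner ℝ θ e) • e := by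
    rw [Submodule.reflection_orthogonal_apply, Submodule.reflection_singleton_apply, he,
      real_inner_comm]
    simp [two_smul, two_mul, add_smul]
  rw [hR, show η - (θ - (2 * inner ℝ θ e) • e) = (η - θ) + (2 * inner ℝ θ e) • e by abel,
    norm_add_sq_real, norm_smul, he, inner_smul_right, inner_sub_left, norm_eq_abs, mul_one, sq_abs]
  ring

theorem reflection_inner {e η : E} (he : ‖e‖ = 1) :
    inner ℝ ((ℝ ∙ e)ᗮ.reflection η) e = - inner ℝ η e := by
  have hR : (ℝ ∙ e)ᗮ.reflection η = η - (2 * inner ℝ η e) • e := by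
    rw [Submodule.reflection_orthogonal_apply, Submodule.reflection_singleton_apply, he,
      real_inner_comm]
    simp [two_smul, two_mul, add_smul]
  rw [hR, inner_sub_left, inner_smul_left, real_inner_self_eq_norm_sq, he]
  simp only [RCLike.conj_to_real]; ring

/-- The sign of the kernel difference under reflection across the hyperplane `e^⊥`. -/
theorem abs_kernel_reflection {b : ℝ} (hb : b ≠ 0) {e θ η : E} (he : ‖e‖ = 1)
    (h1 : η ≠ θ) (h2 : η ≠ (ℝ ∙ e)ᗮ.reflection θ) (h3 : inner ℝ η e ≠ 0) (h4 : inner ℝ θ e ≠ 0) :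
    |‖η - θ‖ ^ b - ‖η - (ℝ ∙ e)ᗮ.reflection θ‖ ^ b| =
      -(b / |b|) * (inner ℝ θ e / |inner ℝ θ e|) * (inner ℝ η e / |inner ℝ η e|) *
        (‖η - θ‖ ^ b - ‖η - (ℝ ∙ e)ᗮ.reflection θ‖ ^ b) ∧
    0 < |‖η - θ‖ ^ b - ‖η - (ℝ ∙ e)ᗮ.reflection θ‖ ^ b| := by
  have hsq := norm_sub_reflection_sq (θ := θ) (η := η) he
  have p1 := norm_pos_iff.2 (sub_ne_zero.2 h1)
  have p2 := norm_pos_iff.2 (sub_ne_zero.2 h2)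
  set A := ‖η - θ‖
  set B := ‖η - (ℝ ∙ e)ᗮ.reflection θ‖
  set x := inner ℝ η e
  set y := inner ℝ θ e
  have key : (A < B ∧ 0 < x * y) ∨ (B < A ∧ x * y < 0) := by
    rcases (mul_ne_zero h3 h4).lt_or_gt with h | h
    · right; exact ⟨lt_of_pow_lt_pow_left₀ 2 p1.le (by linarith), h⟩
    · left; exact ⟨lt_of_pow_lt_pow_left₀ 2 p2.le (by linarith), h⟩
  have hxy : y / |y| * (x / |x|) = x * y / |x * y| := by rw [abs_mul]; ring
  rw [mul_assoc (-(b / |b|)), hxy]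
  have s1 : ∀ t : ℝ, 0 < t → t / |t| = 1 := fun t ht => by rw [abs_of_pos ht, div_self ht.ne']
  have s2 : ∀ t : ℝ, t < 0 → t / |t| = -1 := fun t ht => by
    rw [abs_of_neg ht, div_neg, div_self ht.ne]
  rcases hb.lt_or_gt with hb | hb <;> rcases key with ⟨hAB, hp⟩ | ⟨hAB, hp⟩
  · have := rpow_lt_rpow_of_neg p1 hAB hb
    rw [s2 _ hb, s1 _ hp, abs_of_pos (by linarith)]
    constructor <;> linarith
  · have := rpow_lt_rpow_of_neg p2 hAB hb
    rw [s2 _ hb, s2 _ hp, abs_of_neg (by linarith)]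
    constructor <;> linarith
  · have := rpow_lt_rpow p1.le hAB hb
    rw [s1 _ hb, s1 _ hp, abs_of_neg (by linarith)]
    constructor <;> linarith
  · have := rpow_lt_rpow p2.le hAB hb
    rw [s1 _ hb, s2 _ hp, abs_of_pos (by linarith)]
    constructor <;> linarith

/-- An odd eigenfunction of the Riesz operator with the eigenvalue of linear functions
is linear. -/
theorem riesz_odd_eigen (hN : 2 ≤ finrank ℝ E) (hα : 0 < α) (ha : α + 2 - dim E ≠ 0)
    {c : ℝ} (hc : c ≠ 0)
    (hlin : ∀ θ e : E, ‖θ‖ = 1 → riesz α (fun η => inner ℝ η e) θ = c * inner ℝ θ e)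
    {e : E} (he : ‖e‖ = 1) {w : E → ℝ} (hw : AEStronglyMeasurable w (surf E)) {B : ℝ}
    (hB : ∀ x, ‖x‖ = 1 → |w x| ≤ B)
    (hodd : ∀ x, ‖x‖ = 1 → w ((ℝ ∙ e)ᗮ.reflection x) = - w x)
    (heig : ∀ x, ‖x‖ = 1 → riesz α w x = c * w x) :
    ∃ t : ℝ, ∀ x, ‖x‖ = 1 → w x = t * inner ℝ x e := by
  have hd := dim_ge hN
  obtain ⟨A, hA, hInt⟩ := surf_rpow_integrable hN (e := α + 2 - dim E) (by linarith)
  set b := α + 2 - dim E with hbdef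
  set R := (ℝ ∙ e)ᗮ.reflection with hR
  set k : E → E → ℝ := fun θ η => 2⁻¹ * |‖η - θ‖ ^ b - ‖η - R θ‖ ^ b| with hk
  set l : E → ℝ := fun η => inner ℝ η e with hl
  have hRl : ∀ η, l (R η) = - l η := fun η => reflection_inner he
  have hlm : Measurable l := by fun_prop
  have hkm : Measurable (uncurry k) := by
    have h1 : Measurable fun z : E × E => ‖z.2 - z.1‖ ^ b :=
      (measurable_snd.sub measurable_fst).norm.pow_const _
    have h2 : Measurable fun z : E × E => ‖z.2 - R z.1‖ ^ b :=
      (measurable_snd.sub (R.continuous.measurable.comp measurable_fst)).norm.pow_const _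
    exact ((h1.sub h2).norm).const_mul _
  have hRR : ∀ x, R (R x) = x := fun x => Submodule.reflection_reflection _ x
  have hsymm : ∀ x y, k x y = k y x := by
    intro x y
    simp only [hk]
    rw [norm_sub_rev y x, show ‖y - R x‖ = ‖x - R y‖ by
      rw [← R.norm_map, map_sub, hRR, norm_sub_rev]]
  have hnn : ∀ x y, 0 ≤ k x y := fun x y => by positivity
  have hkA : ∀ᵐ x ∂surf E, Integrable (k x) (surf E) ∧ ∫ y, k x y ∂surf E ≤ A := by
    filter_upwards [ae_surf_norm] with x hx
    have hRx : ‖R x‖ = 1 := by rw [R.norm_map, hx]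
    have h1 := hInt x hx
    have h2 := hInt (R x) hRx
    have hi : Integrable (k x) (surf E) := ((h1.1.sub h2.1).abs).const_mul _
    refine ⟨hi, ?_⟩
    calc ∫ y, k x y ∂surf E ≤ ∫ y, 2⁻¹ * (‖y - x‖ ^ b + ‖y - R x‖ ^ b) ∂surf E := by
          refine integral_mono hi ((h1.1.add h2.1).const_mul _) fun y => ?_
          simp only [hk]
          have p1 : 0 ≤ ‖y - x‖ ^ b := by positivity
          have p2 : 0 ≤ ‖y - R x‖ ^ b := by positivity
          gcongr
          rw [abs_le]; constructor <;> linarith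
      _ ≤ A := by
          rw [integral_const_mul, integral_add h1.1 h2.1]; linarith [h1.2, h2.2]
  have hgood : ∀ᵐ x ∂surf E, ∀ᵐ y ∂surf E, |‖y - x‖ ^ b - ‖y - R x‖ ^ b| =
      -(b / |b|) * (l x / |l x|) * (l y / |l y|) * (‖y - x‖ ^ b - ‖y - R x‖ ^ b) ∧
      0 < |‖y - x‖ ^ b - ‖y - R x‖ ^ b| := by
    filter_upwards [ae_surf_inner_ne he] with x hx
    filter_upwards [ae_surf_inner_ne he, ae_surf_ne hN x, ae_surf_ne hN (R x)] with y h1 h2 h3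
    exact abs_kernel_reflection ha he h2 h3 h1 hx
  have hpos : ∀ᵐ x ∂surf E, ∀ᵐ y ∂surf E, 0 < k x y := by
    filter_upwards [hgood] with x hx
    filter_upwards [hx] with y hy
    have := hy.2
    positivity
  have hlb : ∀ x, ‖x‖ = 1 → |l x| ≤ 1 := fun x hx => abs_inner_le_one hx he
  set ε := -(b / |b|) * c with hε
  have main : ∀ (v : E → ℝ), AEStronglyMeasurable v (surf E) → ∀ B, (∀ x, ‖x‖ = 1 → |v x| ≤ B) →
      (∀ x, ‖x‖ = 1 → v (R x) = - v x) → (∀ x, ‖x‖ = 1 → riesz α v x = c * v x) →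
      ∀ᵐ x ∂surf E, ∫ y, k x y * (l y / |l y| * v y) ∂surf E = ε * (l x / |l x| * v x) := by
    intro v hv B hvB hvo hve
    filter_upwards [hgood, ae_surf_norm] with x hx hx1
    have hRx : ‖R x‖ = 1 := by rw [R.norm_map, hx1]
    have e1 : ∫ y, k x y * (l y / |l y| * v y) ∂surf E =
        ∫ y, (2⁻¹ * (-(b / |b|) * (l x / |l x|))) *
          (‖y - x‖ ^ b * v y - ‖y - R x‖ ^ b * v y) ∂surf E := by
      refine integral_congr_ae ?_
      filter_upwards [hx, ae_surf_inner_ne he] with y hy hly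
      simp only [hk]
      rw [hy.1]
      have : l y / |l y| * (l y / |l y|) = 1 := by
        rw [div_mul_div_comm, abs_mul_abs_self, div_self (mul_ne_zero hly hly)]
      calc _ = 2⁻¹ * (-(b / |b|) * (l x / |l x|)) *
          (‖y - x‖ ^ b * v y - ‖y - R x‖ ^ b * v y) * (l y / |l y| * (l y / |l y|)) := by ring
        _ = _ := by rw [this, mul_one]
    have e2 : ∫ y, (‖y - x‖ ^ b * v y - ‖y - R x‖ ^ b * v y) ∂surf E = 2 * (c * v x) := by
      rw [integral_sub (riesz_integrable hN hα hv hvB hx1) (riesz_integrable hN hα hv hvB hRx)]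
      have h1 := hve x hx1
      have h2 := hve (R x) hRx
      rw [hvo x hx1] at h2
      simp only [riesz] at h1 h2
      rw [h1, h2]; ring
    rw [e1, integral_const_mul, e2, hε]; ring
  have hne : (ae (surf E)).NeBot := ae_neBot.2 (surf_ne_zero hN)
  have habs : ∀ x, l x / |l x| * l x = |l x| := by
    intro x
    rcases eq_or_ne (l x) 0 with h | h
    · simp [h]
    · rw [div_mul_eq_mul_div, ← abs_mul_abs_self, mul_div_assoc, div_self (abs_ne_zero.2 h), mul_one]
  have hhe : ∀ᵐ x ∂surf E, ∫ y, k x y * |l y| ∂surf E = ε * |l x| := by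
    have := main l hlm.aestronglyMeasurable 1 hlb (fun x _ => hRl x) (fun x hx => hlin x e hx)
    simpa only [habs] using this
  have hε0 : 0 ≤ ε := by
    obtain ⟨x, h1, h2⟩ := (hhe.and (ae_surf_inner_ne he)).exists
    have h3 : 0 ≤ ε * |l x| := by
      rw [← h1]
      exact integral_nonneg fun y => mul_nonneg (hnn _ _) (abs_nonneg _)
    exact nonneg_of_mul_nonneg_left h3 (abs_pos.2 h2)
  have hsm : Measurable fun x => l x / |l x| := hlm.div hlm.norm
  obtain ⟨t, ht⟩ := perron_unique hkm (surf_ne_zero hN) hnn hsymm hkA hpos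
    (h := fun x => |l x|) (v := fun x => l x / |l x| * w x) hlm.norm.aestronglyMeasurable
    (hsm.aestronglyMeasurable.mul hw) (B := 1) (B' := B) hε0
    ((ae_surf_inner_ne he).mono fun x hx => abs_pos.2 hx)
    (by filter_upwards [ae_surf_norm] with x hx; rw [abs_abs]; exact hlb x hx)
    (by
      filter_upwards [ae_surf_norm] with x hx
      rw [abs_mul, abs_div, abs_abs]
      exact (mul_le_of_le_one_left (abs_nonneg _) (div_self_le_one _)).trans (hB x hx))
    hhe (main w hw B hB hodd heig)
  have hwt : w =ᵐ[surf E] fun x => t * l x := by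
    filter_upwards [ht, ae_surf_inner_ne he] with x hx hlx
    have h1 : l x / |l x| * (l x / |l x|) = 1 := by
      rw [div_mul_div_comm, abs_mul_abs_self, div_self (mul_ne_zero hlx hlx)]
    calc w x = (l x / |l x| * (l x / |l x|)) * w x := by rw [h1, one_mul]
      _ = l x / |l x| * (l x / |l x| * w x) := by ring
      _ = l x / |l x| * (t * (l x / |l x| * l x)) := by rw [hx, habs]
      _ = (l x / |l x| * (l x / |l x|)) * (t * l x) := by ring
      _ = t * l x := by rw [h1, one_mul]
  refine ⟨t, fun x hx => mul_left_cancel₀ hc ?_⟩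
  rw [← heig x hx, riesz_congr hwt, riesz_const_mul, hlin x e hx]
  ring

theorem riesz_injective (hN : 2 ≤ finrank ℝ E) (hα : 0 < α) (ha : α + 2 - dim E ≠ 0)
    {c : ℝ} (hc : c ≠ 0)
    (hlin : ∀ θ e : E, ‖θ‖ = 1 → riesz α (fun η => inner ℝ η e) θ = c * inner ℝ θ e)
    {f : E → ℝ} (hf : AEStronglyMeasurable f (surf E)) {B : ℝ}
    (hB : ∀ x, ‖x‖ = 1 → |f x| ≤ B) (heven : ∀ x, ‖x‖ = 1 → f (-x) = f x)
    (heig : ∀ x, ‖x‖ = 1 → riesz α f x = c * f x) : ∀ x, ‖x‖ = 1 → f x = 0 := by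
  have hrefl : ∀ e x : E, ‖e‖ = 1 → ‖x‖ = 1 → f ((ℝ ∙ e)ᗮ.reflection x) = f x := by
    intro e x he hx
    set R := (ℝ ∙ e)ᗮ.reflection with hR
    have hRR : ∀ x, R (R x) = x := fun x => Submodule.reflection_reflection _ x
    have hRn : ∀ x, ‖R x‖ = ‖x‖ := R.norm_map
    have hfR : AEStronglyMeasurable (fun x => f (R x)) (surf E) :=
      hf.comp_measurePreserving (surf_measurePreserving R)
    have hBR : ∀ x, ‖x‖ = 1 → |f (R x)| ≤ B := fun x hx => hB _ (by rw [hRn, hx])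
    obtain ⟨t, ht⟩ := riesz_odd_eigen hN hα ha hc hlin he (w := fun x => f x - f (R x))
      (hf.sub hfR) (B := B + B)
      (fun x hx => (abs_sub _ _).trans (add_le_add (hB x hx) (hBR x hx)))
      (fun x hx => by rw [hRR]; ring)
      (fun x hx => by
        rw [riesz_sub hN hα hf hfR hB hBR hx, ← riesz_comp, heig x hx, heig _ (by rw [hRn, hx])]
        ring)
    have h1 := ht e he
    have h2 := ht (-e) (by rw [norm_neg, he])
    rw [map_neg, heven _ he, heven _ (by rw [hRn, he]), inner_neg_left] at h2
    rw [real_inner_self_eq_norm_sq, he] at h1 h2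
    have ht0 : t = 0 := by linarith
    have := ht x hx
    rw [ht0, zero_mul] at this
    linarith
  have hconst : ∀ x y, ‖x‖ = 1 → ‖y‖ = 1 → f x = f y := by
    intro x y hx hy
    rcases eq_or_ne x y with rfl | hxy
    · rfl
    have hp := norm_pos_iff.2 (sub_ne_zero.2 hxy)
    have h1 := hrefl (‖x - y‖⁻¹ • (x - y)) x (by rw [norm_smul, norm_inv, norm_norm, inv_mul_cancel₀ hp.ne']) hx
    have h2 : (ℝ ∙ (‖x - y‖⁻¹ • (x - y)))ᗮ.reflection x = y := by
      have : (ℝ ∙ (‖x - y‖⁻¹ • (x - y))) = ℝ ∙ (x - y) :=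
        Submodule.span_singleton_smul_eq (IsUnit.mk0 _ (inv_ne_zero hp.ne')) _
      simp only [this]
      exact Submodule.reflection_sub (hx.trans hy.symm)
    rw [h2] at h1
    exact h1.symm
  intro x hx
  have hm := riesz_inner_lt_one (E := E) (α := α) hN hα hx
  rw [hlin x x hx, real_inner_self_eq_norm_sq, hx, one_pow, mul_one] at hm
  have h1 : riesz α f x = f x * riesz α (fun _ => 1) x := by
    rw [← riesz_const_mul]
    refine riesz_congr ?_ x
    filter_upwards [ae_surf_norm] with y hy
    rw [mul_one, hconst x y hx hy]
  rw [heig x hx] at h1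
  have : f x * (riesz α (fun _ => 1) x - c) = 0 := by linarith
  rcases mul_eq_zero.1 this with h | h
  · exact h
  · linarith [hm.2]

section Fredholm

open BoundedContinuousFunction

open scoped Classical in
/-- The even part of a function on the unit sphere, extended by zero. -/
noncomputable def evenExt (f : sphere (0 : E) 1 →ᵇ ℝ) (x : E) : ℝ :=
  if h : ‖x‖ = 1 then (f ⟨x, by simpa using h⟩ + f ⟨-x, by simpa using h⟩) / 2 else 0

theorem evenExt_apply (f : sphere (0 : E) 1 →ᵇ ℝ) {x : E} (h : ‖x‖ = 1) :
    evenExt f x = (f ⟨x, by simpa using h⟩ + f ⟨-x, by simpa using h⟩) / 2 := dif_pos h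

theorem evenExt_neg (f : sphere (0 : E) 1 →ᵇ ℝ) {x : E} (h : ‖x‖ = 1) :
    evenExt f (-x) = evenExt f x := by
  rw [evenExt_apply f h, evenExt_apply f (by rwa [norm_neg]), add_comm]
  simp only [neg_neg]

theorem evenExt_bound (f : sphere (0 : E) 1 →ᵇ ℝ) {x : E} (h : ‖x‖ = 1) :
    |evenExt f x| ≤ ‖f‖ := by
  rw [evenExt_apply f h]
  have h1 := abs_le.1 (f.norm_coe_le_norm ⟨x, by simpa using h⟩)
  have h2 := abs_le.1 (f.norm_coe_le_norm ⟨-x, by simpa using h⟩)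
  rw [abs_le]
  constructor <;> linarith [h1.1, h1.2, h2.1, h2.2]

theorem evenExt_aesm (f : sphere (0 : E) 1 →ᵇ ℝ) :
    AEStronglyMeasurable (evenExt f) (surf E) := by
  refine aestronglyMeasurable_surf ?_
  rw [continuousOn_iff_continuous_domRestrict]
  have : (sphere (0 : E) 1).domRestrict (evenExt f) = fun x => (f x + f (-x)) / 2 := by
    ext x
    rw [domRestrict_apply, evenExt_apply f (by simp)]
    rfl
  rw [this]
  fun_prop

theorem evenExt_add (f g : sphere (0 : E) 1 →ᵇ ℝ) :
    evenExt (f + g) = fun x => evenExt f x + evenExt g x := by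
  ext x
  by_cases h : ‖x‖ = 1
  · rw [evenExt_apply _ h, evenExt_apply _ h, evenExt_apply _ h]
    simp only [BoundedContinuousFunction.add_apply]
    ring
  · simp [evenExt, h]

theorem evenExt_smul (c : ℝ) (f : sphere (0 : E) 1 →ᵇ ℝ) :
    evenExt (c • f) = fun x => c * evenExt f x := by
  ext x
  by_cases h : ‖x‖ = 1
  · rw [evenExt_apply _ h, evenExt_apply _ h]
    simp only [BoundedContinuousFunction.smul_apply, smul_eq_mul]
    ring
  · simp [evenExt, h]

theorem riesz_even {f : E → ℝ} (hf : ∀ x, ‖x‖ = 1 → f (-x) = f x) (θ : E) :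
    riesz α f (-θ) = riesz α f θ := by
  have := riesz_comp (α := α) (LinearIsometryEquiv.neg ℝ) f θ
  rw [LinearIsometryEquiv.coe_neg] at this
  rw [this]
  refine riesz_congr ?_ θ
  filter_upwards [ae_surf_norm] with y hy
  exact hf y hy

/-- The Riesz operator on bounded continuous functions, precomposed with the projection to even
functions, is compact. -/
theorem exists_compact_riesz (hN : 2 ≤ finrank ℝ E) (hα : 0 < α) (hα1 : α < 1) :
    ∃ T : (sphere (0 : E) 1 →ᵇ ℝ) →L[ℝ] (sphere (0 : E) 1 →ᵇ ℝ),
      IsCompactOperator T ∧ ∀ f θ, T f θ = riesz α (evenExt f) θ.1 := by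
  obtain ⟨K, hK, h⟩ := riesz_lip hN hα hα1
  have hb := fun f : sphere (0 : E) 1 →ᵇ ℝ =>
    h (evenExt f) ‖f‖ (evenExt_aesm f) (fun x hx => evenExt_bound f hx)
  have hn : ∀ θ : sphere (0 : E) 1, ‖θ.1‖ = 1 := fun θ => by simp
  have hlip : ∀ f : sphere (0 : E) 1 →ᵇ ℝ,
      LipschitzWith (toNNReal (K * ‖f‖)) (fun θ : sphere (0 : E) 1 =>
        riesz α (evenExt f) θ.1) := fun f => by
    refine LipschitzWith.of_dist_le_mul fun x y => ?_
    rw [coe_toNNReal _ (by positivity), dist_eq, Subtype.dist_eq, dist_eq_norm]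
    exact (hb f).2 _ _ (hn x) (hn y)
  let L : (sphere (0 : E) 1 →ᵇ ℝ) →ₗ[ℝ] (sphere (0 : E) 1 →ᵇ ℝ) :=
    { toFun := fun f => BoundedContinuousFunction.ofNormedAddCommGroup
        (fun θ : sphere (0 : E) 1 => riesz α (evenExt f) θ.1) (hlip f).continuous
        (K * ‖f‖) (fun θ => (hb f).1 _ (hn θ))
      map_add' := fun f g => by
        ext θ
        simp only [BoundedContinuousFunction.coe_ofNormedAddCommGroup,
          BoundedContinuousFunction.add_apply]
        rw [evenExt_add, riesz_add hN hα (evenExt_aesm f) (evenExt_aesm g)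
          (fun x hx => evenExt_bound f hx) (fun x hx => evenExt_bound g hx) (hn θ)]
      map_smul' := fun c f => by
        ext θ
        simp only [BoundedContinuousFunction.coe_ofNormedAddCommGroup,
          BoundedContinuousFunction.smul_apply, RingHom.id_apply, smul_eq_mul]
        rw [evenExt_smul, riesz_const_mul] }
  have hL : ∀ f θ, L f θ = riesz α (evenExt f) θ.1 := fun f θ => rfl
  refine ⟨L.mkContinuous K fun f => ?_, ?_, fun f θ => rfl⟩
  · exact (BoundedContinuousFunction.norm_le (by positivity)).2 fun θ => (hb f).1 _ (hn θ)
  · have : IsCompactOperator L := by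
      rw [isCompactOperator_iff_isCompact_closure_image_closedBall L zero_lt_one]
      refine BoundedContinuousFunction.arzela_ascoli (closedBall 0 K)
        (isCompact_closedBall _ _) _ ?_ ?_
      · rintro _ x ⟨f, hf, rfl⟩
        rw [mem_closedBall_zero_iff] at hf ⊢
        exact ((hb f).1 _ (hn x)).trans (mul_le_of_le_one_right hK hf)
      · refine (LipschitzWith.uniformEquicontinuous _ (toNNReal K) ?_).equicontinuous
        rintro ⟨_, f, hf, rfl⟩
        rw [mem_closedBall_zero_iff] at hf
        refine (hlip f).weaken (toNNReal_le_toNNReal (mul_le_of_le_one_right hK hf))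
    exact this

/-- Solvability of `G f - c f = h` among even Hölder functions, `G` the Riesz operator and `c` its
eigenvalue on linear functions. -/
theorem riesz_solve (hN : 2 ≤ finrank ℝ E) (hα : 0 < α) (hα1 : α < 1)
    (ha : α + 2 - dim E ≠ 0) {c : ℝ} (hc : c ≠ 0)
    (hlin : ∀ θ e : E, ‖θ‖ = 1 → riesz α (fun η => inner ℝ η e) θ = c * inner ℝ θ e) :
    ∃ K, 0 ≤ K ∧ ∀ (h : E → ℝ) (C : ℝ), HB α C h → (∀ x, ‖x‖ = 1 → h (-x) = h x) →
      ∃ f : E → ℝ, HB α (K * C) f ∧ (∀ x, ‖x‖ = 1 → f (-x) = f x) ∧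
        ∀ x, ‖x‖ = 1 → riesz α f x - c * f x = h x := by
  obtain ⟨K₁, hK₁, hlip⟩ := riesz_lip hN hα hα1
  obtain ⟨T, hT, hTf⟩ := exists_compact_riesz hN hα hα1
  have hn : ∀ θ : sphere (0 : E) 1, ‖θ.1‖ = 1 := fun θ => by simp
  have hs : ∀ {x : E}, ‖x‖ = 1 → x ∈ sphere (0 : E) 1 := fun hx => by simpa using hx
  have hev : ∀ (f g : sphere (0 : E) 1 →ᵇ ℝ), (∀ θ, g (-θ) = g θ) →
      (∀ θ, c * f θ = T f θ - g θ) → ∀ x (hx : ‖x‖ = 1), evenExt f x = f ⟨x, hs hx⟩ := by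
    intro f g hg hfg x hx
    rw [evenExt_apply f hx]
    have h1 := hfg ⟨x, hs hx⟩
    have h2 := hfg (-⟨x, hs hx⟩)
    rw [hg, hTf, show (↑(-(⟨x, hs hx⟩ : sphere (0 : E) 1)) : E) = -x from rfl,
      riesz_even (fun x hx => evenExt_neg f hx), ← hTf f ⟨x, hs hx⟩,
      ← h1] at h2
    have h3 := mul_left_cancel₀ hc h2
    have h4 : f ⟨-x, by simpa using hx⟩ = f ⟨x, hs hx⟩ := h3
    rw [h4]
    ring
  have hno : ¬ Module.End.HasEigenvalue (T : Module.End ℝ (sphere (0 : E) 1 →ᵇ ℝ)) c := by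
    intro he
    obtain ⟨f, hf⟩ := he.exists_hasEigenvector
    refine hf.2 ?_
    have h1 : ∀ θ, T f θ = c * f θ := fun θ => by
      have := congrArg (fun g : sphere (0 : E) 1 →ᵇ ℝ => g θ) hf.apply_eq_smul
      simpa using this
    have h2 := hev f 0 (by simp) (fun θ => by rw [h1]; simp)
    have h3 := riesz_injective hN hα ha hc hlin (evenExt_aesm f) (fun x hx => evenExt_bound f hx)
      (fun x hx => evenExt_neg f hx)
      (fun x hx => by rw [h2 x hx, ← h1, hTf])
    ext θ
    rw [← h2 θ.1 (hn θ), h3 _ (hn θ)]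
    rfl
  have hres := (hT.hasEigenvalue_or_mem_resolventSet hc).resolve_left hno
  rw [spectrum.mem_resolventSet_iff] at hres
  obtain ⟨U, hU⟩ := hres.exists_right_inv
  refine ⟨|c⁻¹| * (2 * (K₁ * ‖U‖) + 1) + ‖U‖, by positivity, fun h C hh heven => ?_⟩
  have hC : 0 ≤ C := by
    obtain ⟨x, hx⟩ := exists_unit hN
    exact hh.nonneg hx
  let g : sphere (0 : E) 1 →ᵇ ℝ := BoundedContinuousFunction.ofNormedAddCommGroup
    (fun θ : sphere (0 : E) 1 => h θ.1)
    (continuousOn_iff_continuous_domRestrict.1 (hh.continuousOn hα1)) C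
    (fun θ => hh.bound _ (hn θ))
  have hg : ∀ θ, g θ = h θ.1 := fun θ => rfl
  have hgn : ‖g‖ ≤ C := (BoundedContinuousFunction.norm_le hC).2 fun θ => hh.bound _ (hn θ)
  set f := U (-g) with hf
  have hfn : ‖f‖ ≤ ‖U‖ * C := by
    refine (U.le_opNorm _).trans ?_
    rw [norm_neg]
    gcongr
  have hfg : ∀ θ, c * f θ = T f θ - g θ := by
    intro θ
    have h1 := congrArg (fun A : (sphere (0 : E) 1 →ᵇ ℝ) →L[ℝ] (sphere (0 : E) 1 →ᵇ ℝ) => A (-g) θ) hU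
    change c * f θ - T f θ = -g θ at h1
    linarith
  have h2 := hev f g (fun θ => by rw [hg, hg]; exact heven _ (hn θ)) hfg
  have heq : ∀ x, ‖x‖ = 1 → riesz α (evenExt f) x - c * evenExt f x = h x := by
    intro x hx
    rw [h2 x hx, hfg, hTf, hg]
    ring
  have hl := hlip (evenExt f) (‖U‖ * C) (evenExt_aesm f)
    (fun x hx => (evenExt_bound f hx).trans hfn)
  refine ⟨evenExt f, ⟨fun x hx => ?_, fun x y hx hy => ?_⟩, fun x hx => evenExt_neg f hx, heq⟩
  · refine ((evenExt_bound f hx).trans hfn).trans ?_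
    gcongr
    exact le_add_of_nonneg_left (by positivity)
  · have e1 : evenExt f x - evenExt f y =
        c⁻¹ * ((riesz α (evenExt f) x - riesz α (evenExt f) y) - (h x - h y)) := by
      have := heq x hx
      have := heq y hy
      field_simp
      linarith
    have e2 : ‖x - y‖ ≤ 2 * ‖x - y‖ ^ ((1 - α) / 2) := by
      have e3 : ‖x - y‖ ≤ 2 := (norm_sub_le _ _).trans (by rw [hx, hy]; norm_num)
      rcases eq_or_ne ‖x - y‖ 0 with h0 | h0
      · rw [h0]; positivity
      have h0' : 0 < ‖x - y‖ := lt_of_le_of_ne (norm_nonneg _) h0.symm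
      calc ‖x - y‖ = ‖x - y‖ ^ ((1 + α) / 2) * ‖x - y‖ ^ ((1 - α) / 2) := by
            rw [← rpow_add h0', show (1 + α) / 2 + (1 - α) / 2 = 1 by ring, rpow_one]
        _ ≤ 2 ^ ((1 + α) / 2) * ‖x - y‖ ^ ((1 - α) / 2) := by gcongr
        _ ≤ 2 ^ (1 : ℝ) * ‖x - y‖ ^ ((1 - α) / 2) := by
            gcongr
            · norm_num
            · linarith
        _ = _ := by rw [rpow_one]
    rw [e1, abs_mul]
    set P := ‖x - y‖ ^ ((1 - α) / 2) with hP
    have hP0 : 0 ≤ P := by positivity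
    have e4 : |riesz α (evenExt f) x - riesz α (evenExt f) y - (h x - h y)| ≤
        (2 * (K₁ * ‖U‖) + 1) * C * P := by
      refine (abs_sub _ _).trans ?_
      have e5 := (hl.2 x y hx hy).trans (mul_le_mul_of_nonneg_left e2 (by positivity))
      have e6 := hh.holder x y hx hy
      rw [← hP] at e6
      calc _ ≤ K₁ * (‖U‖ * C) * (2 * P) + C * P := add_le_add e5 e6
        _ = _ := by ring
    have e7 := mul_le_mul_of_nonneg_left e4 (abs_nonneg c⁻¹)
    have e8 : 0 ≤ ‖U‖ * C * P := by positivity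
    calc _ ≤ |c⁻¹| * ((2 * (K₁ * ‖U‖) + 1) * C * P) := e7
      _ ≤ |c⁻¹| * ((2 * (K₁ * ‖U‖) + 1) * C * P) + ‖U‖ * C * P := le_add_of_nonneg_right e8
      _ = _ := by ring

end Fredholm

theorem flat_measurePreserving_add {θ v : E} (hv : inner ℝ θ v = 0) :
    MeasurePreserving (fun y => y + v) (flat θ) (flat θ) := by
  refine ⟨measurable_add_const v, Measure.ext_of_lintegral _ fun F hF => ?_⟩
  rw [lintegral_map hF (measurable_add_const v), lintegral_flat_add hv hF]

theorem flat_integral_smul (hθ : ‖θ‖ = 1) {c : ℝ} (hc : 0 < c) (F : E → ℝ) :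
    c ^ finrank ℝ E * ∫ y, F (c • y) ∂flat θ = c * ∫ y, F y ∂flat θ := by
  have h : ofReal (c ^ finrank ℝ E) • Measure.map (fun y : E => c • y) (flat θ) =
      ofReal c • flat θ := by
    refine Measure.ext_of_lintegral _ fun F hF => ?_
    rw [lintegral_smul_measure, lintegral_smul_measure, lintegral_map hF (measurable_const_smul c),
      smul_eq_mul, smul_eq_mul, lintegral_flat_smul hθ hc hF]
  have h2 := congrArg (fun μ => ∫ y, F y ∂μ) h
  simp only [integral_smul_measure, smul_eq_mul] at h2
  rw [toReal_ofReal (by positivity), toReal_ofReal hc.le] at h2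
  rw [← h2]
  congr 1
  exact ((Homeomorph.smulOfNeZero c hc.ne').measurableEmbedding.integral_map F).symm

/-- The surface measure in stereographic coordinates. -/
theorem surf_eq_map_stereo (hN : 2 ≤ finrank ℝ E) (hθ : ‖θ‖ = 1) :
    surf E = Measure.map (stereo θ)
      ((flat θ).withDensity fun y => ofReal ((‖y‖ ^ 2 + 1 / 4) ^ (1 - dim E))) := by
  have hw : ∀ y : E, (‖y‖ ^ 2 + 1 / 4)⁻¹ ^ finrank ℝ E * (‖y‖ ^ 2 + 1 / 4) =
      (‖y‖ ^ 2 + 1 / 4) ^ (1 - dim E) := fun y => by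
    have hp : 0 < ‖y‖ ^ 2 + 1 / 4 := by positivity
    rw [rpow_sub hp, rpow_one, dim, rpow_natCast, inv_pow]
    field_simp
  have hm : Measurable fun y : E => ofReal ((‖y‖ ^ 2 + 1 / 4) ^ (1 - dim E)) := by fun_prop
  refine Measure.ext_of_lintegral _ fun F hF => ?_
  rw [lintegral_map hF (continuous_stereo θ).measurable,
    lintegral_withDensity_eq_lintegral_mul _ hm (g := fun y => F (stereo θ y))
      (hF.comp (continuous_stereo θ).measurable),
    lintegral_surf_stereo hN hθ hF]
  simp only [hw]
  rfl

theorem integral_surf_stereo (hN : 2 ≤ finrank ℝ E) (hθ : ‖θ‖ = 1) {F : E → ℝ}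
    (hF : Measurable F) :
    (Integrable F (surf E) ↔
      Integrable (fun y => (‖y‖ ^ 2 + 1 / 4) ^ (1 - dim E) * F (stereo θ y)) (flat θ)) ∧
    ∫ σ, F σ ∂surf E = ∫ y, (‖y‖ ^ 2 + 1 / 4) ^ (1 - dim E) * F (stereo θ y) ∂flat θ := by
  have hm : Measurable fun y : E => ofReal ((‖y‖ ^ 2 + 1 / 4) ^ (1 - dim E)) := by fun_prop
  have ht : ∀ y : E, (ofReal ((‖y‖ ^ 2 + 1 / 4) ^ (1 - dim E))).toReal =
    (‖y‖ ^ 2 + 1 / 4) ^ (1 - dim E) := fun y => toReal_ofReal (by positivity)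
  have hl : ∀ᵐ y ∂flat θ, ofReal ((‖y‖ ^ 2 + 1 / 4) ^ (1 - dim E)) < ⊤ :=
    Eventually.of_forall fun y => ofReal_lt_top
  rw [surf_eq_map_stereo hN hθ, integrable_map_measure hF.aestronglyMeasurable
    (continuous_stereo θ).measurable.aemeasurable, integral_map
    (continuous_stereo θ).measurable.aemeasurable hF.aestronglyMeasurable,
    integrable_withDensity_iff_integrable_smul' hm hl,
    integral_withDensity_eq_integral_toReal_smul hm hl]
  simp only [ht, smul_eq_mul, comp_def, and_self, iff_self]

/-- The integrand defining the constant relating the second difference to the Riesz kernel. -/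
noncomputable def poleFun (α : ℝ) (y : E) : ℝ :=
  ‖y‖ ^ (α + 2 - dim E) - (‖y‖ ^ 2 + 1 / 4) ^ ((α + 2 - dim E) / 2)

theorem poleFun_integrable (hN : 2 ≤ finrank ℝ E) (hα : 0 < α) (hα1 : α < 1) 
    (hθ : ‖θ‖ = 1) : Integrable (poleFun α) (flat θ) := by
  have hd := dim_ge hN
  obtain ⟨C, hC, hfl⟩ := flat_ballGrowth (E := E)
  set a := α + 2 - dim E with ha
  have hg : BallGrowth (flat θ) (dim E - 1) C := hfl θ hθ
  obtain ⟨K, hK, h⟩ := hg.nearFar (by linarith) hC (e₁ := min a 0) (e₂ := a - 2)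
    (by rcases min_choice a 0 with h | h <;> rw [h] <;> linarith) (by linarith)
  have hm : Measurable (poleFun α : E → ℝ) := by unfold poleFun; fun_prop
  have hB : ∃ B, 0 ≤ B ∧ ∀ y : E, ‖y‖ ≤ 1 → (‖y‖ ^ 2 + 1 / 4) ^ (a / 2) ≤ B := by
    have hc : ContinuousOn (fun t : ℝ => t ^ (a / 2)) (Icc (1 / 4) (5 / 4)) :=
      fun t ht => (continuousAt_rpow_const _ _ (Or.inl (by linarith [ht.1]))).continuousWithinAt
    obtain ⟨B, hB⟩ := isCompact_Icc.exists_bound_of_continuousOn hc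
    refine ⟨B, (norm_nonneg _).trans (hB 1 (by norm_num)), fun y hy => ?_⟩
    refine (le_abs_self _).trans (hB _ ⟨by nlinarith [norm_nonneg y], by nlinarith [norm_nonneg y]⟩)
  obtain ⟨B, hB0, hB⟩ := hB
  refine (h 0 1 (fun _ => 0) (1 + B) (|a / 2| * (1 / 2)) (poleFun α) one_pos (by positivity)
    (by positivity) hm.aestronglyMeasurable (by simp) ?_ ?_).1
  · have hne : ∀ᵐ y ∂flat θ, y ≠ 0 := by
      rw [ae_iff]; simpa using hg.singleton (by linarith) 0
    filter_upwards [hne] with y hy0 hy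
    rw [sub_zero] at hy
    have hp : 0 < ‖y‖ := norm_pos_iff.2 hy0
    have e1 : ‖y‖ ^ a ≤ ‖y‖ ^ min a 0 :=
      rpow_le_rpow_of_exponent_ge hp hy (min_le_left _ _)
    have e2 : 1 ≤ ‖y‖ ^ min a 0 := one_le_rpow_of_pos_of_le_one_of_nonpos hp hy (min_le_right _ _)
    have e3 := hB y hy
    have e4 : 0 ≤ ‖y‖ ^ a := by positivity
    have e5 : 0 ≤ (‖y‖ ^ 2 + 1 / 4) ^ (a / 2) := by positivity
    have e6 : |poleFun α y| ≤ ‖y‖ ^ a + (‖y‖ ^ 2 + 1 / 4) ^ (a / 2) := by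
      rw [poleFun, abs_le]; constructor <;> linarith
    simp only [sub_zero, Finset.sum_const, Finset.card_univ, Fintype.card_fin, nsmul_eq_mul]
    push_cast
    nlinarith
  · refine Eventually.of_forall fun y hy => ?_
    rw [sub_zero] at hy ⊢
    have hp : 0 < ‖y‖ := by linarith
    have e1 := abs_rpow_sub_rpow_le (b := a / 2) (by linarith) (x := ‖y‖ ^ 2)
      (y := ‖y‖ ^ 2 + 1 / 4) (by positivity) (by positivity)
    have e0 : ∀ b : ℝ, (‖y‖ ^ 2) ^ b = ‖y‖ ^ (2 * b) := fun b => by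
      rw [rpow_mul hp.le, rpow_two]
    have e2 : (‖y‖ ^ 2 + 1 / 4) ^ (a / 2 - 1) ≤ (‖y‖ ^ 2) ^ (a / 2 - 1) :=
      rpow_le_rpow_of_nonpos (by positivity) (by linarith) (by linarith)
    rw [e0, e0, show 2 * (a / 2) = a by ring, show 2 * (a / 2 - 1) = a - 2 by ring] at e1
    rw [e0, show 2 * (a / 2 - 1) = a - 2 by ring] at e2
    rw [show ‖y‖ ^ 2 - (‖y‖ ^ 2 + 1 / 4) = -(1 / 4) by ring, abs_neg,
      abs_of_pos (show (0 : ℝ) < 1 / 4 by norm_num)] at e1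
    refine (show |poleFun α y| ≤ _ from e1).trans ?_
    have : 0 ≤ |a / 2| := abs_nonneg _
    nlinarith

theorem flat_ne_zero (hN : 2 ≤ finrank ℝ E) (hθ : ‖θ‖ = 1) : flat θ ≠ 0 := by
  intro h
  have := surf_eq_map_stereo hN hθ
  rw [h] at this
  refine surf_ne_zero hN (this.trans ?_)
  simp

theorem poleFun_integral_ne_zero (hN : 2 ≤ finrank ℝ E) (hα : 0 < α) (hα1 : α < 1)
    (ha : α + 2 - dim E ≠ 0) (hθ : ‖θ‖ = 1) : ∫ y, poleFun α y ∂flat θ ≠ 0 := by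
  have hd := dim_ge hN
  have hi := poleFun_integrable hN hα hα1 hθ
  obtain ⟨C, hC, hfl⟩ := flat_ballGrowth (E := E)
  have hg : BallGrowth (flat θ) (dim E - 1) C := hfl θ hθ
  have hne : ∀ᵐ y ∂flat θ, y ≠ 0 := by
    rw [ae_iff]; simpa using hg.singleton (by linarith) 0
  have hnb : (ae (flat θ)).NeBot := ae_neBot.2 (flat_ne_zero hN hθ)
  have e0 : ∀ y : E, ‖y‖ ^ (α + 2 - dim E) = (‖y‖ ^ 2) ^ ((α + 2 - dim E) / 2) := fun y => by
    rw [← rpow_two, ← rpow_mul (norm_nonneg _)]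
    congr 1; ring
  intro h0
  rcases lt_or_gt_of_ne ha with hlt | hgt
  · have hpos : ∀ᵐ y ∂flat θ, 0 < poleFun α y := by
      filter_upwards [hne] with y hy
      have hp : 0 < ‖y‖ := norm_pos_iff.2 hy
      rw [poleFun, e0, sub_pos]
      exact rpow_lt_rpow_of_neg (by positivity) (by linarith) (by linarith)
    have := (integral_eq_zero_iff_of_nonneg_ae (hpos.mono fun y hy => hy.le) hi).1 h0
    obtain ⟨y, hy1, hy2⟩ := (hpos.and this).exists
    rw [hy2] at hy1
    exact lt_irrefl _ hy1
  · have hpos : ∀ y : E, 0 < -poleFun α y := by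
      intro y
      rw [poleFun, e0, neg_sub, sub_pos]
      exact rpow_lt_rpow (by positivity) (by linarith) (by linarith)
    have h1 : ∫ y, -poleFun α y ∂flat θ = 0 := by rw [integral_neg, h0, neg_zero]
    have := (integral_eq_zero_iff_of_nonneg_ae (Eventually.of_forall fun y => (hpos y).le) hi.neg).1 h1
    obtain ⟨y, hy⟩ := this.exists
    have h2 := hpos y
    simp only [Pi.zero_apply] at hy
    rw [hy] at h2
    exact lt_irrefl _ h2

/-- The symmetric second difference of `‖·‖ ^ a` has vanishing integral over the hyperplane. -/
theorem flat_second_difference {θ z : E} (hθ : ‖θ‖ = 1) (hα1 : α < 1) (hz : inner ℝ θ z = 0)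
    (hi : Integrable (fun y => 1 / 2 * ‖y - z‖ ^ (α + 2 - dim E) +
      1 / 2 * ‖y + z‖ ^ (α + 2 - dim E) - ‖y‖ ^ (α + 2 - dim E)) (flat θ)) :
    ∫ y, (1 / 2 * ‖y - z‖ ^ (α + 2 - dim E) +
      1 / 2 * ‖y + z‖ ^ (α + 2 - dim E) - ‖y‖ ^ (α + 2 - dim E)) ∂flat θ = 0 := by
  set a := α + 2 - dim E with ha
  set g : E → ℝ := fun y => 1 / 2 * ‖y - z‖ ^ a + 1 / 2 * ‖y + z‖ ^ a - ‖y‖ ^ a with hgd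
  set g2 : E → ℝ := fun y => g (y + -z) + g (y + z) + 2 * g y with hg2
  have hp := flat_measurePreserving_add hz
  have hp' := flat_measurePreserving_add (θ := θ) (v := -z) (by rw [inner_neg_right, hz, neg_zero])
  have he : ∀ v : E, MeasurableEmbedding fun y : E => y + v := fun v =>
    (Homeomorph.addRight v).measurableEmbedding
  have i1 : Integrable (fun y => g (y + z)) (flat θ) := (hp.integrable_comp_emb (he z)).2 hi
  have i2 : Integrable (fun y => g (y + -z)) (flat θ) := (hp'.integrable_comp_emb (he (-z))).2 hi
  have h4 : ∫ y, g2 y ∂flat θ = 4 * ∫ y, g y ∂flat θ := by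
    have e1 : ∫ y, g2 y ∂flat θ = ∫ y, (g (y + -z) + g (y + z)) ∂flat θ + ∫ y, 2 * g y ∂flat θ :=
      integral_add (i2.add i1) (hi.const_mul 2)
    rw [e1, integral_add i2 i1, integral_const_mul,
      hp.integral_comp (he z), hp'.integral_comp (he (-z))]
    ring
  have hs : ∀ y, g2 ((2 : ℝ) • y) = 2 ^ a * g y := by
    intro y
    have n1 : ∀ x : E, ‖(2 : ℝ) • x‖ ^ a = 2 ^ a * ‖x‖ ^ a := fun x => by
      rw [norm_smul, norm_of_nonneg zero_le_two, mul_rpow zero_le_two (norm_nonneg _)]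
    simp only [hg2, hgd]
    rw [show (2 : ℝ) • y + -z - z = (2 : ℝ) • (y - z) by module,
      show (2 : ℝ) • y + -z + z = (2 : ℝ) • y by module,
      show (2 : ℝ) • y + z - z = (2 : ℝ) • y by module,
      show (2 : ℝ) • y + z + z = (2 : ℝ) • (y + z) by module,
      show (2 : ℝ) • y + -z = (2 : ℝ) • y - z by module, n1, n1, n1]
    ring
  have h5 := flat_integral_smul hθ two_pos g2
  simp only [hs] at h5
  rw [integral_const_mul, h4] at h5
  have h6 : ((2 : ℝ) ^ (finrank ℝ E) * 2 ^ a - 8) * ∫ y, g y ∂flat θ = 0 := by linarith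
  rcases mul_eq_zero.1 h6 with h | h
  · exfalso
    rw [← rpow_natCast, ← rpow_add two_pos] at h
    have h7 : (2 : ℝ) ^ ((finrank ℝ E : ℝ) + a) < 2 ^ (3 : ℝ) :=
      rpow_lt_rpow_of_exponent_lt one_lt_two (by rw [ha, dim]; linarith)
    rw [show (2 : ℝ) ^ (3 : ℝ) = 8 by norm_num] at h7
    linarith
  · exact h

/-- The second difference of the Riesz kernel, integrated against the hypersingular kernel, is a
multiple of the Riesz kernel. -/
theorem kernel_second_integral (hN : 2 ≤ finrank ℝ E) (hα : 0 < α) (hα1 : α < 1) {θ η : E}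
    (hθ : ‖θ‖ = 1) (hη : ‖η‖ = 1) (hne : η ≠ θ)
    (hi : Integrable (fun σ => (‖η - σ‖ ^ (α + 2 - dim E) + ‖η - axisRefl θ σ‖ ^ (α + 2 - dim E) -
        2 * ‖η - θ‖ ^ (α + 2 - dim E)) * ‖σ - θ‖ ^ (-(dim E + α))) (surf E)) :
    ∫ σ, (‖η - σ‖ ^ (α + 2 - dim E) + ‖η - axisRefl θ σ‖ ^ (α + 2 - dim E) -
        2 * ‖η - θ‖ ^ (α + 2 - dim E)) * ‖σ - θ‖ ^ (-(dim E + α)) ∂surf E =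
      2 * (∫ y, poleFun α y ∂flat θ) * ‖η - θ‖ ^ (α + 2 - dim E) := by
  obtain ⟨z, hz, rfl⟩ := stereo_surjective hθ hη hne
  have hmeas : Measurable (fun σ => (‖stereo θ z - σ‖ ^ (α + 2 - dim E) +
      ‖stereo θ z - axisRefl θ σ‖ ^ (α + 2 - dim E) -
        2 * ‖stereo θ z - θ‖ ^ (α + 2 - dim E)) * ‖σ - θ‖ ^ (-(dim E + α))) := by
    unfold axisRefl; fun_prop
  obtain ⟨k1, k2⟩ := integral_surf_stereo hN hθ hmeas
  rw [k1] at hi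
  rw [k2]
  clear k1 k2
  set a := α + 2 - dim E with ha
  set Z := ‖stereo θ z - θ‖ ^ a with hZ
  have hqp : ∀ y : E, 0 < ‖y‖ ^ 2 + 1 / 4 := fun y => by positivity
  have hZe : Z = (‖z‖ ^ 2 + 1 / 4) ^ (-(a / 2)) := by
    rw [hZ, norm_stereo_sub_pole hθ hz, ← rpow_mul (hqp z).le]; congr 1; ring
  have hZ0 : Z ≠ 0 := by rw [hZe]; exact (rpow_pos_of_pos (hqp z) _).ne'
  set g : E → ℝ := fun y => 1 / 2 * ‖y - z‖ ^ a + 1 / 2 * ‖y + z‖ ^ a - ‖y‖ ^ a with hgd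
  have hae : (fun y => (‖y‖ ^ 2 + 1 / 4) ^ (1 - dim E) * ((‖stereo θ z - stereo θ y‖ ^ a +
      ‖stereo θ z - axisRefl θ (stereo θ y)‖ ^ a - 2 * Z) * ‖stereo θ y - θ‖ ^ (-(dim E + α))))
      =ᵐ[flat θ] fun y => 2 * Z * (g y + poleFun α y) := by
    filter_upwards [ae_flat_inner hθ] with y hy
    rw [show axisRefl θ (stereo θ y) = stereo θ (-y) from (stereo_neg hθ hy).symm,
      norm_stereo_sub_stereo hθ hz hy, norm_stereo_sub_stereo hθ hz
      (by rw [inner_neg_right, hy, neg_zero]), norm_stereo_sub_pole hθ hy, norm_neg, sub_neg_eq_add,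
      norm_sub_rev z y, add_comm z y]
    have e1 : ∀ t : ℝ, 0 ≤ t → (t * (‖z‖ ^ 2 + 1 / 4) ^ (-(1 / 2) : ℝ) *
        (‖y‖ ^ 2 + 1 / 4) ^ (-(1 / 2) : ℝ)) ^ a = t ^ a * Z * (‖y‖ ^ 2 + 1 / 4) ^ (-(a / 2)) := by
      intro t ht
      rw [mul_rpow (by positivity) (by positivity), mul_rpow ht (by positivity),
        ← rpow_mul (hqp z).le, ← rpow_mul (hqp y).le, hZe]
      congr 2 <;> [congr 2; skip] <;> ring
    rw [e1 _ (norm_nonneg _), e1 _ (norm_nonneg _), ← rpow_mul (hqp y).le]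
    have e2 : (‖y‖ ^ 2 + 1 / 4) ^ (1 - dim E) * (‖y‖ ^ 2 + 1 / 4) ^ (-(1 / 2) * -(dim E + α)) =
        (‖y‖ ^ 2 + 1 / 4) ^ (a / 2) := by
      rw [← rpow_add (hqp y)]; congr 1; rw [ha]; ring
    have e3 : (‖y‖ ^ 2 + 1 / 4) ^ (a / 2) * (‖y‖ ^ 2 + 1 / 4) ^ (-(a / 2)) = 1 := by
      rw [← rpow_add (hqp y), add_neg_cancel, rpow_zero]
    simp only [hgd, poleFun, ← ha]
    set P := (‖y‖ ^ 2 + 1 / 4) ^ (a / 2)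
    set Q := (‖y‖ ^ 2 + 1 / 4) ^ (-(a / 2))
    set W := (‖y‖ ^ 2 + 1 / 4) ^ (1 - dim E)
    set V := (‖y‖ ^ 2 + 1 / 4) ^ (-(1 / 2) * -(dim E + α))
    calc W * ((‖y - z‖ ^ a * Z * Q + ‖y + z‖ ^ a * Z * Q - 2 * Z) * V)
        = W * V * Q * (‖y - z‖ ^ a + ‖y + z‖ ^ a) * Z - 2 * Z * (W * V) := by ring
      _ = _ := by rw [e2, e3]; ring
  have hi2 := hi.congr hae
  have hi3 : Integrable (fun y => g y + poleFun α y) (flat θ) := by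
    refine (hi2.const_mul (2 * Z)⁻¹).congr (Eventually.of_forall fun y => ?_)
    simp only
    rw [← mul_assoc, inv_mul_cancel₀ (mul_ne_zero two_ne_zero hZ0), one_mul]
  have hpi := poleFun_integrable hN hα hα1 hθ
  have hi4 : Integrable g (flat θ) := by
    refine (hi3.sub hpi).congr (Eventually.of_forall fun y => ?_)
    simp
  rw [integral_congr_ae hae, integral_const_mul, integral_add hi4 hpi,
    flat_second_difference hθ hα1 hz hi4]
  ring

/-- The hypersingular operator of order `1 + α` on the sphere, in symmetrized form. -/
noncomputable def hyper (α : ℝ) (u : E → ℝ) (θ : E) : ℝ :=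
  ∫ σ, 1 / 2 * (u σ + u (axisRefl θ σ) - 2 * u θ) * ‖σ - θ‖ ^ (-(dim E + α)) ∂surf E

theorem aesm_comp_axisRefl (hθ : ‖θ‖ = 1) {u : E → ℝ}
    (hu : AEStronglyMeasurable u (surf E)) :
    AEStronglyMeasurable (fun σ => u (axisRefl θ σ)) (surf E) := by
  obtain ⟨R, hR⟩ := axisRefl_isometry hθ
  simp only [← hR]
  exact hu.comp_measurePreserving (surf_measurePreserving R)

theorem hyper_integrable (hN : 2 ≤ finrank ℝ E) (hα1 : α < 1) {u : E → ℝ} {η : ℝ}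
    (hu : XB α η u) (hθ : ‖θ‖ = 1) :
    Integrable (fun σ => 1 / 2 * (u σ + u (axisRefl θ σ) - 2 * u θ) * ‖σ - θ‖ ^ (-(dim E + α)))
      (surf E) := by
  have hm := aestronglyMeasurable_surf hu.continuousOn
  obtain ⟨A, -, hA⟩ := surf_rpow_integrable hN
    (e := (3 + α) / 2 - (dim E + α)) (by linarith)
  refine ((hA θ hθ).1.const_mul (1 / 2 * η)).mono' ?_ ?_
  · exact (((hm.add (aesm_comp_axisRefl hθ hm)).sub aestronglyMeasurable_const).const_mul _).mul
      (measurable_norm_sub_rpow _ θ).aestronglyMeasurable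
  · filter_upwards [ae_surf_norm, ae_surf_ne hN θ] with σ hσ hne
    have hd : 0 < ‖σ - θ‖ := norm_pos_iff.2 (sub_ne_zero.2 hne)
    rw [norm_eq_abs, abs_mul, abs_mul, abs_of_pos (rpow_pos_of_pos hd _),
      abs_of_pos (show (0 : ℝ) < 1 / 2 by norm_num), sub_eq_add_neg ((3 + α) / 2),
      rpow_add hd]
    have := hu.second σ θ hσ hθ
    calc _ ≤ 1 / 2 * (η * ‖σ - θ‖ ^ ((3 + α) / 2)) * ‖σ - θ‖ ^ (-(dim E + α)) := by gcongr
      _ = _ := by ring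

theorem hyper_riesz (hN : 2 ≤ finrank ℝ E) (hα : 0 < α) (hα1 : α < 1) {f : E → ℝ} {C : ℝ}
    (hf : HB α C f) (hθ : ‖θ‖ = 1) :
    hyper α (riesz α f) θ =
      (∫ y, poleFun α y ∂flat θ) * (riesz α f θ - f θ * riesz α (fun _ => 1) θ) := by
  obtain ⟨K, hK, h2⟩ := riesz_second hN hα hα1
  have hd := dim_ge hN
  have hfm := aestronglyMeasurable_surf (hf.continuousOn hα1)
  have hC := hf.nonneg hθ
  set a := α + 2 - dim E with ha
  set D : E → E → ℝ := fun σ η => ‖η - σ‖ ^ a + ‖η - axisRefl θ σ‖ ^ a - 2 * ‖η - θ‖ ^ a with hD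
  have hDm : Measurable (uncurry D) := by
    simp only [hD, axisRefl]
    unfold uncurry
    fun_prop
  set F : E → E → ℝ := fun σ η => D σ η * (f η - f θ) * ‖σ - θ‖ ^ (-(dim E + α)) with hF
  have hFm : AEStronglyMeasurable (uncurry F) ((surf E).prod (surf E)) := by
    refine (hDm.aestronglyMeasurable.mul ((hfm.comp_snd (μ := surf E)).sub
      aestronglyMeasurable_const)).mul ?_
    exact (Measurable.aestronglyMeasurable (by fun_prop))
  have hsum : ∀ σ, ‖σ‖ = 1 → riesz α f σ + riesz α f (axisRefl θ σ) - 2 * riesz α f θ =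
      ∫ η, D σ η * (f η - f θ) ∂surf E := by
    intro σ hσ
    have := sum_riesz hN hα hfm hf.bound ![σ, axisRefl θ σ, θ]
      (by intro i; fin_cases i <;> simp [hσ, hθ, norm_axisRefl hθ]) ![1, 1, -2]
      (by simp [Fin.sum_univ_three]; norm_num) (f θ)
    simp only [Fin.sum_univ_three, Matrix.cons_val_zero, Matrix.cons_val_one,
      Matrix.cons_val, ← ha] at this
    calc _ = 1 * riesz α f σ + 1 * riesz α f (axisRefl θ σ) + -2 * riesz α f θ := by ring
      _ = _ := this
      _ = _ := by
        refine integral_congr_ae (Eventually.of_forall fun η => ?_)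
        simp only [hD]; ring
  have hFi : Integrable (uncurry F) ((surf E).prod (surf E)) := by
    rw [integrable_prod_iff hFm]
    obtain ⟨A, -, hA⟩ := surf_rpow_integrable hN
      (e := (3 + α) / 2 - (dim E + α)) (by linarith)
    constructor
    · filter_upwards [ae_surf_norm] with σ hσ
      exact (h2 f C hf σ θ hσ hθ).1.mul_const (‖σ - θ‖ ^ (-(dim E + α)))
    · refine ((hA θ hθ).1.const_mul (K * C)).mono' hFm.norm.integral_prod_right' ?_
      filter_upwards [ae_surf_norm, ae_surf_ne hN θ] with σ hσ hne
      have hdp : 0 < ‖σ - θ‖ := norm_pos_iff.2 (sub_ne_zero.2 hne)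
      rw [norm_of_nonneg (integral_nonneg fun η => norm_nonneg _)]
      have hP := rpow_pos_of_pos hdp (-(dim E + α))
      have habs : ∀ η, ‖F σ η‖ = |D σ η * (f η - f θ)| * ‖σ - θ‖ ^ (-(dim E + α)) := fun η => by
        simp only [hF]
        rw [norm_eq_abs, abs_mul, abs_of_pos hP]
      simp only [Function.uncurry_apply_pair, habs]
      rw [integral_mul_const, sub_eq_add_neg ((3 + α) / 2), rpow_add hdp, ← mul_assoc (K * C)]
      gcongr
      exact (h2 f C hf σ θ hσ hθ).2
  have e1 : hyper α (riesz α f) θ = ∫ σ, 1 / 2 * ∫ η, F σ η ∂surf E ∂surf E := by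
    refine integral_congr_ae ?_
    filter_upwards [ae_surf_norm] with σ hσ
    simp only [hF]
    rw [hsum σ hσ, integral_mul_const]
    ring
  rw [e1, integral_const_mul, integral_integral_swap hFi]
  set J := ∫ y, poleFun α y ∂flat θ with hJ
  have e2 : ∀ᵐ η ∂surf E, ∫ σ, F σ η ∂surf E =
      (2 * J) * (‖η - θ‖ ^ a * f η - f θ * (‖η - θ‖ ^ a * 1)) := by
    filter_upwards [hFi.prod_left_ae, ae_surf_norm, ae_surf_ne hN θ] with η hη hη1 hne
    have e3 : ∀ σ, F σ η = (f η - f θ) * (D σ η * ‖σ - θ‖ ^ (-(dim E + α))) := fun σ => by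
      simp only [hF]; ring
    simp only [Function.uncurry_apply_pair, e3] at hη
    simp only [e3]
    rcases eq_or_ne (f η - f θ) 0 with h0 | h0
    · simp only [h0, zero_mul, integral_zero]
      have : f η = f θ := sub_eq_zero.1 h0
      rw [this]; ring
    · have hi : Integrable (fun σ => D σ η * ‖σ - θ‖ ^ (-(dim E + α))) (surf E) := by
        refine (hη.const_mul (f η - f θ)⁻¹).congr (Eventually.of_forall fun σ => ?_)
        simp only
        rw [← mul_assoc, inv_mul_cancel₀ h0, one_mul]
      rw [integral_const_mul, kernel_second_integral hN hα hα1 hθ hη1 hne hi]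
      ring
  have i1 := riesz_integrable hN hα hfm hf.bound hθ
  have i2 := riesz_integrable hN hα (f := fun _ => 1) (B := 1)
    aestronglyMeasurable_const (by simp) hθ
  rw [integral_congr_ae e2, integral_const_mul, integral_sub i1 (i2.const_mul _), integral_const_mul]
  simp only [riesz, ← ha]
  ring

/-- The first eigenvalue of the hypersingular operator. -/
noncomputable def lamInt (α : ℝ) (θ : E) : ℝ := ∫ σ, 1 / 2 * ‖σ - θ‖ ^ (2 - (dim E + α)) ∂surf E

theorem lamInt_eq {θ θ' : E} (hθ : ‖θ‖ = 1) (hθ' : ‖θ'‖ = 1) : lamInt α θ = lamInt α θ' := by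
  obtain ⟨R, hR⟩ := exists_isometry_map (hθ'.trans hθ.symm)
  rw [lamInt, lamInt, ← surf_integral_comp R, ← hR]
  simp only [← map_sub, R.norm_map]

theorem hyper_inner (hN : 2 ≤ finrank ℝ E) (hθ : ‖θ‖ = 1) (c : ℝ) (e : E) :
    hyper α (fun x => c * inner ℝ x e) θ = -(lamInt α θ * (c * inner ℝ θ e)) := by
  have : hyper α (fun x => c * inner ℝ x e) θ =
      ∫ σ, -(c * inner ℝ θ e) * (1 / 2 * ‖σ - θ‖ ^ (2 - (dim E + α))) ∂surf E := by
    refine integral_congr_ae ?_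
    filter_upwards [ae_surf_norm, ae_surf_ne hN θ] with σ hσ hne
    have hd : 0 < ‖σ - θ‖ := norm_pos_iff.2 (sub_ne_zero.2 hne)
    have h1 := congrArg (fun x => (inner ℝ x e : ℝ)) (add_axisRefl hθ hσ)
    simp only [inner_add_left, inner_sub_left, inner_smul_left] at h1
    simp only [conj_trivial] at h1
    rw [sub_eq_add_neg 2 (dim E + α), rpow_add hd, rpow_two]
    have h2 : inner ℝ σ e + inner ℝ (axisRefl θ σ) e - 2 * inner ℝ θ e =
      -(‖σ - θ‖ ^ 2 * inner ℝ θ e) := by rw [h1]; ring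
    calc _ = 1 / 2 * (c * (inner ℝ σ e + inner ℝ (axisRefl θ σ) e - 2 * inner ℝ θ e)) *
          ‖σ - θ‖ ^ (-(dim E + α)) := by ring
      _ = _ := by rw [h2]; ring
  rw [this, integral_const_mul, lamInt]
  ring

theorem hyper_congr {u v : E → ℝ} (h : ∀ x, ‖x‖ = 1 → u x = v x) (hθ : ‖θ‖ = 1) :
    hyper α u θ = hyper α v θ := by
  refine integral_congr_ae ?_
  filter_upwards [ae_surf_norm] with σ hσ
  rw [h σ hσ, h θ hθ, h _ ((norm_axisRefl hθ).trans hσ)]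

theorem HB_inner (hα : 0 < α) (hα1 : α < 1) {e : E} (he : ‖e‖ = 1) :
    HB α 2 (fun x : E => inner ℝ x e) := by
  refine ⟨fun x hx => (abs_inner_le_one hx he).trans one_le_two, fun x y hx hy => ?_⟩
  rw [← inner_sub_left]
  have h1 : |inner ℝ (x - y) e| ≤ ‖x - y‖ := by simpa [he] using abs_real_inner_le_norm (x - y) e
  have h2 : ‖x - y‖ ≤ 2 := (norm_sub_le _ _).trans (by rw [hx, hy]; norm_num)
  refine h1.trans ?_
  rcases eq_or_ne ‖x - y‖ 0 with h0 | h0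
  · rw [h0]; positivity
  have h0' : 0 < ‖x - y‖ := lt_of_le_of_ne (norm_nonneg _) h0.symm
  calc ‖x - y‖ = ‖x - y‖ ^ ((1 + α) / 2) * ‖x - y‖ ^ ((1 - α) / 2) := by
        rw [← rpow_add h0', show (1 + α) / 2 + (1 - α) / 2 = 1 by ring, rpow_one]
    _ ≤ 2 ^ ((1 + α) / 2) * ‖x - y‖ ^ ((1 - α) / 2) := by gcongr
    _ ≤ 2 ^ (1 : ℝ) * ‖x - y‖ ^ ((1 - α) / 2) := by
        gcongr
        · norm_num
        · linarith
    _ = _ := by rw [rpow_one]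

/-- The hypersingular operator shifted by its first eigenvalue factors through the Riesz
operator. -/
theorem exists_linearization (hN : 2 ≤ finrank ℝ E) (hα : 0 < α) (hα1 : α < 1)
    (ha : α + 2 - dim E ≠ 0) :
    ∃ c J lam : ℝ, c ≠ 0 ∧ J ≠ 0 ∧ (∀ θ : E, ‖θ‖ = 1 → lamInt α θ = lam) ∧
      (∀ θ e : E, ‖θ‖ = 1 → riesz α (fun η => inner ℝ η e) θ = c * inner ℝ θ e) ∧
      ∀ (f : E → ℝ) (C : ℝ), HB α C f → ∀ θ, ‖θ‖ = 1 →
        hyper α (riesz α f) θ + lam * riesz α f θ = J * (riesz α f θ - c * f θ) := by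
  obtain ⟨θ₀, hθ₀⟩ := exists_unit hN
  obtain ⟨c, hc⟩ := riesz_inner hN hα
  set m := riesz α (fun _ => 1) θ₀ with hm
  set lam := lamInt α θ₀ with hlam
  obtain ⟨hm0, hmc⟩ := riesz_inner_lt_one hN hα hθ₀
  rw [hc θ₀ θ₀ hθ₀, real_inner_self_eq_norm_sq, hθ₀, one_pow, mul_one, ← hm] at hmc
  rw [← hm] at hm0
  have key : ∀ θ : E, ‖θ‖ = 1 → (∫ y, poleFun α y ∂flat θ) * (m - c) = lam * c := by
    intro θ hθ
    have h1 := hyper_riesz hN hα hα1 (HB_inner hα hα1 hθ) hθ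
    rw [hyper_congr (fun x hx => hc x θ hx) hθ, hyper_inner hN hθ, hc θ θ hθ,
      real_inner_self_eq_norm_sq, hθ, riesz_one_const hθ hθ₀, ← hm, lamInt_eq hθ hθ₀, ← hlam] at h1
    linarith
  have hmc0 : m - c ≠ 0 := by linarith
  have h0 := key θ₀ hθ₀
  have hJ0 := poleFun_integral_ne_zero hN hα hα1 ha hθ₀
  have hne : lam * c ≠ 0 := by rw [← h0]; exact mul_ne_zero hJ0 hmc0
  have hc0 : c ≠ 0 := right_ne_zero_of_mul hne
  have hl0 : lam ≠ 0 := left_ne_zero_of_mul hne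
  refine ⟨c, lam * m / (m - c), lam, hc0, div_ne_zero (mul_ne_zero hl0 hm0.ne') hmc0,
    fun θ hθ => lamInt_eq hθ hθ₀, hc, fun f C hf θ hθ => ?_⟩
  have h1 : ∫ y, poleFun α y ∂flat θ = lam * c / (m - c) := by
    rw [eq_div_iff hmc0, key θ hθ]
  rw [hyper_riesz hN hα hα1 hf hθ, h1, riesz_one_const hθ hθ₀, ← hm]
  field_simp
  ring

theorem lintegral_surf_pole (hN : 2 ≤ finrank ℝ E) (hθ : ‖θ‖ = 1) :
    ∫⁻ σ, ofReal (‖σ - θ‖ ^ (2 - (dim E + α))) ∂surf E =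
      ∫⁻ y, ofReal ((‖y‖ ^ 2 + 1 / 4) ^ ((α - dim E) / 2)) ∂flat θ := by
  rw [lintegral_surf_stereo hN hθ (by fun_prop)]
  refine lintegral_congr_ae ?_
  filter_upwards [ae_flat_inner hθ] with y hy
  have hp : 0 < ‖y‖ ^ 2 + 1 / 4 := by positivity
  rw [← ofReal_mul (by positivity), norm_stereo_sub_pole hθ hy, ← rpow_mul hp.le]
  congr 1
  have h1 : (‖y‖ ^ 2 + 1 / 4)⁻¹ ^ finrank ℝ E * (‖y‖ ^ 2 + 1 / 4) =
      (‖y‖ ^ 2 + 1 / 4) ^ (1 - dim E) := by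
    rw [rpow_sub hp, rpow_one, rpow_natCast, inv_pow, mul_comm]
    rfl
  rw [h1, ← rpow_add hp]
  congr 1
  ring

theorem lintegral_strip_rpow (hα : 0 < α) :
    ∫⁻ t : ℝ, {t : ℝ | |t| < 1 / 2}.indicator (fun t => ofReal ((2 * |t|) ^ (α - 1))) t =
      ofReal (1 / α) := by
  set g : ℝ → ℝ := (Iio (1 / 2)).indicator fun t => (2 * t) ^ (α - 1) with hg
  have hii : IntervalIntegrable (fun t : ℝ => 2 ^ (α - 1) * t ^ (α - 1)) volume 0 (1 / 2) :=
    (intervalIntegral.intervalIntegrable_rpow' (by linarith)).const_mul _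
  have hon : IntegrableOn (fun t : ℝ => 2 ^ (α - 1) * t ^ (α - 1)) (Ioo 0 (1 / 2)) :=
    ((intervalIntegrable_iff_integrableOn_Ioc_of_le (by norm_num)).1 hii).mono_set
      Ioo_subset_Ioc_self
  have heq : EqOn (fun t : ℝ => (2 * t) ^ (α - 1)) (fun t : ℝ => 2 ^ (α - 1) * t ^ (α - 1))
      (Ioo 0 (1 / 2)) := fun t ht => mul_rpow two_pos.le ht.1.le
  have hs : Ioi (0 : ℝ) ∩ Iio (1 / 2) = Ioo 0 (1 / 2) := by ext; simp
  have hgi : IntegrableOn g (Ioi 0) := by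
    rw [hg, IntegrableOn, integrable_indicator_iff measurableSet_Iio, IntegrableOn,
      Measure.restrict_restrict measurableSet_Iio, inter_comm, hs]
    exact hon.congr_fun heq.symm measurableSet_Ioo
  have hgint : ∫ t in Ioi 0, g t = 1 / (2 * α) := by
    rw [hg, setIntegral_indicator measurableSet_Iio, hs, setIntegral_congr_fun measurableSet_Ioo heq,
      ← integral_Ioc_eq_integral_Ioo, ← intervalIntegral.integral_of_le (by norm_num),
      intervalIntegral.integral_const_mul, integral_rpow (Or.inl (by linarith)),
      sub_add_cancel, zero_rpow hα.ne', sub_zero, one_div, inv_rpow two_pos.le,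
      rpow_sub two_pos, rpow_one]
    have : (2 : ℝ) ^ α ≠ 0 := (rpow_pos_of_pos two_pos _).ne'
    field_simp
  have hgabs : ∀ t, {t : ℝ | |t| < 1 / 2}.indicator
      (fun t => ofReal ((2 * |t|) ^ (α - 1))) t = ofReal (g |t|) := by
    intro t
    simp only [hg, indicator_apply, mem_ofPred_eq, mem_Iio]
    split_ifs <;> simp
  have hi : Integrable fun t => g |t| := by
    by_contra h
    have h1 := (integral_undef h).symm.trans integral_comp_abs
    rw [hgint] at h1
    have : 0 < 2 * (1 / (2 * α)) := by positivity
    linarith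
  simp only [hgabs]
  rw [← ofReal_integral_eq_lintegral_ofReal hi, integral_comp_abs, hgint]
  · congr 1; field_simp
  · refine Eventually.of_forall fun t => ?_
    simp only [hg, indicator_apply]
    split_ifs
    · exact rpow_nonneg (by positivity) _
    · exact le_rfl

theorem lintegral_slab (hN : 2 ≤ finrank ℝ E) (hα : 0 < α) (hθ : ‖θ‖ = 1) :
    ∫⁻ x, {x : E | |inner ℝ θ x| < 1 / 2}.indicator
      (fun x => ofReal (‖x‖ ^ (α - dim E))) x =
      ofReal (1 / α) *
        ∫⁻ σ, ofReal (‖σ - θ‖ ^ (2 - (dim E + α))) ∂surf E := by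
  set L := ∫⁻ y, ofReal ((‖y‖ ^ 2 + 1 / 4) ^ ((α - dim E) / 2)) ∂flat θ with hL
  have hm : MeasurableSet {x : E | |inner ℝ θ x| < 1 / 2} :=
    measurableSet_lt (by fun_prop) (by fun_prop)
  have hmt : MeasurableSet {t : ℝ | |t| < 1 / 2} := measurableSet_lt (by fun_prop) (by fun_prop)
  rw [lintegral_surf_pole hN hθ, ← hL,
    ← lintegral_flat_prod hθ (Measurable.indicator (by fun_prop) hm)]
  have h1 : ∀ᵐ y ∂flat θ, ∫⁻ t : ℝ, {x : E | |inner ℝ θ x| < 1 / 2}.indicator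
      (fun x => ofReal (‖x‖ ^ (α - dim E))) (y + t • θ) =
      ∫⁻ t : ℝ, {t : ℝ | |t| < 1 / 2}.indicator (fun _ => 1) t *
        ofReal ((‖y‖ ^ 2 + t ^ 2) ^ ((α - dim E) / 2)) := by
    filter_upwards [ae_flat_inner hθ] with y hy
    refine lintegral_congr fun t => ?_
    have e1 : inner ℝ θ (y + t • θ) = t := by
      rw [inner_add_right, hy, inner_smul_right, real_inner_self_eq_norm_sq, hθ]; ring
    have e2 : ‖y + t • θ‖ ^ 2 = ‖y‖ ^ 2 + t ^ 2 := by
      rw [norm_add_sq_real, inner_smul_right, real_inner_comm, hy, norm_smul, hθ, mul_one,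
        norm_eq_abs, sq_abs]
      ring
    have e3 : ‖y + t • θ‖ ^ (α - dim E) = (‖y‖ ^ 2 + t ^ 2) ^ ((α - dim E) / 2) := by
      rw [← e2, ← rpow_natCast, ← rpow_mul (norm_nonneg _)]
      congr 1
      push_cast
      ring
    simp only [indicator_apply, mem_ofPred_eq, e1, e3]
    split_ifs <;> simp
  have h2 : ∀ t : ℝ, t ≠ 0 → ∫⁻ y, ofReal ((‖y‖ ^ 2 + t ^ 2) ^ ((α - dim E) / 2)) ∂flat θ =
      ofReal ((2 * |t|) ^ (α - 1)) * L := by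
    intro t ht
    have hc : 0 < 2 * |t| := by positivity
    set c := 2 * |t| with hcd
    have h3 := lintegral_flat_smul hθ hc
      (F := fun y => ofReal ((‖y‖ ^ 2 + t ^ 2) ^ ((α - dim E) / 2))) (by fun_prop)
    have h4 : ∀ y : E, ofReal ((‖c • y‖ ^ 2 + t ^ 2) ^ ((α - dim E) / 2)) =
        ofReal (c ^ (α - dim E)) *
          ofReal ((‖y‖ ^ 2 + 1 / 4) ^ ((α - dim E) / 2)) := by
      intro y
      rw [← ofReal_mul (by positivity)]
      congr 1
      have : ‖c • y‖ ^ 2 + t ^ 2 = c ^ 2 * (‖y‖ ^ 2 + 1 / 4) := by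
        rw [norm_smul, norm_of_nonneg hc.le, hcd, ← sq_abs t]; ring
      rw [this, mul_rpow (by positivity) (by positivity), ← rpow_natCast c 2,
        ← rpow_mul hc.le]
      congr 2
      push_cast
      ring
    simp only [h4] at h3
    rw [lintegral_const_mul _ (by fun_prop), ← mul_assoc, ← ofReal_mul (by positivity),
      ← rpow_natCast, ← rpow_add hc] at h3
    have h5 : (finrank ℝ E : ℝ) + (α - dim E) = 1 + (α - 1) := by unfold dim; ring
    rw [h5, rpow_add hc, rpow_one, ofReal_mul hc.le, mul_assoc] at h3
    exact ((ENNReal.mul_right_inj (by simpa using hc) ofReal_ne_top).1 h3).symm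
  rw [lintegral_congr_ae h1, lintegral_lintegral_swap, ← lintegral_strip_rpow hα,
    ← lintegral_mul_const _ (Measurable.indicator (by fun_prop) hmt)]
  · refine lintegral_congr_ae ?_
    filter_upwards [compl_mem_ae_iff.2 (measure_singleton (0 : ℝ))] with t ht
    rw [lintegral_const_mul _ (by fun_prop), h2 t ht, ← mul_assoc]
    congr 1
    simp only [indicator_apply]
    split_ifs <;> simp
  · refine Measurable.aemeasurable ?_
    unfold uncurry
    exact ((Measurable.indicator measurable_const hmt).comp measurable_snd).mul (by fun_prop)

/-- The mass of the kernel outside the two unit balls tangent at the origin. -/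
theorem lintegral_outside (hN : 2 ≤ finrank ℝ E) (hα : 0 < α) (hθ : ‖θ‖ = 1) :
    ∫⁻ x, {x : E | 2 * |inner ℝ θ x| < ‖x‖ ^ 2}.indicator
      (fun x => ofReal (‖x‖ ^ (-(dim E + α)))) x =
      ofReal (1 / α) *
        ∫⁻ σ, ofReal (‖σ - θ‖ ^ (2 - (dim E + α))) ∂surf E := by
  have := nontrivial_of_two_le hN
  have hm : MeasurableSet {x : E | |inner ℝ θ x| < 1 / 2} :=
    measurableSet_lt (by fun_prop) (by fun_prop)
  have hm' : MeasurableSet {x : E | 2 * |inner ℝ θ x| < ‖x‖ ^ 2} :=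
    measurableSet_lt (by fun_prop) (by fun_prop)
  have hF : Measurable ({x : E | |inner ℝ θ x| < 1 / 2}.indicator
      (fun x => ofReal (‖x‖ ^ (α - dim E)))) := Measurable.indicator (by fun_prop) hm
  have hG : Measurable ({x : E | 2 * |inner ℝ θ x| < ‖x‖ ^ 2}.indicator
      (fun x => ofReal (‖x‖ ^ (-(dim E + α))))) := Measurable.indicator (by fun_prop) hm'
  rw [← lintegral_slab hN hα hθ, lintegral_polar_log hF, lintegral_polar_log hG]
  refine lintegral_congr_ae ?_
  filter_upwards [ae_surf_norm] with σ hσ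
  have hexp : Measurable fun τ : ℝ => exp τ • σ := by fun_prop
  have hF1 := hF.comp hexp
  have hG1 := hG.comp hexp
  simp only [comp_def] at hF1 hG1
  rw [lintegral_logRadial hF1, lintegral_logRadial hG1, ← lintegral_neg_eq_self]
  refine lintegral_congr fun τ => ?_
  have e1 : ∀ τ, ‖exp τ • σ‖ = exp τ := fun τ => by
    rw [norm_smul, hσ, mul_one, norm_of_nonneg (exp_pos _).le]
  have e2 : ∀ τ, |inner ℝ θ (exp τ • σ)| = exp τ * |inner ℝ θ σ| := fun τ => by
    rw [inner_smul_right, abs_mul, abs_of_pos (exp_pos _)]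
  have e3 : 2 * (exp (-τ) * |inner ℝ θ σ|) < exp (-τ) ^ 2 ↔
      exp τ * |inner ℝ θ σ| < 1 / 2 := by
    have h1 : exp (-τ) * exp τ = 1 := by rw [← exp_add]; simp
    have h2 := exp_pos (-τ)
    have h3 : exp τ * |inner ℝ θ σ| < 1 / 2 ↔
        (exp (-τ) ^ 2 * 2) * (exp τ * |inner ℝ θ σ|) < (exp (-τ) ^ 2 * 2) * (1 / 2) :=
      (mul_lt_mul_iff_right₀ (by positivity)).symm
    rw [h3]
    have h4 : (exp (-τ) ^ 2 * 2) * (exp τ * |inner ℝ θ σ|) =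
        2 * (exp (-τ) * |inner ℝ θ σ|) * (exp (-τ) * exp τ) := by ring
    rw [h4, h1]
    ring_nf
  simp only [indicator_apply, mem_ofPred_eq, e1, e2, e3]
  split_ifs
  · rw [← ofReal_mul (by positivity), ← ofReal_mul (by positivity),
      ← exp_mul, ← exp_mul, ← exp_add, ← exp_add]
    congr 2
    unfold dim
    ring
  · simp

variable (E) in
theorem volume_ballGrowth : ∃ C, 0 ≤ C ∧ BallGrowth (volume : Measure E) (dim E) C := by
  refine ⟨(volume (closedBall (0 : E) 1)).toReal, toReal_nonneg, fun x r hr => ?_⟩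
  have hfin : volume (closedBall (0 : E) 1) ≠ ⊤ :=
    (isCompact_closedBall _ _).measure_lt_top.ne
  have h := Measure.addHaar_closedBall' (volume : Measure E) x hr.le
  rw [h, mul_comm, ofReal_mul toReal_nonneg, ENNReal.ofReal_toReal hfin]
  refine le_of_eq ?_
  congr 2
  exact (rpow_natCast _ _).symm

/-- The truncated principal value integral defining the nonlocal mean curvature. -/
noncomputable def pv (α : ℝ) (A : Set E) (x : E) (ε : ℝ) : ℝ :=
  ∫ y in {y : E | ε < ‖y - x‖},
    (indicator (closure A)ᶜ (fun _ => (1 : ℝ)) y - indicator A (fun _ => (1 : ℝ)) y) *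
      ‖y - x‖ ^ (-(dim E + α))

theorem integrableOn_kernel_far (hα : 0 < α) (x : E) {ε : ℝ} (hε : 0 < ε) :
    IntegrableOn (fun y => ‖y - x‖ ^ (-(dim E + α))) {y | ε < ‖y - x‖} := by
  obtain ⟨C, hC, h⟩ := volume_ballGrowth E
  obtain ⟨A, -, hA⟩ := h.far hC (e := -(dim E + α)) (by linarith)
  exact (hA x ε hε).1.mono_set fun y (hy : ε < ‖y - x‖) => hy.le

theorem pv_ball (hN : 2 ≤ finrank ℝ E) (hα : 0 < α) (hα1 : α < 1) (hθ : ‖θ‖ = 1) :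
    Tendsto (pv α (ball (0 : E) 1) θ) (𝓝[>] 0)
      (nhds (2 * lamInt α θ / α)) := by
  have := nontrivial_of_two_le hN
  set s := -(dim E + α) with hs
  have hm' : MeasurableSet {x : E | 2 * |inner ℝ θ x| < ‖x‖ ^ 2} :=
    measurableSet_lt (by fun_prop) (by fun_prop)
  set G : E → ℝ := {x : E | 2 * |inner ℝ θ x| < ‖x‖ ^ 2}.indicator fun x => ‖x‖ ^ s with hG
  have hG0 : ∀ x, 0 ≤ G x := fun x => indicator_nonneg (fun x _ => by positivity) x
  have hGm : Measurable G := Measurable.indicator (by fun_prop) hm'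
  obtain ⟨A, -, hA⟩ := surf_rpow_integrable hN (e := 2 - (dim E + α)) (by linarith)
  have hlint : ∫⁻ x, ofReal (G x) = ofReal (2 * lamInt α θ / α) := by
    have h1 : ∀ x, ofReal (G x) = {x : E | 2 * |inner ℝ θ x| < ‖x‖ ^ 2}.indicator
      (fun x => ofReal (‖x‖ ^ (-(dim E + α)))) x := fun x => by
      simp only [hG, indicator_apply]
      split_ifs <;> simp [hs]
    simp only [h1]
    rw [lintegral_outside hN hα hθ, ← ofReal_integral_eq_lintegral_ofReal (hA θ hθ).1
      (Eventually.of_forall fun σ => by positivity), ← ofReal_mul (by positivity), lamInt,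
      integral_const_mul]
    congr 1
    ring
  have hGi : Integrable G := by
    refine ⟨hGm.aestronglyMeasurable, ?_⟩
    rw [hasFiniteIntegral_iff_ofReal (Eventually.of_forall hG0), hlint]
    exact ofReal_lt_top
  have hl0 : 0 ≤ 2 * lamInt α θ / α := by
    have : 0 ≤ lamInt α θ := integral_nonneg fun σ => by positivity
    positivity
  have hGint : ∫ x, G x = 2 * lamInt α θ / α := by
    rw [integral_eq_lintegral_of_nonneg_ae (Eventually.of_forall hG0) hGm.aestronglyMeasurable,
      hlint, toReal_ofReal hl0]
  rw [← hGint]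
  set χ : E → ℝ := fun y => indicator (closure (ball (0 : E) 1))ᶜ (fun _ => (1 : ℝ)) y -
    indicator (ball (0 : E) 1) (fun _ => (1 : ℝ)) y with hχ
  have hχm : Measurable χ := (measurable_const.indicator isClosed_closure.measurableSet.compl).sub
    (measurable_const.indicator measurableSet_ball)
  have hχb : ∀ y, |χ y| ≤ 1 := by
    intro y
    classical
    simp only [hχ, indicator_apply]
    by_cases h : y ∈ ball (0 : E) 1
    · simp [h, subset_closure h]
    · simp only [h, if_false, sub_zero]; split_ifs <;> simp
  have key : ∀ ε : ℝ, 0 < ε → pv α (ball (0 : E) 1) θ ε =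
      ∫ z, {z : E | ε < ‖z‖}.indicator G z := by
    intro ε hε
    have hmε : MeasurableSet {z : E | ε < ‖z‖} := measurableSet_lt (by fun_prop) (by fun_prop)
    have hmε' : MeasurableSet {z : E | ε < ‖z - θ‖} := measurableSet_lt (by fun_prop) (by fun_prop)
    set F : E → ℝ := fun z => {z : E | ε < ‖z‖}.indicator (fun z => χ (z + θ) * ‖z‖ ^ s) z with hF
    have h1 : pv α (ball (0 : E) 1) θ ε = ∫ z, F z := by
      rw [pv, ← integral_indicator hmε', ← integral_add_right_eq_self _ θ]
      simp only [hF, indicator_apply, mem_ofPred_eq, add_sub_cancel_right, hχ, hs]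
    have hFi : Integrable F := by
      rw [hF, integrable_indicator_iff hmε]
      have h2 := integrableOn_kernel_far (E := E) hα 0 hε
      simp only [sub_zero] at h2
      refine Integrable.mono' h2 ?_ (Eventually.of_forall fun z => ?_)
      · exact Measurable.aestronglyMeasurable
          ((hχm.comp (measurable_add_const θ)).mul (by fun_prop))
      · rw [norm_eq_abs, abs_mul, abs_of_nonneg (rpow_nonneg (norm_nonneg z) s)]
        exact mul_le_of_le_one_left (by positivity) (hχb _)
    have h3 : ∫ z, F z = ∫ z, 1 / 2 * (F z + F (-z)) := by
      have e1 : ∫ z, (F z + F (-z)) = (∫ z, F z) + ∫ z, F (-z) := integral_add hFi hFi.comp_neg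
      rw [integral_const_mul, e1, integral_neg_eq_self]
      ring
    rw [h1, h3]
    refine integral_congr_ae ?_
    have hn : ∀ c : E, ∀ᵐ z : E, ‖z - c‖ ≠ 1 := by
      intro c
      have := Measure.addHaar_sphere (volume : Measure E) c 1
      refine (measure_eq_zero_iff_ae_notMem.1 this).mono fun z hz h => hz ?_
      rw [mem_sphere_iff_norm, h]
    filter_upwards [hn (-θ), hn θ] with z hz1 hz2
    rw [sub_neg_eq_add] at hz1
    by_cases hz : ε < ‖z‖
    · have e1 : ‖z + θ‖ ^ 2 = ‖z‖ ^ 2 + 2 * inner ℝ θ z + 1 := by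
        rw [norm_add_sq_real, hθ, real_inner_comm]; ring
      have e2 : ‖-z + θ‖ ^ 2 = ‖z‖ ^ 2 - 2 * inner ℝ θ z + 1 := by
        rw [norm_add_sq_real, hθ, norm_neg, inner_neg_left, real_inner_comm]; ring
      have hz2' : ‖-z + θ‖ ≠ 1 := by rwa [← norm_neg, neg_add_rev, neg_neg, add_comm, ← sub_eq_add_neg]
      have hzp : 0 < ‖z‖ ^ 2 := by have := hε.trans hz; positivity
      have hval : ∀ w : E, ‖w‖ ≠ 1 → χ w = if 1 < ‖w‖ ^ 2 then 1 else -1 := by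
        intro w hw
        classical
        simp only [hχ, indicator_apply, closure_ball (0 : E) one_ne_zero, mem_compl_iff,
          mem_closedBall_zero_iff, mem_ball_zero_iff, one_lt_sq_iff₀ (norm_nonneg w)]
        rcases lt_or_gt_of_ne hw with h | h
        · simp [h, h.le, h.not_gt]
        · simp [h, h.not_ge, h.le.not_gt]
      have hz' : ε < ‖-z‖ := by rwa [norm_neg]
      rw [indicator_of_mem (by exact hz), hF]
      simp only
      rw [indicator_of_mem (by exact hz), indicator_of_mem (by exact hz'), hval _ hz1,
        hval _ hz2', e1, e2, norm_neg, hG, indicator_apply]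
      simp only [mem_ofPred_eq]
      rcases le_or_gt 0 (inner ℝ θ z) with h0 | h0
      · have ha := abs_of_nonneg h0
        rw [if_pos (by linarith)]
        split_ifs
        · ring
        · exfalso; linarith
        · exfalso; linarith
        · ring
      · have ha := abs_of_neg h0
        rw [if_pos (show 1 < ‖z‖ ^ 2 - 2 * inner ℝ θ z + 1 by linarith)]
        split_ifs
        · ring
        · exfalso; linarith
        · exfalso; linarith
        · ring
    · have hz' : ¬ ε < ‖-z‖ := by rwa [norm_neg]
      rw [indicator_of_notMem (by exact hz), hF]
      simp only
      rw [indicator_of_notMem (by exact hz), indicator_of_notMem (by exact hz')]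
      ring
  have hlim : Tendsto (fun ε : ℝ => ∫ z, {z : E | ε < ‖z‖}.indicator G z) (𝓝[>] 0)
      (nhds (∫ z, G z)) := by
    refine tendsto_integral_filter_of_dominated_convergence G ?_ ?_ hGi ?_
    · exact Eventually.of_forall fun ε => (hGm.indicator
        (measurableSet_lt (by fun_prop) (by fun_prop))).aestronglyMeasurable
    · refine Eventually.of_forall fun ε => Eventually.of_forall fun z => ?_
      rw [norm_of_nonneg (indicator_nonneg (fun z _ => hG0 z) z)]
      exact indicator_le_self' (fun _ _ => hG0 _) z
    · filter_upwards [compl_mem_ae_iff.2 (measure_singleton (0 : E))] with z hz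
      have hz0 : 0 < ‖z‖ := norm_pos_iff.2 hz
      refine tendsto_const_nhds.congr' ?_
      filter_upwards [nhdsWithin_le_nhds (Iio_mem_nhds hz0)] with ε hε
      rw [indicator_of_mem (by exact hε)]
  refine hlim.congr' ?_
  filter_upwards [self_mem_nhdsWithin] with ε hε
  exact (key ε hε).symm

section Kernel

theorem abs_sinh_le {x R : ℝ} (h : |x| ≤ R) : |sinh x| ≤ cosh R * |x| := by
  have hR : 0 ≤ R := (abs_nonneg x).trans h
  have := (convex_Icc (-R) R).norm_image_sub_le_of_norm_hasDerivWithin_le (f := sinh)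
    (f' := cosh) (C := cosh R) (x := 0) (y := x)
    (fun y _ => (hasDerivAt_sinh y).hasDerivWithinAt)
    (fun y hy => by
      rw [norm_of_nonneg (cosh_pos y).le, cosh_le_cosh, abs_of_nonneg hR]
      exact abs_le.2 hy) ⟨by linarith, hR⟩ (abs_le.1 h)
  simpa using this

theorem exists_hyperbolic_bound (c : ℝ) : ∃ B, 1 ≤ B ∧ ∀ τ : ℝ, |τ| ≤ 2 →
    |sinh (c * τ)| ≤ B * |τ| ∧ cosh (c * τ) ≤ B ∧ cosh (c * τ) - 1 ≤ B * τ ^ 2 := by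
  set R := 2 * |c| with hR
  have hc1 := one_le_cosh R
  refine ⟨cosh R ^ 2 * (1 + |c|) ^ 2, ?_, fun τ hτ => ?_⟩
  · have h1 : 1 ≤ cosh R ^ 2 := one_le_pow₀ hc1
    have h2 : 1 ≤ (1 + |c|) ^ 2 := one_le_pow₀ (by linarith [abs_nonneg c])
    nlinarith
  have hb : |c * τ| ≤ R := by rw [abs_mul, hR, mul_comm]; gcongr
  have hb2 : |c * τ / 2| ≤ R := by
    rw [abs_div, abs_two]; linarith [abs_nonneg (c * τ)]
  have h1 : cosh R ≤ cosh R ^ 2 := by nlinarith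
  have hca := abs_nonneg c
  have h2 : |c| ≤ (1 + |c|) ^ 2 := by nlinarith
  have h3 : 1 ≤ (1 + |c|) ^ 2 := by nlinarith
  refine ⟨?_, ?_, ?_⟩
  · refine (abs_sinh_le hb).trans ?_
    rw [abs_mul, ← mul_assoc]
    gcongr
  · calc cosh (c * τ) ≤ cosh R := by
          rw [cosh_le_cosh]; exact hb.trans (le_abs_self R)
      _ ≤ cosh R ^ 2 * 1 := by linarith
      _ ≤ _ := by gcongr
  · have e : cosh (c * τ) - 1 = 2 * sinh (c * τ / 2) ^ 2 := by
      have h4 := cosh_two_mul (c * τ / 2)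
      rw [show 2 * (c * τ / 2) = c * τ by ring] at h4
      rw [h4, cosh_sq]; ring
    have h5 := abs_sinh_le hb2
    have h6 : sinh (c * τ / 2) ^ 2 ≤ (cosh R * |c * τ / 2|) ^ 2 := by
      rw [← sq_abs]; gcongr
    rw [e]
    calc 2 * sinh (c * τ / 2) ^ 2 ≤ 2 * (cosh R * |c * τ / 2|) ^ 2 := by gcongr
      _ = cosh R ^ 2 * (|c| ^ 2 / 2) * τ ^ 2 := by
        rw [mul_pow, sq_abs, sq_abs]; ring
      _ ≤ _ := by
        gcongr
        nlinarith

/-- The squared distance between `e^(τ/2) σ` and `e^(-τ/2) θ` for unit vectors at distance `d`. -/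
noncomputable def gap (d τ : ℝ) : ℝ := 2 * cosh τ - 2 + d ^ 2

theorem sq_le_gap (d τ : ℝ) : d ^ 2 ≤ gap d τ := by
  have := one_le_cosh τ
  unfold gap; linarith

theorem gap_pos {d : ℝ} (hd : 0 < d) (τ : ℝ) : 0 < gap d τ :=
  lt_of_lt_of_le (by positivity) (sq_le_gap d τ)

/-- The interaction kernel in logarithmic polar coordinates. -/
noncomputable def kap (c p d τ : ℝ) : ℝ := exp (c * τ) * gap d τ ^ (-p)

/-- The primitive of the kernel, minus its linearization. -/
noncomputable def qfun (c p d w : ℝ) : ℝ := ∫ τ in (0 : ℝ)..w, (kap c p d τ - d ^ (-(2 * p)))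

/-- The odd part of `qfun`. -/
noncomputable def qodd (c p d w : ℝ) : ℝ :=
  ∫ τ in (0 : ℝ)..w, (cosh (c * τ) * gap d τ ^ (-p) - d ^ (-(2 * p)))

/-- The even part of `qfun`. -/
noncomputable def qeven (c p d w : ℝ) : ℝ :=
  ∫ τ in (0 : ℝ)..w, sinh (c * τ) * gap d τ ^ (-p)

variable {c p d : ℝ}

theorem continuous_gap_rpow (hd : 0 < d) (b : ℝ) : Continuous fun τ => gap d τ ^ b := by
  refine Continuous.rpow_const ?_ fun τ => Or.inl (gap_pos hd τ).ne'
  unfold gap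
  fun_prop

theorem continuous_kap (hd : 0 < d) : Continuous (kap c p d) :=
  Continuous.mul (by fun_prop) (continuous_gap_rpow hd _)

theorem qfun_eq_add (hd : 0 < d) (w : ℝ) : qfun c p d w = qodd c p d w + qeven c p d w := by
  have hg := continuous_gap_rpow hd (-p)
  have h1 : Continuous fun τ => cosh (c * τ) * gap d τ ^ (-p) - d ^ (-(2 * p)) := by fun_prop
  have h2 : Continuous fun τ => sinh (c * τ) * gap d τ ^ (-p) := by fun_prop
  rw [qodd, qeven, ← intervalIntegral.integral_add (h1.intervalIntegrable _ _)
    (h2.intervalIntegrable _ _), qfun]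
  congr 1
  ext τ
  rw [kap, ← cosh_add_sinh]
  ring

theorem qodd_neg (w : ℝ) : qodd c p d (-w) = -qodd c p d w := by
  have h := intervalIntegral.integral_comp_neg (a := 0) (b := w)
    (fun τ => cosh (c * τ) * gap d τ ^ (-p) - d ^ (-(2 * p)))
  have he : ∀ τ : ℝ, cosh (c * -τ) * gap d (-τ) ^ (-p) - d ^ (-(2 * p)) =
      cosh (c * τ) * gap d τ ^ (-p) - d ^ (-(2 * p)) := fun τ => by
    rw [mul_neg, cosh_neg, gap, cosh_neg, gap]
  simp only [he] at h
  rw [qodd, qodd, h, neg_zero, intervalIntegral.integral_symm]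

theorem hasDerivAt_qodd (hd : 0 < d) (w : ℝ) :
    HasDerivAt (qodd c p d) (cosh (c * w) * gap d w ^ (-p) - d ^ (-(2 * p))) w := by
  have hg := continuous_gap_rpow hd (-p)
  have h1 : Continuous fun τ => cosh (c * τ) * gap d τ ^ (-p) - d ^ (-(2 * p)) := by fun_prop
  exact (h1.integral_hasStrictDerivAt 0 w).hasDerivAt

theorem hasDerivAt_qeven (hd : 0 < d) (w : ℝ) :
    HasDerivAt (qeven c p d) (sinh (c * w) * gap d w ^ (-p)) w := by
  have hg := continuous_gap_rpow hd (-p)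
  have h1 : Continuous fun τ => sinh (c * τ) * gap d τ ^ (-p) := by fun_prop
  exact (h1.integral_hasStrictDerivAt 0 w).hasDerivAt

theorem hasDerivAt_gap_rpow (hd : 0 < d) (b w : ℝ) :
    HasDerivAt (fun τ => gap d τ ^ b) (2 * sinh w * b * gap d w ^ (b - 1)) w := by
  have h : HasDerivAt (gap d) (2 * sinh w) w := by
    unfold gap
    exact (((hasDerivAt_cosh w).const_mul 2).sub_const 2).add_const _
  exact h.rpow_const (Or.inl (gap_pos hd w).ne')

theorem exists_q_bounds (c : ℝ) (hp : 0 < p) : ∃ C, 0 ≤ C ∧ ∀ d, 0 < d → d ≤ 2 →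
    ∀ τ, |τ| ≤ d →
      |cosh (c * τ) * gap d τ ^ (-p) - d ^ (-(2 * p))| ≤ C * (τ ^ 2 * d ^ (-(2 * p) - 2)) ∧
      |sinh (c * τ) * c * gap d τ ^ (-p) +
        cosh (c * τ) * (2 * sinh τ * (-p) * gap d τ ^ (-p - 1))| ≤
          C * (|τ| * d ^ (-(2 * p) - 2)) ∧
      |sinh (c * τ) * gap d τ ^ (-p)| ≤ C * (|τ| * d ^ (-(2 * p))) ∧
      |cosh (c * τ) * c * gap d τ ^ (-p) +
        sinh (c * τ) * (2 * sinh τ * (-p) * gap d τ ^ (-p - 1))| ≤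
          C * d ^ (-(2 * p)) := by
  obtain ⟨B, hB1, hB⟩ := exists_hyperbolic_bound c
  obtain ⟨D, hD1, hD⟩ := exists_hyperbolic_bound 1
  have hca := abs_nonneg c
  refine ⟨4 * B + 4 * p * D * B + 4 * |c| * B, by positivity, fun d hd hd2 τ hτ => ?_⟩
  obtain ⟨b1, b2, b3⟩ := hB τ (hτ.trans hd2)
  obtain ⟨d1, d2, d3⟩ := hD τ (hτ.trans hd2)
  rw [one_mul] at d1 d2 d3
  have hd0 : 0 < d ^ (-(2 * p) - 2) := rpow_pos_of_pos hd _
  set P := d ^ (-(2 * p) - 2) with hP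
  have eP : d ^ (-(2 * p)) = d ^ 2 * P := by
    rw [hP, ← rpow_natCast d 2, ← rpow_add hd]; congr 1; push_cast; ring
  have hgp := gap_pos hd τ
  have hsq : d ^ 2 = d ^ (2 : ℝ) := (rpow_natCast d 2).symm
  have g1 : gap d τ ^ (-p) ≤ d ^ 2 * P := by
    rw [← eP, show -(2 * p) = 2 * (-p) by ring, rpow_mul hd.le, ← hsq]
    exact rpow_le_rpow_of_nonpos (by positivity) (sq_le_gap d τ) (by linarith)
  have g2 : gap d τ ^ (-p - 1) ≤ P := by
    rw [hP, show -(2 * p) - 2 = 2 * (-p - 1) by ring, rpow_mul hd.le, ← hsq]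
    exact rpow_le_rpow_of_nonpos (by positivity) (sq_le_gap d τ) (by linarith)
  have g1' : 0 ≤ gap d τ ^ (-p) := by positivity
  have g2' : 0 ≤ gap d τ ^ (-p - 1) := by positivity
  have g3 : |gap d τ ^ (-p) - d ^ (-(2 * p))| ≤ 4 * p * D * (τ ^ 2 * P) := by
    have h := abs_rpow_sub_rpow_le (b := -p) (by linarith) hgp (show 0 < d ^ 2 by positivity)
    have e1 : (d ^ 2) ^ (-p) = d ^ (-(2 * p)) := by
      rw [hsq, ← rpow_mul hd.le]; congr 1; ring
    have e2 : (d ^ 2) ^ (-p - 1) = P := by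
      rw [hsq, ← rpow_mul hd.le, hP]; congr 1; ring
    rw [e1, e2, abs_neg, abs_of_pos hp] at h
    refine h.trans ?_
    have e3 : |gap d τ - d ^ 2| ≤ 2 * (D * τ ^ 2) := by
      have := one_le_cosh τ
      rw [gap, add_sub_cancel_right, abs_of_nonneg (by linarith)]
      linarith
    calc p * |gap d τ - d ^ 2| * (gap d τ ^ (-p - 1) + P)
        ≤ p * (2 * (D * τ ^ 2)) * (P + P) := by gcongr
      _ = _ := by ring
  have hc1 : |cosh (c * τ)| ≤ B := by rwa [abs_of_pos (cosh_pos _)]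
  have hc2 : |cosh (c * τ) - 1| ≤ B * τ ^ 2 := by
    rwa [abs_of_nonneg (by linarith [one_le_cosh (c * τ)])]
  have hd4 : d ^ 2 ≤ 4 := by nlinarith
  have ht2 : |τ| * |τ| ≤ d ^ 2 := by nlinarith [abs_nonneg τ]
  have ht0 := abs_nonneg τ
  have hB0 : 0 ≤ B := by linarith
  have hD0 : 0 ≤ D := by linarith
  have aux : |2 * sinh τ * (-p) * gap d τ ^ (-p - 1)| ≤ 2 * (D * |τ|) * p * P := by
    rw [abs_mul, abs_mul, abs_mul, abs_neg, abs_two, abs_of_pos hp, abs_of_nonneg g2']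
    gcongr
  refine ⟨?_, ?_, ?_, ?_⟩
  · calc _ = |(cosh (c * τ) - 1) * gap d τ ^ (-p) + (gap d τ ^ (-p) - d ^ (-(2 * p)))| := by
          congr 1; ring
      _ ≤ |cosh (c * τ) - 1| * gap d τ ^ (-p) + |gap d τ ^ (-p) - d ^ (-(2 * p))| := by
          refine (abs_add_le _ _).trans ?_
          rw [abs_mul, abs_of_nonneg g1']
      _ ≤ (B * τ ^ 2) * (4 * P) + 4 * p * D * (τ ^ 2 * P) := by
          have : gap d τ ^ (-p) ≤ 4 * P := g1.trans (by gcongr)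
          gcongr
      _ = (4 * B + 4 * p * D) * (τ ^ 2 * P) := by ring
      _ ≤ _ := by
          refine mul_le_mul_of_nonneg_right ?_ (by positivity)
          have : 4 * p * D ≤ 4 * p * D * B := le_mul_of_one_le_right (by positivity) hB1
          have : 0 ≤ 4 * |c| * B := by positivity
          linarith
  · calc _ ≤ |sinh (c * τ)| * |c| * gap d τ ^ (-p) +
          |cosh (c * τ)| * |2 * sinh τ * (-p) * gap d τ ^ (-p - 1)| := by
          refine (abs_add_le _ _).trans ?_
          rw [abs_mul, abs_mul, abs_of_nonneg g1', abs_mul (cosh _)]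
      _ ≤ (B * |τ|) * |c| * (4 * P) + B * (2 * (D * |τ|) * p * P) := by
          have : gap d τ ^ (-p) ≤ 4 * P := g1.trans (by gcongr)
          gcongr
      _ = (4 * |c| * B + 2 * p * D * B) * (|τ| * P) := by ring
      _ ≤ _ := by
          refine mul_le_mul_of_nonneg_right ?_ (by positivity)
          have : 0 ≤ p * D * B := by positivity
          linarith
  · rw [abs_mul, abs_of_nonneg g1', eP]
    calc _ ≤ (B * |τ|) * (d ^ 2 * P) := by gcongr
      _ = B * (|τ| * (d ^ 2 * P)) := by ring
      _ ≤ _ := by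
          refine mul_le_mul_of_nonneg_right ?_ (by positivity)
          have : 0 ≤ 4 * p * D * B := by positivity
          have : 0 ≤ 4 * |c| * B := by positivity
          linarith
  · rw [eP]
    calc _ ≤ |cosh (c * τ)| * |c| * gap d τ ^ (-p) +
          |sinh (c * τ)| * |2 * sinh τ * (-p) * gap d τ ^ (-p - 1)| := by
          refine (abs_add_le _ _).trans ?_
          rw [abs_mul, abs_mul, abs_of_nonneg g1', abs_mul (sinh (c * τ))]
      _ ≤ B * |c| * (d ^ 2 * P) + (B * |τ|) * (2 * (D * |τ|) * p * P) := by gcongr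
      _ = B * |c| * (d ^ 2 * P) + (2 * p * D * B) * ((|τ| * |τ|) * P) := by ring
      _ ≤ B * |c| * (d ^ 2 * P) + (2 * p * D * B) * (d ^ 2 * P) := by gcongr
      _ = (|c| * B + 2 * p * D * B) * (d ^ 2 * P) := by ring
      _ ≤ _ := by
          refine mul_le_mul_of_nonneg_right ?_ (by positivity)
          have : 0 ≤ p * D * B := by positivity
          have : 0 ≤ |c| * B := by positivity
          linarith

end Kernel

section QBounds

variable {p : ℝ}

theorem hasDerivAt_qodd_deriv {c d : ℝ} (hd : 0 < d) (τ : ℝ) :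
    HasDerivAt (fun w => cosh (c * w) * gap d w ^ (-p) - d ^ (-(2 * p)))
      (sinh (c * τ) * c * gap d τ ^ (-p) +
        cosh (c * τ) * (2 * sinh τ * (-p) * gap d τ ^ (-p - 1))) τ := by
  have h1 : HasDerivAt (fun w => cosh (c * w)) (sinh (c * τ) * c) τ := by
    simpa using ((hasDerivAt_id τ).const_mul c).cosh
  exact (h1.mul (hasDerivAt_gap_rpow hd (-p) τ)).sub_const _

theorem hasDerivAt_qeven_deriv {c d : ℝ} (hd : 0 < d) (τ : ℝ) :
    HasDerivAt (fun w => sinh (c * w) * gap d w ^ (-p))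
      (cosh (c * τ) * c * gap d τ ^ (-p) +
        sinh (c * τ) * (2 * sinh τ * (-p) * gap d τ ^ (-p - 1))) τ := by
  have h1 : HasDerivAt (fun w => sinh (c * w)) (cosh (c * τ) * c) τ := by
    simpa using ((hasDerivAt_id τ).const_mul c).sinh
  exact h1.mul (hasDerivAt_gap_rpow hd (-p) τ)

theorem exists_qfun_near (c : ℝ) (hp : 0 < p) : ∃ C, 0 ≤ C ∧ ∀ d, 0 < d → d ≤ 2 →
    ∀ η ν H w₁ w₁' w₂ w₂', η ≤ 1 → 0 ≤ ν → 0 ≤ H → |w₁| ≤ η * d → |w₁'| ≤ η * d →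
      |w₂| ≤ η * d → |w₂'| ≤ η * d → |w₁ - w₂| ≤ ν * d → |w₁' - w₂'| ≤ ν * d →
      |w₂ + w₂'| ≤ η * H → |w₁ + w₁'| ≤ η * H → |w₁ - w₂ + (w₁' - w₂')| ≤ ν * H →
      |qfun c p d w₁ + qfun c p d w₁' - qfun c p d w₂ - qfun c p d w₂'| ≤
        C * (η * ν * (d ^ (-(2 * p)) * H + d ^ (2 - 2 * p))) := by
  obtain ⟨C, hC, hb⟩ := exists_q_bounds c hp
  refine ⟨3 * C, by positivity, ?_⟩
  intro d hd hd2 η ν H w₁ w₁' w₂ w₂' hη1 hν hH h1 h1' h2 h2' k k' a2 a1 m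
  have hη : 0 ≤ η := by
    by_contra h
    push Not at h
    have := (abs_nonneg w₁).trans h1
    nlinarith
  set P := d ^ (-(2 * p) - 2) with hP
  have hP0 : 0 < P := by positivity
  have eP : d ^ (-(2 * p)) = d ^ 2 * P := by
    rw [hP, ← rpow_natCast d 2, ← rpow_add hd]; congr 1; push_cast; ring
  have eP2 : d ^ (2 - 2 * p) = d ^ 4 * P := by
    rw [hP, ← rpow_natCast d 4, ← rpow_add hd]; congr 1; push_cast; ring
  have hs : ∀ x ∈ Icc (-(η * d)) (η * d), |x| ≤ η * d ∧ |x| ≤ d := by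
    intro x hx
    have : |x| ≤ η * d := abs_le.2 hx
    exact ⟨this, this.trans (by nlinarith)⟩
  have ho := abs_fourPoint_le (convex_Icc (-(η * d)) (η * d))
    (f := qodd c p d) (fun x _ => hasDerivAt_qodd hd x) (fun x _ => hasDerivAt_qodd_deriv hd x)
    (M₁ := C * ((η * d) ^ 2 * P)) (M₂ := C * (η * d * P))
    (fun x hx => (hb d hd hd2 x (hs x hx).2).1.trans (by
      have := (hs x hx).1
      have : x ^ 2 ≤ (η * d) ^ 2 := by rw [← sq_abs]; gcongr
      gcongr))
    (fun x hx => (hb d hd hd2 x (hs x hx).2).2.1.trans (by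
      have := (hs x hx).1
      gcongr))
    (a := w₁) (b := w₂) (c := -w₁') (e := -w₂') (abs_le.1 h1) (abs_le.1 h2)
    (abs_le.1 (by rwa [abs_neg])) (abs_le.1 (by rwa [abs_neg]))
  have he : ∀ x ∈ Icc (-(η * d)) (η * d), ∀ y ∈ Icc (-(η * d)) (η * d), |x - y| ≤ ν * d →
      |qeven c p d x - qeven c p d y| ≤ C * (η * d * (d ^ 2 * P)) * (ν * d) := by
    intro x hx y hy hxy
    have := (convex_Icc (-(η * d)) (η * d)).norm_image_sub_le_of_norm_hasDerivWithin_le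
      (f := qeven c p d) (C := C * (η * d * (d ^ 2 * P))) (x := y) (y := x)
      (fun z _ => (hasDerivAt_qeven hd z).hasDerivWithinAt)
      (fun z hz => (hb d hd hd2 z (hs z hz).2).2.2.1.trans (by
        have := (hs z hz).1
        rw [eP]
        gcongr)) hy hx
    rw [norm_eq_abs, norm_eq_abs] at this
    exact this.trans (by gcongr)
  have he1 := he w₁ (abs_le.1 h1) w₂ (abs_le.1 h2) k
  have he2 := he w₁' (abs_le.1 h1') w₂' (abs_le.1 h2') k'
  simp only [qodd_neg] at ho
  have r1 : |w₁ - w₂ - -w₁' + -w₂'| ≤ ν * H := by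
    rw [show w₁ - w₂ - -w₁' + -w₂' = w₁ - w₂ + (w₁' - w₂') by ring]; exact m
  have r2 : |w₂ - -w₂'| ≤ η * H := by rwa [sub_neg_eq_add]
  have r3 : |w₁ - -w₁'| ≤ η * H := by rwa [sub_neg_eq_add]
  have r4 : |-w₁' - -w₂'| ≤ ν * d := by rwa [show -w₁' - -w₂' = -(w₁' - w₂') by ring, abs_neg]
  have ho' : |qodd c p d w₁ - qodd c p d w₂ - -qodd c p d w₁' + -qodd c p d w₂'| ≤
      C * ((η * d) ^ 2 * P) * (ν * H) + C * (η * d * P) * (η * H + η * H) * (ν * d) :=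
    ho.trans (by gcongr)
  rw [qfun_eq_add hd, qfun_eq_add hd, qfun_eq_add hd, qfun_eq_add hd, eP, eP2]
  calc _ = |(qodd c p d w₁ - qodd c p d w₂ - -qodd c p d w₁' + -qodd c p d w₂') +
        (qeven c p d w₁ - qeven c p d w₂) + (qeven c p d w₁' - qeven c p d w₂')| := by
        congr 1; ring
    _ ≤ (C * ((η * d) ^ 2 * P) * (ν * H) + C * (η * d * P) * (η * H + η * H) * (ν * d)) +
        C * (η * d * (d ^ 2 * P)) * (ν * d) + C * (η * d * (d ^ 2 * P)) * (ν * d) :=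
        (abs_add_three _ _ _).trans (by gcongr)
    _ = 3 * C * ((η * η) * ν * (d ^ 2 * P * H)) + 2 * C * (η * ν * (d ^ 4 * P)) := by ring
    _ ≤ 3 * C * ((η * 1) * ν * (d ^ 2 * P * H)) + 3 * C * (η * ν * (d ^ 4 * P)) := by
        gcongr
        linarith
    _ = _ := by ring

theorem exists_qfun_far (c : ℝ) (hp : 0 < p) : ∃ C, 0 ≤ C ∧ ∀ d, 0 < d → d ≤ 2 →
    ∀ η ν H w₁ w₂ v₁ v₂, η ≤ 1 → 0 ≤ ν → 0 ≤ H → |w₁| ≤ η * d → |w₂| ≤ η * d →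
      |v₁| ≤ η * d → |v₂| ≤ η * d → |v₁ - v₂| ≤ ν * d →
      |w₁ - v₁| ≤ η * H → |w₂ - v₂| ≤ η * H → |w₁ - w₂ - v₁ + v₂| ≤ ν * H →
      |qfun c p d w₁ - qfun c p d w₂ - qfun c p d v₁ + qfun c p d v₂| ≤
        C * (η * ν * (d ^ (-(2 * p)) * H)) := by
  obtain ⟨C, hC, hb⟩ := exists_q_bounds c hp
  refine ⟨9 * C, by positivity, ?_⟩
  intro d hd hd2 η ν H w₁ w₂ v₁ v₂ hη1 hν hH h1 h2 k1 k2 kk a1 a2 m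
  have hη : 0 ≤ η := by
    by_contra h
    push Not at h
    have := (abs_nonneg w₁).trans h1
    nlinarith
  set P := d ^ (-(2 * p) - 2) with hP
  have hP0 : 0 < P := by positivity
  have eP : d ^ (-(2 * p)) = d ^ 2 * P := by
    rw [hP, ← rpow_natCast d 2, ← rpow_add hd]; congr 1; push_cast; ring
  have hs : ∀ x ∈ Icc (-(η * d)) (η * d), |x| ≤ η * d ∧ |x| ≤ d := by
    intro x hx
    have : |x| ≤ η * d := abs_le.2 hx
    exact ⟨this, this.trans (by nlinarith)⟩
  have ho := abs_fourPoint_le (convex_Icc (-(η * d)) (η * d))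
    (f := fun w => qodd c p d w + qeven c p d w)
    (fun x _ => (hasDerivAt_qodd hd x).add (hasDerivAt_qeven hd x))
    (fun x _ => (hasDerivAt_qodd_deriv hd x).add (hasDerivAt_qeven_deriv hd x))
    (M₁ := 3 * C * (η * (d ^ 2 * P))) (M₂ := 3 * C * (d * P))
    (fun x hx => by
      obtain ⟨b1, -, b3, -⟩ := hb d hd hd2 x (hs x hx).2
      have h := (hs x hx).1
      rw [eP] at b1 b3
      rw [eP]
      have hx2 : x ^ 2 ≤ (η * d) ^ 2 := by rw [← sq_abs]; gcongr
      calc _ ≤ C * (x ^ 2 * P) + C * (|x| * (d ^ 2 * P)) := (abs_add_le _ _).trans (by gcongr)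
        _ ≤ C * ((η * d) ^ 2 * P) + C * (η * 2 * (d ^ 2 * P)) := by
            have : |x| ≤ η * 2 := h.trans (by gcongr)
            gcongr
        _ = C * ((η * η) * (d ^ 2 * P)) + 2 * C * (η * (d ^ 2 * P)) := by ring
        _ ≤ C * ((η * 1) * (d ^ 2 * P)) + 2 * C * (η * (d ^ 2 * P)) := by gcongr
        _ = _ := by ring)
    (fun x hx => by
      obtain ⟨-, b2, -, b4⟩ := hb d hd hd2 x (hs x hx).2
      have h := (hs x hx).2
      rw [eP] at b4
      calc _ ≤ C * (|x| * P) + C * (d ^ 2 * P) := (abs_add_le _ _).trans (by gcongr)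
        _ ≤ C * (d * P) + C * (2 * d * P) := by
            have : d ^ 2 ≤ 2 * d := by nlinarith
            gcongr
        _ = _ := by ring)
    (a := w₁) (b := w₂) (c := v₁) (e := v₂) (abs_le.1 h1) (abs_le.1 h2) (abs_le.1 k1)
    (abs_le.1 k2)
  rw [qfun_eq_add hd, qfun_eq_add hd, qfun_eq_add hd, qfun_eq_add hd, eP]
  refine ho.trans ?_
  calc _ ≤ 3 * C * (η * (d ^ 2 * P)) * (ν * H) + 3 * C * (d * P) * (η * H + η * H) * (ν * d) := by
        gcongr
    _ = _ := by ring

end QBounds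

theorem norm_axisRefl_sub_axisRefl {x y : E} (hx : ‖x‖ = 1) (hy : ‖y‖ = 1) (z : E) :
    ‖axisRefl y z - axisRefl x z‖ ≤ 4 * ‖y - x‖ * ‖z‖ := by
  have e : axisRefl y z - axisRefl x z =
      (2 * inner ℝ z (y - x)) • y + (2 * inner ℝ z x) • (y - x) := by
    unfold axisRefl
    rw [inner_sub_right]
    module
  have h1 := abs_real_inner_le_norm z (y - x)
  have h2 := abs_real_inner_le_norm z x
  rw [e]
  calc _ ≤ ‖(2 * inner ℝ z (y - x)) • y‖ + ‖(2 * inner ℝ z x) • (y - x)‖ := norm_add_le _ _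
    _ = 2 * |inner ℝ z (y - x)| + 2 * |inner ℝ z x| * ‖y - x‖ := by
        rw [norm_smul, norm_smul, norm_eq_abs, norm_eq_abs, abs_mul, abs_mul, abs_two, hy,
          mul_one]
    _ ≤ 2 * (‖z‖ * ‖y - x‖) + 2 * (‖z‖ * ‖x‖) * ‖y - x‖ := by gcongr
    _ = _ := by rw [hx]; ring

theorem exists_small_rotation {x y : E} (hx : ‖x‖ = 1) (hy : ‖y‖ = 1) :
    ∃ R : E ≃ₗᵢ[ℝ] E, R x = y ∧ ∀ z, ‖R z - z‖ ≤ 4 * ‖x - y‖ * ‖z‖ := by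
  have hxy := real_inner_self_eq_norm_sq (x + y)
  rw [inner_add_add_self, real_inner_self_eq_norm_sq, real_inner_self_eq_norm_sq, hx, hy,
    real_inner_comm x y] at hxy
  have hxy2 := norm_sub_sq_real x y
  rw [hx, hy] at hxy2
  rcases eq_or_ne (x + y) 0 with h0 | h0
  · obtain ⟨R, hR⟩ := exists_isometry_map (x := x) (y := y) (by rw [hx, hy])
    refine ⟨R, hR, fun z => ?_⟩
    have h2 : ‖x - y‖ = 2 := by
      rw [show x - y = (2 : ℝ) • x - (x + y) by module, h0, sub_zero, norm_smul, hx]; norm_num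
    have := norm_sub_le (R z) z
    rw [R.norm_map] at this
    rw [h2]
    linarith [norm_nonneg z]
  · set m := ‖x + y‖ with hm
    have hm0 : 0 < m := norm_pos_iff.2 h0
    set v : E := m⁻¹ • (x + y) with hv
    have hv1 : ‖v‖ = 1 := by
      rw [hv, norm_smul, norm_inv, norm_eq_abs, abs_of_pos hm0, ← hm]
      field_simp
    have hxv : inner ℝ x v = m / 2 := by
      rw [hv, inner_smul_right, inner_add_right, real_inner_self_eq_norm_sq, hx]
      field_simp
      have : inner ℝ y x = inner ℝ x y := real_inner_comm x y
      linarith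
    obtain ⟨Rx, hRx⟩ := axisRefl_isometry hx
    obtain ⟨Rv, hRv⟩ := axisRefl_isometry hv1
    have hd : ‖v - x‖ ≤ ‖x - y‖ := by
      have h1 := norm_sub_sq_real v x
      rw [hv1, hx, real_inner_comm, hxv] at h1
      have hm2 : m ≤ 2 := by
        have := norm_add_le x y
        rw [hx, hy] at this; linarith
      have hc : inner ℝ y x = inner ℝ x y := real_inner_comm x y
      refine le_of_sq_le_sq ?_ (norm_nonneg _)
      rw [h1, hxy2]
      nlinarith
    refine ⟨Rx.trans Rv, ?_, fun z => ?_⟩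
    · rw [LinearIsometryEquiv.trans_apply, hRx, axisRefl_self hx, hRv]
      unfold axisRefl
      rw [hxv, hv, smul_smul, show 2 * (m / 2) * m⁻¹ = 1 by field_simp, one_smul]
      abel
    · have hz : axisRefl x (axisRefl x z) = z := by
        unfold axisRefl
        rw [inner_sub_left, inner_smul_left, real_inner_self_eq_norm_sq, hx]
        simp only [conj_trivial]
        module
      rw [LinearIsometryEquiv.trans_apply, hRv, hRx]
      nth_rw 2 [← hz]
      have hn : ‖axisRefl x z‖ = ‖z‖ := by rw [← hRx, Rx.norm_map]
      calc _ ≤ _ := norm_axisRefl_sub_axisRefl hx hv1 _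
        _ ≤ _ := by rw [hn]; gcongr

theorem axisRefl_map (R : E ≃ₗᵢ[ℝ] E) (θ σ : E) : axisRefl (R θ) (R σ) = R (axisRefl θ σ) := by
  unfold axisRefl
  rw [R.inner_map_map, map_sub, map_smul]

theorem qfun_zero (c p d : ℝ) : qfun c p d 0 = 0 := by
  unfold qfun; simp

theorem measurable_qfun (c p : ℝ) : Measurable fun z : ℝ × ℝ => qfun c p z.1 z.2 := by
  have e : ∀ z : ℝ × ℝ, qfun c p z.1 z.2 =
      z.2 * ∫ t in (0 : ℝ)..1, (kap c p z.1 (z.2 * t) - z.1 ^ (-(2 * p))) := by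
    intro z
    have := intervalIntegral.mul_integral_comp_mul_left
      (f := fun τ => kap c p z.1 τ - z.1 ^ (-(2 * p))) (a := 0) (b := 1) z.2
    rw [this]
    simp [qfun]
  simp_rw [e]
  refine measurable_snd.mul ?_
  simp only [intervalIntegral.integral_of_le zero_le_one]
  have hm : Measurable fun q : (ℝ × ℝ) × ℝ =>
      kap c p q.1.1 (q.1.2 * q.2) - q.1.1 ^ (-(2 * p)) := by
    unfold kap gap
    refine Measurable.sub (Measurable.mul ?_ (Measurable.pow_const ?_ _)) (by fun_prop)
    · fun_prop
    · have : Measurable fun q : (ℝ × ℝ) × ℝ => cosh (q.1.2 * q.2) := by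
        exact continuous_cosh.measurable.comp (by fun_prop)
      exact ((this.const_mul 2).sub_const 2).add (by fun_prop)
  exact (hm.stronglyMeasurable.integral_prod_right (ν := volume.restrict (Ioc (0:ℝ) 1))).measurable

/-- Integrand of the nonlinear remainder of the nonlocal mean curvature of the graph of `u` over
the unit sphere, in logarithmic polar coordinates, symmetrised in the pole `θ`. -/
noncomputable def qInt (α : ℝ) (u : E → ℝ) (θ σ : E) : ℝ :=
  1 / 2 * (qfun ((dim E - α) / 2) ((dim E + α) / 2) ‖σ - θ‖ (u σ - u θ) +
    qfun ((dim E - α) / 2) ((dim E + α) / 2) ‖σ - θ‖ (u (axisRefl θ σ) - u θ))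

/-- The nonlinear remainder of the nonlocal mean curvature of the graph of `u`. -/
noncomputable def qRem (α : ℝ) (u : E → ℝ) (θ : E) : ℝ := ∫ σ, qInt α u θ σ ∂surf E

theorem aesm_qInt {u : E → ℝ} (hθ : ‖θ‖ = 1) (hu : AEStronglyMeasurable u (surf E)) :
    AEStronglyMeasurable (qInt α u θ) (surf E) := by
  have hu' := aesm_comp_axisRefl hθ hu
  have hn : AEMeasurable (fun σ : E => ‖σ - θ‖) (surf E) := by fun_prop
  have h1 := ((measurable_qfun ((dim E - α) / 2) ((dim E + α) / 2)).comp_aemeasurable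
    (hn.prodMk (hu.aemeasurable.sub_const (u θ))))
  have h2 := ((measurable_qfun ((dim E - α) / 2) ((dim E + α) / 2)).comp_aemeasurable
    (hn.prodMk (hu'.aemeasurable.sub_const (u θ))))
  exact ((h1.add h2).const_mul (1 / 2)).aestronglyMeasurable

theorem norm_sub_le_two {x y : E} (hx : ‖x‖ = 1) (hy : ‖y‖ = 1) : ‖x - y‖ ≤ 2 := by
  have := norm_sub_le x y
  rw [hx, hy] at this; linarith

theorem XB.zero {η : ℝ} (hη : 0 ≤ η) : XB α η (fun _ : E => 0) := by
  constructor <;> intros <;> simp <;> positivity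

theorem qInt_near (hN : 2 ≤ finrank ℝ E) (hα : 0 < α) (hα1 : α < 1) :
    ∃ K, 0 ≤ K ∧ ∀ (u₁ u₂ : E → ℝ) (η ν : ℝ), η ≤ 1 → XB α η u₁ → XB α η u₂ →
      XB α ν (fun x => u₁ x - u₂ x) → ∀ θ σ : E, ‖θ‖ = 1 → ‖σ‖ = 1 → σ ≠ θ →
      |qInt α u₁ θ σ - qInt α u₂ θ σ| ≤ K * (η * ν) * ‖σ - θ‖ ^ ((3 - α) / 2 - dim E) := by
  have hd := dim_ge hN
  obtain ⟨C, hC, hq⟩ := exists_qfun_near ((dim E - α) / 2) (p := (dim E + α) / 2) (by linarith)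
  refine ⟨2 * C, by positivity, ?_⟩
  intro u₁ u₂ η ν hη1 h1 h2 h θ σ hθ hσ hne
  have hη := h1.nonneg hθ
  have hν := h.nonneg hθ
  have hd0 : 0 < ‖σ - θ‖ := norm_pos_iff.2 (sub_ne_zero.2 hne)
  have hd2 := norm_sub_le_two hσ hθ
  have hσ' : ‖axisRefl θ σ‖ = 1 := by rw [norm_axisRefl hθ, hσ]
  have hdr := norm_axisRefl_sub_pole (θ := θ) (σ := σ) hθ
  have key := hq ‖σ - θ‖ hd0 hd2 η ν (‖σ - θ‖ ^ ((3 + α) / 2)) (u₁ σ - u₁ θ)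
    (u₁ (axisRefl θ σ) - u₁ θ) (u₂ σ - u₂ θ) (u₂ (axisRefl θ σ) - u₂ θ) hη1 hν (by positivity)
    (h1.lip _ _ hσ hθ) (hdr ▸ h1.lip _ _ hσ' hθ) (h2.lip _ _ hσ hθ) (hdr ▸ h2.lip _ _ hσ' hθ)
    (by convert h.lip _ _ hσ hθ using 2; ring)
    (by have := h.lip _ _ hσ' hθ; rw [hdr] at this; convert this using 2; ring)
    (by convert h2.second _ _ hσ hθ using 2; ring)
    (by convert h1.second _ _ hσ hθ using 2; ring)
    (by convert h.second _ _ hσ hθ using 2; ring)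
  have e1 : ‖σ - θ‖ ^ (-(2 * ((dim E + α) / 2))) * ‖σ - θ‖ ^ ((3 + α) / 2) =
      ‖σ - θ‖ ^ ((3 - α) / 2 - dim E) := by
    rw [← rpow_add hd0]; congr 1; ring
  have e2 : ‖σ - θ‖ ^ (2 - 2 * ((dim E + α) / 2)) ≤ 2 * ‖σ - θ‖ ^ ((3 - α) / 2 - dim E) := by
    have : ‖σ - θ‖ ^ (2 - 2 * ((dim E + α) / 2)) =
        ‖σ - θ‖ ^ ((1 - α) / 2) * ‖σ - θ‖ ^ ((3 - α) / 2 - dim E) := by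
      rw [← rpow_add hd0]; congr 1; ring
    rw [this]
    gcongr
    calc ‖σ - θ‖ ^ ((1 - α) / 2) ≤ 2 ^ ((1 - α) / 2) :=
          rpow_le_rpow hd0.le hd2 (by linarith)
      _ ≤ 2 ^ (1 : ℝ) := rpow_le_rpow_of_exponent_le (by norm_num) (by linarith)
      _ = 2 := by simp
  have e3 := mul_nonneg (mul_nonneg hη hν) (rpow_nonneg hd0.le ((3 - α) / 2 - dim E))
  unfold qInt
  rw [← mul_sub, abs_mul, show |(1 / 2 : ℝ)| = 1 / 2 by norm_num]
  rw [e1] at key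
  rw [show ∀ a b c d : ℝ, a + b - (c + d) = a + b - c - d by intros; ring]
  calc _ ≤ 1 / 2 * (C * (η * ν * (‖σ - θ‖ ^ ((3 - α) / 2 - dim E) +
        2 * ‖σ - θ‖ ^ ((3 - α) / 2 - dim E)))) := by
        refine mul_le_mul_of_nonneg_left (key.trans ?_) (by norm_num)
        gcongr
    _ = 3 / 2 * (C * (η * ν * ‖σ - θ‖ ^ ((3 - α) / 2 - dim E))) := by ring
    _ ≤ 2 * (C * (η * ν * ‖σ - θ‖ ^ ((3 - α) / 2 - dim E))) := by
        refine mul_le_mul_of_nonneg_right (by norm_num) (by positivity)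
    _ = _ := by ring

theorem qInt_zero (θ σ : E) : qInt α (fun _ : E => 0) θ σ = 0 := by
  unfold qInt; simp [qfun_zero]

theorem qInt_integrable (hN : 2 ≤ finrank ℝ E) (hα : 0 < α) (hα1 : α < 1) {u : E → ℝ}
    {η : ℝ} (hη1 : η ≤ 1) (hu : XB α η u) (hθ : ‖θ‖ = 1) :
    Integrable (qInt α u θ) (surf E) := by
  have hd := dim_ge hN
  obtain ⟨K, hK, hn⟩ := qInt_near hN hα hα1
  obtain ⟨A, -, hA⟩ := surf_rpow_integrable hN (e := (3 - α) / 2 - dim E) (by linarith)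
  refine ((hA θ hθ).1.const_mul (K * (η * η))).mono'
    (aesm_qInt hθ (aestronglyMeasurable_surf hu.continuousOn)) ?_
  filter_upwards [ae_surf_norm (E := E), ae_surf_ne hN θ] with σ hσ hne
  have := hn u (fun _ => 0) η η hη1 hu (XB.zero (hu.nonneg hθ)) (by simpa using hu) θ σ hθ hσ hne
  rwa [qInt_zero, sub_zero] at this

theorem qInt_far (hN : 2 ≤ finrank ℝ E) (hα : 0 < α) :
    ∃ K, 0 ≤ K ∧ ∀ (u₁ u₂ : E → ℝ) (η ν : ℝ), η ≤ 1 → XB α η u₁ → XB α η u₂ →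
      XB α ν (fun x => u₁ x - u₂ x) → ∀ (R : E ≃ₗᵢ[ℝ] E) (δ : ℝ), 0 ≤ δ →
      (∀ x, ‖R x - x‖ ≤ δ * ‖x‖) → ∀ θ σ : E, ‖θ‖ = 1 → ‖σ‖ = 1 → σ ≠ θ → δ ≤ ‖σ - θ‖ →
      |(qInt α u₁ (R θ) (R σ) - qInt α u₂ (R θ) (R σ)) - (qInt α u₁ θ σ - qInt α u₂ θ σ)| ≤
        K * (η * ν * δ) * ‖σ - θ‖ ^ ((1 - α) / 2 - dim E) := by
  have hd := dim_ge hN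
  obtain ⟨C, hC, hq⟩ := exists_qfun_far ((dim E - α) / 2) (p := (dim E + α) / 2) (by linarith)
  refine ⟨C, hC, ?_⟩
  intro u₁ u₂ η ν hη1 h1 h2 h R δ hδ hR θ σ hθ hσ hne hδd
  have hη := h1.nonneg hθ
  have hν := h.nonneg hθ
  have hd0 : 0 < ‖σ - θ‖ := norm_pos_iff.2 (sub_ne_zero.2 hne)
  have hd2 := norm_sub_le_two hσ hθ
  have hRd : ∀ x, ‖R x - R θ‖ = ‖x - θ‖ := fun x => by rw [← map_sub, R.norm_map]
  let Q := qfun ((dim E - α) / 2) ((dim E + α) / 2) ‖σ - θ‖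
  have main : ∀ τ : E, ‖τ‖ = 1 → ‖τ - θ‖ = ‖σ - θ‖ →
      |Q (u₁ (R τ) - u₁ (R θ)) - Q (u₂ (R τ) - u₂ (R θ)) - Q (u₁ τ - u₁ θ) + Q (u₂ τ - u₂ θ)| ≤
      C * (η * ν * (‖σ - θ‖ ^ (-(2 * ((dim E + α) / 2))) * (δ * ‖σ - θ‖ ^ ((1 + α) / 2)))) := by
    intro τ hτ hτd
    have n1 : ‖R τ‖ = 1 := by rw [R.norm_map, hτ]
    have n2 : ‖R θ‖ = 1 := by rw [R.norm_map, hθ]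
    have d1 : ‖R τ - R θ‖ = ‖σ - θ‖ := by rw [hRd, hτd]
    refine hq ‖σ - θ‖ hd0 hd2 η ν _ _ _ _ _ hη1 hν (by positivity) (d1 ▸ h1.lip _ _ n1 n2)
      (d1 ▸ h2.lip _ _ n1 n2) (hτd ▸ h1.lip _ _ hτ hθ) (hτd ▸ h2.lip _ _ hτ hθ) ?_ ?_ ?_ ?_
    · have := h.lip _ _ hτ hθ
      rw [hτd] at this; convert this using 2; ring
    · have := h1.rot R δ hδ hR τ θ hτ hθ (hτd ▸ hδd)
      rw [hτd] at this; convert this using 2; ring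
    · have := h2.rot R δ hδ hR τ θ hτ hθ (hτd ▸ hδd)
      rw [hτd] at this; convert this using 2; ring
    · have := h.rot R δ hδ hR τ θ hτ hθ (hτd ▸ hδd)
      rw [hτd] at this; convert this using 2; ring
  have m1 := main σ hσ rfl
  have m2 := main (axisRefl θ σ) (by rw [norm_axisRefl hθ, hσ]) (norm_axisRefl_sub_pole hθ)
  have e1 : ‖σ - θ‖ ^ (-(2 * ((dim E + α) / 2))) * (δ * ‖σ - θ‖ ^ ((1 + α) / 2)) =
      δ * ‖σ - θ‖ ^ ((1 - α) / 2 - dim E) := by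
    rw [mul_left_comm, ← rpow_add hd0]; congr 2; ring
  rw [e1] at m1 m2
  unfold qInt
  rw [axisRefl_map, hRd]
  rw [abs_le] at m1 m2 ⊢
  constructor <;> linarith [m1.1, m1.2, m2.1, m2.2]

theorem qRem_HB (hN : 2 ≤ finrank ℝ E) (hα : 0 < α) (hα1 : α < 1) :
    ∃ K, 0 ≤ K ∧ ∀ (u₁ u₂ : E → ℝ) (η ν : ℝ), η ≤ 1 → XB α η u₁ → XB α η u₂ →
      XB α ν (fun x => u₁ x - u₂ x) →
      HB α (K * (η * ν)) (fun θ => qRem α u₁ θ - qRem α u₂ θ) := by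
  have hd := dim_ge hN
  obtain ⟨C0, hC0, hg⟩ := surf_growth hN
  obtain ⟨K1, hK1, hn⟩ := qInt_near hN hα hα1
  obtain ⟨K2, hK2, hf⟩ := qInt_far hN hα
  obtain ⟨A, hA0, hA⟩ := surf_rpow_integrable hN (e := (3 - α) / 2 - dim E) (by linarith)
  obtain ⟨K3, hK3, hnf⟩ := hg.nearFar (by linarith) hC0 (e₁ := (3 - α) / 2 - dim E)
    (e₂ := (1 - α) / 2 - dim E) (by linarith) (by linarith)
  refine ⟨K1 * A + K3 * (2 * K1 + K2) * 4, by positivity, ?_⟩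
  intro u₁ u₂ η ν hη1 h1 h2 h
  have i1 := fun θ (hθ : ‖θ‖ = 1) => qInt_integrable hN hα hα1 hη1 h1 hθ
  have i2 := fun θ (hθ : ‖θ‖ = 1) => qInt_integrable hN hα hα1 hη1 h2 hθ
  constructor
  · intro θ hθ
    have hη := h1.nonneg hθ
    have hν := h.nonneg hθ
    unfold qRem
    rw [← integral_sub (i1 θ hθ) (i2 θ hθ)]
    calc _ ≤ ∫ σ, K1 * (η * ν) * ‖σ - θ‖ ^ ((3 - α) / 2 - dim E) ∂surf E := by
          rw [← norm_eq_abs]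
          refine norm_integral_le_of_norm_le ((hA θ hθ).1.const_mul _) ?_
          filter_upwards [ae_surf_norm (E := E), ae_surf_ne hN θ] with σ hσ hne
          exact hn u₁ u₂ η ν hη1 h1 h2 h θ σ hθ hσ hne
      _ = K1 * (η * ν) * ∫ σ, ‖σ - θ‖ ^ ((3 - α) / 2 - dim E) ∂surf E := integral_const_mul _ _
      _ ≤ K1 * (η * ν) * A := by
          have := (hA θ hθ).2
          gcongr
      _ ≤ _ := by
          have : 0 ≤ K3 * (2 * K1 + K2) * 4 * (η * ν) := by positivity
          linarith
  · intro θ' θ hθ' hθ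
    have hη := h1.nonneg hθ
    have hν := h.nonneg hθ
    rcases eq_or_ne θ' θ with rfl | hne'
    · simp only [sub_self, abs_zero]
      positivity
    obtain ⟨R, hRθ, hR⟩ := exists_small_rotation hθ hθ'
    set δ := 4 * ‖θ - θ'‖ with hδ
    have hδ0 : 0 < δ := by
      have : 0 < ‖θ - θ'‖ := norm_pos_iff.2 (sub_ne_zero.2 hne'.symm)
      positivity
    have e1 : qRem α u₁ θ' - qRem α u₂ θ' - (qRem α u₁ θ - qRem α u₂ θ) =
        ∫ σ, ((qInt α u₁ (R θ) (R σ) - qInt α u₂ (R θ) (R σ)) -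
          (qInt α u₁ θ σ - qInt α u₂ θ σ)) ∂surf E := by
      have j1 : Integrable (fun σ => qInt α u₁ (R θ) (R σ) - qInt α u₂ (R θ) (R σ)) (surf E) := by
        rw [hRθ]
        exact (surf_measurePreserving R).integrable_comp_of_integrable
          ((i1 θ' hθ').sub (i2 θ' hθ'))
      have j2 : Integrable (fun σ => qInt α u₁ θ σ - qInt α u₂ θ σ) (surf E) :=
        (i1 θ hθ).sub (i2 θ hθ)
      rw [integral_sub j1 j2,
        surf_integral_comp R (fun σ => qInt α u₁ (R θ) σ - qInt α u₂ (R θ) σ), hRθ,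
        integral_sub (i1 θ' hθ') (i2 θ' hθ'), integral_sub (i1 θ hθ) (i2 θ hθ)]
      rfl
    have hm : AEStronglyMeasurable (fun σ => (qInt α u₁ (R θ) (R σ) - qInt α u₂ (R θ) (R σ)) -
          (qInt α u₁ θ σ - qInt α u₂ θ σ)) (surf E) := by
      rw [hRθ]
      exact ((surf_measurePreserving R).integrable_comp_of_integrable
          ((i1 θ' hθ').sub (i2 θ' hθ'))).aestronglyMeasurable.sub
          ((i1 θ hθ).sub (i2 θ hθ)).aestronglyMeasurable
    have key := hnf θ δ (fun _ => θ) (2 * (K1 * (η * ν))) (K2 * (η * ν * δ)) _ hδ0 (by positivity)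
      (by positivity) hm (fun _ => by simpa using hδ0.le) ?_ ?_
    · rw [e1]
      refine (abs_integral_le_integral_abs).trans (key.2.trans ?_)
      have x1 : δ ^ ((3 - α) / 2 - dim E + (dim E - 1)) = δ ^ ((1 - α) / 2) := by
        congr 1; ring
      have x2 : δ * δ ^ ((1 - α) / 2 - dim E + (dim E - 1)) = δ ^ ((1 - α) / 2) := by
        nth_rw 1 [← rpow_one δ]
        rw [← rpow_add hδ0]; congr 1; ring
      have x3 : δ ^ ((1 - α) / 2) ≤ 4 * ‖θ' - θ‖ ^ ((1 - α) / 2) := by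
        rw [hδ, mul_rpow (by norm_num) (norm_nonneg _), norm_sub_rev]
        gcongr
        calc (4:ℝ) ^ ((1 - α) / 2) ≤ 4 ^ (1 : ℝ) :=
              rpow_le_rpow_of_exponent_le (by norm_num) (by linarith)
          _ = 4 := by simp
      calc _ = K3 * (2 * (K1 * (η * ν)) * δ ^ ((3 - α) / 2 - dim E + (dim E - 1)) +
            K2 * (η * ν) * (δ * δ ^ ((1 - α) / 2 - dim E + (dim E - 1)))) := by ring
        _ = K3 * (2 * K1 + K2) * (η * ν) * δ ^ ((1 - α) / 2) := by rw [x1, x2]; ring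
        _ ≤ K3 * (2 * K1 + K2) * (η * ν) * (4 * ‖θ' - θ‖ ^ ((1 - α) / 2)) := by gcongr
        _ = K3 * (2 * K1 + K2) * 4 * (η * ν) * ‖θ' - θ‖ ^ ((1 - α) / 2) := by ring
        _ ≤ _ := by
            gcongr
            have : 0 ≤ K1 * A := by positivity
            linarith
    · filter_upwards [ae_surf_norm (E := E), ae_surf_ne hN θ] with σ hσ hne _
      have hd0 : 0 < ‖σ - θ‖ := norm_pos_iff.2 (sub_ne_zero.2 hne)
      have b1 := hn u₁ u₂ η ν hη1 h1 h2 h θ σ hθ hσ hne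
      have b2 := hn u₁ u₂ η ν hη1 h1 h2 h (R θ) (R σ) (by rw [R.norm_map, hθ])
        (by rw [R.norm_map, hσ]) (R.injective.ne hne)
      rw [← map_sub, R.norm_map] at b2
      have hp : 0 ≤ K1 * (η * ν) * ‖σ - θ‖ ^ ((3 - α) / 2 - dim E) := by positivity
      refine (abs_sub _ _).trans ?_
      simp only [Finset.sum_const, Finset.card_univ, Fintype.card_fin, nsmul_eq_mul]
      push_cast
      linarith
    · filter_upwards [ae_surf_norm (E := E), ae_surf_ne hN θ] with σ hσ hne hfar
      exact hf u₁ u₂ η ν hη1 h1 h2 h R δ hδ0.le hR θ σ hθ hσ hne hfar.le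

theorem abs_exp_mul_sub_le {c R a b : ℝ} (hc : 0 ≤ c) (ha : |a| ≤ R) (hb : |b| ≤ R) :
    |exp (c * a) - exp (c * b)| ≤ c * exp (c * R) * |a - b| := by
  have := (convex_Icc (-R) R).norm_image_sub_le_of_norm_hasDerivWithin_le
    (f := fun x => exp (c * x)) (f' := fun x => exp (c * x) * (c * 1))
    (C := c * exp (c * R)) (x := b) (y := a)
    (fun y _ => (((hasDerivAt_id y).const_mul c).exp).hasDerivWithinAt)
    (fun y hy => by
      rw [norm_eq_abs, abs_mul, mul_one, abs_of_nonneg hc, abs_exp, mul_comm]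
      have := hy.2
      gcongr) (abs_le.1 hb) (abs_le.1 ha)
  simpa [norm_eq_abs] using this

theorem abs_exp_fourPoint_le {R a b c e : ℝ} (ha : |a| ≤ R) (hb : |b| ≤ R) (hc : |c| ≤ R)
    (he : |e| ≤ R) : |exp a - exp b - exp c + exp e| ≤
      exp R * |a - b - c + e| + exp R * (|b - e| + |a - c|) * |c - e| :=
  abs_fourPoint_le (convex_Icc (-R) R) (fun x _ => Real.hasDerivAt_exp x)
    (fun x _ => Real.hasDerivAt_exp x)
    (fun x hx => by rw [abs_exp]; exact exp_le_exp.2 hx.2)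
    (fun x hx => by rw [abs_exp]; exact exp_le_exp.2 hx.2)
    (abs_le.1 ha) (abs_le.1 hb) (abs_le.1 hc) (abs_le.1 he)

theorem exp_half_le_two : exp (1 / 2) ≤ 2 := by
  have h := exp_one_lt_d9
  have h2 : exp (1 / 2) ^ 2 = exp 1 := by rw [← exp_nat_mul]; norm_num
  nlinarith [exp_pos (1 / 2)]

/-- Kernels which are bounded and twice regular, with constant `B`, on the ball of radius `4`. -/
structure KB (B : ℝ) (k : E → ℝ) : Prop where
  meas : Measurable k
  bound : ∀ z, ‖z‖ ≤ 4 → |k z| ≤ B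
  lip : ∀ z w, ‖z‖ ≤ 4 → ‖w‖ ≤ 4 → |k z - k w| ≤ B * ‖z - w‖
  four : ∀ x₁ x₂ x₃ x₄, ‖x₁‖ ≤ 4 → ‖x₂‖ ≤ 4 → ‖x₃‖ ≤ 4 → ‖x₄‖ ≤ 4 →
    |k x₁ - k x₂ - k x₃ + k x₄| ≤
      B * (‖x₁ - x₂ - x₃ + x₄‖ + (‖x₁ - x₃‖ + ‖x₂ - x₄‖) * ‖x₃ - x₄‖)

/-- Radial projection onto the unit sphere. -/
noncomputable def hat (y : E) : E := ‖y‖⁻¹ • y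

theorem norm_hat {y : E} (hy : y ≠ 0) : ‖hat y‖ = 1 := by
  rw [hat, norm_smul, norm_inv, norm_norm, inv_mul_cancel₀ (norm_ne_zero_iff.2 hy)]

theorem ae_ne_zero (hN : 2 ≤ finrank ℝ E) : ∀ᵐ y : E, y ≠ 0 := by
  have := nontrivial_of_two_le hN
  exact compl_mem_ae_iff.2 (measure_singleton 0)

theorem aesm_hat (hN : 2 ≤ finrank ℝ E) {u : E → ℝ}
    (hu : ContinuousOn u (sphere 0 1)) :
    AEStronglyMeasurable (fun y => u (hat y)) (volume : Measure E) := by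
  have h1 : ContinuousOn (fun y : E => u (hat y)) {0}ᶜ := by
    refine hu.comp (f := hat) ?_ ?_
    · intro y hy
      have : ‖y‖ ≠ 0 := norm_ne_zero_iff.2 hy
      unfold hat
      have : ContinuousAt (fun y : E => ‖y‖⁻¹ • y) y := by fun_prop (disch := assumption)
      exact this.continuousWithinAt
    · intro y hy
      rw [mem_sphere_zero_iff_norm]
      exact norm_hat hy
  have h2 := h1.aestronglyMeasurable (μ := volume) (measurableSet_singleton (0:E)).compl
  rwa [Measure.restrict_eq_self_of_ae_mem] at h2
  exact ae_ne_zero hN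

/-- The potential of kernel `k` generated by the body with boundary `exp (u σ) σ`, pulled back
to the unit ball, at the boundary point in direction `θ`. -/
noncomputable def farPot (k : E → ℝ) (u : E → ℝ) (θ : E) : ℝ :=
  ∫ y in ball (0 : E) 1,
    exp (dim E * u (hat y)) * k (exp (u (hat y)) • y - exp (u θ) • θ)

theorem XB.mono_left {η η' : ℝ} {u : E → ℝ} (h : XB α η u) (hη : η ≤ η') : XB α η' u where
  bound x hx := (h.bound x hx).trans hη
  lip x y hx hy := (h.lip x y hx hy).trans (by gcongr)
  second σ θ hσ hθ := (h.second σ θ hσ hθ).trans (by gcongr)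
  rot R δ hδ hR σ θ hσ hθ hd := (h.rot R δ hδ hR σ θ hσ hθ hd).trans (by gcongr)

theorem exp_le_two_of_XB {u : E → ℝ} (h : XB α (1 / 2) u) (hθ : ‖θ‖ = 1) :
    exp (u θ) ≤ 2 :=
  (exp_le_exp.2 (abs_le.1 (h.bound θ hθ)).2).trans exp_half_le_two

theorem abs_exp_sub_of_XB {ν : ℝ} {u₁ u₂ : E → ℝ} (h₁ : XB α (1 / 2) u₁) (h₂ : XB α (1 / 2) u₂)
    (h : XB α ν fun x => u₁ x - u₂ x) (hθ : ‖θ‖ = 1) :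
    |exp (u₁ θ) - exp (u₂ θ)| ≤ 2 * ν := by
  have h3 := abs_exp_mul_sub_le zero_le_one (h₁.bound θ hθ) (h₂.bound θ hθ)
  simp only [one_mul] at h3
  refine h3.trans ?_
  have := h.bound θ hθ
  have := exp_half_le_two
  gcongr

theorem norm_pos_sub_le {u : E → ℝ} (h : XB α (1 / 2) u) {θ θ' : E} (hθ : ‖θ‖ = 1)
    (hθ' : ‖θ'‖ = 1) :
    ‖exp (u θ) • θ - exp (u θ') • θ'‖ ≤ 3 * ‖θ - θ'‖ := by
  have h3 := abs_exp_mul_sub_le zero_le_one (h.bound θ hθ) (h.bound θ' hθ')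
  simp only [one_mul] at h3
  have h4 := h.lip θ θ' hθ hθ'
  have h5 := exp_half_le_two
  calc _ = ‖(exp (u θ) - exp (u θ')) • θ + exp (u θ') • (θ - θ')‖ := by
        congr 1; module
    _ ≤ |exp (u θ) - exp (u θ')| + exp (u θ') * ‖θ - θ'‖ := by
        refine (norm_add_le _ _).trans (le_of_eq ?_)
        rw [norm_smul, norm_smul, hθ, norm_eq_abs, norm_eq_abs, abs_exp, mul_one]
    _ ≤ 2 * (1 / 2 * ‖θ - θ'‖) + 2 * ‖θ - θ'‖ := by
        refine add_le_add (h3.trans (by gcongr)) ?_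
        have := exp_le_two_of_XB h hθ'
        gcongr
    _ = _ := by ring

theorem norm_pos_four_le {ν : ℝ} {u₁ u₂ : E → ℝ} (h₁ : XB α (1 / 2) u₁) (h₂ : XB α (1 / 2) u₂)
    (h : XB α ν fun x => u₁ x - u₂ x) {θ θ' : E} (hθ : ‖θ‖ = 1) (hθ' : ‖θ'‖ = 1) :
    ‖(exp (u₁ θ) • θ - exp (u₂ θ) • θ) -
      (exp (u₁ θ') • θ' - exp (u₂ θ') • θ')‖ ≤ 6 * ν * ‖θ - θ'‖ := by
  have h4 := abs_exp_fourPoint_le (h₁.bound θ hθ) (h₂.bound θ hθ) (h₁.bound θ' hθ')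
    (h₂.bound θ' hθ')
  have h5 := exp_half_le_two
  have h6 := h.nonneg hθ
  have l1 := h₁.lip θ θ' hθ hθ'
  have l2 := h₂.lip θ θ' hθ hθ'
  have l3 := h.lip θ θ' hθ hθ'
  have l4 := h.bound θ' hθ'
  rw [show u₁ θ - u₂ θ - (u₁ θ' - u₂ θ') = u₁ θ - u₂ θ - u₁ θ' + u₂ θ' by ring] at l3
  have l5 := abs_exp_sub_of_XB h₁ h₂ h hθ'
  calc _ = ‖(exp (u₁ θ) - exp (u₂ θ) - exp (u₁ θ') + exp (u₂ θ')) • θ +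
        (exp (u₁ θ') - exp (u₂ θ')) • (θ - θ')‖ := by congr 1; module
    _ ≤ |exp (u₁ θ) - exp (u₂ θ) - exp (u₁ θ') + exp (u₂ θ')| +
        |exp (u₁ θ') - exp (u₂ θ')| * ‖θ - θ'‖ := by
        refine (norm_add_le _ _).trans (le_of_eq ?_)
        rw [norm_smul, norm_smul, hθ, norm_eq_abs, norm_eq_abs, mul_one]
    _ ≤ (2 * (ν * ‖θ - θ'‖) + 2 * (1 / 2 * ‖θ - θ'‖ + 1 / 2 * ‖θ - θ'‖) * ν) +
        2 * ν * ‖θ - θ'‖ := by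
        refine add_le_add (h4.trans (by gcongr)) (by gcongr)
    _ = _ := by ring

theorem le_two_mul_rpow (hα : 0 < α) (hα1 : α < 1) {x y : E} (hx : ‖x‖ = 1) (hy : ‖y‖ = 1) :
    ‖x - y‖ ≤ 2 * ‖x - y‖ ^ ((1 - α) / 2) := by
  have h2 := norm_sub_le_two hx hy
  rcases (norm_nonneg (x - y)).eq_or_lt with h0 | h0
  · rw [← h0]; positivity
  have : ‖x - y‖ = ‖x - y‖ ^ ((1 + α) / 2) * ‖x - y‖ ^ ((1 - α) / 2) := by
    rw [← rpow_add h0, show (1 + α) / 2 + (1 - α) / 2 = 1 by ring, rpow_one]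
  nth_rw 1 [this]
  gcongr
  calc ‖x - y‖ ^ ((1 + α) / 2) ≤ 2 ^ ((1 + α) / 2) := by gcongr
    _ ≤ 2 ^ (1 : ℝ) := rpow_le_rpow_of_exponent_le (by norm_num) (by linarith)
    _ = 2 := by simp

theorem norm_farArg_le {u : E → ℝ} (h : XB α (1 / 2) u) {y : E} (hθ : ‖θ‖ = 1) (hy : ‖y‖ < 1)
    (hy0 : y ≠ 0) : ‖exp (u (hat y)) • y - exp (u θ) • θ‖ ≤ 4 := by
  have h1 := exp_le_two_of_XB h hθ
  have h2 := exp_le_two_of_XB h (norm_hat hy0)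
  refine (norm_sub_le _ _).trans ?_
  rw [norm_smul, norm_smul, hθ, norm_eq_abs, norm_eq_abs, abs_exp, abs_exp]
  nlinarith [norm_nonneg y, exp_pos (u (hat y))]

theorem exp_dim_le {u : E → ℝ} (h : XB α (1 / 2) u) (hθ : ‖θ‖ = 1) :
    exp (dim E * u θ) ≤ exp (dim E * (1 / 2)) := by
  have := (abs_le.1 (h.bound θ hθ)).2
  have : (0:ℝ) ≤ dim E := by positivity
  gcongr

theorem farPot_integrable (hN : 2 ≤ finrank ℝ E) {k : E → ℝ} {B : ℝ} (hk : KB B k)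
    {u : E → ℝ} (hu : XB α (1 / 2) u) (hθ : ‖θ‖ = 1) :
    IntegrableOn (fun y => exp (dim E * u (hat y)) *
      k (exp (u (hat y)) • y - exp (u θ) • θ)) (ball 0 1) := by
  have hm := aesm_hat hN hu.continuousOn
  have hc : AEMeasurable (fun y => exp (u (hat y)) • y - exp (u θ) • θ)
      (volume : Measure E) := by
    exact ((measurable_exp.comp_aemeasurable hm.aemeasurable).smul aemeasurable_id).sub_const _
  have hm2 : AEStronglyMeasurable (fun y => exp (dim E * u (hat y)) *
      k (exp (u (hat y)) • y - exp (u θ) • θ)) (volume : Measure E) := by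
    have h2 := hk.meas.comp_aemeasurable hc
    have h3 := measurable_exp.comp_aemeasurable (hm.aemeasurable.const_mul (dim E))
    exact (h3.mul h2).aestronglyMeasurable
  refine Measure.integrableOn_of_bounded (M := exp (dim E * (1 / 2)) * B)
    measure_ball_lt_top.ne hm2 ?_
  filter_upwards [self_mem_ae_restrict isOpen_ball.measurableSet,
    ae_restrict_of_ae (ae_ne_zero hN)] with y hy hy0
  rw [mem_ball_zero_iff] at hy
  rw [norm_eq_abs, abs_mul, abs_exp]
  have := hk.bound _ (norm_farArg_le hu hθ hy hy0)
  have := exp_dim_le hu (norm_hat hy0)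
  gcongr

theorem exists_farPot_HB (hN : 2 ≤ finrank ℝ E) (hα : 0 < α) (hα1 : α < 1) :
    ∃ K, 0 ≤ K ∧ ∀ (k : E → ℝ) (B : ℝ), KB B k →
      (∀ u, XB α (1 / 2) u → HB α (K * B) (farPot k u)) ∧
      ∀ (u₁ u₂ : E → ℝ) (ν : ℝ), XB α (1 / 2) u₁ → XB α (1 / 2) u₂ →
        XB α ν (fun x => u₁ x - u₂ x) →
        HB α (K * (B * ν)) (fun θ => farPot k u₁ θ - farPot k u₂ θ) := by
  set M := exp (dim E * (1 / 2)) with hM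
  set v := (volume : Measure E).real (ball 0 1) with hv
  have hd : (0:ℝ) ≤ dim E := by positivity
  have hM0 : 0 < M := exp_pos _
  have hv0 : 0 ≤ v := measureReal_nonneg
  have hvt : (volume : Measure E) (ball 0 1) < ⊤ := measure_ball_lt_top
  refine ⟨M * (6 * dim E + 60) * v, by positivity, ?_⟩
  intro k B hk
  have hB : 0 ≤ B := (abs_nonneg _).trans (hk.bound 0 (by simp))
  have hae : ∀ᵐ y : E ∂(volume : Measure E).restrict (ball 0 1), ‖y‖ < 1 ∧ y ≠ 0 := by
    filter_upwards [self_mem_ae_restrict isOpen_ball.measurableSet,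
      ae_restrict_of_ae (ae_ne_zero hN)] with y hy hy0
    exact ⟨by simpa using hy, hy0⟩
  have hInt : ∀ (f : E → ℝ) (C : ℝ), (∀ y, ‖y‖ < 1 → y ≠ 0 → |f y| ≤ C) →
      |∫ y in ball (0 : E) 1, f y| ≤ C * v := by
    intro f C hf
    have := norm_setIntegral_le_of_norm_le_const_ae (μ := volume) (f := f) (C := C) hvt
      (hae.mono fun y hy => hf y hy.1 hy.2)
    simpa [norm_eq_abs] using this
  constructor
  · intro u hu
    constructor
    · intro θ hθ
      refine (hInt _ (M * B) ?_).trans ?_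
      · intro y hy hy0
        rw [abs_mul, abs_exp]
        have := hk.bound _ (norm_farArg_le hu hθ hy hy0)
        have := exp_dim_le hu (norm_hat hy0)
        gcongr
      · have : 0 ≤ M * B * v * (6 * dim E + 59) := by positivity
        linarith
    · intro θ θ' hθ hθ'
      unfold farPot
      rw [← integral_sub (farPot_integrable hN hk hu hθ) (farPot_integrable hN hk hu hθ')]
      refine (hInt _ (M * (B * (3 * (2 * ‖θ - θ'‖ ^ ((1 - α) / 2))))) ?_).trans ?_
      · intro y hy hy0
        rw [← mul_sub, abs_mul, abs_exp]
        have h1 := hk.lip _ _ (norm_farArg_le hu hθ hy hy0) (norm_farArg_le hu hθ' hy hy0)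
        rw [sub_sub_sub_cancel_left, norm_sub_rev] at h1
        have h2 := norm_pos_sub_le hu hθ hθ'
        have h3 := le_two_mul_rpow hα hα1 hθ hθ'
        have h4 := exp_dim_le hu (norm_hat hy0)
        have h5 := h1.trans (b := _) (mul_le_mul_of_nonneg_left
          (h2.trans (mul_le_mul_of_nonneg_left h3 (by norm_num))) hB)
        gcongr
      · have : 0 ≤ M * B * v * (6 * dim E + 54) * ‖θ - θ'‖ ^ ((1 - α) / 2) := by positivity
        linarith
  · intro u₁ u₂ ν h₁ h₂ h
    have hm : ∀ y : E, y ≠ 0 → |exp (dim E * u₁ (hat y)) - exp (dim E * u₂ (hat y))| ≤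
        dim E * M * ν := by
      intro y hy0
      have hy := norm_hat hy0
      refine (abs_exp_mul_sub_le hd (h₁.bound _ hy) (h₂.bound _ hy)).trans ?_
      have := h.bound _ hy
      gcongr
    have hz : ∀ y θ : E, ‖y‖ < 1 → y ≠ 0 → ‖θ‖ = 1 →
        ‖(exp (u₁ (hat y)) • y - exp (u₁ θ) • θ) -
          (exp (u₂ (hat y)) • y - exp (u₂ θ) • θ)‖ ≤ 4 * ν := by
      intro y θ hy hy0 hθ
      have e1 := abs_exp_sub_of_XB h₁ h₂ h hθ
      have e2 := abs_exp_sub_of_XB h₁ h₂ h (norm_hat hy0)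
      have hν := h.nonneg hθ
      calc _ = ‖(exp (u₁ (hat y)) - exp (u₂ (hat y))) • y -
            (exp (u₁ θ) - exp (u₂ θ)) • θ‖ := by congr 1; module
        _ ≤ |exp (u₁ (hat y)) - exp (u₂ (hat y))| * ‖y‖ +
            |exp (u₁ θ) - exp (u₂ θ)| := by
            refine (norm_sub_le _ _).trans (le_of_eq ?_)
            rw [norm_smul, norm_smul, hθ, norm_eq_abs, norm_eq_abs, mul_one]
        _ ≤ 2 * ν * 1 + 2 * ν := by gcongr
        _ = _ := by ring
    constructor
    · intro θ hθ
      have hν := h.nonneg hθ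
      unfold farPot
      rw [← integral_sub (farPot_integrable hN hk h₁ hθ) (farPot_integrable hN hk h₂ hθ)]
      refine (hInt _ (dim E * M * ν * B + M * (B * (4 * ν))) ?_).trans ?_
      · intro y hy hy0
        have a1 := norm_farArg_le h₁ hθ hy hy0
        have a2 := norm_farArg_le h₂ hθ hy hy0
        have b1 := hk.bound _ a1
        have b2 := (hk.lip _ _ a1 a2).trans (mul_le_mul_of_nonneg_left (hz y θ hy hy0 hθ) hB)
        have b3 := hm y hy0
        have b4 := exp_dim_le h₂ (norm_hat hy0)
        set k1 := k (exp (u₁ (hat y)) • y - exp (u₁ θ) • θ)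
        set k2 := k (exp (u₂ (hat y)) • y - exp (u₂ θ) • θ)
        calc _ = |(exp (dim E * u₁ (hat y)) - exp (dim E * u₂ (hat y))) * k1 +
              exp (dim E * u₂ (hat y)) * (k1 - k2)| := by congr 1; ring
          _ ≤ |exp (dim E * u₁ (hat y)) - exp (dim E * u₂ (hat y))| * |k1| +
              exp (dim E * u₂ (hat y)) * |k1 - k2| := by
              refine (abs_add_le _ _).trans (le_of_eq ?_)
              rw [abs_mul, abs_mul, abs_exp]
          _ ≤ _ := by gcongr
      · have : 0 ≤ M * (B * ν) * v * (5 * dim E + 56) := by positivity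
        linarith
    · intro θ θ' hθ hθ'
      have hν := h.nonneg hθ
      have i1 := fun θ (hθ : ‖θ‖ = 1) => farPot_integrable hN hk h₁ hθ
      have i2 := fun θ (hθ : ‖θ‖ = 1) => farPot_integrable hN hk h₂ hθ
      have j : ∀ θ, ‖θ‖ = 1 → IntegrableOn (fun y =>
          exp (dim E * u₁ (hat y)) * k (exp (u₁ (hat y)) • y - exp (u₁ θ) • θ) -
          exp (dim E * u₂ (hat y)) * k (exp (u₂ (hat y)) • y - exp (u₂ θ) • θ))
          (ball 0 1) := fun θ hθ => (i1 θ hθ).sub (i2 θ hθ)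
      unfold farPot
      rw [← integral_sub (i1 θ hθ) (i2 θ hθ), ← integral_sub (i1 θ' hθ') (i2 θ' hθ'),
        ← integral_sub (j θ hθ) (j θ' hθ')]
      refine (hInt _ ((dim E * M * ν * (B * 3) + M * (B * (30 * ν))) *
        (2 * ‖θ - θ'‖ ^ ((1 - α) / 2))) ?_).trans ?_
      · intro y hy hy0
        have a1 := norm_farArg_le h₁ hθ hy hy0
        have a2 := norm_farArg_le h₂ hθ hy hy0
        have a1' := norm_farArg_le h₁ hθ' hy hy0
        have a2' := norm_farArg_le h₂ hθ' hy hy0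
        have c1 := hk.lip _ _ a1 a1'
        have c2 := hk.four _ _ _ _ a1 a2 a1' a2'
        have b3 := hm y hy0
        have b4 := exp_dim_le h₂ (norm_hat hy0)
        have z := hz y θ' hy hy0 hθ'
        have p1 := norm_pos_sub_le h₁ hθ hθ'
        have p2 := norm_pos_sub_le h₂ hθ hθ'
        have p4 := norm_pos_four_le h₁ h₂ h hθ hθ'
        rw [show (exp (u₁ (hat y)) • y - exp (u₁ θ) • θ) -
          (exp (u₂ (hat y)) • y - exp (u₂ θ) • θ) -
          (exp (u₁ (hat y)) • y - exp (u₁ θ') • θ') +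
          (exp (u₂ (hat y)) • y - exp (u₂ θ') • θ') =
          -((exp (u₁ θ) • θ - exp (u₂ θ) • θ) -
            (exp (u₁ θ') • θ' - exp (u₂ θ') • θ')) by abel, norm_neg,
          sub_sub_sub_cancel_left, sub_sub_sub_cancel_left, norm_sub_rev (exp (u₁ θ') • θ'),
          norm_sub_rev (exp (u₂ θ') • θ')] at c2
        rw [sub_sub_sub_cancel_left, norm_sub_rev] at c1
        set k1 := k (exp (u₁ (hat y)) • y - exp (u₁ θ) • θ)
        set k2 := k (exp (u₂ (hat y)) • y - exp (u₂ θ) • θ)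
        set k3 := k (exp (u₁ (hat y)) • y - exp (u₁ θ') • θ')
        set k4 := k (exp (u₂ (hat y)) • y - exp (u₂ θ') • θ')
        have c1' : |k1 - k3| ≤ B * 3 * ‖θ - θ'‖ := c1.trans (by nlinarith)
        have c2' : |k1 - k2 - k3 + k4| ≤ B * (30 * ν) * ‖θ - θ'‖ :=
          calc _ ≤ B * (6 * ν * ‖θ - θ'‖ + (3 * ‖θ - θ'‖ + 3 * ‖θ - θ'‖) * (4 * ν)) :=
                c2.trans (by gcongr)
            _ = _ := by ring
        calc _ = |(exp (dim E * u₁ (hat y)) - exp (dim E * u₂ (hat y))) * (k1 - k3) +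
              exp (dim E * u₂ (hat y)) * (k1 - k2 - k3 + k4)| := by congr 1; ring
          _ ≤ |exp (dim E * u₁ (hat y)) - exp (dim E * u₂ (hat y))| * |k1 - k3| +
              exp (dim E * u₂ (hat y)) * |k1 - k2 - k3 + k4| := by
              refine (abs_add_le _ _).trans (le_of_eq ?_)
              rw [abs_mul, abs_mul, abs_exp]
          _ ≤ (dim E * M * ν) * (B * 3 * ‖θ - θ'‖) + M * (B * (30 * ν) * ‖θ - θ'‖) := by gcongr
          _ = (dim E * M * ν * (B * 3) + M * (B * (30 * ν))) * ‖θ - θ'‖ := by ring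
          _ ≤ _ := by
              have := le_two_mul_rpow hα hα1 hθ hθ'
              gcongr
      · exact le_of_eq (by ring)

/-- Superposition of the kernels `‖·‖ ^ (-s)` centred at the points `-q i`. -/
noncomputable def latKer {ι : Type*} (s : ℝ) (q : ι → E) (z : E) : ℝ := ∑' i, ‖z + q i‖ ^ (-s)

theorem rpow_neg_add_le {s : ℝ} (hs : 0 < s) {z q : E} (hz : ‖z‖ ≤ 4) (hq : 8 ≤ ‖q‖) :
    ‖z + q‖ ^ (-s) ≤ 2 ^ s * ‖q‖ ^ (-s) := by
  have h1 : ‖q‖ / 2 ≤ ‖z + q‖ := by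
    have := norm_sub_norm_le q (-z)
    rw [norm_neg, sub_neg_eq_add, add_comm q] at this
    linarith
  calc _ ≤ (‖q‖ / 2) ^ (-s) := rpow_le_rpow_of_nonpos (by linarith) h1 (by linarith)
    _ = _ := by
      rw [div_rpow (by positivity) (by norm_num), rpow_neg (by norm_num : (0:ℝ) ≤ 2)]
      field_simp

theorem latKer_summable {ι : Type*} {s : ℝ} (hs : 0 < s) {q : ι → E} (hq : ∀ i, 8 ≤ ‖q i‖)
    (hsum : Summable fun i => ‖q i‖ ^ (-s)) {z : E} (hz : ‖z‖ ≤ 4) :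
    Summable fun i => ‖z + q i‖ ^ (-s) :=
  Summable.of_nonneg_of_le (fun _ => by positivity) (fun i => rpow_neg_add_le hs hz (hq i))
    (hsum.mul_left _)

theorem exists_latKer_KB {s : ℝ} (hs : 0 < s) : ∃ C, 0 ≤ C ∧ ∀ (ι : Type) [Countable ι]
    (q : ι → E), (∀ i, 8 ≤ ‖q i‖) → (Summable fun i => ‖q i‖ ^ (-s)) →
    KB (C * ∑' i, ‖q i‖ ^ (-s)) (latKer s q) := by
  obtain ⟨C, hC, h4⟩ := abs_norm_rpow_fourPoint_le (E := E) (-s) 3 (by norm_num)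
  refine ⟨2 ^ s * (1 + 2 * s + C), by positivity, ?_⟩
  intro ι _ q hq hsum
  have hS : 0 ≤ ∑' i, ‖q i‖ ^ (-s) := tsum_nonneg fun _ => by positivity
  have hsm := fun z (hz : ‖z‖ ≤ 4) => latKer_summable hs hq hsum hz
  have hlow : ∀ i z, ‖z‖ ≤ 4 → ‖q i‖ / 2 ≤ ‖z + q i‖ ∧ ‖z + q i‖ ≤ 3 * (‖q i‖ / 2) := by
    intro i z hz
    have h1 := norm_sub_norm_le (q i) (-z)
    have h2 := norm_add_le z (q i)
    rw [norm_neg, sub_neg_eq_add, add_comm (q i)] at h1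
    have := hq i
    constructor <;> linarith
  have hpow : ∀ i (b : ℝ), b ≤ 0 → (‖q i‖ / 2) ^ (-s + b) ≤ 2 ^ s * ‖q i‖ ^ (-s) := by
    intro i b hb
    have := hq i
    calc _ ≤ (‖q i‖ / 2) ^ (-s) :=
          rpow_le_rpow_of_exponent_le (by linarith) (by linarith)
      _ = _ := by
        rw [div_rpow (by positivity) (by norm_num), rpow_neg (by norm_num : (0:ℝ) ≤ 2)]
        field_simp
  constructor
  · have e : latKer s q = fun z => (∑' i, ofReal (‖z + q i‖ ^ (-s))).toReal := by
      funext z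
      rw [ENNReal.tsum_toReal_eq (fun _ => ofReal_ne_top), latKer]
      congr 1; funext i
      rw [toReal_ofReal (by positivity)]
    rw [e]
    exact (Measurable.tsum fun i => by fun_prop).ennreal_toReal
  · intro z hz
    have := tsum_of_norm_bounded (hsum.mul_left (2 ^ s)).hasSum
      (f := fun i => ‖z + q i‖ ^ (-s)) (fun i => by
        rw [norm_of_nonneg (by positivity)]
        exact rpow_neg_add_le hs hz (hq i))
    rw [tsum_mul_left, norm_eq_abs] at this
    refine this.trans ?_
    have : 0 ≤ 2 ^ s * (2 * s + C) * ∑' i, ‖q i‖ ^ (-s) := by positivity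
    linarith
  · intro z w hz hw
    unfold latKer
    rw [← (hsm z hz).tsum_sub (hsm w hw)]
    have := tsum_of_norm_bounded (hsum.mul_left (s * ‖z - w‖ * (2 * 2 ^ s))).hasSum
      (f := fun i => ‖z + q i‖ ^ (-s) - ‖w + q i‖ ^ (-s)) (fun i => by
        obtain ⟨a1, -⟩ := hlow i z hz
        obtain ⟨b1, -⟩ := hlow i w hw
        have hqi : 0 < ‖q i‖ / 2 := by linarith [hq i]
        have := abs_norm_rpow_sub_le (b := -s) (by linarith) (x := z + q i) (y := w + q i)
          (norm_pos_iff.1 (hqi.trans_le a1)) (norm_pos_iff.1 (hqi.trans_le b1))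
        rw [add_sub_add_right_eq_sub, abs_neg, abs_of_pos hs] at this
        rw [norm_eq_abs]
        have p := hpow i (-1) (by norm_num)
        have p1 := (rpow_le_rpow_of_nonpos hqi a1 (z := -s - 1) (by linarith)).trans p
        have p2 := (rpow_le_rpow_of_nonpos hqi b1 (z := -s - 1) (by linarith)).trans p
        calc _ ≤ _ := this
          _ ≤ s * ‖z - w‖ * (2 ^ s * ‖q i‖ ^ (-s) + 2 ^ s * ‖q i‖ ^ (-s)) := by gcongr
          _ = _ := by ring)
    rw [tsum_mul_left, norm_eq_abs] at this
    refine this.trans ?_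
    have : 0 ≤ 2 ^ s * (1 + C) * (∑' i, ‖q i‖ ^ (-s)) * ‖z - w‖ := by positivity
    linarith
  · intro x₁ x₂ x₃ x₄ h₁ h₂ h₃ h₄
    unfold latKer
    rw [← (hsm _ h₁).tsum_sub (hsm _ h₂), ← ((hsm _ h₁).sub (hsm _ h₂)).tsum_sub (hsm _ h₃),
      ← (((hsm _ h₁).sub (hsm _ h₂)).sub (hsm _ h₃)).tsum_add (hsm _ h₄)]
    set X := ‖x₁ - x₂ - x₃ + x₄‖ + (‖x₁ - x₃‖ + ‖x₂ - x₄‖) * ‖x₃ - x₄‖ with hX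
    have hX0 : 0 ≤ X := by positivity
    have := tsum_of_norm_bounded (hsum.mul_left (C * X * 2 ^ s)).hasSum
      (f := fun i => ‖x₁ + q i‖ ^ (-s) - ‖x₂ + q i‖ ^ (-s) - ‖x₃ + q i‖ ^ (-s) +
        ‖x₄ + q i‖ ^ (-s)) (fun i => by
        have hqi : 0 < ‖q i‖ / 2 := by linarith [hq i]
        have := h4 (‖q i‖ / 2) _ _ _ _ hqi (hlow i _ h₁) (hlow i _ h₂) (hlow i _ h₃) (hlow i _ h₄)
        rw [show x₁ + q i - (x₂ + q i) - (x₃ + q i) + (x₄ + q i) = x₁ - x₂ - x₃ + x₄ by abel,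
          add_sub_add_right_eq_sub, add_sub_add_right_eq_sub, add_sub_add_right_eq_sub] at this
        rw [norm_eq_abs]
        have p := hpow i (-1) (by norm_num)
        have p' := hpow i (-2) (by norm_num)
        calc _ ≤ _ := this
          _ ≤ C * (2 ^ s * ‖q i‖ ^ (-s) * ‖x₁ - x₂ - x₃ + x₄‖ +
              2 ^ s * ‖q i‖ ^ (-s) * ((‖x₁ - x₃‖ + ‖x₂ - x₄‖) * ‖x₃ - x₄‖)) := by
              gcongr
              · exact p
              · exact p'
          _ = _ := by rw [hX]; ring)
    rw [tsum_mul_left, norm_eq_abs] at this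
    refine this.trans ?_
    have : 0 ≤ 2 ^ s * (1 + 2 * s) * (∑' i, ‖q i‖ ^ (-s)) * X := by positivity
    linarith

/-- The nonzero elements of `L` scaled by `r`. -/
def scaledPts (L : Submodule ℤ E) (r : ℝ) (p : {p : L // p ≠ 0}) : E := r • (p.1 : E)

theorem exists_min_norm (L : Submodule ℤ E) [DiscreteTopology L] :
    ∃ m, 0 < m ∧ ∀ p ∈ L, p ≠ 0 → m ≤ ‖p‖ := by
  have h : IsOpen ({0} : Set L) := isOpen_discrete _
  obtain ⟨m, hm, hb⟩ := Metric.isOpen_iff.1 h 0 rfl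
  refine ⟨m, hm, fun p hp hp0 => ?_⟩
  by_contra hlt
  push Not at hlt
  have : (⟨p, hp⟩ : L) ∈ ({0} : Set L) := hb (by
    rw [Metric.mem_ball, dist_zero_right]; exact hlt)
  exact hp0 (by simpa using this)

theorem scaledPts_summable (L : Submodule ℤ E) [DiscreteTopology L] {s : ℝ}
    (hs : (finrank ℤ L : ℝ) < s) {r : ℝ} (hr : 0 < r) :
    (Summable fun p => ‖scaledPts L r p‖ ^ (-s)) ∧
      ∑' p, ‖scaledPts L r p‖ ^ (-s) = r ^ (-s) * ∑' p : {p : L // p ≠ 0}, ‖p.1‖ ^ (-s) := by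
  have h1 := (ZLattice.summable_norm_rpow L (-s) (by linarith)).comp_injective
    (Subtype.val_injective (p := fun p : L => p ≠ 0))
  have e : ∀ p : {p : L // p ≠ 0}, ‖scaledPts L r p‖ ^ (-s) = r ^ (-s) * ‖p.1‖ ^ (-s) := by
    intro p
    rw [scaledPts, norm_smul, norm_of_nonneg hr.le, mul_rpow hr.le (norm_nonneg _)]
    rfl
  simp_rw [e]
  exact ⟨h1.mul_left _, tsum_mul_left⟩

theorem latKer_scaledPts_neg (L : Submodule ℤ E) (s r : ℝ) (z : E) :
    latKer s (scaledPts L r) (-z) = latKer s (scaledPts L r) z := by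
  unfold latKer
  let e : {p : L // p ≠ 0} ≃ {p : L // p ≠ 0} :=
    (Equiv.neg L).subtypeEquiv (fun p => by simp)
  rw [← e.tsum_eq]
  congr 1; funext p
  have : scaledPts L r (e p) = -scaledPts L r p := by simp [scaledPts, e]
  rw [this, ← neg_add, norm_neg]

theorem HB_comp_sub (hα : 0 < α) (hα1 : α < 1) {f f' f'' : ℝ → ℝ} {M₁ M₂ η ν : ℝ}
    (hf : ∀ x ∈ Icc (-η) η, HasDerivAt f (f' x) x)
    (hf' : ∀ x ∈ Icc (-η) η, HasDerivAt f' (f'' x) x)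
    (h₁ : ∀ x ∈ Icc (-η) η, |f' x| ≤ M₁) (h₂ : ∀ x ∈ Icc (-η) η, |f'' x| ≤ M₂)
    (hM₁ : 0 ≤ M₁) (hM₂ : 0 ≤ M₂) {u₁ u₂ : E → ℝ} (hu₁ : XB α η u₁) (hu₂ : XB α η u₂)
    (hu : XB α ν fun x => u₁ x - u₂ x) :
    HB α ((2 * M₁ + 4 * η * M₂) * ν) (fun x => f (u₁ x) - f (u₂ x)) := by
  have m₁ : ∀ x, ‖x‖ = 1 → u₁ x ∈ Icc (-η) η := fun x hx => abs_le.1 (hu₁.bound x hx)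
  have m₂ : ∀ x, ‖x‖ = 1 → u₂ x ∈ Icc (-η) η := fun x hx => abs_le.1 (hu₂.bound x hx)
  refine ⟨fun x hx => ?_, fun x y hx hy => ?_⟩
  · have h4 := abs_fourPoint_le (convex_Icc _ _) hf hf' h₁ h₂ (m₁ x hx) (m₂ x hx) (m₂ x hx)
      (m₂ x hx)
    have hν := hu.nonneg hx
    have hη := hu₁.nonneg hx
    have hb := hu.bound x hx
    have e1 : f (u₁ x) - f (u₂ x) - f (u₂ x) + f (u₂ x) = f (u₁ x) - f (u₂ x) := by ring
    have e2 : u₁ x - u₂ x - u₂ x + u₂ x = u₁ x - u₂ x := by ring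
    rw [e1, e2, sub_self (u₂ x), abs_zero, mul_zero, add_zero] at h4
    have := mul_le_mul_of_nonneg_left hb hM₁
    have : 0 ≤ M₁ * ν := by positivity
    have : 0 ≤ η * M₂ * ν := by positivity
    nlinarith
  · have h4 := abs_fourPoint_le (convex_Icc _ _) hf hf' h₁ h₂ (m₁ x hx) (m₂ x hx) (m₁ y hy)
      (m₂ y hy)
    have hν := hu.nonneg hx
    have hη := hu₁.nonneg hx
    have hb := hu.bound y hy
    have hl := hu.lip x y hx hy
    have hl1 := hu₁.lip x y hx hy
    have hl2 := hu₂.lip x y hx hy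
    have hd := le_two_mul_rpow hα hα1 hx hy
    rw [show f (u₁ x) - f (u₂ x) - (f (u₁ y) - f (u₂ y)) =
      f (u₁ x) - f (u₂ x) - f (u₁ y) + f (u₂ y) by ring]
    rw [show u₁ x - u₂ x - (u₁ y - u₂ y) = u₁ x - u₂ x - u₁ y + u₂ y by ring] at hl
    refine h4.trans ?_
    set D := ‖x - y‖ ^ ((1 - α) / 2)
    calc _ ≤ M₁ * (ν * (2 * D)) + M₂ * (η * (2 * D) + η * (2 * D)) * ν := by
          have a1 : ν * ‖x - y‖ ≤ ν * (2 * D) := by gcongr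
          have a2 : η * ‖x - y‖ ≤ η * (2 * D) := by gcongr
          gcongr
          · exact hl.trans a1
          · exact hl2.trans a2
          · exact hl1.trans a2
      _ = _ := by ring

theorem exp_mul_le_two (hα : 0 < α) (hα1 : α < 1) {x : ℝ} (hx : x ∈ Icc (-(1/2):ℝ) (1 / 2)) :
    exp (α * x) ≤ 2 := by
  refine (exp_le_exp.2 ?_).trans exp_half_le_two
  nlinarith [hx.1, hx.2]

theorem HB_exp_sub (hα : 0 < α) (hα1 : α < 1) {ν : ℝ} {u₁ u₂ : E → ℝ} (hu₁ : XB α (1 / 2) u₁)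
    (hu₂ : XB α (1 / 2) u₂) (hu : XB α ν fun x => u₁ x - u₂ x) :
    HB α (8 * ν) (fun x => exp (α * u₁ x) - exp (α * u₂ x)) := by
  have h1 : ∀ x : ℝ, HasDerivAt (fun x => exp (α * x)) (α * exp (α * x)) x := fun x => by
    have := ((hasDerivAt_id x).const_mul α).exp
    simpa [mul_comm] using this
  have h2 : ∀ x : ℝ, HasDerivAt (fun x => α * exp (α * x)) (α * (α * exp (α * x))) x :=
    fun x => (h1 x).const_mul α
  have := HB_comp_sub hα hα1 (M₁ := 2) (M₂ := 2) (fun x _ => h1 x) (fun x _ => h2 x) ?_ ?_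
    (by norm_num) (by norm_num) hu₁ hu₂ hu
  · convert this using 2; ring
  · intro x hx
    have := exp_mul_le_two hα hα1 hx
    rw [abs_of_pos (by positivity)]
    nlinarith [exp_pos (α * x)]
  · intro x hx
    have := exp_mul_le_two hα hα1 hx
    rw [abs_of_pos (by positivity)]
    have : α * exp (α * x) ≤ 2 := by nlinarith [exp_pos (α * x)]
    have h0 : 0 < α * exp (α * x) := by positivity
    nlinarith

theorem HB_exp (hα : 0 < α) (hα1 : α < 1) {u : E → ℝ} (hu : XB α (1 / 2) u) :
    HB α 5 (fun x => exp (α * u x)) := by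
  have h0 : XB α (1 / 2) fun _ : E => 0 := XB.zero (by norm_num)
  have := HB_exp_sub hα hα1 hu h0 (ν := 1 / 2) (by simpa using hu)
  have h1 : HB α 1 fun _ : E => (1:ℝ) := ⟨fun x _ => by simp, fun x y _ _ => by simp; positivity⟩
  have h2 := this.add h1
  norm_num at h2
  exact h2

theorem HB_lin_sub (hα : 0 < α) (hα1 : α < 1) {η ν : ℝ} (hη : 0 ≤ η) (hη1 : η ≤ 1 / 2)
    {u₁ u₂ : E → ℝ} (hu₁ : XB α η u₁)
    (hu₂ : XB α η u₂) (hu : XB α ν fun x => u₁ x - u₂ x) :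
    HB α (12 * (η * ν)) (fun x => (1 - exp (α * u₁ x) + α * u₁ x) -
      (1 - exp (α * u₂ x) + α * u₂ x)) := by
  have h1 : ∀ x : ℝ, HasDerivAt (fun x => exp (α * x)) (α * exp (α * x)) x := fun x => by
    have := ((hasDerivAt_id x).const_mul α).exp
    simpa [mul_comm] using this
  have h3 : ∀ x : ℝ, HasDerivAt (fun x => 1 - exp (α * x) + α * x)
      (-(α * exp (α * x)) + α) x := fun x => by
    have := ((h1 x).const_sub 1).fun_add ((hasDerivAt_id x).const_mul α)
    simpa using this
  have h2 : ∀ x : ℝ, HasDerivAt (fun x => -(α * exp (α * x)) + α)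
      (-(α * (α * exp (α * x)))) x :=
    fun x => (((h1 x).const_mul α).neg).add_const α
  have := HB_comp_sub hα hα1 (M₁ := 2 * η) (M₂ := 2) (fun x _ => h3 x) (fun x _ => h2 x) ?_ ?_
    (by positivity) (by norm_num) hu₁ hu₂ hu
  · convert this using 1; ring
  · intro x hx
    have hb := abs_exp_mul_sub_le (c := α) (R := 1 / 2) (a := x) (b := 0) hα.le
      (abs_le.2 ⟨by linarith [hx.1], by linarith [hx.2]⟩) (by norm_num)
    have hx' : |x| ≤ η := abs_le.2 hx
    have he := exp_mul_le_two hα hα1 (x := 1 / 2) ⟨by norm_num, le_rfl⟩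
    rw [mul_zero, exp_zero, sub_zero] at hb
    rw [show -(α * exp (α * x)) + α = -(α * (exp (α * x) - 1)) by ring, abs_neg, abs_mul,
      abs_of_pos hα]
    have k1 : |exp (α * x) - 1| ≤ 2 * η := by
      refine hb.trans ?_
      calc α * exp (α * (1 / 2)) * |x| ≤ 1 * 2 * η := by gcongr
        _ = 2 * η := by ring
    nlinarith [abs_nonneg (exp (α * x) - 1)]
  · intro x hx
    have := exp_mul_le_two hα hα1 (x := x) ⟨by linarith [hx.1], by linarith [hx.2]⟩
    rw [abs_neg, abs_of_pos (by positivity)]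
    have : α * exp (α * x) ≤ 2 := by nlinarith [exp_pos (α * x)]
    have h0 : 0 < α * exp (α * x) := by positivity
    nlinarith

/-- The right-hand side of the equation for the logarithmic radius `u`, once the linearization of
the nonlocal mean curvature has been isolated. -/
noncomputable def rhs (α lam : ℝ) (k : E → ℝ) (u : E → ℝ) (θ : E) : ℝ :=
  lam / α * (1 - exp (α * u θ) + α * u θ) - qRem α u θ - exp (α * u θ) * farPot k u θ

theorem qRem_zero (θ : E) : qRem α (fun _ : E => 0) θ = 0 := by
  simp [qRem, qInt_zero]

theorem exists_rhs_HB (hN : 2 ≤ finrank ℝ E) (hα : 0 < α) (hα1 : α < 1) (lam : ℝ) :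
    ∃ K, 0 ≤ K ∧ ∀ (k : E → ℝ) (B : ℝ), KB B k →
      HB α (K * B) (rhs α lam k fun _ => 0) ∧
      ∀ (u₁ u₂ : E → ℝ) (η ν : ℝ), η ≤ 1 / 2 → XB α η u₁ → XB α η u₂ →
        XB α ν (fun x => u₁ x - u₂ x) →
        HB α (K * ((η + B) * ν)) (fun θ => rhs α lam k u₁ θ - rhs α lam k u₂ θ) := by
  obtain ⟨K1, hK1, h1⟩ := qRem_HB hN hα hα1
  obtain ⟨K2, hK2, h2⟩ := exists_farPot_HB hN hα hα1
  obtain ⟨e, he⟩ := exists_unit hN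
  refine ⟨|lam / α| * 12 + K1 + 26 * K2, by positivity, fun k B hk => ?_⟩
  have hB : 0 ≤ B := (abs_nonneg _).trans (hk.bound 0 (by simp))
  obtain ⟨h3, h4⟩ := h2 k B hk
  constructor
  · have := (h3 _ (XB.zero (by norm_num))).const_mul (-1)
    rw [abs_neg, abs_one, one_mul] at this
    refine (this.mono ?_).congr fun x _ => ?_
    · gcongr
      have := mul_nonneg (abs_nonneg (lam / α)) (show (0:ℝ) ≤ 12 by norm_num)
      linarith
    · simp [rhs, qRem_zero]
  · intro u₁ u₂ η ν hη hu₁ hu₂ hu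
    have hη0 := hu₁.nonneg he
    have hν0 := hu.nonneg he
    have hu₁' := hu₁.mono_left hη
    have hu₂' := hu₂.mono_left hη
    have a1 := (HB_lin_sub hα hα1 hη0 hη hu₁ hu₂ hu).const_mul (lam / α)
    have a2 := h1 u₁ u₂ η ν (by linarith) hu₁ hu₂ hu
    have a3 := (HB_exp hα hα1 hu₁').mul (h4 u₁ u₂ ν hu₁' hu₂' hu)
    have a4 := (HB_exp_sub hα hα1 hu₁' hu₂' hu).mul (h3 u₂ hu₂')
    refine (((a1.sub a2).sub a3).sub a4).mono ?_ |>.congr fun x _ => ?_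
    · have := mul_nonneg hη0 hν0
      have := mul_nonneg hB hν0
      have := mul_nonneg (abs_nonneg (lam / α)) (mul_nonneg hB hν0)
      have := mul_nonneg hK1 (mul_nonneg hB hν0)
      have := mul_nonneg hK2 (mul_nonneg hη0 hν0)
      linarith
    · simp only [rhs]; ring

theorem qRem_even {u : E → ℝ} (hu : ∀ x, ‖x‖ = 1 → u (-x) = u x) (hθ : ‖θ‖ = 1) :
    qRem α u (-θ) = qRem α u θ := by
  rw [qRem, qRem, ← surf_integral_comp (LinearIsometryEquiv.neg ℝ)]
  refine integral_congr_ae ?_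
  filter_upwards [ae_surf_norm] with σ hσ
  have h1 := axisRefl_map (LinearIsometryEquiv.neg ℝ) θ σ
  rw [LinearIsometryEquiv.coe_neg] at h1 ⊢
  simp only [qInt]
  rw [h1, hu _ hσ, hu _ hθ, hu _ (by rw [norm_axisRefl hθ, hσ]), neg_sub_neg, norm_sub_rev]

theorem hat_neg (y : E) : hat (-y) = -hat y := by simp [hat]

theorem farPot_even {k u : E → ℝ} (hk : ∀ z, k (-z) = k z) (hu : ∀ x, ‖x‖ = 1 → u (-x) = u x)
    (hθ : ‖θ‖ = 1) : farPot k u (-θ) = farPot k u θ := by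
  have hu' : ∀ y : E, u (hat (-y)) = u (hat y) := by
    intro y
    rcases eq_or_ne y 0 with rfl | hy
    · simp
    · rw [hat_neg, hu _ (norm_hat hy)]
  rw [farPot, farPot, ← integral_indicator isOpen_ball.measurableSet,
    ← integral_indicator isOpen_ball.measurableSet, ← integral_neg_eq_self]
  congr 1
  funext y
  classical
  simp only [indicator_apply, mem_ball_zero_iff, norm_neg, hu', hu θ hθ]
  split_ifs
  · rw [← hk]; congr 2; simp only [smul_neg]; abel
  · rfl

theorem rhs_even {lam : ℝ} {k u : E → ℝ} (hk : ∀ z, k (-z) = k z)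
    (hu : ∀ x, ‖x‖ = 1 → u (-x) = u x) (hθ : ‖θ‖ = 1) :
    rhs α lam k u (-θ) = rhs α lam k u θ := by
  rw [rhs, rhs, farPot_even hk hu hθ, qRem_even hu hθ, hu θ hθ]

theorem XB.congr {η : ℝ} {u v : E → ℝ} (h : XB α η u) (huv : ∀ x, ‖x‖ = 1 → u x = v x) :
    XB α η v where
  bound x hx := by rw [← huv x hx]; exact h.bound x hx
  lip x y hx hy := by rw [← huv x hx, ← huv y hy]; exact h.lip x y hx hy
  second σ θ hσ hθ := by
    rw [← huv σ hσ, ← huv θ hθ, ← huv _ (by rw [norm_axisRefl hθ, hσ])]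
    exact h.second σ θ hσ hθ
  rot R δ hδ hR σ θ hσ hθ hd := by
    rw [← huv σ hσ, ← huv θ hθ, ← huv _ (by rw [R.norm_map, hσ]),
      ← huv _ (by rw [R.norm_map, hθ])]
    exact h.rot R δ hδ hR σ θ hσ hθ hd

theorem HB.of_tendsto {C : ℝ} {F : ℕ → E → ℝ} {f : E → ℝ} (h : ∀ n, HB α C (F n))
    (hF : ∀ x, ‖x‖ = 1 → Tendsto (fun n => F n x) atTop (nhds (f x))) : HB α C f where
  bound x hx := le_of_tendsto (hF x hx).abs (Eventually.of_forall fun n => (h n).bound x hx)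
  holder x y hx hy := le_of_tendsto ((hF x hx).sub (hF y hy)).abs
    (Eventually.of_forall fun n => (h n).holder x y hx hy)

theorem riesz_sub_of_HB (hN : 2 ≤ finrank ℝ E) (hα : 0 < α) (hα1 : α < 1) {C C' : ℝ}
    {f g : E → ℝ} (hf : HB α C f) (hg : HB α C' g) (hθ : ‖θ‖ = 1) :
    riesz α (fun x => f x - g x) θ = riesz α f θ - riesz α g θ :=
  riesz_sub hN hα (aestronglyMeasurable_surf (hf.continuousOn hα1))
    (aestronglyMeasurable_surf (hg.continuousOn hα1)) hf.bound hg.bound hθ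

theorem HB.zero {C : ℝ} (hC : 0 ≤ C) : HB α C (fun _ : E => 0) :=
  ⟨fun x _ => by simpa using hC, fun x y _ _ => by simp; positivity⟩

/-- A contraction principle for equations `L f = T f` on Hölder functions, where `L` is linear and
boundedly invertible and `T` is a small nonlinear perturbation. -/
theorem exists_fixedPoint (P : (E → ℝ) → Prop) (L T : (E → ℝ) → E → ℝ) {K' B' A : ℝ}
    (hK' : 0 ≤ K') (hB' : 0 ≤ B')
    (hP0 : P fun _ => 0)
    (hPadd : ∀ f g, P f → P g → P fun x => f x + g x)
    (hPlim : ∀ (F : ℕ → E → ℝ) (f : E → ℝ), (∀ n, P (F n)) →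
      (∀ x, ‖x‖ = 1 → Tendsto (fun n => F n x) atTop (nhds (f x))) → P f)
    (hLP : ∀ f C, HB α C f → P f → P (L f)) (hTP : ∀ f C, HB α C f → P f → P (T f))
    (hPneg : ∀ f, P f → P fun x => -f x)
    (hL0 : ∀ x, ‖x‖ = 1 → L (fun _ => 0) x = 0)
    (hLadd : ∀ f g C C', HB α C f → HB α C' g → ∀ x, ‖x‖ = 1 →
      L (fun x => f x + g x) x = L f x + L g x)
    (hLb : ∀ f C, HB α C f → ∀ x, ‖x‖ = 1 → |L f x| ≤ A * C)
    (hinv : ∀ h C, HB α C h → P h → ∃ f, HB α (K' * C) f ∧ P f ∧ ∀ x, ‖x‖ = 1 → L f x = h x)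
    (hT0 : HB α B' (T fun _ => 0))
    (hT : ∀ f g ν, 0 ≤ ν → HB α (2 * (K' * B')) f → HB α (2 * (K' * B')) g →
      HB α (K' * ν) (fun x => f x - g x) → HB α (ν / 2) fun x => T f x - T g x) :
    ∃ f, HB α (2 * (K' * B')) f ∧ P f ∧ ∀ x, ‖x‖ = 1 → L f x = T f x := by
  set D := K' * B' with hD
  have hD0 : 0 ≤ D := by positivity
  have hle : ∀ n : ℕ, 2 * D - 2 * D / 2 ^ n ≤ 2 * D := fun n => by
    have : 0 ≤ 2 * D / 2 ^ n := by positivity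
    linarith
  set Q : ℕ → (E → ℝ) → Prop := fun n f => HB α (2 * D - 2 * D / 2 ^ n) f ∧ P f ∧
    HB α (B' / 2 ^ n) fun x => T f x - L f x with hQ
  have hstep : ∀ n f, ∃ f', Q n f → Q (n + 1) f' ∧ HB α (D / 2 ^ n) fun x => f' x - f x := by
    intro n f
    by_cases hf : Q n f
    · obtain ⟨h1, h2, h3⟩ := hf
      have hPd : P fun x => T f x - L f x := by
        simp only [sub_eq_add_neg]
        exact hPadd _ _ (hTP f _ h1 h2) (hPneg _ (hLP f _ h1 h2))
      obtain ⟨d, hd, hPd, hLd⟩ := hinv _ _ h3 hPd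
      have e1 : K' * (B' / 2 ^ n) = D / 2 ^ n := by rw [hD]; ring
      have h4 : HB α (2 * D - 2 * D / 2 ^ (n + 1)) fun x => f x + d x := by
        convert h1.add hd using 1
        rw [e1, pow_succ]
        have : (2:ℝ) ^ n ≠ 0 := by positivity
        field_simp
        ring
      refine ⟨fun x => f x + d x, fun _ => ⟨⟨h4, hPadd _ _ h2 hPd, ?_⟩, ?_⟩⟩
      · have := hT _ f (B' / 2 ^ n) (by positivity) (h4.mono (hle _)) (h1.mono (hle _))
          (hd.congr fun x _ => by ring)
        rw [pow_succ, ← div_div]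
        refine this.congr fun x hx => ?_
        rw [hLadd f d _ _ h1 hd x hx, hLd x hx]
        ring
      · rw [← e1]
        exact hd.congr fun x _ => by ring
    · exact ⟨f, fun h => absurd h hf⟩
  choose nxt hnxt using hstep
  set F : ℕ → E → ℝ := fun n => Nat.rec (fun _ => 0) (fun n f => nxt n f) n with hF
  have hQF : ∀ n, Q n (F n) := by
    intro n
    induction n with
    | zero =>
      refine ⟨HB.zero (by simp), hP0, ?_⟩
      simp only [pow_zero, div_one]
      exact hT0.congr fun x hx => by
        change _ = T (fun _ => 0) x - L (fun _ => 0) x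
        rw [hL0 x hx, sub_zero]
    | succ n ih => exact (hnxt n (F n) ih).1
  have hdiff : ∀ n, HB α (D / 2 ^ n) fun x => F (n + 1) x - F n x := fun n =>
    (hnxt n (F n) (hQF n)).2
  have hcau : ∀ x, ∃ l, ‖x‖ = 1 → Tendsto (fun n => F n x) atTop (nhds l) := by
    intro x
    by_cases hx : ‖x‖ = 1
    · have : CauchySeq fun n => F n x := cauchySeq_of_le_geometric_two (C := 2 * D) fun n => by
        rw [dist_comm, dist_eq]
        convert (hdiff n).bound x hx using 1
        ring
      obtain ⟨l, hl⟩ := cauchySeq_tendsto_of_complete this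
      exact ⟨l, fun _ => hl⟩
    · exact ⟨0, fun h => absurd h hx⟩
  choose f hf using hcau
  have hj : ∀ n j, HB α (2 * D / 2 ^ n - 2 * D / 2 ^ (n + j)) fun x => F (n + j) x - F n x := by
    intro n j
    induction j with
    | zero => simpa using HB.zero (α := α) (E := E) le_rfl
    | succ j ih =>
      have h1 := ih.add (hdiff (n + j))
      have e1 : 2 * D / 2 ^ n - 2 * D / 2 ^ (n + j) + D / 2 ^ (n + j) =
          2 * D / 2 ^ n - 2 * D / 2 ^ (n + (j + 1)) := by
        rw [← add_assoc, pow_succ (2:ℝ) (n + j)]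
        have : (2:ℝ) ^ (n + j) ≠ 0 := by positivity
        field_simp
        ring
      rw [e1] at h1
      exact h1.congr fun x _ => by rw [← add_assoc]; ring
  have hfF : ∀ n, HB α (2 * D / 2 ^ n) fun x => f x - F n x := fun n =>
    HB.of_tendsto (F := fun j x => F (n + j) x - F n x)
      (fun j => (hj n j).mono (by
        have : 0 ≤ 2 * D / 2 ^ (n + j) := by positivity
        linarith))
      fun x hx => by
        have := (tendsto_add_atTop_iff_nat n).2 (hf x hx)
        simp only [add_comm _ n] at this
        exact this.sub_const _
  have hfH : HB α (2 * D) f := HB.of_tendsto (fun n => (hQF n).1.mono (hle n)) hf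
  refine ⟨f, hfH, hPlim F f (fun n => (hQF n).2.1) hf, fun x hx => ?_⟩
  have hz : ∀ n : ℕ, |L f x - T f x| ≤ (A * (2 * D) + B' + B') * (1 / 2) ^ n := by
    intro n
    obtain ⟨h1, -, h3⟩ := hQF n
    have t1 := hT f (F n) (2 * B' / 2 ^ n) (by positivity) hfH (h1.mono (hle n))
      (by convert hfF n using 1; rw [hD]; ring)
    have t2 := hLadd (fun x => f x - F n x) (F n) _ _ (hfF n) h1 x hx
    simp only [sub_add_cancel] at t2
    have t3 := hLb _ _ (hfF n) x hx
    have t4 := t1.bound x hx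
    have t5 := h3.bound x hx
    rw [t2, show L (fun x => f x - F n x) x + L (F n) x - T f x =
      L (fun x => f x - F n x) x - (T f x - T (F n) x) - (T (F n) x - L (F n) x) by ring]
    refine (abs_sub _ _).trans ((add_le_add_left (abs_sub _ _) _).trans ?_)
    refine (add_le_add (add_le_add t3 t4) t5).trans (le_of_eq ?_)
    rw [one_div, inv_pow]
    ring
  have h0 : Tendsto (fun n : ℕ => (A * (2 * D) + B' + B') * (1 / 2 : ℝ) ^ n) atTop (nhds 0) := by
    have := (tendsto_pow_atTop_nhds_zero_of_lt_one (r := (1/2:ℝ)) (by norm_num)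
      (by norm_num)).const_mul (A * (2 * D) + B' + B')
    simpa using this
  have := ge_of_tendsto' h0 hz
  exact sub_eq_zero.1 (abs_eq_zero.1 (le_antisymm this (abs_nonneg _)))

/-- For every small even kernel `k` there is a small even `u` whose graph over the unit sphere
solves the prescribed curvature equation. -/
theorem exists_solution (hN : 2 ≤ finrank ℝ E) (hα : 0 < α) (hα1 : α < 1)
    (ha : α + 2 - dim E ≠ 0) :
    ∃ lam K B₀ : ℝ, 0 ≤ K ∧ 0 < B₀ ∧ K * B₀ ≤ 1 / 2 ∧
      (∀ θ : E, ‖θ‖ = 1 → lamInt α θ = lam) ∧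
      ∀ (k : E → ℝ) (B : ℝ), KB B k → B ≤ B₀ → (∀ z, k (-z) = k z) →
        ∃ u : E → ℝ, XB α (K * B) u ∧ (∀ x, ‖x‖ = 1 → u (-x) = u x) ∧
          ∀ θ, ‖θ‖ = 1 → hyper α u θ + lam * u θ = rhs α lam k u θ := by
  obtain ⟨c, J, lam, hc, hJ, hlam, hlin, hLf⟩ := exists_linearization hN hα hα1 ha
  obtain ⟨K₃, hK₃, h3⟩ := riesz_XB hN hα hα1
  obtain ⟨K₄, hK₄, h4⟩ := riesz_solve hN hα hα1 ha hc hlin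
  obtain ⟨K₅, hK₅, h5⟩ := exists_rhs_HB hN hα hα1 lam
  obtain ⟨e₀, he₀⟩ := exists_unit hN
  set K' := K₄ * |J|⁻¹ with hK'
  have hK'0 : 0 ≤ K' := by positivity
  set K := K₃ * (2 * (K' * K₅)) with hK
  have hK0 : 0 ≤ K := by positivity
  set Z := K₅ * (K + 1) * (K₃ * K') with hZ
  have hZ0 : 0 ≤ Z := by positivity
  refine ⟨lam, K, 1 / (2 * (K + Z + 1)), hK0, by positivity, ?_, hlam, fun k B hk hB hev => ?_⟩
  · rw [mul_one_div, div_le_div_iff₀ (by positivity) (by norm_num)]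
    linarith
  have hB0 : 0 ≤ B := (abs_nonneg _).trans (hk.bound 0 (by simp))
  rw [le_div_iff₀ (by positivity)] at hB
  have hKB : K * B ≤ 1 / 2 := by nlinarith [mul_nonneg hZ0 hB0]
  have hZB : Z * B ≤ 1 / 2 := by nlinarith [mul_nonneg hK0 hB0]
  obtain ⟨hr0, hr⟩ := h5 k B hk
  have hX : ∀ f, HB α (2 * (K' * (K₅ * B))) f → XB α (K * B) (riesz α f) := fun f hf => by
    convert h3 _ _ hf using 1; rw [hK]; ring
  have hadd : ∀ (f g : E → ℝ) (C C' : ℝ), HB α C f → HB α C' g → ∀ x, ‖x‖ = 1 →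
      riesz α (fun x => f x + g x) x = riesz α f x + riesz α g x := fun f g C C' hf hg x hx =>
    riesz_add hN hα (aestronglyMeasurable_surf (hf.continuousOn hα1))
      (aestronglyMeasurable_surf (hg.continuousOn hα1)) hf.bound hg.bound hx
  have hz : ∀ θ : E, riesz α (fun _ => 0) θ = 0 := fun θ => by simp [riesz]
  obtain ⟨f, hf, hfe, hfs⟩ := exists_fixedPoint (α := α) (E := E) (fun f => ∀ x, ‖x‖ = 1 → f (-x) = f x)
    (fun f x => J * (riesz α f x - c * f x)) (fun f => rhs α lam k (riesz α f))
    (K' := K') (B' := K₅ * B) (A := |J| * (K₃ + |c|)) hK'0 (by positivity) (fun _ _ => rfl)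
    (fun f g hf hg x hx => by beta_reduce; rw [hf x hx, hg x hx])
    (fun F f hF hFf x hx => tendsto_nhds_unique (hFf (-x) (by rwa [norm_neg]))
      (by simp only [hF _ x hx]; exact hFf x hx))
    (fun f C hfC hf x hx => by beta_reduce; rw [riesz_even hf, hf x hx])
    (fun f C hfC hf x hx => rhs_even hev (fun y _ => riesz_even hf y) hx)
    (fun f hf x hx => by beta_reduce; rw [hf x hx])
    (fun x hx => by simp [hz])
    (fun f g C C' hf hg x hx => by beta_reduce; rw [hadd f g C C' hf hg x hx]; ring)
    (fun f C hf x hx => by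
      have h1 := (h3 f C hf).bound x hx
      have h2 := hf.bound x hx
      rw [abs_mul, mul_assoc, add_mul]
      gcongr
      refine (abs_sub _ _).trans ?_
      rw [abs_mul]
      gcongr)
    (fun h C hh he => by
      have h1 := hh.const_mul J⁻¹
      rw [abs_inv] at h1
      obtain ⟨f, hf, hfe, hfs⟩ := h4 _ _ h1 fun x hx => by rw [he x hx]
      refine ⟨f, by rw [hK', mul_assoc]; exact hf, hfe, fun x hx => ?_⟩
      rw [hfs x hx, mul_inv_cancel_left₀ hJ])
    (by
      convert hr0 using 2
      exact funext hz)
    (fun f g ν hν hf hg hfg => by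
      have h1 := (h3 _ _ hfg).congr fun x hx => riesz_sub_of_HB hN hα hα1 hf hg hx
      refine (hr _ _ _ _ hKB (hX f hf) (hX g hg) h1).mono ?_
      have e1 : K₅ * ((K * B + B) * (K₃ * (K' * ν))) = (Z * B) * ν := by rw [hZ]; ring
      rw [e1]; nlinarith)
  refine ⟨riesz α f, hX f hf, fun x _ => riesz_even hfe x, fun θ hθ => ?_⟩
  rw [hLf f _ hf θ hθ]
  exact hfs θ hθ

/-- The open star-shaped set with logarithmic radial function `u`. -/
def starSet (u : E → ℝ) : Set E := {x | ‖x‖ < exp (u (hat x))}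

theorem norm_exp_smul {σ : E} (hσ : ‖σ‖ = 1) (τ : ℝ) : ‖exp τ • σ‖ = exp τ := by
  rw [norm_smul, hσ, mul_one, norm_of_nonneg (exp_pos τ).le]

theorem hat_exp_smul {σ : E} (hσ : ‖σ‖ = 1) (τ : ℝ) : hat (exp τ • σ) = σ := by
  rw [hat, norm_exp_smul hσ, smul_smul, inv_mul_cancel₀ (exp_pos τ).ne', one_smul]

theorem exp_smul_mem_starSet {u : E → ℝ} {σ : E} (hσ : ‖σ‖ = 1) (τ : ℝ) :
    exp τ • σ ∈ starSet u ↔ τ < u σ := by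
  rw [starSet, mem_ofPred_eq, norm_exp_smul hσ, hat_exp_smul hσ, exp_lt_exp]

theorem continuousOn_hat {u : E → ℝ} (hu : ContinuousOn u (sphere 0 1)) :
    ContinuousOn (fun x : E => exp (u (hat x)) - ‖x‖) {0}ᶜ := by
  refine (continuous_exp.comp_continuousOn (hu.comp (f := hat) ?_ ?_)).sub
    continuous_norm.continuousOn
  · intro y hy
    have : ‖y‖ ≠ 0 := norm_ne_zero_iff.2 hy
    unfold hat
    have : ContinuousAt (fun y : E => ‖y‖⁻¹ • y) y := by fun_prop (disch := assumption)
    exact this.continuousWithinAt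
  · intro y hy
    rw [mem_sphere_zero_iff_norm]
    exact norm_hat hy

theorem isOpen_starSet {u : E → ℝ} (hu : ContinuousOn u (sphere 0 1)) {η : ℝ}
    (hη : ∀ x, ‖x‖ = 1 → |u x| ≤ η) : IsOpen (starSet u) := by
  have h1 := (continuousOn_hat hu).isOpen_inter_preimage isOpen_compl_singleton
    (isOpen_Ioi (a := (0:ℝ)))
  have h2 : starSet u = ({0}ᶜ ∩ (fun x : E => exp (u (hat x)) - ‖x‖) ⁻¹' Ioi 0) ∪
      ball 0 (min (exp (-η)) (exp (u (hat 0)))) := by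
    ext x
    rcases eq_or_ne x 0 with rfl | hx
    · simp [starSet, exp_pos]
    · have h3 := exp_le_exp.2 (abs_le.1 (hη _ (norm_hat hx))).1
      simp only [starSet, mem_ofPred_eq, mem_union, mem_inter_iff, mem_compl_iff,
        mem_singleton_iff, hx, not_false_eq_true, true_and, mem_preimage, mem_Ioi,
        sub_pos, mem_ball_zero_iff, lt_min_iff]
      exact ⟨Or.inl, fun h => h.elim id fun h => h.1.trans_le h3⟩
  rw [h2]
  exact h1.union isOpen_ball

theorem closure_starSet_subset {u : E → ℝ} (hu : ContinuousOn u (sphere 0 1)) :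
    closure (starSet u) ⊆ {x | ‖x‖ ≤ exp (u (hat x))} := by
  have h1 := (continuousOn_hat hu).isOpen_inter_preimage isOpen_compl_singleton
    (isOpen_Iio (a := (0:ℝ)))
  have h2 : {x : E | ‖x‖ ≤ exp (u (hat x))} =
      ({0}ᶜ ∩ (fun x : E => exp (u (hat x)) - ‖x‖) ⁻¹' Iio 0)ᶜ := by
    ext x
    rcases eq_or_ne x 0 with rfl | hx
    · simp [exp_nonneg]
    · simp [hx]
  refine closure_minimal (fun x (hx : ‖x‖ < _) => hx.le) ?_
  rw [h2]
  exact h1.isClosed_compl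

theorem frontier_starSet {u : E → ℝ} (hu : ContinuousOn u (sphere 0 1)) {η : ℝ}
    (hη : ∀ x, ‖x‖ = 1 → |u x| ≤ η) :
    frontier (starSet u) ⊆ {x | ‖x‖ = exp (u (hat x))} := by
  rw [(isOpen_starSet hu hη).frontier_eq]
  exact fun x hx => le_antisymm (closure_starSet_subset hu hx.1) (not_lt.1 hx.2)

theorem volume_frontier_starSet (hN : 2 ≤ finrank ℝ E) {u : E → ℝ}
    (hu : ContinuousOn u (sphere 0 1)) {η : ℝ} (hη : ∀ x, ‖x‖ = 1 → |u x| ≤ η) :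
    volume (frontier (starSet u)) = 0 := by
  have := nontrivial_of_two_le hN
  have hm : MeasurableSet (frontier (starSet u)) := isClosed_frontier.measurableSet
  rw [← lintegral_indicator_one hm, lintegral_polar_log (measurable_one.indicator hm),
    lintegral_eq_zero_iff' (Measurable.aemeasurable ?_)]
  · filter_upwards [ae_surf_norm] with σ hσ
    rw [Pi.zero_apply]
    have hac : logRadial E ≪ volume := withDensity_absolutelyContinuous _ _
    have h0 : ∀ᵐ τ ∂logRadial E, τ ≠ u σ := hac.ae_le (compl_mem_ae_iff.2 (measure_singleton _))
    rw [lintegral_congr_ae (g := 0), Pi.zero_def, lintegral_zero]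
    filter_upwards [h0] with τ hτ
    refine indicator_of_notMem (fun h => hτ ?_) _
    have := frontier_starSet hu hη h
    rwa [mem_ofPred_eq, norm_exp_smul hσ, hat_exp_smul hσ, exp_eq_exp] at this
  · apply Measurable.lintegral_prod_right'
      (f := fun p : E × ℝ => (frontier (starSet u)).indicator (1 : E → ENNReal) (exp p.2 • p.1))
    exact (measurable_one.indicator hm).comp (by fun_prop)

theorem pv_sub_pv (hα : 0 < α) {A B : Set E} (hA : MeasurableSet A) (hB : MeasurableSet B)
    (hA0 : volume (frontier A) = 0) (hB0 : volume (frontier B) = 0) (x : E) {ε : ℝ} (hε : 0 < ε) :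
    pv α A x ε - pv α B x ε = -2 * ∫ y in {y : E | ε < ‖y - x‖},
      (A.indicator (fun _ => (1 : ℝ)) y - B.indicator (fun _ => (1 : ℝ)) y) *
        ‖y - x‖ ^ (-(dim E + α)) := by
  have hk := integrableOn_kernel_far (E := E) hα x hε
  have hInt : ∀ A : Set E, MeasurableSet A → IntegrableOn (fun y =>
      ((closure A)ᶜ.indicator (fun _ => (1 : ℝ)) y - A.indicator (fun _ => (1 : ℝ)) y) *
        ‖y - x‖ ^ (-(dim E + α))) {y : E | ε < ‖y - x‖} := by
    intro A hA
    refine Integrable.mono' hk ?_ (Eventually.of_forall fun y => ?_)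
    · exact Measurable.aestronglyMeasurable
        (((measurable_const.indicator isClosed_closure.measurableSet.compl).sub
          (measurable_const.indicator hA)).mul (by fun_prop))
    · rw [norm_eq_abs, abs_mul, abs_of_nonneg (rpow_nonneg (norm_nonneg (y - x)) _)]
      refine mul_le_of_le_one_left (by positivity) ?_
      classical
      simp only [indicator_apply]
      by_cases h : y ∈ A
      · simp [h, subset_closure h]
      · simp only [h, if_false, sub_zero]; split_ifs <;> simp
  rw [pv, pv, ← integral_sub (hInt A hA) (hInt B hB), ← integral_const_mul]
  refine integral_congr_ae (ae_restrict_of_ae ?_)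
  have hae : ∀ A : Set E, volume (frontier A) = 0 → ∀ᵐ y : E,
      (closure A)ᶜ.indicator (fun _ => (1 : ℝ)) y = 1 - A.indicator (fun _ => (1 : ℝ)) y := by
    intro A h0
    filter_upwards [measure_eq_zero_iff_ae_notMem.1 h0] with y hy
    classical
    simp only [indicator_apply, mem_compl_iff]
    by_cases h : y ∈ A
    · simp [h, subset_closure h]
    · have : y ∉ closure A := fun hc => hy ⟨hc, fun hi => h (interior_subset hi)⟩
      simp [h, this]
  filter_upwards [hae A hA0, hae B hB0] with y h1 h2
  rw [h1, h2]
  ring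

theorem integral_indicator_sub (h : ℝ → ℝ) (w : ℝ) :
    ∫ τ, ((if τ < w then (1:ℝ) else 0) - if τ < 0 then 1 else 0) * h τ = ∫ τ in (0:ℝ)..w, h τ := by
  rcases le_total 0 w with hw | hw
  · rw [intervalIntegral.integral_of_le hw, ← integral_Ico_eq_integral_Ioc,
      ← integral_indicator measurableSet_Ico]
    congr 1
    funext τ
    classical
    rw [indicator_apply]
    by_cases h0 : τ < 0
    · simp [h0, h0.trans_le hw]
    · simp [h0, not_lt.1 h0]
  · rw [intervalIntegral.integral_symm, intervalIntegral.integral_of_le hw,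
      ← integral_Ico_eq_integral_Ioc, ← integral_indicator measurableSet_Ico, ← integral_neg]
    congr 1
    funext τ
    classical
    rw [indicator_apply]
    by_cases h0 : τ < w
    · simp [h0, h0.trans_le hw]
    · simp [h0, not_lt.1 h0]

theorem norm_exp_smul_sub_sq {σ θ : E} (hσ : ‖σ‖ = 1) (hθ : ‖θ‖ = 1) (τ : ℝ) :
    ‖exp τ • σ - θ‖ ^ 2 = exp τ * gap ‖σ - θ‖ τ := by
  rw [norm_sub_sq_real, norm_exp_smul hσ, hθ, gap, norm_sub_sq_real, hσ, hθ, inner_smul_left,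
    cosh_eq, exp_neg]
  have := exp_pos τ
  simp only [conj_trivial]
  field_simp
  ring

theorem exp_mul_norm_rpow {σ θ : E} (hσ : ‖σ‖ = 1) (hθ : ‖θ‖ = 1) (hne : σ ≠ θ) (τ : ℝ) :
    exp (dim E * τ) * ‖exp τ • σ - θ‖ ^ (-(dim E + α)) =
      kap ((dim E - α) / 2) ((dim E + α) / 2) ‖σ - θ‖ τ := by
  have hd : 0 < ‖σ - θ‖ := norm_pos_iff.2 (sub_ne_zero.2 hne)
  have hg := gap_pos hd τ
  have h1 : ‖exp τ • σ - θ‖ ^ (-(dim E + α)) =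
      (exp τ * gap ‖σ - θ‖ τ) ^ (-((dim E + α) / 2)) := by
    rw [← norm_exp_smul_sub_sq hσ hθ, ← rpow_natCast, ← rpow_mul (norm_nonneg _)]
    congr 1
    push_cast
    ring
  rw [h1, mul_rpow (exp_pos τ).le hg.le, ← exp_mul, ← mul_assoc, ← exp_add, kap]
  congr 2
  ring

theorem integral_logRadial (f : ℝ → ℝ) :
    ∫ τ, f τ ∂logRadial E = ∫ τ, exp (dim E * τ) * f τ := by
  rw [logRadial, integral_withDensity_eq_integral_toReal_smul (by fun_prop)
    (Eventually.of_forall fun _ => ofReal_lt_top)]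
  refine integral_congr_ae (Eventually.of_forall fun τ => ?_)
  simp only [smul_eq_mul]
  rw [toReal_ofReal (exp_pos _).le]

/-- The difference of the indicators of a star-shaped set and of the unit ball. -/
noncomputable def bodyDiff (w : E → ℝ) (y : E) : ℝ :=
  (starSet w).indicator (fun _ => (1 : ℝ)) y - (ball (0:E) 1).indicator (fun _ => (1 : ℝ)) y

theorem abs_bodyDiff_le (w : E → ℝ) (y : E) : |bodyDiff w y| ≤ 1 := by
  classical
  simp only [bodyDiff, indicator_apply]
  split_ifs <;> simp

theorem bodyDiff_exp_smul (w : E → ℝ) {σ : E} (hσ : ‖σ‖ = 1) (τ : ℝ) :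
    bodyDiff w (exp τ • σ) = (if τ < w σ then (1:ℝ) else 0) - if τ < 0 then 1 else 0 := by
  classical
  simp only [bodyDiff, indicator_apply, exp_smul_mem_starSet hσ, mem_ball_zero_iff,
    norm_exp_smul hσ, exp_lt_one_iff]

theorem measurable_bodyDiff {w : E → ℝ} (hw : MeasurableSet (starSet w)) :
    Measurable (bodyDiff w) :=
  (measurable_const.indicator hw).sub (measurable_const.indicator measurableSet_ball)

/-- The kernel `kap` cut off near the pole, symmetrically in the logarithmic radius. -/
noncomputable def cutKap (α ε : ℝ) (θ σ : E) (τ : ℝ) : ℝ :=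
  if ε ^ 2 < gap ‖σ - θ‖ τ then kap ((dim E - α) / 2) ((dim E + α) / 2) ‖σ - θ‖ τ else 0

theorem integrableOn_lens (hα : 0 < α) (hθ : ‖θ‖ = 1) {ε : ℝ} (hε : 0 < ε) (hε1 : ε < 1) :
    IntegrableOn (fun y => ‖y - θ‖ ^ (-(dim E + α))) {y | ε ^ 2 * ‖y‖ < ‖y - θ‖ ^ 2} := by
  refine (integrableOn_kernel_far (E := E) hα θ (half_pos hε)).mono_set fun y hy => ?_
  rw [mem_ofPred_eq] at hy ⊢
  have h1 : 1 ≤ ‖y‖ + ‖y - θ‖ := by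
    rw [← hθ, norm_sub_rev y θ]
    exact norm_le_norm_add_norm_sub' _ _
  by_contra! h
  have h2 := norm_nonneg (y - θ)
  nlinarith [norm_nonneg y]

theorem integral_lens (hN : 2 ≤ finrank ℝ E) (hα : 0 < α) {w : E → ℝ}
    (hw : MeasurableSet (starSet w)) (hθ : ‖θ‖ = 1) {ε : ℝ} (hε : 0 < ε) (hε1 : ε < 1) :
    Integrable (fun σ => ∫ τ in (0:ℝ)..w σ, cutKap α ε θ σ τ) (surf E) ∧
    ∫ y in {y | ε ^ 2 * ‖y‖ < ‖y - θ‖ ^ 2}, bodyDiff w y * ‖y - θ‖ ^ (-(dim E + α)) =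
      ∫ σ, (∫ τ in (0:ℝ)..w σ, cutKap α ε θ σ τ) ∂surf E := by
  have := nontrivial_of_two_le hN
  have hU : MeasurableSet {y : E | ε ^ 2 * ‖y‖ < ‖y - θ‖ ^ 2} :=
    measurableSet_lt (by fun_prop) (by fun_prop)
  have hmg : Measurable fun y : E => bodyDiff w y * ‖y - θ‖ ^ (-(dim E + α)) :=
    (measurable_bodyDiff hw).mul (by fun_prop)
  have hgi : IntegrableOn (fun y : E => bodyDiff w y * ‖y - θ‖ ^ (-(dim E + α)))
      {y : E | ε ^ 2 * ‖y‖ < ‖y - θ‖ ^ 2} := by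
    refine Integrable.mono' (integrableOn_lens hα hθ hε hε1) hmg.aestronglyMeasurable
      (Eventually.of_forall fun y => ?_)
    rw [norm_eq_abs, abs_mul, abs_of_nonneg (rpow_nonneg (norm_nonneg (y - θ)) _)]
    exact mul_le_of_le_one_left (by positivity) (abs_bodyDiff_le w y)
  have hmp := measurePreserving_polar_log (E := E)
  rw [← integrable_indicator_iff hU] at hgi
  have hi2 := hmp.integrable_comp_of_integrable hgi
  simp only [comp_def] at hi2
  have hin : ∀ᵐ σ ∂surf E, ∫ τ, {y : E | ε ^ 2 * ‖y‖ < ‖y - θ‖ ^ 2}.indicator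
      (fun y => bodyDiff w y * ‖y - θ‖ ^ (-(dim E + α))) (exp τ • σ) ∂logRadial E =
      ∫ τ in (0:ℝ)..w σ, cutKap α ε θ σ τ := by
    filter_upwards [ae_surf_norm, ae_surf_ne hN θ] with σ hσ hne
    rw [integral_logRadial, ← integral_indicator_sub]
    refine integral_congr_ae (Eventually.of_forall fun τ => ?_)
    classical
    simp only [indicator_apply, cutKap, mem_ofPred_eq]
    simp only [bodyDiff_exp_smul w hσ, norm_exp_smul hσ, norm_exp_smul_sub_sq hσ hθ,
      ← exp_mul_norm_rpow (α := α) hσ hθ hne, mul_comm (ε ^ 2),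
      mul_lt_mul_iff_right₀ (exp_pos τ)]
    by_cases h : ε ^ 2 < gap ‖σ - θ‖ τ
    · simp only [if_pos h]; ring
    · simp only [if_neg h]; ring
  refine ⟨hi2.integral_prod_left.congr hin, ?_⟩
  rw [← integral_indicator hU, ← hmp.map_eq, integral_map hmp.aemeasurable
    (hmg.indicator hU).aestronglyMeasurable, integral_prod _ hi2]
  exact integral_congr_ae hin

theorem intervalIntegral_add_reflect {f : ℝ → ℝ} (hf : ∀ a b, IntervalIntegrable f volume a b)
    (w v : ℝ) : (∫ τ in (0:ℝ)..w, f τ) + ∫ τ in (0:ℝ)..v, f τ =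
      (∫ τ in (0:ℝ)..w, (f τ - f (-τ))) + ∫ τ in (-v)..w, f (-τ) := by
  have hf' : ∀ a b, IntervalIntegrable (fun τ => f (-τ)) volume a b := fun a b => by
    have := (hf (-a) (-b)).comp_mul_left (c := -1)
    simpa using this
  have h1 : ∫ τ in (0:ℝ)..v, f τ = ∫ τ in (-v)..0, f (-τ) := by
    rw [intervalIntegral.integral_comp_neg, neg_neg, neg_zero]
  rw [intervalIntegral.integral_sub (hf _ _) (hf' _ _), h1,
    ← intervalIntegral.integral_add_adjacent_intervals (hf' (-v) 0) (hf' 0 w)]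
  ring

theorem abs_cutKap_reflect_le (hα : 0 < α) {B : ℝ}
    (hB : ∀ τ : ℝ, |τ| ≤ 2 → |sinh ((dim E - α) / 2 * τ)| ≤ B * |τ| ∧
      cosh ((dim E - α) / 2 * τ) ≤ B) (ε : ℝ) {θ σ : E} (hd : 0 < ‖σ - θ‖) {τ : ℝ}
    (hτ : |τ| ≤ 1) :
    |cutKap α ε θ σ τ - cutKap α ε θ σ (-τ)| ≤ 2 * B * |τ| * ‖σ - θ‖ ^ (-(dim E + α)) ∧
      |cutKap α ε θ σ (-τ)| ≤ 2 * B * ‖σ - θ‖ ^ (-(dim E + α)) := by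
  obtain ⟨h1, h2⟩ := hB τ (by linarith)
  have hB0 : 0 ≤ B := (cosh_pos _).le.trans h2
  have hdim : (0:ℝ) ≤ dim E := by unfold dim; positivity
  have he : gap ‖σ - θ‖ (-τ) = gap ‖σ - θ‖ τ := by rw [gap, gap, cosh_neg]
  have hg : gap ‖σ - θ‖ τ ^ (-((dim E + α) / 2)) ≤ ‖σ - θ‖ ^ (-(dim E + α)) := by
    calc _ ≤ (‖σ - θ‖ ^ 2) ^ (-((dim E + α) / 2)) :=
          rpow_le_rpow_of_nonpos (by positivity) (sq_le_gap _ _) (by linarith)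
      _ = _ := by
          rw [← rpow_natCast, ← rpow_mul hd.le]
          congr 1
          push_cast
          ring
  have hg0 := rpow_nonneg (gap_pos hd τ).le (-((dim E + α) / 2))
  have hr0 := rpow_nonneg hd.le (-(dim E + α))
  simp only [cutKap, he]
  split_ifs
  · simp only [kap, he]
    rw [mul_neg, ← sub_mul]
    have e1 : exp ((dim E - α) / 2 * τ) - exp (-((dim E - α) / 2 * τ)) =
        2 * sinh ((dim E - α) / 2 * τ) := by rw [sinh_eq]; ring
    have e2 : exp (-((dim E - α) / 2 * τ)) ≤ 2 * B := by
      have := cosh_sub_sinh ((dim E - α) / 2 * τ)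
      rw [← this]
      have := (abs_le.1 h1).1
      nlinarith
    rw [e1, abs_mul, abs_mul, abs_mul, abs_two, abs_of_nonneg hg0, abs_of_nonneg (exp_pos _).le]
    constructor
    · rw [mul_assoc 2 B]
      gcongr
    · gcongr
  · simp only [sub_self, abs_zero]
    constructor <;> positivity

theorem tendsto_integral_lens (hN : 2 ≤ finrank ℝ E) (hα : 0 < α) (hα1 : α < 1) {u : E → ℝ}
    {η : ℝ} (hη : η ≤ 1 / 2) (hu : XB α η u) (hθ : ‖θ‖ = 1)
    (hm : MeasurableSet (starSet fun σ => u σ - u θ)) :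
    Tendsto (fun ε : ℝ => ∫ y in {y | ε ^ 2 * ‖y‖ < ‖y - θ‖ ^ 2},
      bodyDiff (fun σ => u σ - u θ) y * ‖y - θ‖ ^ (-(dim E + α)))
      (𝓝[>] 0) (nhds (hyper α u θ + qRem α u θ)) := by
  have hη0 := hu.nonneg hθ
  set w : E → ℝ := fun σ => u σ - u θ with hw
  set c := (dim E - α) / 2 with hc
  set p := (dim E + α) / 2 with hp
  have hd2 := dim_ge hN
  obtain ⟨B, hB1, hB⟩ := exists_hyperbolic_bound c
  set G : ℝ → E → ℝ := fun ε σ => 1 / 2 * ((∫ τ in (0:ℝ)..w σ, cutKap α ε θ σ τ) +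
    ∫ τ in (0:ℝ)..w (axisRefl θ σ), cutKap α ε θ σ τ) with hG
  obtain ⟨R, hR⟩ := axisRefl_isometry hθ
  have hcr : ∀ ε (σ : E) τ, cutKap α ε θ (R σ) τ = cutKap α ε θ σ τ := fun ε σ τ => by
    simp only [cutKap, hR, norm_axisRefl_sub_pole hθ]
  have hInt : ∀ ε, 0 < ε → ε < 1 → Integrable (G ε) (surf E) ∧
      ∫ y in {y | ε ^ 2 * ‖y‖ < ‖y - θ‖ ^ 2}, bodyDiff w y * ‖y - θ‖ ^ (-(dim E + α)) =
        ∫ σ, G ε σ ∂surf E := by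
    intro ε hε hε1
    obtain ⟨h1, h2⟩ := integral_lens hN hα hm hθ hε hε1
    have h3 := (surf_measurePreserving R).integrable_comp_of_integrable h1
    have h4 := surf_integral_comp R fun σ => ∫ τ in (0:ℝ)..w σ, cutKap α ε θ σ τ
    simp only [comp_def, hcr] at h3
    simp only [hcr] at h4
    simp only [hR] at h3 h4
    refine ⟨(h1.add h3).const_mul _, ?_⟩
    rw [h2]
    simp only [hG]
    rw [integral_const_mul, integral_add h1 h3, h4]
    ring
  have hlim : hyper α u θ + qRem α u θ = ∫ σ, (1 / 2 * (u σ + u (axisRefl θ σ) - 2 * u θ) *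
      ‖σ - θ‖ ^ (-(dim E + α)) + qInt α u θ σ) ∂surf E := by
    rw [hyper, qRem, ← integral_add (hyper_integrable hN hα1 hu hθ)
      (qInt_integrable hN hα hα1 (by linarith) hu hθ)]
  rw [hlim]
  obtain ⟨A, -, hA⟩ := surf_rpow_integrable hN
    (e := (3 + α) / 2 - (dim E + α)) (by linarith)
  obtain ⟨A', -, hA'⟩ := surf_rpow_integrable hN
    (e := 2 - (dim E + α)) (by linarith)
  have hev : ∀ᶠ ε : ℝ in 𝓝[>] 0, 0 < ε ∧ ε < 1 :=
    (eventually_mem_nhdsWithin).and (nhdsWithin_le_nhds (eventually_lt_nhds one_pos))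
  refine Tendsto.congr' (hev.mono fun ε hε => ((hInt ε hε.1 hε.2).2).symm) ?_
  refine tendsto_integral_filter_of_dominated_convergence
    (fun σ => B * ‖σ - θ‖ ^ (2 - (dim E + α)) + B * ‖σ - θ‖ ^ ((3 + α) / 2 - (dim E + α)))
    (hev.mono fun ε hε => (hInt ε hε.1 hε.2).1.aestronglyMeasurable) ?_
    (((hA' θ hθ).1.const_mul B).add ((hA θ hθ).1.const_mul B)) ?_
  · refine hev.mono fun ε hε => ?_
    filter_upwards [ae_surf_norm, ae_surf_ne hN θ] with σ hσ hne
    have hd : 0 < ‖σ - θ‖ := norm_pos_iff.2 (sub_ne_zero.2 hne)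
    have hle2 := norm_sub_le_two hσ hθ
    have hf : ∀ a b, IntervalIntegrable (cutKap α ε θ σ) volume a b := fun a b => by
      have hk := continuous_kap (c := c) (p := p) hd
      have hgc : Continuous (gap ‖σ - θ‖) := by unfold gap; fun_prop
      have hk' := hk.intervalIntegrable (μ := volume) a b
      have hS : MeasurableSet {τ | ε ^ 2 < gap ‖σ - θ‖ τ} :=
        measurableSet_lt measurable_const hgc.measurable
      refine ⟨(hk'.1.indicator hS).congr ?_, (hk'.2.indicator hS).congr ?_⟩ <;>
      · refine Eventually.of_forall fun τ => ?_
        classical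
        simp only [indicator_apply, cutKap, mem_ofPred_eq, hc, hp]
    have hB' : ∀ τ : ℝ, |τ| ≤ 1 → _ := fun τ hτ =>
      abs_cutKap_reflect_le (E := E) hα (fun τ hτ => ⟨(hB τ hτ).1, (hB τ hτ).2.1⟩) ε hd hτ
    have hr0 := rpow_nonneg hd.le (-(dim E + α))
    have hσ' : ‖axisRefl θ σ‖ = 1 := by rw [norm_axisRefl hθ, hσ]
    have hw1 : |w σ| ≤ ‖σ - θ‖ / 2 := (hu.lip σ θ hσ hθ).trans (by nlinarith)
    have hw2 : |w (axisRefl θ σ)| ≤ ‖σ - θ‖ / 2 := by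
      refine (hu.lip _ θ hσ' hθ).trans ?_
      rw [norm_axisRefl_sub_pole hθ]
      nlinarith
    have hs : |w σ + w (axisRefl θ σ)| ≤ 1 / 2 * ‖σ - θ‖ ^ ((3 + α) / 2) := by
      have := hu.second σ θ hσ hθ
      rw [show u σ + u (axisRefl θ σ) - 2 * u θ = w σ + w (axisRefl θ σ) by simp only [hw]; ring]
        at this
      exact this.trans (by gcongr)
    have i1 : |∫ τ in (0:ℝ)..w σ, (cutKap α ε θ σ τ - cutKap α ε θ σ (-τ))| ≤
        2 * B * (‖σ - θ‖ / 2) * ‖σ - θ‖ ^ (-(dim E + α)) * (‖σ - θ‖ / 2) := by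
      rw [← norm_eq_abs]
      refine (intervalIntegral.norm_integral_le_of_norm_le_const
        (C := 2 * B * (‖σ - θ‖ / 2) * ‖σ - θ‖ ^ (-(dim E + α))) fun τ hτ => ?_).trans ?_
      · have hτ' : |τ| ≤ |w σ| := by
          have := abs_sub_left_of_mem_uIcc (uIoc_subset_uIcc hτ)
          simpa using this
        refine (hB' τ (by linarith)).1.trans ?_
        gcongr
        linarith
      · rw [sub_zero]
        gcongr
    have i2 : |∫ τ in (-w (axisRefl θ σ))..w σ, cutKap α ε θ σ (-τ)| ≤
        2 * B * ‖σ - θ‖ ^ (-(dim E + α)) * (1 / 2 * ‖σ - θ‖ ^ ((3 + α) / 2)) := by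
      rw [← norm_eq_abs]
      refine (intervalIntegral.norm_integral_le_of_norm_le_const
        (C := 2 * B * ‖σ - θ‖ ^ (-(dim E + α))) fun τ hτ => ?_).trans ?_
      · refine (hB' τ ?_).2
        have a1 := abs_le.1 hw1
        have a2 := abs_le.1 hw2
        rcases mem_uIoc.1 hτ with h | h <;> exact abs_le.2 ⟨by linarith, by linarith⟩
      · rw [sub_neg_eq_add]
        gcongr
    have e1 : ‖σ - θ‖ ^ (2 - (dim E + α)) = ‖σ - θ‖ ^ (-(dim E + α)) * ‖σ - θ‖ ^ 2 := by
      rw [← rpow_natCast, ← rpow_add hd]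
      congr 1
      push_cast
      ring
    have e2 : ‖σ - θ‖ ^ ((3 + α) / 2 - (dim E + α)) =
        ‖σ - θ‖ ^ (-(dim E + α)) * ‖σ - θ‖ ^ ((3 + α) / 2) := by
      rw [← rpow_add hd]
      congr 1
      ring
    have hr1 := rpow_nonneg hd.le ((3 + α) / 2)
    rw [norm_eq_abs, hG]
    beta_reduce
    rw [intervalIntegral_add_reflect hf, abs_mul, abs_of_pos (by norm_num : (0:ℝ) < 1 / 2), e1, e2]
    refine (mul_le_mul_of_nonneg_left (abs_add_le _ _) (by norm_num)).trans ?_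
    have p1 : 0 ≤ B * (‖σ - θ‖ ^ (-(dim E + α)) * ‖σ - θ‖ ^ 2) := by positivity
    have p2 : 0 ≤ B * (‖σ - θ‖ ^ (-(dim E + α)) * ‖σ - θ‖ ^ ((3 + α) / 2)) := by positivity
    nlinarith
  · filter_upwards [ae_surf_norm, ae_surf_ne hN θ] with σ hσ hne
    have hd : 0 < ‖σ - θ‖ := norm_pos_iff.2 (sub_ne_zero.2 hne)
    refine tendsto_const_nhds.congr' ?_
    have hev2 : ∀ᶠ ε : ℝ in 𝓝[>] 0, 0 < ε ∧ ε < ‖σ - θ‖ :=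
      (eventually_mem_nhdsWithin).and (nhdsWithin_le_nhds (eventually_lt_nhds hd))
    filter_upwards [hev2] with ε hε
    have hk : ∀ τ, cutKap α ε θ σ τ = kap c p ‖σ - θ‖ τ := fun τ => by
      rw [cutKap, if_pos]
      have := sq_le_gap ‖σ - θ‖ τ
      nlinarith [hε.1, hε.2]
    have hkc := continuous_kap (c := c) (p := p) hd
    have hq : ∀ v, qfun c p ‖σ - θ‖ v = (∫ τ in (0:ℝ)..v, kap c p ‖σ - θ‖ τ) -
        v * ‖σ - θ‖ ^ (-(dim E + α)) := fun v => by
      rw [qfun, intervalIntegral.integral_sub (hkc.intervalIntegrable _ _)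
        (by simp), intervalIntegral.integral_const, sub_zero, smul_eq_mul, hp]
      congr 3
      ring
    simp only [hG, hk, qInt, ← hc, ← hp, hq, hw]
    ring

theorem lens_diff_subset (hθ : ‖θ‖ = 1) {ε : ℝ} (hε : 0 < ε) (hε1 : ε < 1 / 2) {y : E}
    (hy : ¬(ε < ‖y - θ‖ ↔ ε ^ 2 * ‖y‖ < ‖y - θ‖ ^ 2)) :
    ε * (1 - ε) ≤ ‖y - θ‖ ∧ ‖y - θ‖ ≤ ε * (1 + 2 * ε) := by
  have h1 : 1 ≤ ‖y‖ + ‖y - θ‖ := by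
    rw [← hθ, norm_sub_rev y θ]
    exact norm_le_norm_add_norm_sub' _ _
  have h2 : ‖y‖ ≤ 1 + ‖y - θ‖ := by
    rw [← hθ]
    exact norm_le_norm_add_norm_sub' _ _
  have h0 := norm_nonneg (y - θ)
  set d := ‖y - θ‖
  set b := ‖y‖
  rcases not_iff.1 hy with h
  by_cases hd : ε < d
  · have h3 : d ^ 2 ≤ ε ^ 2 * b := by
      by_contra! h4
      exact (h.2 h4) hd
    refine ⟨by nlinarith, ?_⟩
    have h4 : d ≤ ε * (1 + d) := by
      refine abs_le_of_sq_le_sq' ?_ (by positivity) |>.2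
      nlinarith [sq_nonneg ε, mul_nonneg (sq_nonneg ε) h0, mul_nonneg (sq_nonneg ε) (sq_nonneg d)]
    nlinarith
  · have h3 := h.1 hd
    push Not at hd
    refine ⟨?_, by nlinarith⟩
    have h4 : ε * (1 - d) ≤ d := by
      refine abs_le_of_sq_le_sq' ?_ h0 |>.2
      nlinarith [mul_nonneg (sq_nonneg ε) (mul_nonneg h0 (by linarith : 0 ≤ 1 - d))]
    nlinarith

theorem tendsto_annulus_bound (n : ℕ) (hα1 : α < 1) :
    Tendsto (fun ε : ℝ => ε ^ (-((n:ℝ) + α)) * ((ε * (1 + 2 * ε)) ^ n - (ε * (1 - ε)) ^ n))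
      (𝓝[>] 0) (nhds 0) := by
  set f : ℝ → ℝ := fun ε => (1 + 2 * ε) ^ n - (1 - ε) ^ n with hf
  have hd : DifferentiableAt ℝ f 0 := by fun_prop
  have h1 := (hasDerivAt_iff_tendsto_slope_zero.1 hd.hasDerivAt).mono_left
    (nhdsWithin_mono _ fun x (hx : x ∈ Ioi (0:ℝ)) => ne_of_gt hx)
  have h2 : Tendsto (fun ε : ℝ => ε ^ (1 - α)) (𝓝[>] 0) (nhds 0) := by
    have := (continuousAt_rpow_const (0:ℝ) (1 - α) (Or.inr (by linarith))).tendsto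
    rw [zero_rpow (by linarith)] at this
    exact this.mono_left nhdsWithin_le_nhds
  have h3 := h2.mul h1
  rw [zero_mul] at h3
  refine h3.congr' (eventually_mem_nhdsWithin.mono fun ε (hε : 0 < ε) => ?_)
  simp only [hf, zero_add, smul_eq_mul]
  rw [rpow_sub hε, rpow_neg hε.le, rpow_add hε, rpow_natCast, rpow_one,
    mul_pow, mul_pow]
  have := (rpow_pos_of_pos hε α).ne'
  field_simp
  simp

theorem abs_cutoff_sub_le (hN : 2 ≤ finrank ℝ E) (hα : 0 < α) {w : E → ℝ}
    (hw : MeasurableSet (starSet w)) (hθ : ‖θ‖ = 1) {ε : ℝ} (hε : 0 < ε)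
    (hε1 : ε < 1 / 2) :
    |(∫ y in {y | ε < ‖y - θ‖}, bodyDiff w y * ‖y - θ‖ ^ (-(dim E + α))) -
        ∫ y in {y | ε ^ 2 * ‖y‖ < ‖y - θ‖ ^ 2}, bodyDiff w y * ‖y - θ‖ ^ (-(dim E + α))| ≤
      2 ^ (dim E + α) * volume.real (ball (0:E) 1) *
        (ε ^ (-((finrank ℝ E : ℝ) + α)) *
        ((ε * (1 + 2 * ε)) ^ finrank ℝ E - (ε * (1 - ε)) ^ finrank ℝ E)) := by
  have := nontrivial_of_two_le hN
  have hdim : (0:ℝ) ≤ dim E := by unfold dim; positivity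
  have hU : MeasurableSet {y : E | ε ^ 2 * ‖y‖ < ‖y - θ‖ ^ 2} :=
    measurableSet_lt (by fun_prop) (by fun_prop)
  have hU' : MeasurableSet {y : E | ε < ‖y - θ‖} :=
    measurableSet_lt (by fun_prop) (by fun_prop)
  have hmg : Measurable fun y : E => bodyDiff w y * ‖y - θ‖ ^ (-(dim E + α)) :=
    (measurable_bodyDiff hw).mul (by fun_prop)
  have hle : ∀ y : E, |bodyDiff w y * ‖y - θ‖ ^ (-(dim E + α))| ≤ ‖y - θ‖ ^ (-(dim E + α)) := by
    intro y
    rw [abs_mul, abs_of_nonneg (rpow_nonneg (norm_nonneg (y - θ)) _)]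
    exact mul_le_of_le_one_left (by positivity) (abs_bodyDiff_le w y)
  have g1 : IntegrableOn (fun y : E => bodyDiff w y * ‖y - θ‖ ^ (-(dim E + α)))
      {y : E | ε ^ 2 * ‖y‖ < ‖y - θ‖ ^ 2} :=
    Integrable.mono' (integrableOn_lens hα hθ hε (by linarith)) hmg.aestronglyMeasurable
      (Eventually.of_forall hle)
  have g2 : IntegrableOn (fun y : E => bodyDiff w y * ‖y - θ‖ ^ (-(dim E + α)))
      {y : E | ε < ‖y - θ‖} :=
    Integrable.mono' (integrableOn_kernel_far hα θ hε) hmg.aestronglyMeasurable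
      (Eventually.of_forall hle)
  set A : Set E := closedBall θ (ε * (1 + 2 * ε)) \ ball θ (ε * (1 - ε)) with hA
  have hAm : MeasurableSet A := measurableSet_closedBall.diff measurableSet_ball
  have hAf : volume A ≠ ⊤ := ((measure_mono sdiff_subset).trans_lt
    measure_closedBall_lt_top).ne
  have hε2 : 0 < ε * (1 - ε) := by nlinarith
  have hvol : volume.real A = ((ε * (1 + 2 * ε)) ^ finrank ℝ E -
      (ε * (1 - ε)) ^ finrank ℝ E) * volume.real (ball (0:E) 1) := by
    rw [hA, measureReal_sdiff (Metric.ball_subset_closedBall.trans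
      (Metric.closedBall_subset_closedBall (by nlinarith))) measurableSet_ball
        measure_closedBall_lt_top.ne,
      Measure.addHaar_real_closedBall _ _ (by positivity), measureReal_def volume (ball θ _),
      Measure.addHaar_ball _ _ hε2.le, toReal_mul,
      toReal_ofReal (by positivity), ← measureReal_def]
    ring
  rw [← integral_indicator hU, ← integral_indicator hU',
    ← integral_sub ((integrable_indicator_iff hU').2 g2) ((integrable_indicator_iff hU).2 g1)]
  have hI : Integrable (A.indicator fun _ => (ε / 2) ^ (-(dim E + α))) :=
    (integrable_indicator_iff hAm).2 (integrableOn_const hAf)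
  rw [← norm_eq_abs]
  refine (norm_integral_le_of_norm_le hI (Eventually.of_forall fun y => ?_)).trans ?_
  · have hpos : 0 ≤ A.indicator (fun _ => (ε / 2) ^ (-(dim E + α))) y :=
      indicator_nonneg (fun _ _ => by positivity) _
    by_cases hy : ε < ‖y - θ‖ ↔ ε ^ 2 * ‖y‖ < ‖y - θ‖ ^ 2
    · rw [show ∀ f : E → ℝ, {y | ε < ‖y - θ‖}.indicator f y -
          {y | ε ^ 2 * ‖y‖ < ‖y - θ‖ ^ 2}.indicator f y = 0 from fun f => ?_, norm_zero]
      · exact hpos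
      · classical
        simp only [indicator_apply, mem_ofPred_eq, hy, sub_self]
    · obtain ⟨h1, h2⟩ := lens_diff_subset hθ hε hε1 hy
      have hyA : y ∈ A := by
        rw [hA, Set.mem_sdiff, mem_closedBall_iff_norm, mem_ball_iff_norm]
        exact ⟨h2, not_lt.2 h1⟩
      rw [indicator_of_mem hyA]
      have h3 : ‖y - θ‖ ^ (-(dim E + α)) ≤ (ε / 2) ^ (-(dim E + α)) :=
        rpow_le_rpow_of_nonpos (by positivity) (by nlinarith) (by linarith)
      refine le_trans ?_ ((hle y).trans h3)
      rw [norm_eq_abs]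
      classical
      simp only [indicator_apply, mem_ofPred_eq]
      by_cases c1 : ε < ‖y - θ‖
      · have c2 : ¬(ε ^ 2 * ‖y‖ < ‖y - θ‖ ^ 2) := fun c2 => hy ⟨fun _ => c2, fun _ => c1⟩
        rw [if_pos c1, if_neg c2, sub_zero]
      · have c2 : ε ^ 2 * ‖y‖ < ‖y - θ‖ ^ 2 := by
          by_contra c2
          exact hy ⟨fun h => absurd h c1, fun h => absurd h c2⟩
        rw [if_neg c1, if_pos c2, zero_sub, abs_neg]
  · rw [integral_indicator hAm, setIntegral_const, smul_eq_mul, hvol,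
      div_rpow hε.le zero_le_two, rpow_neg zero_le_two, div_inv_eq_mul]
    simp only [dim]
    apply le_of_eq
    ring

theorem tendsto_pv_starSet_pole (hN : 2 ≤ finrank ℝ E) (hα : 0 < α) (hα1 : α < 1)
    {u : E → ℝ} {η : ℝ} (hη : η ≤ 1 / 2) (hu : XB α η u) (hθ : ‖θ‖ = 1) :
    Tendsto (pv α (starSet fun σ => u σ - u θ) θ) (𝓝[>] 0)
      (nhds (2 * lamInt α θ / α - 2 * (hyper α u θ + qRem α u θ))) := by
  have := nontrivial_of_two_le hN
  set w : E → ℝ := fun σ => u σ - u θ with hw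
  have hwc : ContinuousOn w (sphere 0 1) := hu.continuousOn.sub continuousOn_const
  have hwb : ∀ x : E, ‖x‖ = 1 → |w x| ≤ 2 * η := fun x hx => by
    have h1 := hu.bound x hx
    have h2 := hu.bound θ hθ
    exact (abs_sub _ _).trans (by linarith)
  have ho := isOpen_starSet hwc hwb
  have hev : ∀ᶠ ε : ℝ in 𝓝[>] 0, 0 < ε ∧ ε < 1 / 2 :=
    (eventually_mem_nhdsWithin).and (nhdsWithin_le_nhds (eventually_lt_nhds (by norm_num)))
  have h1 := tendsto_integral_lens hN hα hα1 hη hu hθ ho.measurableSet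
  have h2 : Tendsto (fun ε : ℝ =>
      (∫ y in {y | ε < ‖y - θ‖}, bodyDiff w y * ‖y - θ‖ ^ (-(dim E + α))) -
        ∫ y in {y | ε ^ 2 * ‖y‖ < ‖y - θ‖ ^ 2}, bodyDiff w y * ‖y - θ‖ ^ (-(dim E + α)))
      (𝓝[>] 0) (nhds 0) := by
    have h3 := (tendsto_annulus_bound (finrank ℝ E) hα1).const_mul
      (2 ^ (dim E + α) * volume.real (ball (0:E) 1))
    rw [mul_zero] at h3
    exact squeeze_zero_norm' (hev.mono fun ε hε =>
      abs_cutoff_sub_le hN hα ho.measurableSet hθ hε.1 hε.2) h3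
  have h4 := (pv_ball hN hα hα1 hθ).add ((h2.add h1).const_mul (-2))
  rw [zero_add, neg_mul, ← sub_eq_add_neg] at h4
  refine h4.congr' (hev.mono fun ε hε => ?_)
  have hb0 : volume (frontier (ball (0:E) 1)) = 0 := by
    rw [frontier_ball _ one_ne_zero]
    exact Measure.addHaar_sphere volume 0 1
  have h5 := pv_sub_pv hα ho.measurableSet measurableSet_ball
    (volume_frontier_starSet hN hwc hwb) hb0 θ hε.1
  change pv α (starSet w) θ ε - pv α (ball 0 1) θ ε = -2 * ∫ y in {y | ε < ‖y - θ‖},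
    bodyDiff w y * ‖y - θ‖ ^ (-(dim E + α)) at h5
  rw [sub_add_cancel, ← h5]
  ring

theorem pv_smul {c : ℝ} (hc : 0 < c) (A : Set E) (x : E) (ε : ℝ) :
    pv α A (c • x) ε = c ^ (-α) * pv α ((fun y => c • y) ⁻¹' A) x (ε / c) := by
  have hU : ∀ (x : E) (ε : ℝ), MeasurableSet {y : E | ε < ‖y - x‖} := fun x ε =>
    measurableSet_lt (by fun_prop) (by fun_prop)
  have hcl : closure ((fun y => c • y) ⁻¹' A) = (fun y : E => c • y) ⁻¹' closure A :=
    ((Homeomorph.smulOfNeZero c hc.ne').preimage_closure A).symm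
  unfold pv
  rw [← integral_indicator (hU _ _), ← integral_indicator (hU _ _), hcl]
  set F : E → ℝ := {y : E | ε < ‖y - c • x‖}.indicator fun y =>
    ((closure A)ᶜ.indicator (fun _ => (1 : ℝ)) y - A.indicator (fun _ => (1 : ℝ)) y) *
      ‖y - c • x‖ ^ (-(dim E + α)) with hF
  have h1 := Measure.integral_comp_smul (volume : Measure E) F c
  have h2 : ∀ y, F (c • y) = c ^ (-(dim E + α)) * {y : E | ε / c < ‖y - x‖}.indicator (fun y =>
      (((fun y => c • y) ⁻¹' closure A)ᶜ.indicator (fun _ => (1 : ℝ)) y -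
        ((fun y => c • y) ⁻¹' A).indicator (fun _ => (1 : ℝ)) y) *
          ‖y - x‖ ^ (-(dim E + α))) y := by
    intro y
    classical
    simp only [hF, indicator_apply, mem_ofPred_eq, ← smul_sub, norm_smul,
      norm_of_nonneg hc.le, div_lt_iff₀' hc, mem_compl_iff, mem_preimage,
      mul_rpow hc.le (norm_nonneg _)]
    split_ifs <;> ring
  simp only [h2] at h1
  rw [integral_const_mul, abs_of_nonneg (by positivity), smul_eq_mul,
    eq_inv_mul_iff_mul_eq₀ (by positivity)] at h1
  rw [← h1, ← mul_assoc, ← rpow_natCast, ← rpow_add hc]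
  congr 2
  simp [dim]

theorem hat_smul {c : ℝ} (hc : 0 < c) (y : E) : hat (c • y) = hat y := by
  rw [hat, hat, norm_smul, norm_of_nonneg hc.le, smul_smul, mul_inv]
  congr 1
  field_simp

theorem preimage_starSet (u : E → ℝ) (θ : E) :
    (fun y => exp (u θ) • y) ⁻¹' starSet u = starSet fun σ => u σ - u θ := by
  ext y
  have h := exp_pos (u θ)
  rw [mem_preimage, starSet, starSet, mem_ofPred_eq, mem_ofPred_eq, hat_smul h,
    norm_smul, norm_of_nonneg h.le, exp_sub, lt_div_iff₀' h]

theorem tendsto_pv_starSet (hN : 2 ≤ finrank ℝ E) (hα : 0 < α) (hα1 : α < 1)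
    {u : E → ℝ} {η : ℝ} (hη : η ≤ 1 / 2) (hu : XB α η u) (hθ : ‖θ‖ = 1) :
    Tendsto (pv α (starSet u) (exp (u θ) • θ)) (𝓝[>] 0)
      (nhds (exp (-(α * u θ)) *
        (2 * lamInt α θ / α - 2 * (hyper α u θ + qRem α u θ)))) := by
  have hc := exp_pos (u θ)
  have h1 : Tendsto (fun ε => ε / exp (u θ)) (𝓝[>] 0)
      (𝓝[>] 0) := by
    refine tendsto_nhdsWithin_iff.2 ⟨?_, eventually_mem_nhdsWithin.mono fun ε hε => ?_⟩
    · have : Tendsto (fun ε => ε / exp (u θ)) (nhds 0) (nhds (0 / exp (u θ))) :=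
        tendsto_id.div_const _
      rw [zero_div] at this
      exact this.mono_left nhdsWithin_le_nhds
    · exact div_pos hε hc
  refine (((tendsto_pv_starSet_pole hN hα hα1 hη hu hθ).comp h1).const_mul
    (exp (-(α * u θ)))).congr fun ε => ?_
  rw [pv_smul hc, preimage_starSet, ← exp_mul, Function.comp_apply]
  congr 2
  ring

theorem setIntegral_starSet (hN : 2 ≤ finrank ℝ E) {u : E → ℝ}
    (hm : MeasurableSet (starSet u)) {F : E → ℝ} (h1 : IntegrableOn F (starSet u))
    (h2 : IntegrableOn (fun y => exp (dim E * u (hat y)) * F (exp (u (hat y)) • y))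
      (ball 0 1)) :
    ∫ y in starSet u, F y =
      ∫ y in ball (0:E) 1, exp (dim E * u (hat y)) * F (exp (u (hat y)) • y) := by
  have := nontrivial_of_two_le hN
  have hmp := measurePreserving_polar_log (E := E)
  rw [← integrable_indicator_iff hm] at h1
  rw [← integrable_indicator_iff measurableSet_ball] at h2
  have i1 := hmp.integrable_comp_of_integrable h1
  have i2 := hmp.integrable_comp_of_integrable h2
  simp only [comp_def] at i1 i2
  rw [← integral_indicator hm, ← integral_indicator measurableSet_ball, ← hmp.map_eq]
  have a1 : AEStronglyMeasurable ((starSet u).indicator F)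
      (Measure.map (fun p : E × ℝ => exp p.2 • p.1) ((surf E).prod (logRadial E))) := by
    rw [hmp.map_eq]; exact h1.aestronglyMeasurable
  have a2 : AEStronglyMeasurable ((ball (0:E) 1).indicator
      fun y => exp (dim E * u (hat y)) * F (exp (u (hat y)) • y))
      (Measure.map (fun p : E × ℝ => exp p.2 • p.1) ((surf E).prod (logRadial E))) := by
    rw [hmp.map_eq]; exact h2.aestronglyMeasurable
  rw [integral_map hmp.aemeasurable a1, integral_map hmp.aemeasurable a2, integral_prod _ i1,
    integral_prod _ i2]
  refine integral_congr_ae ?_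
  filter_upwards [ae_surf_norm] with σ hσ
  rw [integral_logRadial, integral_logRadial, ← integral_add_right_eq_self _ (u σ)]
  congr 1
  funext τ
  classical
  simp only [indicator_apply, exp_smul_mem_starSet hσ, mem_ball_zero_iff, norm_exp_smul hσ,
    exp_lt_one_iff, hat_exp_smul hσ, smul_smul, ← exp_add, add_lt_iff_neg_right]
  rw [add_comm (u σ) τ]
  split_ifs
  · rw [← mul_assoc, ← exp_add, mul_add]
  · simp

section Translates

theorem pv_add (A : Set E) (x v : E) (ε : ℝ) :
    pv α A (x + v) ε = pv α ((fun y => y + v) ⁻¹' A) x ε := by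
  have hU : ∀ x : E, MeasurableSet {y : E | ε < ‖y - x‖} := fun x =>
    measurableSet_lt (by fun_prop) (by fun_prop)
  have hcl : closure ((fun y => y + v) ⁻¹' A) = (fun y : E => y + v) ⁻¹' closure A :=
    ((Homeomorph.addRight v).preimage_closure A).symm
  unfold pv
  rw [← integral_indicator (hU _), ← integral_indicator (hU _), hcl,
    ← integral_add_right_eq_self _ v]
  congr 1
  funext y
  classical
  simp only [indicator_apply, mem_ofPred_eq, add_sub_add_right_eq_sub, mem_compl_iff,
    mem_preimage]

/-- The union of the translates of a set by a family of vectors. -/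
def translates {ι : Type*} (q : ι → E) (S : Set E) : Set E := ⋃ i, (fun y => y + q i) '' S

variable {ι : Type*} {q : ι → E} {S : Set E}

theorem isOpen_translates (hS : IsOpen S) : IsOpen (translates q S) :=
  isOpen_iUnion fun i => (Homeomorph.addRight (q i)).isOpenMap _ hS

theorem translates_add (hS : S ⊆ ball 0 2) {i : ι} {y : E}
    (hy : y ∈ (fun y => y + q i) '' S) : ‖y - q i‖ < 2 := by
  obtain ⟨z, hz, rfl⟩ := hy
  simpa using hS hz

theorem locallyFinite_translates (hsep : ∀ i j, i ≠ j → 8 ≤ ‖q i - q j‖)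
    (hS : S ⊆ ball 0 2) : LocallyFinite fun i => (fun y => y + q i) '' S := by
  intro x
  refine ⟨ball x 1, Metric.ball_mem_nhds x one_pos, Set.Subsingleton.finite ?_⟩
  rintro i ⟨y, hy, hyx⟩ j ⟨z, hz, hzx⟩
  by_contra hij
  have h1 := translates_add hS hy
  have h2 := translates_add hS hz
  rw [mem_ball_iff_norm] at hyx hzx
  have h3 := hsep i j hij
  have h4 : q i - q j = -(y - q i) + (y - x) - (z - x) + (z - q j) := by abel
  have h5 := norm_add_le (-(y - q i) + (y - x) - (z - x)) (z - q j)
  have h6 := norm_sub_le (-(y - q i) + (y - x)) (z - x)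
  have h7 := norm_add_le (-(y - q i)) (y - x)
  rw [norm_neg] at h7
  rw [h4] at h3
  linarith

theorem frontier_translates_subset (hsep : ∀ i j, i ≠ j → 8 ≤ ‖q i - q j‖)
    (hS : S ⊆ ball 0 2) (ho : IsOpen S) :
    frontier (translates q S) ⊆ ⋃ i, (fun y => y + q i) '' frontier S := by
  intro x hx
  rw [(isOpen_translates ho).frontier_eq, translates,
    (locallyFinite_translates hsep hS).closure_iUnion] at hx
  obtain ⟨i, hi⟩ := mem_iUnion.1 hx.1
  refine mem_iUnion.2 ⟨i, ?_⟩
  have h1 : (fun y => y + q i) '' frontier S = frontier ((fun y => y + q i) '' S) :=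
    (Homeomorph.addRight (q i)).image_frontier S
  have h2 : IsOpen ((fun y => y + q i) '' S) := (Homeomorph.addRight (q i)).isOpenMap _ ho
  rw [h1, h2.frontier_eq]
  exact ⟨hi, fun h => hx.2 (mem_iUnion.2 ⟨i, h⟩)⟩

theorem volume_frontier_translates [Countable ι] (hsep : ∀ i j, i ≠ j → 8 ≤ ‖q i - q j‖)
    (hS : S ⊆ ball 0 2) (ho : IsOpen S) (h0 : volume (frontier S) = 0) :
    volume (frontier (translates q S)) = 0 := by
  refine measure_mono_null (frontier_translates_subset hsep hS ho) (measure_iUnion_null fun i => ?_)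
  rw [image_add_right, measure_preimage_add_right, h0]

theorem pv_translates [Countable ι] (hα : 0 < α) (hsep : ∀ i j, i ≠ j → 8 ≤ ‖q i - q j‖)
    (hS : S ⊆ ball 0 2) (ho : IsOpen S) (h0 : volume (frontier S) = 0) {o : ι}
    (hq : q o = 0) {x : E} (hx : ‖x‖ ≤ 2) {ε : ℝ} (hε : 0 < ε)
    (hε1 : ε < 1) :
    pv α (translates q S) x ε = pv α S x ε -
      2 * ∫ y in S, latKer (dim E + α) (fun i : {i // i ≠ o} => q i.1) (y - x) := by
  have hs : 0 < dim E + α := by unfold dim; positivity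
  have hq8 : ∀ i : {i // i ≠ o}, 8 ≤ ‖q i.1‖ := fun i => by
    simpa [hq] using hsep i.1 o i.2
  set U : Set E := ⋃ i : {i // i ≠ o}, (fun y => y + q i.1) '' S with hU
  have hTm : ∀ i, MeasurableSet ((fun y => y + q i) '' S) := fun i =>
    ((Homeomorph.addRight (q i)).isOpenMap _ ho).measurableSet
  have hUm : MeasurableSet U := MeasurableSet.iUnion fun i => hTm i.1
  have hfar : ∀ y ∈ U, ε < ‖y - x‖ := by
    intro y hy
    obtain ⟨i, hi⟩ := mem_iUnion.1 hy
    have h1 := translates_add hS hi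
    have h2 := hq8 i
    have h3 : q i.1 = (y - x) - (y - q i.1) + x := by abel
    have h4 := norm_add_le ((y - x) - (y - q i.1)) x
    have h5 := norm_sub_le (y - x) (y - q i.1)
    rw [← h3] at h4
    linarith
  have hdis : Disjoint S U := by
    rw [disjoint_left]
    intro y hy hyU
    obtain ⟨i, hi⟩ := mem_iUnion.1 hyU
    have h1 := translates_add hS hi
    have h2 := hq8 i
    have h3 : ‖y‖ < 2 := by simpa using hS hy
    have h4 := norm_sub_le y (y - q i.1)
    rw [sub_sub_cancel] at h4
    linarith
  have hT : translates q S = S ∪ U := by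
    ext y
    simp only [translates, hU, mem_iUnion, mem_union]
    constructor
    · rintro ⟨i, hi⟩
      by_cases h : i = o
      · left
        rw [h, hq] at hi
        simpa using hi
      · exact Or.inr ⟨⟨i, h⟩, hi⟩
    · rintro (h | ⟨i, hi⟩)
      · exact ⟨o, by rw [hq]; simpa using h⟩
      · exact ⟨i.1, hi⟩
  have hpd : Pairwise (onFun Disjoint
      fun i : {i // i ≠ o} => (fun y => y + q i.1) '' S) := by
    intro i j hij
    rw [onFun, disjoint_left]
    intro y hi hj
    have h1 := translates_add hS hi
    have h2 := translates_add hS hj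
    have h3 := hsep i.1 j.1 fun h => hij (Subtype.ext h)
    have h4 := norm_sub_le (y - q j.1) (y - q i.1)
    rw [sub_sub_sub_cancel_left] at h4
    linarith
  have hUi : IntegrableOn (fun y => ‖y - x‖ ^ (-(dim E + α))) U :=
    (integrableOn_kernel_far (E := E) hα x hε).mono_set hfar
  have hsI := hasSum_integral_iUnion (fun i : {i // i ≠ o} => hTm i.1) hpd hUi
  have hone : ∀ i : {i // i ≠ o}, ∫ y in (fun y => y + q i.1) '' S, ‖y - x‖ ^ (-(dim E + α)) =
      ∫ y in S, ‖y - x + q i.1‖ ^ (-(dim E + α)) := by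
    intro i
    rw [← integral_indicator (hTm i.1), ← integral_indicator ho.measurableSet,
      ← integral_add_right_eq_self _ (q i.1)]
    congr 1
    funext y
    classical
    simp only [indicator_apply, mem_image, add_left_inj, exists_eq_right]
    rw [add_sub_right_comm]
  simp only [hone] at hsI
  have hSf : volume S ≠ ⊤ := ((measure_mono hS).trans_lt measure_ball_lt_top).ne
  have hInt : ∀ i : {i // i ≠ o},
      IntegrableOn (fun y => ‖y - x + q i.1‖ ^ (-(dim E + α))) S := by
    intro i
    refine Measure.integrableOn_of_bounded (M := 2 ^ (dim E + α) * ‖q i.1‖ ^ (-(dim E + α))) hSf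
      (by fun_prop : Measurable _).aestronglyMeasurable ?_
    filter_upwards [ae_restrict_mem ho.measurableSet] with y hy
    rw [norm_of_nonneg (by positivity)]
    refine rpow_neg_add_le hs ?_ (hq8 i)
    have h3 : ‖y‖ < 2 := by simpa using hS hy
    exact (norm_sub_le _ _).trans (by linarith)
  have hnorm : Summable fun i : {i // i ≠ o} =>
      ∫ y in S, ‖‖y - x + q i.1‖ ^ (-(dim E + α))‖ := by
    refine hsI.summable.congr fun i => ?_
    congr 1
    funext y
    rw [norm_of_nonneg (by positivity)]
  have hsw := integral_tsum_of_summable_integral_norm hInt hnorm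
  have hd := pv_sub_pv hα (isOpen_translates (q := q) ho).measurableSet ho.measurableSet
    (volume_frontier_translates hsep hS ho h0) h0 x hε
  rw [sub_eq_iff_eq_add'] at hd
  rw [hd, sub_eq_add_neg, ← neg_mul]
  congr 2
  have : ∫ y in S, latKer (dim E + α) (fun i : {i // i ≠ o} => q i.1) (y - x) =
      ∫ y in U, ‖y - x‖ ^ (-(dim E + α)) := by
    rw [← hsI.tsum_eq, hsw]
    rfl
  rw [this, ← integral_indicator (measurableSet_lt (by fun_prop) (by fun_prop)),
    ← integral_indicator hUm]
  congr 1
  funext y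
  classical
  by_cases h1 : y ∈ U
  · have h2 := disjoint_right.1 hdis h1
    rw [indicator_of_mem h1, indicator_of_mem (s := {y : E | ε < ‖y - x‖}) (hfar y h1), hT,
      indicator_of_mem (mem_union_right S h1), indicator_of_notMem h2]
    ring
  · rw [indicator_of_notMem h1, hT]
    simp [indicator_apply, h1]

end Translates

theorem exp_half_lt_two : exp (1 / 2) < 2 := by
  have h := exp_one_lt_three
  rw [show (1:ℝ) = 1 / 2 + 1 / 2 by norm_num, exp_add] at h
  nlinarith [exp_pos (1 / 2)]

theorem XB.starSet_subset {u : E → ℝ} (hu : XB α (1 / 2) u) : starSet u ⊆ ball 0 2 := by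
  intro x hx
  rw [mem_ball_zero_iff]
  rcases eq_or_ne x 0 with rfl | h0
  · simp
  · exact (show ‖x‖ < _ from hx).trans ((exp_le_exp.2 (abs_le.1 (hu.bound _
      (norm_hat h0))).2).trans_lt exp_half_lt_two)

theorem tendsto_pv_translates (hN : 2 ≤ finrank ℝ E) (hα : 0 < α) (hα1 : α < 1)
    {ι : Type*} [Countable ι] {q : ι → E} (hsep : ∀ i j, i ≠ j → 8 ≤ ‖q i - q j‖) {o : ι}
    (hq : q o = 0) {B : ℝ} (hk : KB B (latKer (dim E + α) fun i : {i // i ≠ o} => q i.1))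
    {u : E → ℝ} (hu : XB α (1 / 2) u) (hθ : ‖θ‖ = 1)
    (heq : hyper α u θ + lamInt α θ * u θ =
      rhs α (lamInt α θ) (latKer (dim E + α) fun i : {i // i ≠ o} => q i.1) u θ) :
    Tendsto (pv α (translates q (starSet u)) (exp (u θ) • θ)) (𝓝[>] 0)
      (nhds (2 * lamInt α θ / α)) := by
  set k := latKer (dim E + α) fun i : {i // i ≠ o} => q i.1 with hkdef
  have ho := isOpen_starSet hu.continuousOn hu.bound
  have hS := hu.starSet_subset
  have hx : ‖exp (u θ) • θ‖ ≤ 2 := by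
    rw [norm_exp_smul hθ]
    exact (exp_le_exp.2 (abs_le.1 (hu.bound θ hθ)).2).trans exp_half_lt_two.le
  have hki : IntegrableOn (fun y => k (y - exp (u θ) • θ)) (starSet u) := by
    refine Measure.integrableOn_of_bounded (M := B)
      ((measure_mono hS).trans_lt measure_ball_lt_top).ne
      (hk.meas.comp (measurable_id.sub_const _)).aestronglyMeasurable ?_
    filter_upwards [ae_restrict_mem ho.measurableSet] with y hy
    refine hk.bound _ ((norm_sub_le _ _).trans ?_)
    have h3 : ‖y‖ < 2 := by simpa using hS hy
    linarith
  have hV : ∫ y in starSet u, k (y - exp (u θ) • θ) = farPot k u θ :=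
    setIntegral_starSet hN ho.measurableSet hki (farPot_integrable hN hk hu hθ)
  have hlim := (tendsto_pv_starSet hN hα hα1 le_rfl hu hθ).sub_const (2 * farPot k u θ)
  have hval : exp (-(α * u θ)) * (2 * lamInt α θ / α - 2 * (hyper α u θ + qRem α u θ)) -
      2 * farPot k u θ = 2 * lamInt α θ / α := by
    have h1 : hyper α u θ + qRem α u θ = lamInt α θ / α * (1 - exp (α * u θ)) -
        exp (α * u θ) * farPot k u θ := by
      rw [rhs] at heq
      have : lamInt α θ / α * (α * u θ) = lamInt α θ * u θ := by field_simp
      linear_combination heq + this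
    rw [h1, exp_neg]
    have := (exp_pos (α * u θ)).ne'
    field_simp
    ring
  rw [hval] at hlim
  have hev : ∀ᶠ ε : ℝ in 𝓝[>] 0, 0 < ε ∧ ε < 1 :=
    (eventually_mem_nhdsWithin).and (nhdsWithin_le_nhds (eventually_lt_nhds one_pos))
  refine hlim.congr' (hev.mono fun ε hε => ?_)
  rw [pv_translates hα hsep hS ho (volume_frontier_starSet hN hu.continuousOn hu.bound) hq hx
    hε.1 hε.2, ← hV]

theorem tendsto_pv_translates_frontier (hN : 2 ≤ finrank ℝ E) (hα : 0 < α) (hα1 : α < 1)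
    {ι : Type*} [Countable ι] {q : ι → E} (hsep : ∀ i j, i ≠ j → 8 ≤ ‖q i - q j‖) {o : ι}
    (hq : q o = 0) {B lam : ℝ}
    (hk : KB B (latKer (dim E + α) fun i : {i // i ≠ o} => q i.1))
    {u : E → ℝ} (hu : XB α (1 / 2) u) (hlam : ∀ θ : E, ‖θ‖ = 1 → lamInt α θ = lam)
    (heq : ∀ θ : E, ‖θ‖ = 1 → hyper α u θ + lam * u θ =
      rhs α lam (latKer (dim E + α) fun i : {i // i ≠ o} => q i.1) u θ)
    (hinv : ∀ i, (fun y => y + q i) ⁻¹' translates q (starSet u) = translates q (starSet u))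
    {x : E} (hx : x ∈ frontier (translates q (starSet u))) :
    Tendsto (pv α (translates q (starSet u)) x) (𝓝[>] 0)
      (nhds (2 * lam / α)) := by
  obtain ⟨i, hi⟩ := mem_iUnion.1 (frontier_translates_subset hsep hu.starSet_subset
    (isOpen_starSet hu.continuousOn hu.bound) hx)
  obtain ⟨y, hy, rfl⟩ := hi
  have hy' : ‖y‖ = exp (u (hat y)) := frontier_starSet hu.continuousOn hu.bound hy
  have hy0 : y ≠ 0 := by
    rintro rfl
    rw [norm_zero] at hy'
    exact (exp_pos _).ne hy'
  have hθ := norm_hat hy0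
  have hye : y = exp (u (hat y)) • hat y := by
    rw [← hy', hat, smul_smul, mul_inv_cancel₀ (norm_ne_zero_iff.2 hy0), one_smul]
  have h1 := tendsto_pv_translates hN hα hα1 hsep hq hk hu hθ (by rw [hlam _ hθ]; exact heq _ hθ)
  rw [hlam _ hθ, ← hye] at h1
  refine h1.congr fun ε => ?_
  rw [pv_add, hinv]

theorem strictConvexOn_shifted_rpow {b c p : ℝ} (hb : |b| ≤ 2) (hbc : b ^ 2 ≤ c) (hc : c ≤ 4)
    (hp : 0 < p) :
    StrictConvexOn ℝ (Ici 36) fun t : ℝ => (t + 2 * b * √t + c) ^ (-p) := by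
  obtain ⟨hb1, hb2⟩ := abs_le.1 hb
  have hs : ∀ t : ℝ, 36 ≤ t → 6 ≤ √t ∧ √t ^ 2 = t := fun t ht =>
    ⟨le_sqrt_of_sq_le (by linarith), sq_sqrt (by linarith)⟩
  have hφ : ∀ t : ℝ, 36 ≤ t → 0 < t + 2 * b * √t + c := fun t ht => by
    obtain ⟨h1, h2⟩ := hs t ht
    nlinarith
  have hder : ∀ t : ℝ, 36 < t → HasDerivAt (fun t : ℝ => (t + 2 * b * √t + c) ^ (-p))
      (-(p * ((t + 2 * b * √t + c) ^ (-p) * ((1 + b / √t) / (t + 2 * b * √t + c))))) t := by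
    intro t ht
    have h1 := hφ t ht.le
    have h2 : HasDerivAt (fun t : ℝ => t + 2 * b * √t + c) (1 + 2 * b * (1 / (2 * √t))) t :=
      ((hasDerivAt_id t).fun_add
        ((hasDerivAt_sqrt (by linarith)).const_mul (2 * b))).add_const c
    convert h2.rpow_const (p := -p) (Or.inl h1.ne') using 1
    rw [rpow_sub_one h1.ne']
    have := (hs t ht.le).1
    have h3 : √t ≠ 0 := by linarith
    field_simp
  refine StrictMonoOn.strictConvexOn_of_deriv (convex_Ici 36) ?_ ?_
  · refine ContinuousOn.rpow_const (by fun_prop) fun t ht => Or.inl (hφ t ht).ne'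
  · rw [interior_Ici]
    intro x hx y hy hxy
    rw [(hder x hx).deriv, (hder y hy).deriv]
    obtain ⟨x1, x2⟩ := hs x (le_of_lt hx)
    obtain ⟨y1, y2⟩ := hs y (le_of_lt hy)
    have hlt : √x < √y := sqrt_lt_sqrt (by linarith [mem_Ioi.1 hx]) hxy
    have px := hφ x (le_of_lt hx)
    have py := hφ y (le_of_lt hy)
    have h1 : (y + 2 * b * √y + c) ^ (-p) < (x + 2 * b * √x + c) ^ (-p) :=
      rpow_lt_rpow_of_neg px (by nlinarith) (by linarith)
    have hy0 : 0 < (1 + b / √y) / (y + 2 * b * √y + c) := by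
      refine div_pos ?_ py
      have : 0 < √y := by linarith
      rw [← div_self this.ne', ← add_div]
      exact div_pos (by linarith) this
    have aux : ∀ m n : ℝ, 6 ≤ m → m < n → 0 < m ^ 2 + 2 * b * m + c →
        0 < n ^ 2 + 2 * b * n + c → (n + b) / (n * (n ^ 2 + 2 * b * n + c)) ≤
          (m + b) / (m * (m ^ 2 + 2 * b * m + c)) := by
      intro m n hm hmn pm pn
      have m0 : 0 < m := by linarith
      have n0 : 0 < n := by linarith
      rw [div_le_div_iff₀ (by positivity) (by positivity)]
      have key : 0 ≤ m * n * (m + n + 2 * b) +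
          b * (m ^ 2 + m * n + n ^ 2 + 2 * b * (m + n) + c) := by
        have k1 : 6 * (m ^ 2 + n ^ 2) ≤ m * n * (m + n) := by
          have k5 := mul_nonneg (by linarith : 0 ≤ n - 6) (sq_nonneg m)
          have k6 := mul_nonneg (by linarith : 0 ≤ m - 6) (sq_nonneg n)
          linarith
        have k2 : -2 * (m ^ 2 + 3 * m * n + n ^ 2) ≤ b * (m ^ 2 + 3 * m * n + n ^ 2) :=
          mul_le_mul_of_nonneg_right hb1 (by positivity)
        have k3 : -8 ≤ b * c := by
          have k7 := mul_nonneg (by linarith : 0 ≤ b + 2) ((sq_nonneg b).trans hbc)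
          linarith
        have k4 : 0 ≤ b ^ 2 * (m + n) := by positivity
        have k8 : 36 ≤ m * n := by nlinarith
        linarith [sq_nonneg (m - n)]
      have := mul_nonneg (by linarith : 0 ≤ n - m) key
      linarith
    have h2 : (1 + b / √y) / (y + 2 * b * √y + c) ≤ (1 + b / √x) / (x + 2 * b * √x + c) := by
      have e : ∀ ρ : ℝ, 0 < ρ → (1 + b / ρ) = (ρ + b) / ρ := fun ρ hρ => by field_simp
      rw [e _ (by linarith), e _ (by linarith), div_div, div_div]
      have := aux (√x) (√y) x1 hlt (by rw [x2]; exact px) (by rw [y2]; exact py)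
      rwa [x2, y2] at this
    have h3 : (y + 2 * b * √y + c) ^ (-p) * ((1 + b / √y) / (y + 2 * b * √y + c)) <
        (x + 2 * b * √x + c) ^ (-p) * ((1 + b / √x) / (x + 2 * b * √x + c)) :=
      mul_lt_mul h1 h2 hy0 (rpow_nonneg px.le _)
    nlinarith

theorem strictConvexOn_norm_rpow {s : ℝ} (hs : 0 < s) {e y : E} (he : ‖e‖ = 1) (hy : ‖y‖ ≤ 2) :
    StrictConvexOn ℝ (Ici 36) fun t : ℝ => ‖y + √t • e‖ ^ (-s) := by
  have hin : |inner ℝ y e| ≤ ‖y‖ := by simpa [he] using abs_real_inner_le_norm y e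
  have h := strictConvexOn_shifted_rpow (b := inner ℝ y e) (c := ‖y‖ ^ 2) (p := s / 2)
    (hin.trans hy) (sq_le_sq' (by linarith [(abs_le.1 hin).1]) (abs_le.1 hin).2)
    (by nlinarith [norm_nonneg y]) (by linarith)
  refine h.congr fun t ht => ?_
  have ht0 : (0:ℝ) ≤ t := by linarith [mem_Ici.1 ht]
  have h1 : t + 2 * inner ℝ y e * √t + ‖y‖ ^ 2 = ‖y + √t • e‖ ^ 2 := by
    rw [norm_add_sq_real, inner_smul_right, norm_smul, he, mul_one, norm_eq_abs, sq_abs,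
      sq_sqrt ht0]
    ring
  beta_reduce
  rw [h1, ← rpow_natCast, ← rpow_mul (norm_nonneg _)]
  congr 1
  push_cast
  ring

/-- The (rescaled) potential of a ball of radius `R` for the kernel `‖·‖ ^ (-s)`. -/
noncomputable def ballPot (s R : ℝ) (w : E) : ℝ := ∫ y in ball (0:E) 1, ‖R • y + w‖ ^ (-s)

theorem ballPot_map (s R : ℝ) (w : E) (T : E ≃ₗᵢ[ℝ] E) : ballPot s R (T w) = ballPot s R w := by
  rw [ballPot, ballPot, ← integral_indicator measurableSet_ball,
    ← integral_indicator measurableSet_ball,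
    ← T.measurePreserving.integral_comp T.toHomeomorph.measurableEmbedding]
  congr 1
  funext y
  classical
  simp only [indicator_apply, mem_ball_zero_iff, T.norm_map, ← map_smul, ← map_add]

theorem ballPot_integrableOn {s R : ℝ} (hs : 0 < s) (hR0 : 0 ≤ R) (hR : R ≤ 2) {w : E}
    (hw : 6 ≤ ‖w‖) : IntegrableOn (fun y : E => ‖R • y + w‖ ^ (-s)) (ball 0 1) := by
  refine Measure.integrableOn_of_bounded (M := 4 ^ (-s)) measure_ball_lt_top.ne
    (by fun_prop : Measurable _).aestronglyMeasurable ?_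
  filter_upwards [ae_restrict_mem measurableSet_ball] with y hy
  rw [mem_ball_zero_iff] at hy
  have h1 : ‖R • y‖ ≤ 2 := by
    rw [norm_smul, norm_of_nonneg hR0]
    nlinarith [norm_nonneg y]
  have h2 := norm_sub_norm_le w (-(R • y))
  rw [norm_neg, sub_neg_eq_add, add_comm w] at h2
  rw [norm_of_nonneg (by positivity)]
  exact rpow_le_rpow_of_nonpos (by norm_num) (by linarith) (by linarith)

theorem ballPot_eq_of_norm_eq (s R : ℝ) {v w : E} (h : ‖v‖ = ‖w‖) :
    ballPot s R v = ballPot s R w := by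
  rw [← Submodule.reflection_sub h, ballPot_map]

theorem strictConvexOn_ballPot {s R : ℝ} (hs : 0 < s) (hR0 : 0 ≤ R) (hR : R ≤ 2) {e : E}
    (he : ‖e‖ = 1) : StrictConvexOn ℝ (Ici 36) fun t : ℝ => ballPot s R (√t • e) := by
  refine ⟨convex_Ici 36, fun x hx y hy hxy a b ha hb hab => ?_⟩
  have hn : ∀ t : ℝ, t ∈ Ici (36:ℝ) → 6 ≤ ‖√t • e‖ := fun t ht => by
    rw [norm_smul, he, mul_one, norm_of_nonneg (sqrt_nonneg _)]
    exact le_sqrt_of_sq_le (by linarith [mem_Ici.1 ht])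
  have hz : a • x + b • y ∈ Ici (36:ℝ) := convex_Ici 36 hx hy ha.le hb.le hab
  have ix := (ballPot_integrableOn hs hR0 hR (hn x hx)).const_mul a
  have iy := (ballPot_integrableOn hs hR0 hR (hn y hy)).const_mul b
  have iz := ballPot_integrableOn hs hR0 hR (hn _ hz)
  have ixy : IntegrableOn (fun v : E => a * ‖R • v + √x • e‖ ^ (-s) + b * ‖R • v + √y • e‖ ^ (-s))
      (ball 0 1) := ix.add iy
  have ixyz : IntegrableOn (fun v : E => a * ‖R • v + √x • e‖ ^ (-s) +
      b * ‖R • v + √y • e‖ ^ (-s) - ‖R • v + √(a • x + b • y) • e‖ ^ (-s)) (ball 0 1) :=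
    ixy.sub iz
  have hpos : ∀ v ∈ ball (0:E) 1, 0 <
      a * ‖R • v + √x • e‖ ^ (-s) + b * ‖R • v + √y • e‖ ^ (-s) -
        ‖R • v + √(a • x + b • y) • e‖ ^ (-s) := by
    intro v hv
    rw [mem_ball_zero_iff] at hv
    have h1 : ‖R • v‖ ≤ 2 := by
      rw [norm_smul, norm_of_nonneg hR0]
      nlinarith [norm_nonneg v]
    exact sub_pos.2 ((strictConvexOn_norm_rpow hs he h1).2 hx hy hxy ha hb hab)
  have h : 0 < ∫ v in ball (0:E) 1,
      (a * ‖R • v + √x • e‖ ^ (-s) + b * ‖R • v + √y • e‖ ^ (-s) -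
        ‖R • v + √(a • x + b • y) • e‖ ^ (-s)) := by
    rw [setIntegral_pos_iff_support_of_nonneg_ae _ ixyz]
    · refine (Metric.measure_ball_pos volume (0:E) one_pos).trans_le (measure_mono fun v hv => ?_)
      exact ⟨(hpos v hv).ne', hv⟩
    · filter_upwards [ae_restrict_mem measurableSet_ball] with v hv using (hpos v hv).le
  rw [integral_sub ixy iz, integral_add ix iy, integral_const_mul, integral_const_mul]
    at h
  exact sub_pos.1 h

theorem ballPot_parallelogram {s R : ℝ} (hs : 0 < s) (hR0 : 0 ≤ R) (hR : R ≤ 2) {q ξ η : E}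
    (hξη : ‖ξ‖ = ‖η‖) (hη : inner ℝ q η = 0) (h1 : 6 ≤ ‖q - ξ‖) (h2 : 6 ≤ ‖q + ξ‖) :
    ballPot s R (q - η) + ballPot s R (q + η) ≤ ballPot s R (q - ξ) + ballPot s R (q + ξ) ∧
    (inner ℝ q ξ ≠ 0 →
      ballPot s R (q - η) + ballPot s R (q + η) < ballPot s R (q - ξ) + ballPot s R (q + ξ)) := by
  have hpm : ‖q + η‖ = ‖q - η‖ := by
    rw [← sq_eq_sq₀ (norm_nonneg _) (norm_nonneg _), norm_add_sq_real, norm_sub_sq_real, hη]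
    ring
  have hw0 : q - ξ ≠ 0 := by rw [← norm_pos_iff]; linarith
  have he := norm_hat hw0
  have hrad : ∀ w : E, ballPot s R w = ballPot s R (√(‖w‖ ^ 2) • hat (q - ξ)) := fun w => by
    refine ballPot_eq_of_norm_eq s R ?_
    rw [norm_smul, he, sqrt_sq (norm_nonneg _), norm_norm, mul_one]
  have hmid : ‖q - η‖ ^ 2 = (1 / 2 : ℝ) • ‖q - ξ‖ ^ 2 + (1 / 2 : ℝ) • ‖q + ξ‖ ^ 2 := by
    rw [norm_sub_sq_real, norm_sub_sq_real, norm_add_sq_real, hη, hξη, smul_eq_mul, smul_eq_mul]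
    ring
  have hG := strictConvexOn_ballPot hs hR0 hR he
  have m1 : ‖q - ξ‖ ^ 2 ∈ Ici (36:ℝ) := by rw [mem_Ici]; nlinarith
  have m2 : ‖q + ξ‖ ^ 2 ∈ Ici (36:ℝ) := by rw [mem_Ici]; nlinarith
  rw [ballPot_eq_of_norm_eq s R hpm, hrad (q - η), hrad (q - ξ), hrad (q + ξ), hmid]
  constructor
  · have := hG.convexOn.2 m1 m2 (by norm_num : (0:ℝ) ≤ 1 / 2) (by norm_num : (0:ℝ) ≤ 1 / 2)
      (by norm_num)
    simp only [smul_eq_mul] at this ⊢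
    linarith
  · intro hne
    have hne' : ‖q - ξ‖ ^ 2 ≠ ‖q + ξ‖ ^ 2 := by
      rw [norm_sub_sq_real, norm_add_sq_real]
      contrapose! hne
      linarith
    have := hG.2 m1 m2 hne' (by norm_num : (0:ℝ) < 1 / 2) (by norm_num : (0:ℝ) < 1 / 2)
      (by norm_num)
    simp only [smul_eq_mul] at this ⊢
    linarith

theorem farPot_latKer_const (hN : 2 ≤ finrank ℝ E) {ι : Type*} [Countable ι] {s : ℝ}
    (hs : 0 < s) {q : ι → E} (hq : ∀ i, 8 ≤ ‖q i‖) (hsum : Summable fun i => ‖q i‖ ^ (-s))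
    {u : E → ℝ} {c : ℝ} (hc : exp c ≤ 2) (hu : ∀ σ, ‖σ‖ = 1 → u σ = c) 
    (hθ : ‖θ‖ = 1) :
    (Summable fun i => ballPot s (exp c) (q i - exp c • θ)) ∧
    farPot (latKer s q) u θ =
      exp (dim E * c) * ∑' i, ballPot s (exp c) (q i - exp c • θ) := by
  set R := exp c with hRdef
  have hR0 : 0 < R := exp_pos c
  have hn : ‖R • θ‖ ≤ 2 := by rw [norm_smul, hθ, mul_one, norm_of_nonneg hR0.le]; exact hc
  have h6 : ∀ i, 6 ≤ ‖q i - R • θ‖ := fun i => by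
    linarith [norm_sub_norm_le (q i) (R • θ), hq i]
  have hInt := fun i => ballPot_integrableOn hs hR0.le hc (h6 i)
  have hle : ∀ i, ∀ y ∈ ball (0:E) 1,
      ‖R • y + (q i - R • θ)‖ ^ (-s) ≤ 2 ^ s * ‖q i‖ ^ (-s) := fun i y hy => by
    rw [mem_ball_zero_iff] at hy
    have h1 : ‖R • y‖ ≤ 2 := by
      rw [norm_smul, norm_of_nonneg hR0.le]
      nlinarith [norm_nonneg y]
    rw [show R • y + (q i - R • θ) = (R • y - R • θ) + q i by abel]
    exact rpow_neg_add_le hs ((norm_sub_le _ _).trans (by linarith)) (hq i)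
  have hnn : ∀ i, 0 ≤ ballPot s R (q i - R • θ) := fun i =>
    setIntegral_nonneg measurableSet_ball fun y _ => by positivity
  have hS : Summable fun i => ballPot s R (q i - R • θ) := by
    refine Summable.of_nonneg_of_le hnn (fun i => ?_)
      ((hsum.mul_left (2 ^ s)).mul_left (volume.real (ball (0:E) 1)))
    rw [ballPot, ← smul_eq_mul (volume.real _), ← setIntegral_const]
    exact setIntegral_mono_on (hInt i) (integrableOn_const measure_ball_lt_top.ne)
      measurableSet_ball (hle i)
  refine ⟨hS, ?_⟩
  have hsumm := hS
  simp only [ballPot] at hsumm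
  rw [farPot]
  have e1 : ∀ᵐ y ∂(volume : Measure E).restrict (ball 0 1),
      exp (dim E * u (hat y)) * latKer s q (exp (u (hat y)) • y - exp (u θ) • θ) =
      exp (dim E * c) * ∑' i, ‖R • y + (q i - R • θ)‖ ^ (-s) := by
    filter_upwards [ae_restrict_of_ae (ae_ne_zero hN)] with y hy
    rw [hu _ (norm_hat hy), hu θ hθ, latKer]
    congr 2
    funext i
    rw [← hRdef, show R • y + (q i - R • θ) = (R • y - R • θ) + q i by abel]
  rw [integral_congr_ae e1, integral_const_mul, ← integral_tsum_of_summable_integral_norm hInt]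
  · rfl
  · refine hsumm.congr fun i => ?_
    congr 1
    funext y
    rw [norm_of_nonneg (by positivity)]

theorem farPot_latKer_lt (hN : 2 ≤ finrank ℝ E) {ι : Type*} [Countable ι] {s : ℝ}
    (hs : 0 < s) {q : ι → E} (hq : ∀ i, 8 ≤ ‖q i‖) (hsum : Summable fun i => ‖q i‖ ^ (-s))
    (τ : ι ≃ ι) (hτ : ∀ i, q (τ i) = -q i)
    {u : E → ℝ} {c : ℝ} (hc : exp c ≤ 2) (hu : ∀ σ, ‖σ‖ = 1 → u σ = c) {η ξ : E}
    (hη : ‖η‖ = 1) (hξ : ‖ξ‖ = 1) (hqη : ∀ i, inner ℝ (q i) η = 0) {o : ι}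
    (ho : inner ℝ (q o) ξ ≠ 0) :
    farPot (latKer s q) u η < farPot (latKer s q) u ξ := by
  set R := exp c with hRdef
  have hR0 : 0 < R := exp_pos c
  have key : ∀ θ : E, ‖θ‖ = 1 →
      (Summable fun i => ballPot s R (q i - R • θ) + ballPot s R (q i + R • θ)) ∧
      2 * farPot (latKer s q) u θ = exp (dim E * c) *
        ∑' i, (ballPot s R (q i - R • θ) + ballPot s R (q i + R • θ)) := by
    intro θ hθ
    obtain ⟨h1, h2⟩ := farPot_latKer_const hN hs hq hsum hc hu hθ
    have e : (fun i => ballPot s R (q i + R • θ)) = (fun i => ballPot s R (q i - R • θ)) ∘ τ := by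
      funext i
      refine ballPot_eq_of_norm_eq s R ?_
      rw [hτ, ← norm_neg]
      congr 1
      abel
    have h3 : Summable fun i => ballPot s R (q i + R • θ) := by
      rw [e]
      exact (Equiv.summable_iff τ).2 h1
    have h4 : ∑' i, ballPot s R (q i + R • θ) = ∑' i, ballPot s R (q i - R • θ) := by
      rw [e]
      exact Equiv.tsum_eq τ fun i => ballPot s R (q i - R • θ)
    refine ⟨h1.add h3, ?_⟩
    rw [h1.tsum_add h3, h4, h2]
    ring
  obtain ⟨s1, e1⟩ := key η hη
  obtain ⟨s2, e2⟩ := key ξ hξ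
  have hn : ‖R • ξ‖ ≤ 2 := by rw [norm_smul, hξ, mul_one, norm_of_nonneg hR0.le]; exact hc
  have hp := fun i => ballPot_parallelogram hs hR0.le hc (q := q i) (ξ := R • ξ) (η := R • η)
    (by rw [norm_smul, norm_smul, hη, hξ]) (by rw [inner_smul_right, hqη, mul_zero])
    (by linarith [norm_sub_norm_le (q i) (R • ξ), hq i])
    (by
      have := norm_sub_norm_le (q i) (-(R • ξ))
      rw [norm_neg, sub_neg_eq_add] at this
      linarith [hq i])
  have hlt := Summable.tsum_lt_tsum (fun i => (hp i).1)
    ((hp o).2 (by rw [inner_smul_right]; exact mul_ne_zero hR0.ne' ho)) s1 s2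
  have := mul_lt_mul_of_pos_left hlt (exp_pos (dim E * c))
  linarith

theorem hyper_const {u : E → ℝ} {c : ℝ} (hu : ∀ σ, ‖σ‖ = 1 → u σ = c) (hθ : ‖θ‖ = 1) :
    hyper α u θ = 0 := by
  refine integral_eq_zero_of_ae ?_
  filter_upwards [ae_surf_norm (E := E)] with σ hσ
  rw [hu σ hσ, hu θ hθ, hu (axisRefl θ σ) ((norm_axisRefl hθ).trans hσ)]
  simp; ring_nf; simp

theorem qRem_const {u : E → ℝ} {c : ℝ} (hu : ∀ σ, ‖σ‖ = 1 → u σ = c) (hθ : ‖θ‖ = 1) :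
    qRem α u θ = 0 := by
  refine integral_eq_zero_of_ae ?_
  filter_upwards [ae_surf_norm (E := E)] with σ hσ
  rw [qInt, hu σ hσ, hu θ hθ, hu (axisRefl θ σ) ((norm_axisRefl hθ).trans hσ)]
  simp [qfun_zero]

/-- Solutions of the reduced equation with a lattice kernel are not constant on the sphere. -/
theorem solution_not_const (hN : 2 ≤ finrank ℝ E) {ι : Type*} [Countable ι] {s lam : ℝ}
    (hs : 0 < s) {q : ι → E} (hq : ∀ i, 8 ≤ ‖q i‖) (hsum : Summable fun i => ‖q i‖ ^ (-s))
    (τ : ι ≃ ι) (hτ : ∀ i, q (τ i) = -q i) {u : E → ℝ} (hu : XB α (1 / 2) u)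
    (heq : ∀ θ, ‖θ‖ = 1 → hyper α u θ + lam * u θ = rhs α lam (latKer s q) u θ) {η ξ : E}
    (hη : ‖η‖ = 1) (hξ : ‖ξ‖ = 1) (hqη : ∀ i, inner ℝ (q i) η = 0) {o : ι}
    (ho : inner ℝ (q o) ξ ≠ 0) :
    ∃ θ₁ θ₂, ‖θ₁‖ = 1 ∧ ‖θ₂‖ = 1 ∧ u θ₁ ≠ u θ₂ := by
  by_contra! h
  have hc : ∀ σ, ‖σ‖ = 1 → u σ = u η := fun σ hσ => h σ η hσ hη
  have hlt := farPot_latKer_lt hN hs hq hsum τ hτ (exp_le_two_of_XB hu hη) hc hη hξ hqη ho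
  have e1 := heq η hη
  have e2 := heq ξ hξ
  rw [hyper_const hc hη, rhs, qRem_const hc hη] at e1
  rw [hyper_const hc hξ, rhs, qRem_const hc hξ, hc ξ hξ] at e2
  have := mul_lt_mul_of_pos_left hlt (exp_pos (α * u η))
  linarith

end Sphere

section LatticeSolution

variable {E : Type} [NormedAddCommGroup E] [InnerProductSpace ℝ E] [FiniteDimensional ℝ E]
  [MeasurableSpace E] [BorelSpace E] {α : ℝ}

theorem preimage_translates_smul (L : Submodule ℤ E) (r : ℝ) (S : Set E) (i : L) :
    (fun y => y + r • (i : E)) ⁻¹' translates (fun p : L => r • (p : E)) S =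
      translates (fun p : L => r • (p : E)) S := by
  ext y
  simp only [translates, mem_preimage, mem_iUnion, mem_image]
  constructor
  · rintro ⟨p, z, hz, h⟩
    refine ⟨p - i, z, hz, ?_⟩
    rw [Submodule.coe_sub, smul_sub, ← add_sub_assoc, h, add_sub_cancel_right]
  · rintro ⟨p, z, hz, rfl⟩
    refine ⟨p + i, z, hz, ?_⟩
    rw [Submodule.coe_add, smul_add, add_assoc]

theorem exists_lattice_solution (hN : 2 ≤ finrank ℝ E) (hα : 0 < α) (hα1 : α < 1)
    (hα2 : α + 2 - dim E ≠ 0) (L : Submodule ℤ E) [DiscreteTopology L] [Countable L]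
    (hL : (finrank ℤ L : ℝ) < dim E + α) {η ξ p₀ : E} (hη : ‖η‖ = 1) (hξ : ‖ξ‖ = 1)
    (hLη : ∀ p ∈ L, inner ℝ p η = 0) (hp₀ : p₀ ∈ L) (hξp : inner ℝ p₀ ξ ≠ 0) :
    ∃ lam r₀ C : ℝ, 0 < r₀ ∧ 0 ≤ C ∧ (∀ θ : E, ‖θ‖ = 1 → lamInt α θ = lam) ∧
      ∀ r, r₀ < r → ∃ u : E → ℝ, XB α (1 / 2) u ∧ XB α (C * r ^ (-(dim E + α))) u ∧
        (∀ x, ‖x‖ = 1 → u (-x) = u x) ∧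
        (∀ x ∈ frontier (translates (fun p : L => r • (p : E)) (starSet u)),
          Tendsto (pv α (translates (fun p : L => r • (p : E)) (starSet u)) x)
            (𝓝[>] 0) (nhds (2 * lam / α))) ∧
        ∃ θ₁ θ₂, ‖θ₁‖ = 1 ∧ ‖θ₂‖ = 1 ∧ u θ₁ ≠ u θ₂ := by
  have hs : 0 < dim E + α := by linarith [dim_ge hN]
  obtain ⟨lam, K, B₀, hK, hB₀, hKB, hlam, hsol⟩ := exists_solution hN hα hα1 hα2
  obtain ⟨C, hC, hker⟩ := exists_latKer_KB (E := E) hs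
  obtain ⟨m, hm, hmin⟩ := exists_min_norm L
  set S := ∑' p : {p : L // p ≠ 0}, ‖p.1‖ ^ (-(dim E + α)) with hS
  have hS0 : 0 ≤ S := tsum_nonneg fun _ => by positivity
  have hlim : Tendsto (fun r : ℝ => C * (r ^ (-(dim E + α)) * S)) atTop (nhds 0) := by
    simpa using ((tendsto_rpow_neg_atTop hs).mul_const S).const_mul C
  obtain ⟨r₁, hr₁⟩ := eventually_atTop.1 (hlim.eventually_le_const hB₀)
  refine ⟨lam, max r₁ (8 / m), K * (C * S), lt_max_of_lt_right (by positivity), by positivity,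
    hlam, fun r hr => ?_⟩
  have hr1 : r₁ ≤ r := (le_max_left _ _).trans hr.le
  have hr2 : 8 ≤ r * m := (div_le_iff₀ hm).1 ((le_max_right _ _).trans hr.le)
  have hr0 : 0 < r := lt_of_lt_of_le (by positivity) ((le_max_right _ _).trans hr.le)
  have hbig : ∀ p : L, p ≠ 0 → 8 ≤ ‖r • (p : E)‖ := fun p hp => by
    rw [norm_smul, norm_of_nonneg hr0.le]
    exact hr2.trans (mul_le_mul_of_nonneg_left (hmin p p.2 (by simpa using hp)) hr0.le)
  have hq : ∀ p, 8 ≤ ‖scaledPts L r p‖ := fun p => hbig p.1 p.2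
  obtain ⟨hsum, hsum'⟩ := scaledPts_summable L hL hr0
  have hkb := hker _ (scaledPts L r) hq hsum
  rw [hsum', ← hS] at hkb
  obtain ⟨u, hu, hev, heq⟩ := hsol _ _ hkb (hr₁ r hr1) fun z => latKer_scaledPts_neg L _ r z
  have hu2 : XB α (1 / 2) u :=
    hu.mono_left ((mul_le_mul_of_nonneg_left (hr₁ r hr1) hK).trans hKB)
  refine ⟨u, hu2, hu.mono_left (le_of_eq (by ring)), hev, fun x hx => ?_, ?_⟩
  · refine tendsto_pv_translates_frontier hN hα hα1 (q := fun p : L => r • (p : E))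
      (fun i j hij => ?_) (o := 0) (by simp) hkb hu2 hlam heq
      (preimage_translates_smul L r _) hx
    rw [← smul_sub, ← Submodule.coe_sub]
    exact hbig _ (sub_ne_zero.2 hij)
  · refine solution_not_const hN hs hq hsum
      ((Equiv.neg L).subtypeEquiv fun p => by simp) (fun p => by simp [scaledPts]) hu2 heq hη hξ
      (fun p => by rw [scaledPts, inner_smul_left, hLη p.1 p.1.2, mul_zero])
      (o := ⟨⟨p₀, hp₀⟩, ?_⟩) ?_
    · rintro h
      rw [show p₀ = 0 by simpa using h] at hξp
      simp at hξp
    · rw [scaledPts, inner_smul_left]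
      exact mul_ne_zero (by simpa using hr0.ne') hξp

end LatticeSolution

theorem pv_eq_pvInt {N : ℕ} (α : ℝ) (A : Set (EuclideanSpace ℝ (Fin N)))
    (x : EuclideanSpace ℝ (Fin N)) : pv α A x = pvInt N α A x := by
  funext ε
  simp only [pv, pvInt, dim, finrank_euclideanSpace_fin]

theorem coe_span_range_eq_latticeSet {N M : ℕ} (a : Fin M → EuclideanSpace ℝ (Fin N)) :
    (Submodule.span ℤ (range a) : Set (EuclideanSpace ℝ (Fin N))) = latticeSet a := by
  ext p
  rw [SetLike.mem_coe, Submodule.mem_span_range_iff_exists_fun, latticeSet, mem_ofPred_eq]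
  simp only [Int.cast_smul_eq_zsmul, eq_comm]

theorem discreteTopology_span_range {N M : ℕ} {a : Fin M → EuclideanSpace ℝ (Fin N)}
    (ha : LinearIndependent ℝ a) : DiscreteTopology (Submodule.span ℤ (range a)) := by
  have : Finite (ha.linearIndepOn_id.extend (subset_univ _)) :=
    Module.Finite.finite_basis (Module.Basis.extend ha.linearIndepOn_id)
  have h : DiscreteTopology
    (Submodule.span ℤ (range (Module.Basis.extend ha.linearIndepOn_id))) := inferInstance
  refine DiscreteTopology.of_subset h (Submodule.span_mono ?_)
  rw [Module.Basis.range_extend]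
  exact Module.Basis.subset_extend ha.linearIndepOn_id

theorem countable_span_range {N M : ℕ} (a : Fin M → EuclideanSpace ℝ (Fin N)) :
    Countable (Submodule.span ℤ (range a)) := by
  have h : (latticeSet a).Countable :=
    (countable_range fun k : Fin M → ℤ => ∑ i, (k i : ℝ) • a i).mono
      (by rintro p ⟨k, hk⟩; exact ⟨k, hk.symm⟩)
  rw [← coe_span_range_eq_latticeSet] at h
  exact h.to_subtype

theorem starBody_exp_sub_one {N : ℕ} (hN : 2 ≤ N) (u : EuclideanSpace ℝ (Fin N) → ℝ) :
    starBody (fun θ => exp (u θ) - 1) = starSet u := by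
  ext x
  simp only [starBody, starSet, mem_ofPred_eq, mem_sphere_zero_iff_norm, add_sub_cancel]
  constructor
  · rintro ⟨σ, hσ, t, ⟨ht0, ht1⟩, rfl⟩
    have hp := exp_pos (u σ)
    rcases ht0.eq_or_lt with rfl | ht
    · simp [exp_pos]
    · rw [hat_smul ht, hat_exp_smul hσ, norm_smul, norm_exp_smul hσ, norm_of_nonneg ht0]
      nlinarith
  · intro hx
    by_cases h0 : x = 0
    · obtain ⟨σ, hσ⟩ := exists_unit (E := EuclideanSpace ℝ (Fin N)) (by simpa using hN)
      exact ⟨σ, hσ, 0, ⟨le_rfl, one_pos⟩, by simp [h0]⟩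
    · have hp := exp_pos (u (hat x))
      have hn : ‖x‖ ≠ 0 := norm_ne_zero_iff.2 h0
      refine ⟨hat x, norm_hat h0, ‖x‖ / exp (u (hat x)),
        ⟨by positivity, (div_lt_one hp).2 hx⟩, ?_⟩
      rw [smul_smul, div_mul_cancel₀ _ hp.ne', hat, smul_smul, mul_inv_cancel₀ hn, one_smul]

theorem translatedBodies_exp_sub_one {N M : ℕ} (hN : 2 ≤ N) (a : Fin M → EuclideanSpace ℝ (Fin N))
    (r : ℝ) (u : EuclideanSpace ℝ (Fin N) → ℝ) :
    translatedBodies a r (fun θ => exp (u θ) - 1) =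
      translates (fun p : Submodule.span ℤ (range a) => r • (p : EuclideanSpace ℝ (Fin N)))
        (starSet u) := by
  rw [translatedBodies, starBody_exp_sub_one hN, ← coe_span_range_eq_latticeSet, translates,
    biUnion_eq_iUnion]
  rfl

end NonlocalSphere

open NonlocalSphere in
theorem stmt2 (N M : ℕ) (hN : 2 ≤ N) (hM1 : 1 ≤ M) (hMN : M ≤ N - 1)
    (α : ℝ) (hα : α ∈ Set.Ioo (0 : ℝ) 1)
    (a : Fin M → EuclideanSpace ℝ (Fin N)) (ha : LinearIndependent ℝ a)
    (hsub : ∀ i : Fin M, ∀ j : Fin N, M ≤ (j : ℕ) → a i j = 0) :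
    ∃ H₀ : ℝ,
      (∀ e ∈ Metric.sphere (0 : EuclideanSpace ℝ (Fin N)) 1,
        Tendsto (pvInt N α (Metric.ball (0 : EuclideanSpace ℝ (Fin N)) 1) e)
          (nhdsWithin 0 (Set.Ioi 0)) (nhds H₀)) ∧
      ∃ r₀ : ℝ, 0 < r₀ ∧ ∃ Φ : ℝ → EuclideanSpace ℝ (Fin N) → ℝ,
        (∀ r : ℝ, r₀ < r →
          ContinuousOn (Φ r) (Metric.sphere (0 : EuclideanSpace ℝ (Fin N)) 1) ∧
          (∀ θ ∈ Metric.sphere (0 : EuclideanSpace ℝ (Fin N)) 1, |Φ r θ| < 1) ∧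
          (∀ θ ∈ Metric.sphere (0 : EuclideanSpace ℝ (Fin N)) 1, Φ r (-θ) = Φ r θ) ∧
          (∀ x ∈ frontier (translatedBodies a r (Φ r)),
            Tendsto (pvInt N α (translatedBodies a r (Φ r)) x)
              (nhdsWithin 0 (Set.Ioi 0)) (nhds H₀)) ∧
          (∃ θ₁ ∈ Metric.sphere (0 : EuclideanSpace ℝ (Fin N)) 1,
            ∃ θ₂ ∈ Metric.sphere (0 : EuclideanSpace ℝ (Fin N)) 1,
              Φ r θ₁ ≠ Φ r θ₂)) ∧
        Tendsto (fun r : ℝ =>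
            ⨆ θ : Metric.sphere (0 : EuclideanSpace ℝ (Fin N)) 1, |Φ r θ.1|)
          atTop (nhds 0) := by
  obtain ⟨hα0, hα1⟩ := hα
  have hN' : 2 ≤ Module.finrank ℝ (EuclideanSpace ℝ (Fin N)) := by simpa using hN
  have hdim : dim (EuclideanSpace ℝ (Fin N)) = N := by simp
  have hα2 : α + 2 - dim (EuclideanSpace ℝ (Fin N)) ≠ 0 := by
    rw [hdim]
    intro h
    have h1 : (2:ℝ) < N := by linarith
    have h2 : (N:ℝ) < 3 := by linarith
    have h1' : 2 < N := by exact_mod_cast h1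
    have h2' : N < 3 := by exact_mod_cast h2
    omega
  have := discreteTopology_span_range ha
  have := countable_span_range a
  have hs : 0 < dim (EuclideanSpace ℝ (Fin N)) + α := by linarith [dim_ge hN']
  have hL : (Module.finrank ℤ (Submodule.span ℤ (Set.range a)) : ℝ) <
      dim (EuclideanSpace ℝ (Fin N)) + α := by
    have h1 : Module.finrank ℤ (Submodule.span ℤ (Set.range a)) ≤ M := by
      simpa [Set.finrank] using finrank_range_le_card (R := ℤ) a
    have h2 : (Module.finrank ℤ (Submodule.span ℤ (Set.range a)) : ℝ) ≤ N := by
      exact_mod_cast h1.trans (hMN.trans (Nat.sub_le N 1))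
    rw [hdim]
    linarith
  let j₀ : Fin N := ⟨N - 1, by omega⟩
  have ha0 : a ⟨0, hM1⟩ ≠ 0 := ha.ne_zero _
  obtain ⟨lam, r₀, C, hr₀, hC, hlam, hsol⟩ := exists_lattice_solution hN' hα0 hα1 hα2
    (Submodule.span ℤ (Set.range a)) hL (η := EuclideanSpace.single j₀ (1:ℝ))
    (ξ := hat (a ⟨0, hM1⟩)) (p₀ := a ⟨0, hM1⟩) (by simp) (norm_hat ha0)
    (fun p hp => by
      rw [EuclideanSpace.inner_single_right, one_mul]
      induction hp using Submodule.span_induction with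
      | mem x hx =>
        obtain ⟨i, rfl⟩ := hx
        simp [hsub i j₀ hMN]
      | zero => simp
      | add x y _ _ hx hy => simpa using by simp_all
      | smul k x _ hx => simp_all)
    (Submodule.subset_span ⟨_, rfl⟩)
    (by
      rw [hat, inner_smul_right, real_inner_self_eq_norm_sq]
      have := norm_pos_iff.2 ha0
      positivity)
  choose! u hu hub hev hfr hne using hsol
  refine ⟨2 * lam / α, fun e he => ?_, r₀, hr₀, fun r θ => Real.exp (u r θ) - 1,
    fun r hr => ⟨?_, fun θ hθ => ?_, fun θ hθ => ?_, ?_, ?_⟩, ?_⟩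
  · rw [mem_sphere_zero_iff_norm] at he
    rw [← pv_eq_pvInt, ← hlam e he]
    exact pv_ball hN' hα0 hα1 he
  · exact ((hu r hr).continuousOn.rexp).sub continuousOn_const
  · rw [mem_sphere_zero_iff_norm] at hθ
    have h1 := Real.exp_le_exp.2 (abs_le.1 ((hu r hr).bound θ hθ)).2
    rw [abs_lt]
    constructor <;> linarith [exp_half_lt_two, Real.exp_pos (u r θ)]
  · rw [mem_sphere_zero_iff_norm] at hθ
    simp only [hev r hr θ hθ]
  · rw [translatedBodies_exp_sub_one hN]
    simp only [← pv_eq_pvInt]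
    exact hfr r hr
  · obtain ⟨θ₁, θ₂, h1, h2, h⟩ := hne r hr
    refine ⟨θ₁, by simpa using h1, θ₂, by simpa using h2, fun he => h ?_⟩
    exact Real.exp_injective (by linarith)
  · have hlim : Tendsto (fun r : ℝ => 2 * (C * r ^ (-(dim (EuclideanSpace ℝ (Fin N)) + α))))
        atTop (nhds 0) := by
      simpa using ((tendsto_rpow_neg_atTop hs).const_mul C).const_mul 2
    refine squeeze_zero' (Eventually.of_forall fun r => Real.iSup_nonneg fun _ => abs_nonneg _)
      ?_ hlim
    filter_upwards [eventually_gt_atTop r₀] with r hr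
    have hr0 : 0 < r := hr₀.trans hr
    refine Real.iSup_le (fun θ => ?_) (by positivity)
    have hθ : ‖θ.1‖ = 1 := mem_sphere_zero_iff_norm.1 θ.2
    have h1 := (hu r hr).bound θ.1 hθ
    exact (Real.abs_exp_sub_one_le (h1.trans (by norm_num))).trans
      (mul_le_mul_of_nonneg_left ((hub r hr).bound θ.1 hθ) zero_le_two)
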